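/- For every constant C > 0 there exist ε₀ > 0 and N such that the following holds for all integers n ≥ N. Let k be an integer with |k − 2·log₂ n| ≤ C·log log n, let r be an integer with 1 ≤ r ≤ ε₀·(log log n)/(log log log n), and let j ∈ {1, …, r}. Then, writing X = α_{r+1}(G_{n,1/2}), we have |P(X ≥ kr + j) − P(Z_{k+1,μ_j} ≥ ξ_j)| ≤ (log n)^{−1/2}. -/

import Mathlib

open scoped Classical

/-- Probability of an event under the uniform measure on simple graphs on `Fin n`
(equivalently, `G_{n,1/2}`). -/
noncomputable def grPr (n : ℕ) (S : Set (SimpleGraph (Fin n))) : ℝ :=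
  ((PMF.uniformOfFintype (SimpleGraph (Fin n))).toOuterMeasure S).toReal

/-- Number of edges of `G` with both endpoints in `s`. -/
noncomputable def edgesIn {n : ℕ} (G : SimpleGraph (Fin n)) (s : Finset (Fin n)) : ℕ :=
  {e ∈ G.edgeSet | ∀ v ∈ e, v ∈ s}.ncard

/-- `Z_{k,i}(G)`: the number of `k`-element vertex subsets inducing exactly `i` edges. -/
noncomputable def numZ (n k i : ℕ) (G : SimpleGraph (Fin n)) : ℕ :=
  (((Finset.univ : Finset (Fin n)).powersetCard k).filter (fun s => edgesIn G s = i)).card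

/-- `α_r(G)`: the maximum number of vertices in an induced `K_r`-free subgraph of `G`. -/
noncomputable def alphaClq (n r : ℕ) (G : SimpleGraph (Fin n)) : ℕ :=
  sSup {m | ∃ s : Finset (Fin n), s.card = m ∧ (G.induce (s : Set (Fin n))).CliqueFree r}

/-- `μ_j = ⌊(r - j)/j⌋`. -/
def muD (r j : ℕ) : ℕ := (r - j) / j

/-- `ξ_j = j(μ_j + 2) - r`. -/
def xiD (r j : ℕ) : ℕ := j * (muD r j + 2) - r

/-- Expectation of `f` over a uniformly random simple graph on `V`. -/
noncomputable def ex (V : Type*) [Fintype V] (f : SimpleGraph V → ℝ) : ℝ :=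
  (∑ G : SimpleGraph V, f G) / (Fintype.card (SimpleGraph V) : ℝ)

/-- Indicator of a proposition. -/
noncomputable def ind (p : Prop) : ℝ := if p then 1 else 0

lemma ind_of {p : Prop} (h : p) : ind p = 1 := by simp [ind, h]

lemma ind_of_not {p : Prop} (h : ¬ p) : ind p = 0 := by simp [ind, h]

lemma ind_nonneg (p : Prop) : 0 ≤ ind p := by
  unfold ind; positivity

lemma ind_congr {p q : Prop} (h : p ↔ q) : ind p = ind q := by rw [propext h]

lemma ind_mono {p q : Prop} (h : p → q) : ind p ≤ ind q := by
  by_cases hp : p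
  · rw [ind_of hp, ind_of (h hp)]
  · rw [ind_of_not hp]; exact ind_nonneg q

lemma ind_and (p q : Prop) : ind (p ∧ q) = ind p * ind q := by
  by_cases hp : p <;> by_cases hq : q <;> simp [ind, hp, hq]

lemma sum_ind_eq {ι : Type*} (s : Finset ι) (a : ι) : ∑ i ∈ s, ind (i = a) = ind (a ∈ s) := by
  by_cases h : a ∈ s
  · rw [ind_of h, Finset.sum_eq_single_of_mem a h fun b _ hb => ind_of_not hb, ind_of rfl]
  · rw [ind_of_not h]
    exact Finset.sum_eq_zero fun i hi => ind_of_not fun h' => h (h' ▸ hi)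

/-- Probability that a uniformly random simple graph on `V` satisfies `Φ`. -/
noncomputable def pr (V : Type*) [Fintype V] (Φ : SimpleGraph V → Prop) : ℝ :=
  ex V (fun G => ind (Φ G))

/-- The event `Φ` only depends on the pairs in `Q`. -/
def DepOn {V : Type*} (Φ : SimpleGraph V → Prop) (Q : Set (Sym2 V)) : Prop :=
  ∀ G G' : SimpleGraph V, (∀ x y, s(x, y) ∈ Q → (G.Adj x y ↔ G'.Adj x y)) → (Φ G ↔ Φ G')

section Expectation

variable {V : Type*} [Fintype V]

lemma card_graph_pos (V : Type*) [Fintype V] : (0 : ℝ) < Fintype.card (SimpleGraph V) := by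
  have : 0 < Fintype.card (SimpleGraph V) := Fintype.card_pos
  exact_mod_cast this

lemma ex_mono {f g : SimpleGraph V → ℝ} (h : ∀ G, f G ≤ g G) : ex V f ≤ ex V g := by
  unfold ex
  have := card_graph_pos V
  gcongr
  exact h _

lemma ex_nonneg {f : SimpleGraph V → ℝ} (h : ∀ G, 0 ≤ f G) : 0 ≤ ex V f := by
  unfold ex
  have := card_graph_pos V
  exact div_nonneg (Finset.sum_nonneg fun G _ => h G) this.le

lemma ex_sum {ι : Type*} (s : Finset ι) (f : ι → SimpleGraph V → ℝ) :
    ex V (fun G => ∑ i ∈ s, f i G) = ∑ i ∈ s, ex V (f i) := by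
  unfold ex
  rw [Finset.sum_comm, Finset.sum_div]

lemma ex_add (f g : SimpleGraph V → ℝ) : ex V (fun G => f G + g G) = ex V f + ex V g := by
  unfold ex
  rw [Finset.sum_add_distrib, add_div]

lemma ex_const (c : ℝ) : ex V (fun _ => c) = c := by
  unfold ex
  have := card_graph_pos V
  simp

lemma ex_mul_left (c : ℝ) (f : SimpleGraph V → ℝ) : ex V (fun G => c * f G) = c * ex V f := by
  unfold ex
  rw [← Finset.mul_sum, mul_div_assoc]

lemma ex_sub (f g : SimpleGraph V → ℝ) : ex V (fun G => f G - g G) = ex V f - ex V g := by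
  unfold ex
  rw [Finset.sum_sub_distrib, sub_div]

lemma pr_nonneg (Φ : SimpleGraph V → Prop) : 0 ≤ pr V Φ :=
  ex_nonneg fun _ => ind_nonneg _

lemma pr_mono {Φ Ψ : SimpleGraph V → Prop} (h : ∀ G, Φ G → Ψ G) : pr V Φ ≤ pr V Ψ :=
  ex_mono fun G => ind_mono (h G)

lemma pr_congr {Φ Ψ : SimpleGraph V → Prop} (h : ∀ G, Φ G ↔ Ψ G) : pr V Φ = pr V Ψ :=
  le_antisymm (pr_mono fun G => (h G).1) (pr_mono fun G => (h G).2)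

lemma pr_true : pr V (fun _ => True) = 1 := by
  simp [pr, ind, ex_const]

lemma pr_false : pr V (fun _ => False) = 0 := by
  simp [pr, ind, ex_const]

lemma pr_le_one (Φ : SimpleGraph V → Prop) : pr V Φ ≤ 1 :=
  (pr_mono (Ψ := fun _ => True) fun _ _ => trivial).trans_eq pr_true

lemma pr_not (Φ : SimpleGraph V → Prop) : pr V (fun G => ¬ Φ G) = 1 - pr V Φ := by
  rw [← pr_true (V := V)]
  unfold pr
  rw [← ex_sub]
  congr 1
  ext G
  by_cases h : Φ G <;> simp [ind, h]

lemma pr_or_le (Φ Ψ : SimpleGraph V → Prop) : pr V (fun G => Φ G ∨ Ψ G) ≤ pr V Φ + pr V Ψ := by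
  unfold pr
  rw [← ex_add]
  refine ex_mono fun G => ?_
  by_cases h : Φ G <;> by_cases h' : Ψ G <;> simp [ind, h, h']

lemma pr_exists_le {ι : Type*} (s : Finset ι) (Φ : ι → SimpleGraph V → Prop) :
    pr V (fun G => ∃ i ∈ s, Φ i G) ≤ ∑ i ∈ s, pr V (Φ i) := by
  unfold pr
  rw [← ex_sum]
  refine ex_mono fun G => ?_
  by_cases h : ∃ i ∈ s, Φ i G
  · rw [ind_of h]
    obtain ⟨i, hi, hG⟩ := h
    rw [← ind_of hG]
    exact Finset.single_le_sum (f := fun i => ind (Φ i G)) (fun j _ => ind_nonneg _) hi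
  · rw [ind_of_not h]
    exact Finset.sum_nonneg fun j _ => ind_nonneg _

lemma pr_exists_le_card {ι : Type*} (s : Finset ι) (Φ : ι → SimpleGraph V → Prop) (b : ℝ)
    (hb : ∀ i ∈ s, pr V (Φ i) ≤ b) :
    pr V (fun G => ∃ i ∈ s, Φ i G) ≤ s.card * b := by
  refine (pr_exists_le s Φ).trans ?_
  refine (Finset.sum_le_card_nsmul s _ b hb).trans_eq ?_
  simp

lemma card_filter_eq_sum_ind {ι : Type*} (s : Finset ι) (p : ι → Prop) :
    ((s.filter p).card : ℝ) = ∑ i ∈ s, ind (p i) := by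
  simp [ind]

/-- Expected value of a count. -/
lemma ex_card_filter {ι : Type*} (s : Finset ι) (Φ : ι → SimpleGraph V → Prop) :
    ex V (fun G => ((s.filter fun i => Φ i G).card : ℝ)) = ∑ i ∈ s, pr V (Φ i) := by
  unfold pr
  simp_rw [card_filter_eq_sum_ind]
  rw [← ex_sum]

/-- Markov's inequality. -/
lemma markov {f : SimpleGraph V → ℝ} (hf : ∀ G, 0 ≤ f G) {t : ℝ} (ht : 0 < t) :
    pr V (fun G => t ≤ f G) ≤ ex V f / t := by
  rw [le_div_iff₀ ht, mul_comm]
  unfold pr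
  rw [← ex_mul_left]
  refine ex_mono fun G => ?_
  by_cases h : t ≤ f G
  · rw [ind_of h]; simpa using h
  · rw [ind_of_not h]; simpa using hf G

end Expectation

section Independence

variable {V : Type*}

/-- The graph which agrees with `G` on `Q` and with `G'` off `Q`. -/
def mixGraph (Q : Set (Sym2 V)) (G G' : SimpleGraph V) : SimpleGraph V where
  Adj x y := (s(x, y) ∈ Q ∧ G.Adj x y) ∨ (s(x, y) ∉ Q ∧ G'.Adj x y)
  symm := ⟨fun x y h => by
    simpa [Sym2.eq_swap (a := y) (b := x), SimpleGraph.adj_comm] using h⟩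
  loopless := ⟨fun x h => by simp at h⟩

lemma mixGraph_adj_of_mem {Q : Set (Sym2 V)} {G G' : SimpleGraph V} {x y : V} (h : s(x, y) ∈ Q) :
    (mixGraph Q G G').Adj x y ↔ G.Adj x y := by
  simp [mixGraph, h]

lemma mixGraph_adj_of_not_mem {Q : Set (Sym2 V)} {G G' : SimpleGraph V} {x y : V}
    (h : s(x, y) ∉ Q) : (mixGraph Q G G').Adj x y ↔ G'.Adj x y := by
  simp [mixGraph, h]

lemma DepOn.mono {Φ : SimpleGraph V → Prop} {Q Q' : Set (Sym2 V)} (h : DepOn Φ Q) (hQ : Q ⊆ Q') :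
    DepOn Φ Q' := fun G G' hG => h G G' fun x y hxy => hG x y (hQ hxy)

lemma DepOn.and {Φ Ψ : SimpleGraph V → Prop} {Q : Set (Sym2 V)} (h : DepOn Φ Q)
    (h' : DepOn Ψ Q) : DepOn (fun G => Φ G ∧ Ψ G) Q := fun G G' hG =>
  and_congr (h G G' hG) (h' G G' hG)

lemma DepOn.not {Φ : SimpleGraph V → Prop} {Q : Set (Sym2 V)} (h : DepOn Φ Q) :
    DepOn (fun G => ¬ Φ G) Q := fun G G' hG => not_congr (h G G' hG)

lemma DepOn.forall {ι : Sort*} {Φ : ι → SimpleGraph V → Prop} {Q : Set (Sym2 V)}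
    (h : ∀ i, DepOn (Φ i) Q) : DepOn (fun G => ∀ i, Φ i G) Q := fun G G' hG =>
  forall_congr' fun i => h i G G' hG

lemma DepOn.exists {ι : Sort*} {Φ : ι → SimpleGraph V → Prop} {Q : Set (Sym2 V)}
    (h : ∀ i, DepOn (Φ i) Q) : DepOn (fun G => ∃ i, Φ i G) Q := fun G G' hG =>
  exists_congr fun i => h i G G' hG

lemma depOn_adj {x y : V} {Q : Set (Sym2 V)} (h : s(x, y) ∈ Q) :
    DepOn (fun G : SimpleGraph V => G.Adj x y) Q := fun _ _ hG => hG x y h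

lemma depOn_mem {e : Sym2 V} {Q : Set (Sym2 V)} (h : e ∈ Q) :
    DepOn (fun G : SimpleGraph V => e ∈ G.edgeSet) Q := by
  induction e with | _ x y =>
  simpa using depOn_adj h

variable [Fintype V]

lemma pr_and_of_indep {Φ Ψ : SimpleGraph V → Prop} {Q Q' : Set (Sym2 V)}
    (hΦ : DepOn Φ Q) (hΨ : DepOn Ψ Q') (hQ : Disjoint Q Q') :
    pr V (fun G => Φ G ∧ Ψ G) = pr V Φ * pr V Ψ := by
  have hd : ∀ e, e ∈ Q' → e ∉ Q := fun e h1 h2 => Set.disjoint_left.1 hQ h2 h1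
  let σ : SimpleGraph V × SimpleGraph V → SimpleGraph V × SimpleGraph V :=
    fun p => (mixGraph Q p.1 p.2, mixGraph Q p.2 p.1)
  have hσ : Function.Involutive σ := by
    rintro ⟨G, G'⟩
    ext x y
    · by_cases h : s(x, y) ∈ Q <;> simp [σ, mixGraph, h]
    · by_cases h : s(x, y) ∈ Q <;> simp [σ, mixGraph, h]
  have h1 : ∀ p : SimpleGraph V × SimpleGraph V,
      (Φ (σ p).1 ∧ Ψ (σ p).1) ↔ (Φ p.1 ∧ Ψ p.2) := by
    rintro ⟨G, G'⟩
    refine and_congr (hΦ _ _ fun x y h => mixGraph_adj_of_mem h)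
      (hΨ _ _ fun x y h => mixGraph_adj_of_not_mem (hd _ h))
  have hc := card_graph_pos V
  unfold pr ex
  rw [div_mul_div_comm, div_eq_div_iff hc.ne' (by positivity), Finset.sum_mul_sum,
    ← Fintype.sum_prod_type']
  have h2 : ∑ p : SimpleGraph V × SimpleGraph V, ind (Φ p.1) * ind (Ψ p.2) =
      ∑ p : SimpleGraph V × SimpleGraph V, ind (Φ p.1 ∧ Ψ p.1) := by
    rw [← Equiv.sum_comp hσ.toPerm]
    refine Finset.sum_congr rfl fun p _ => ?_
    have := h1 (σ p)
    rw [hσ p] at this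
    rw [← ind_and, ind_congr this]
    rfl
  have h3 : ∑ p : SimpleGraph V × SimpleGraph V, ind (Φ p.1 ∧ Ψ p.1) =
      (Fintype.card (SimpleGraph V) : ℝ) * ∑ G : SimpleGraph V, ind (Φ G ∧ Ψ G) := by
    rw [Fintype.sum_prod_type]
    simp [Finset.mul_sum]
  rw [h2, h3]
  ring

lemma pr_forall_of_indep {ι : Type*} (s : Finset ι) (Φ : ι → SimpleGraph V → Prop)
    (Q : ι → Set (Sym2 V)) (hΦ : ∀ i ∈ s, DepOn (Φ i) (Q i))
    (hQ : (s : Set ι).PairwiseDisjoint Q) :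
    pr V (fun G => ∀ i ∈ s, Φ i G) = ∏ i ∈ s, pr V (Φ i) := by
  induction s using Finset.induction_on with
  | empty => simpa using pr_true
  | insert a s ha ih =>
    rw [Finset.prod_insert ha, ← ih (fun i hi => hΦ i (Finset.mem_insert_of_mem hi))
      (hQ.subset (by simp))]
    rw [← pr_and_of_indep (Q := Q a) (Q' := ⋃ i ∈ s, Q i) (hΦ a (Finset.mem_insert_self _ _))]
    · exact pr_congr fun G => by simp
    · refine DepOn.forall fun i => DepOn.forall fun hi => ?_
      exact (hΦ i (Finset.mem_insert_of_mem hi)).mono (Set.subset_biUnion_of_mem (u := Q) hi)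
    · rw [Set.disjoint_iUnion₂_right]
      intro i hi
      exact hQ (by simp) (by simp [hi]) (by rintro rfl; exact ha hi)

lemma pr_adj {x y : V} (h : x ≠ y) : pr V (fun G => G.Adj x y) = 1 / 2 := by
  have h1 : pr V (fun G => G.Adj x y) = pr V (fun G => ¬ G.Adj x y) := by
    have hi : Function.Involutive (fun G : SimpleGraph V => symmDiff (SimpleGraph.edge x y) G) :=
      fun G => symmDiff_symmDiff_cancel_left _ _
    unfold pr ex
    congr 1
    rw [← Equiv.sum_comp hi.toPerm]
    refine Finset.sum_congr rfl fun G _ => ?_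
    refine ind_congr ?_
    simp [symmDiff, SimpleGraph.edge_adj, h]
  rw [pr_not] at h1
  linarith

lemma pr_mem_edgeSet {e : Sym2 V} (h : ¬ e.IsDiag) : pr V (fun G => e ∈ G.edgeSet) = 1 / 2 := by
  induction e with | _ x y =>
  simpa using pr_adj (V := V) (by simpa using h)

lemma pr_pattern (Q : Finset (Sym2 V)) (hQ : ∀ e ∈ Q, ¬ e.IsDiag) (F : Set (Sym2 V)) :
    pr V (fun G => ∀ e ∈ Q, (e ∈ G.edgeSet ↔ e ∈ F)) = (1 / 2) ^ Q.card := by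
  rw [pr_forall_of_indep Q (fun e G => e ∈ G.edgeSet ↔ e ∈ F) (fun e => {e})]
  · rw [← Finset.prod_const]
    refine Finset.prod_congr rfl fun e he => ?_
    by_cases hF : e ∈ F
    · simpa [hF] using pr_mem_edgeSet (hQ e he)
    · simp only [hF, iff_false]
      rw [pr_not, pr_mem_edgeSet (hQ e he)]; norm_num
  · intro e _ G G' hG
    exact iff_congr (depOn_mem (Set.mem_singleton e) G G' hG) Iff.rfl
  · intro e _ e' _ hne
    simpa using hne

/-- Exactly `t` edges among the pairs in `Q`. -/
lemma pr_card_eq (Q : Finset (Sym2 V)) (hQ : ∀ e ∈ Q, ¬ e.IsDiag) (t : ℕ) :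
    pr V (fun G => (Q.filter fun e => e ∈ G.edgeSet).card = t) =
      Q.card.choose t * (1 / 2) ^ Q.card := by
  have h : ∀ G : SimpleGraph V, ind ((Q.filter fun e => e ∈ G.edgeSet).card = t) =
      ∑ F ∈ Q.powersetCard t, ind (∀ e ∈ Q, (e ∈ G.edgeSet ↔ e ∈ (F : Set (Sym2 V)))) := by
    intro G
    have h1 : ∀ F ∈ Q.powersetCard t, ((∀ e ∈ Q, (e ∈ G.edgeSet ↔ e ∈ (F : Set (Sym2 V)))) ↔
        F = Q.filter fun e => e ∈ G.edgeSet) := by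
      intro F hF
      rw [Finset.mem_powersetCard] at hF
      constructor
      · intro h
        ext e
        by_cases he : e ∈ Q
        · simpa [he] using (h e he).symm
        · simpa [he] using fun h' => he (hF.1 h')
      · rintro rfl e he
        simp [he]
    rw [Finset.sum_congr rfl fun F hF => ind_congr (h1 F hF)]
    rw [sum_ind_eq]
    exact ind_congr (by simp [Finset.mem_powersetCard])
  unfold pr
  simp_rw [h]
  rw [ex_sum]
  change ∑ F ∈ Q.powersetCard t, pr V (fun G => ∀ e ∈ Q, (e ∈ G.edgeSet ↔ e ∈ (F : Set (Sym2 V)))) = _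
  rw [Finset.sum_congr rfl fun (F : Finset (Sym2 V)) _ => pr_pattern Q hQ (F : Set (Sym2 V))]
  simp

lemma sum_range_choose_le (a t : ℕ) : ∑ i ∈ Finset.range (t + 1), a.choose i ≤ (a + 1) ^ t := by
  rw [add_pow]
  refine Finset.sum_le_sum fun i hi => ?_
  simp only [one_pow, mul_one]
  rw [Finset.mem_range] at hi
  refine (Nat.choose_le_pow a i).trans (Nat.le_mul_of_pos_right _ (Nat.choose_pos (by omega)))

lemma pr_card_le (Q : Finset (Sym2 V)) (hQ : ∀ e ∈ Q, ¬ e.IsDiag) (t : ℕ) :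
    pr V (fun G => (Q.filter fun e => e ∈ G.edgeSet).card ≤ t) ≤
      (Q.card + 1) ^ t * (1 / 2) ^ Q.card := by
  calc pr V (fun G => (Q.filter fun e => e ∈ G.edgeSet).card ≤ t)
      ≤ pr V (fun G => ∃ i ∈ Finset.range (t + 1), (Q.filter fun e => e ∈ G.edgeSet).card = i) :=
        pr_mono fun G h => ⟨_, by simpa using Nat.lt_succ_of_le h, rfl⟩
    _ ≤ _ := pr_exists_le _ _
    _ = ((∑ i ∈ Finset.range (t + 1), Q.card.choose i : ℕ) : ℝ) * (1 / 2) ^ Q.card := by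
        push_cast
        rw [Finset.sum_mul]
        exact Finset.sum_congr rfl fun i _ => pr_card_eq Q hQ i
    _ ≤ _ := by
        gcongr
        exact_mod_cast sum_range_choose_le _ t

/-- The induced random graph is uniformly distributed. -/
lemma pr_comap {W : Type*} [Fintype W] (f : V ↪ W) (Ψ : SimpleGraph V → Prop) :
    pr W (fun G => Ψ (G.comap f)) = pr V Ψ := by
  let Q : Finset (Sym2 W) := (Finset.univ.filter fun e : Sym2 V => ¬ e.IsDiag).map
    ⟨Sym2.map f, Sym2.map.injective f.injective⟩
  have hQ : ∀ e ∈ Q, ¬ e.IsDiag := by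
    intro e he
    simp only [Q, Finset.mem_map, Finset.mem_filter, Finset.mem_univ, true_and,
      Function.Embedding.coeFn_mk] at he
    obtain ⟨e', he', rfl⟩ := he
    induction e' with | _ x y =>
    simpa using he'
  have h1 : ∀ H : SimpleGraph V, pr W (fun G => G.comap f = H) = (1 / 2) ^ Q.card := by
    intro H
    rw [← pr_pattern Q hQ (Sym2.map f '' H.edgeSet)]
    refine pr_congr fun G => ?_
    constructor
    · rintro rfl e he
      simp only [Q, Finset.mem_map, Finset.mem_filter, Finset.mem_univ, true_and,
        Function.Embedding.coeFn_mk] at he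
      obtain ⟨e', he', rfl⟩ := he
      rw [(Sym2.map.injective f.injective).mem_set_image]
      induction e' with | _ x y => simp
    · intro h
      ext x y
      by_cases hxy : x = y
      · subst hxy; simp
      have := h (Sym2.map f s(x, y)) (by
        simp only [Q, Finset.mem_map, Finset.mem_filter, Finset.mem_univ, true_and,
          Function.Embedding.coeFn_mk]
        exact ⟨s(x, y), by simpa using hxy, rfl⟩)
      rw [(Sym2.map.injective f.injective).mem_set_image] at this
      simpa using this
  have h2 : ∀ Ψ : SimpleGraph V → Prop, pr W (fun G => Ψ (G.comap f)) =
      (∑ H : SimpleGraph V, ind (Ψ H)) * (1 / 2) ^ Q.card := by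
    intro Ψ
    have h3 : ∀ G : SimpleGraph W, ind (Ψ (G.comap f)) =
        ∑ H : SimpleGraph V, ind (Ψ H) * ind (G.comap f = H) := by
      intro G; simp [ind]
    unfold pr
    simp_rw [h3]
    rw [ex_sum, Finset.sum_mul]
    refine Finset.sum_congr rfl fun H _ => ?_
    rw [ex_mul_left, ← h1 H]
    rfl
  have h4 := h2 fun _ => True
  rw [pr_true] at h4
  simp only [ind, if_true, Finset.sum_const, Finset.card_univ, nsmul_eq_mul, mul_one] at h4
  rw [h2]
  have hc := card_graph_pos V
  unfold pr ex
  rw [eq_div_iff hc.ne', mul_assoc, mul_comm (_ ^ _), ← h4, mul_one]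

end Independence

section Containers

variable {V : Type*} [Fintype V]

/-- Neighbourhood of `v` as a finset. -/
noncomputable def nb (P : SimpleGraph V) (v : V) : Finset V := Finset.univ.filter (P.Adj v)

/-- The number of non-neighbours of `x` in `D`, counting `x` itself if it belongs to `D`. -/
noncomputable def nd (P : SimpleGraph V) (D : Finset V) (x : V) : ℕ :=
  (D.filter fun y => ¬ P.Adj x y).card

/-- The number of ordered adjacent pairs. -/
noncomputable def ec (P : SimpleGraph V) : ℕ := ∑ v, (nb P v).card

@[simp] lemma mem_nb {P : SimpleGraph V} {v w : V} : w ∈ nb P v ↔ P.Adj v w := by simp [nb]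

lemma nd_mono (P : SimpleGraph V) {D D' : Finset V} (h : D ⊆ D') (x : V) : nd P D x ≤ nd P D' x :=
  Finset.card_le_card (Finset.filter_subset_filter _ h)

lemma nd_le_card (P : SimpleGraph V) (D : Finset V) (x : V) : nd P D x ≤ D.card :=
  Finset.card_filter_le _ _

lemma nd_insert (P : SimpleGraph V) {D : Finset V} {y : V} (hy : y ∉ D) (x : V) :
    nd P (insert y D) x = nd P D x + if P.Adj x y then 0 else 1 := by
  unfold nd
  rw [Finset.filter_insert]
  by_cases h : P.Adj x y
  · simp [h]
  · simp [h, hy]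

lemma sum_nd_comm (P : SimpleGraph V) (C J : Finset V) :
    ∑ y ∈ C, nd P J y = ∑ x ∈ J, nd P C x := by
  unfold nd
  simp_rw [Finset.card_filter]
  rw [Finset.sum_comm]
  simp_rw [P.adj_comm]

lemma sum_nd_insert (P : SimpleGraph V) {D : Finset V} {y : V} (hy : y ∉ D) :
    ∑ x ∈ insert y D, nd P (insert y D) x = ∑ x ∈ D, nd P D x + 2 * nd P D y + 1 := by
  rw [Finset.sum_insert hy, nd_insert P hy]
  simp only [nd_insert P hy, Finset.sum_add_distrib]
  have : ∑ x ∈ D, (if P.Adj x y then 0 else 1) = nd P D y := by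
    unfold nd
    rw [Finset.card_filter]
    refine Finset.sum_congr rfl fun x _ => ?_
    rw [P.adj_comm]
    split_ifs <;> simp_all
  rw [this]
  simp
  ring

lemma ec_mono {P P' : SimpleGraph V} (h : P' ≤ P) : ec P' ≤ ec P := by
  refine Finset.sum_le_sum fun v _ => Finset.card_le_card fun w hw => ?_
  rw [mem_nb] at *
  exact h hw

/-- Greedy selection of a dense subset of `N`. -/
lemma exists_greedy (P : SimpleGraph V) (N : Finset V) {θ : ℝ} (hθ : 0 ≤ θ) (l : ℕ) :
    ∃ J ⊆ N, (J.card = l ∧ (∑ x ∈ J, (nd P J x : ℝ)) ≤ θ * l ^ 2 + l) ∨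
      (J.card < l ∧ ∀ y ∈ N, y ∉ J → θ * J.card < nd P J y) := by
  induction l with
  | zero => exact ⟨∅, by simp, Or.inl (by simp)⟩
  | succ l ih =>
    obtain ⟨J, hJ, h | h⟩ := ih
    · by_cases hy : ∃ y ∈ N, y ∉ J ∧ (nd P J y : ℝ) ≤ θ * J.card
      · obtain ⟨y, hyN, hyJ, hy⟩ := hy
        refine ⟨insert y J, Finset.insert_subset hyN hJ, Or.inl ⟨by simp [hyJ, h.1], ?_⟩⟩
        have h1 := sum_nd_insert P hyJ
        have h2 : (∑ x ∈ insert y J, (nd P (insert y J) x : ℝ)) =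
            ∑ x ∈ J, (nd P J x : ℝ) + 2 * nd P J y + 1 := by exact_mod_cast h1
        rw [h2]
        rw [h.1] at hy
        push_cast
        nlinarith [h.2]
      · push Not at hy
        exact ⟨J, hJ, Or.inr ⟨by omega, fun y h1 h2 => hy y h1 h2⟩⟩
    · exact ⟨J, hJ, Or.inr ⟨by omega, h.2⟩⟩

/-- Passing to a subset in which all non-degrees are at most the average. -/
lemma exists_trim (P : SimpleGraph V) (J : Finset V) {θ : ℝ} (hθ : 0 ≤ θ) :
    ∃ W ⊆ J, (∀ x ∈ W, (nd P W x : ℝ) ≤ θ * W.card + 1 / 2) ∧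
      θ * (J.card : ℝ) ^ 2 - ∑ x ∈ J, (nd P J x : ℝ) ≤ θ * (W.card : ℝ) ^ 2 := by
  obtain ⟨W, hW, hmax⟩ := Finset.exists_max_image J.powerset
    (fun W => θ * (W.card : ℝ) ^ 2 - ∑ x ∈ W, (nd P W x : ℝ)) ⟨∅, by simp⟩
  rw [Finset.mem_powerset] at hW
  refine ⟨W, hW, fun x hx => ?_, ?_⟩
  · have h1 := hmax (W.erase x) (by
      rw [Finset.mem_powerset]; exact (Finset.erase_subset _ _).trans hW)
    have h2 := sum_nd_insert P (Finset.notMem_erase x W)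
    have h3 := nd_insert P (Finset.notMem_erase x W) x
    rw [Finset.insert_erase hx] at h2 h3
    have h4 : (∑ x ∈ W, (nd P W x : ℝ)) =
        ∑ y ∈ W.erase x, (nd P (W.erase x) y : ℝ) + 2 * nd P (W.erase x) x + 1 := by
      exact_mod_cast h2
    simp only [SimpleGraph.irrefl, if_false] at h3
    have h5 : (nd P W x : ℝ) = nd P (W.erase x) x + 1 := by exact_mod_cast h3
    have h6 : ((W.erase x).card : ℝ) = W.card - 1 := by
      rw [← Finset.card_erase_add_one hx]; push_cast; ring
    simp only [h6] at h1
    nlinarith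
  · have h1 := hmax J (by simp)
    have : (0 : ℝ) ≤ ∑ x ∈ W, (nd P W x : ℝ) := by positivity
    linarith

lemma card_filter_nd_le (P : SimpleGraph V) {M J : Finset V} {σ θ : ℝ} (hσ : 0 ≤ σ) (hJ : J ⊆ M)
    (hM : ∀ y ∈ M, (nd P M y : ℝ) ≤ σ * M.card) :
    θ * ((M.filter fun y => θ * J.card < nd P J y).card : ℝ) ≤ σ * M.card := by
  set C := M.filter fun y => θ * J.card < nd P J y
  rcases J.eq_empty_or_nonempty with rfl | hne
  · have : C = ∅ := by
      simp [C, nd]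
    rw [this]; simp; positivity
  have h1 : θ * J.card * C.card ≤ ∑ y ∈ C, (nd P J y : ℝ) := by
    rw [mul_comm, ← nsmul_eq_mul]
    exact Finset.card_nsmul_le_sum _ _ _ fun y hy => (Finset.mem_filter.1 hy).2.le
  have h2 : ∑ y ∈ C, (nd P J y : ℝ) = ∑ x ∈ J, (nd P C x : ℝ) := by
    exact_mod_cast sum_nd_comm P C J
  have h3 : ∑ x ∈ J, (nd P C x : ℝ) ≤ J.card * (σ * M.card) := by
    rw [← nsmul_eq_mul]
    refine Finset.sum_le_card_nsmul _ _ _ fun x hx => ?_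
    refine le_trans ?_ (hM x (hJ hx))
    exact_mod_cast nd_mono P (Finset.filter_subset _ _) x
  have h4 : (0 : ℝ) < J.card := by exact_mod_cast hne.card_pos
  have h5 : (J.card : ℝ) * (θ * C.card) ≤ J.card * (σ * M.card) := by
    calc _ = θ * J.card * C.card := by ring
      _ ≤ _ := by linarith
  exact le_of_mul_le_mul_left h5 h4

/-- `P` has a weighted family of containers for the subgraphs satisfying `Φ`. -/
def Cov (κ : ℝ) (P : SimpleGraph V) (Φ : SimpleGraph V → Prop) (K : ℝ) : Prop :=
  ∃ C : Finset (SimpleGraph V), (∀ P' ∈ C, P' ≤ P) ∧ (∀ H, H ≤ P → Φ H → ∃ P' ∈ C, H ≤ P') ∧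
    ∑ P' ∈ C, (2 : ℝ) ^ (-(κ * ((ec P : ℝ) - ec P'))) ≤ K

lemma Cov.mono {κ : ℝ} {P : SimpleGraph V} {Φ Ψ : SimpleGraph V → Prop} {K K' : ℝ}
    (h : Cov κ P Φ K) (hΨ : ∀ H, H ≤ P → Ψ H → Φ H) (hK : K ≤ K') : Cov κ P Ψ K' := by
  obtain ⟨C, h1, h2, h3⟩ := h
  exact ⟨C, h1, fun H hH hΨH => h2 H hH (hΨ H hH hΨH), h3.trans hK⟩

lemma Cov.or {κ : ℝ} {P : SimpleGraph V} {Φ Ψ : SimpleGraph V → Prop} {K K' : ℝ}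
    (h : Cov κ P Φ K) (h' : Cov κ P Ψ K') : Cov κ P (fun H => Φ H ∨ Ψ H) (K + K') := by
  obtain ⟨C, h1, h2, h3⟩ := h
  obtain ⟨C', h1', h2', h3'⟩ := h'
  refine ⟨C ∪ C', ?_, ?_, ?_⟩
  · intro P' hP'
    rcases Finset.mem_union.1 hP' with h | h
    exacts [h1 _ h, h1' _ h]
  · rintro H hH (h | h)
    · obtain ⟨P', hP', hle⟩ := h2 H hH h
      exact ⟨P', Finset.mem_union_left _ hP', hle⟩
    · obtain ⟨P', hP', hle⟩ := h2' H hH h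
      exact ⟨P', Finset.mem_union_right _ hP', hle⟩
  · refine le_trans ?_ (add_le_add h3 h3')
    rw [← Finset.sum_union_inter]
    have : 0 ≤ ∑ P' ∈ C ∩ C', (2 : ℝ) ^ (-(κ * ((ec P : ℝ) - ec P'))) :=
      Finset.sum_nonneg fun _ _ => by positivity
    linarith

lemma cov_exists {κ : ℝ} {P : SimpleGraph V} {ι : Type*} (s : Finset ι)
    {Φ : ι → SimpleGraph V → Prop} {K : ι → ℝ} (h : ∀ i ∈ s, Cov κ P (Φ i) (K i)) :
    Cov κ P (fun H => ∃ i ∈ s, Φ i H) (∑ i ∈ s, K i) := by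
  induction s using Finset.induction_on with
  | empty => exact ⟨∅, by simp, by simp, by simp⟩
  | insert a s ha ih =>
    rw [Finset.sum_insert ha]
    refine Cov.mono (Cov.or (h a (by simp)) (ih fun i hi => h i (by simp [hi]))) ?_ le_rfl
    rintro H _ ⟨i, hi, hH⟩
    rcases Finset.mem_insert.1 hi with rfl | hi
    exacts [Or.inl hH, Or.inr ⟨i, hi, hH⟩]

lemma cov_exists_card {κ : ℝ} {P : SimpleGraph V} {ι : Type*} (s : Finset ι)
    {Φ : ι → SimpleGraph V → Prop} {K : ℝ} (h : ∀ i ∈ s, Cov κ P (Φ i) K) :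
    Cov κ P (fun H => ∃ i ∈ s, Φ i H) (s.card * K) := by
  simpa using cov_exists s h

lemma cov_single {κ : ℝ} {P P' : SimpleGraph V} {Φ : SimpleGraph V → Prop} {K : ℝ} (hP : P' ≤ P)
    (hΦ : ∀ H, H ≤ P → Φ H → H ≤ P') (hK : (2 : ℝ) ^ (-(κ * ((ec P : ℝ) - ec P'))) ≤ K) :
    Cov κ P Φ K :=
  ⟨{P'}, by simpa using hP, fun H h1 h2 => ⟨P', by simp, hΦ H h1 h2⟩, by simpa using hK⟩

lemma sum_choose_le_pow (a t : ℕ) : ∑ i ∈ Finset.range (t + 1), a.choose i ≤ (a + 1) ^ t := by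
  rw [add_pow]
  refine Finset.sum_le_sum fun i hi => ?_
  simp only [one_pow, mul_one]
  rw [Finset.mem_range] at hi
  refine (Nat.choose_le_pow a i).trans (Nat.le_mul_of_pos_right _ (Nat.choose_pos (by omega)))

/-- Finsets with fewer than `l` elements. -/
noncomputable def smallSets (V : Type*) [Fintype V] (l : ℕ) : Finset (Finset V) :=
  Finset.univ.filter fun J => J.card < l

lemma card_smallSets_le (l : ℕ) : (smallSets V l).card ≤ (Fintype.card V + 1) ^ l := by
  cases l with
  | zero => simp [smallSets]
  | succ l =>
    have h : smallSets V (l + 1) ⊆ (Finset.range (l + 1)).biUnion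
        fun i => (Finset.univ : Finset V).powersetCard i := by
      intro J hJ
      simpa [smallSets] using hJ
    refine (Finset.card_le_card h).trans (Finset.card_biUnion_le.trans ?_)
    simp only [Finset.card_powersetCard, Finset.card_univ]
    exact (sum_choose_le_pow _ _).trans (Nat.pow_le_pow_right (by omega) (by omega))

/-- The graph `P` with all pairs `v x`, `v ∈ Y`, `x ∈ R v`, removed. -/
def delStars (P : SimpleGraph V) (Y : Finset V) (R : V → Finset V) : SimpleGraph V where
  Adj x y := P.Adj x y ∧ ¬ (x ∈ Y ∧ y ∈ R x) ∧ ¬ (y ∈ Y ∧ x ∈ R y)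
  symm := ⟨fun x y h => ⟨h.1.symm, h.2.2, h.2.1⟩⟩
  loopless := ⟨fun x h => by simp at h⟩

lemma delStars_le (P : SimpleGraph V) (Y : Finset V) (R : V → Finset V) : delStars P Y R ≤ P :=
  fun _ _ h => h.1

lemma ec_delStars (P : SimpleGraph V) (Y : Finset V) (R : V → Finset V)
    (hR : ∀ v ∈ Y, R v ⊆ nb P v) : ec (delStars P Y R) + ∑ v ∈ Y, (R v).card ≤ ec P := by
  have h1 : ∑ v ∈ Y, (R v).card = ∑ v, if v ∈ Y then (R v).card else 0 := by
    rw [Finset.sum_ite_mem, Finset.univ_inter]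
  rw [h1]
  unfold ec
  rw [← Finset.sum_add_distrib]
  refine Finset.sum_le_sum fun v _ => ?_
  split_ifs with hv
  · rw [← Finset.card_union_of_disjoint]
    · refine Finset.card_le_card (Finset.union_subset ?_ (hR v hv))
      intro w hw
      rw [mem_nb] at *
      exact hw.1
    · rw [Finset.disjoint_left]
      intro w hw hw'
      rw [mem_nb] at hw
      exact hw.2.1 ⟨hv, hw'⟩
  · simp only [add_zero]
    refine Finset.card_le_card fun w hw => ?_
    rw [mem_nb] at *
    exact hw.1

/-- One step of the container construction. -/
lemma cov_step {κ σ η g w₀ K : ℝ} {m l : ℕ} (hκ : 0 ≤ κ) (hσ : 0 < σ) (hη : 0 < η)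
    (P : SimpleGraph V) (Y : Finset V) (M : V → Finset V) (hM : ∀ v ∈ Y, M v ⊆ nb P v)
    (hnd : ∀ v ∈ Y, ∀ y ∈ M v, (nd P (M v) y : ℝ) ≤ σ * (M v).card)
    (hg : ∀ v ∈ Y, g ≤ η / (σ + η) * (M v).card - l)
    (hK : 0 ≤ K)
    (ih : ∀ W : Finset V, w₀ ≤ W.card → (∀ x ∈ W, (nd P W x : ℝ) ≤ (σ + 3 * η) * W.card) →
      Cov κ P (fun H => H.CliqueFreeOn (W : Set V) m) K)
    (hw₀ : 0 < w₀) (hw : 1 / 2 ≤ η * w₀) (hwl : (σ + 2 * η) * w₀ ^ 2 ≤ η * l ^ 2 - l) :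
    Cov κ P (fun H => ∀ v ∈ Y, H.CliqueFreeOn ((nb H v ∩ M v : Finset V) : Set V) m)
      (2 ^ (Fintype.card V) * K +
        (((Fintype.card V + 1 : ℝ) ^ l) * 2 ^ (-(κ * g))) ^ Y.card) := by
  let good : Finset (Finset V) := Finset.univ.filter fun W =>
    w₀ ≤ W.card ∧ ∀ x ∈ W, (nd P W x : ℝ) ≤ (σ + 3 * η) * W.card
  let R : V → Finset V → Finset V := fun v J =>
    (M v).filter fun y => y ∉ J ∧ (nd P J y : ℝ) ≤ (σ + η) * J.card
  let F : Finset (V → Finset V) := Fintype.piFinset fun v =>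
    if v ∈ Y then (smallSets V l).filter (fun J => J ⊆ M v) else {∅}
  have hcov1 : Cov κ P (fun H => ∃ W ∈ good, H.CliqueFreeOn (W : Set V) m) (good.card * K) :=
    cov_exists_card good fun W hW => by
      have := (Finset.mem_filter.1 hW).2
      exact ih W this.1 this.2
  have hcov2 : Cov κ P (fun H => ∃ J ∈ F, H ≤ delStars P Y fun v => R v (J v))
      (F.card * 2 ^ (-(κ * (Y.card * g)))) := by
    refine cov_exists_card F fun J hJ => cov_single (delStars_le _ _ _) (fun H _ h => h) ?_
    have hJ' : ∀ v ∈ Y, (J v).card < l ∧ J v ⊆ M v := by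
      intro v hv
      have := Fintype.mem_piFinset.1 hJ v
      simpa [hv, smallSets] using this
    refine Real.rpow_le_rpow_of_exponent_le (by norm_num) (neg_le_neg (mul_le_mul_of_nonneg_left ?_ hκ))
    have h1 := ec_delStars P Y (fun v => R v (J v)) fun v hv =>
      (Finset.filter_subset _ _).trans (hM v hv)
    have h2 : (ec (delStars P Y fun v => R v (J v)) : ℝ) + ∑ v ∈ Y, ((R v (J v)).card : ℝ) ≤ ec P := by
      exact_mod_cast h1
    have h3 : Y.card * g ≤ ∑ v ∈ Y, ((R v (J v)).card : ℝ) := by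
      rw [← nsmul_eq_mul]
      refine Finset.card_nsmul_le_sum _ _ _ fun v hv => ?_
      refine (hg v hv).trans ?_
      have h4 := card_filter_nd_le P (θ := σ + η) hσ.le (hJ' v hv).2 (hnd v hv)
      have h5 : (M v).card ≤ ((M v).filter fun y => (σ + η) * (J v).card < nd P (J v) y).card +
          (J v).card + (R v (J v)).card := by
        refine le_trans (Finset.card_le_card ?_) ((Finset.card_union_le _ _).trans
          (Nat.add_le_add_right (Finset.card_union_le _ _) _))
        intro y hy
        simp only [Finset.mem_union, Finset.mem_filter, R, hy, true_and]
        by_cases h : y ∈ J v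
        · simp [h]
        · simp [h, lt_or_ge]
      have h6 : ((M v).card : ℝ) ≤ ((M v).filter fun y => (σ + η) * (J v).card < nd P (J v) y).card +
          (J v).card + (R v (J v)).card := by exact_mod_cast h5
      have h7 : ((J v).card : ℝ) ≤ l := by exact_mod_cast (hJ' v hv).1.le
      have h8 : (((M v).filter fun y => (σ + η) * (J v).card < nd P (J v) y).card : ℝ) ≤
          σ / (σ + η) * (M v).card := by
        rw [div_mul_eq_mul_div, le_div_iff₀ (by positivity), mul_comm]
        exact h4
      have h9 : η / (σ + η) * ((M v).card : ℝ) = (M v).card - σ / (σ + η) * (M v).card := by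
        field_simp; ring
      linarith
    linarith
  refine Cov.mono (hcov1.or hcov2) ?_ (add_le_add ?_ ?_)
  · intro H hH hfree
    by_contra hcon
    push Not at hcon
    obtain ⟨hc1, hc2⟩ := hcon
    have key : ∀ v, ∃ J : Finset V, v ∈ Y → J ⊆ nb H v ∩ M v ∧ J.card < l ∧
        ∀ y ∈ nb H v ∩ M v, y ∉ J → (σ + η) * J.card < nd P J y := by
      intro v
      by_cases hv : v ∈ Y
      swap
      · exact ⟨∅, fun h => absurd h hv⟩
      obtain ⟨J, hJN, h | h⟩ := exists_greedy P (nb H v ∩ M v) (θ := σ + η) (by positivity) l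
      · exfalso
        obtain ⟨W, hWJ, hW1, hW2⟩ := exists_trim P J (θ := σ + 2 * η) (by positivity)
        have hWc : w₀ ≤ W.card := by
          by_contra hlt
          push Not at hlt
          have h1 : (W.card : ℝ) ^ 2 < w₀ ^ 2 := by gcongr
          rw [h.1] at hW2
          have h2 : (σ + 2 * η) * (W.card : ℝ) ^ 2 < (σ + 2 * η) * w₀ ^ 2 := by gcongr
          nlinarith [h.2]
        refine hc1 W ?_ ?_
        · simp only [good, Finset.mem_filter, Finset.mem_univ, true_and]
          refine ⟨hWc, fun x hx => (hW1 x hx).trans ?_⟩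
          nlinarith
        · exact (hfree v hv).subset _ (by exact_mod_cast hWJ.trans hJN)
      · exact ⟨J, fun _ => ⟨hJN, h⟩⟩
    choose J hJ using key
    have hF : (fun v => if v ∈ Y then J v else ∅) ∈ F := by
      rw [Fintype.mem_piFinset]
      intro v
      by_cases hv : v ∈ Y
      · simp only [hv, if_true, Finset.mem_filter, smallSets, Finset.mem_univ, true_and]
        exact ⟨(hJ v hv).2.1, (hJ v hv).1.trans Finset.inter_subset_right⟩
      · simp [hv]
    refine hc2 _ hF ?_
    have hstar : ∀ x y, H.Adj x y → ¬ (x ∈ Y ∧ y ∈ R x (if x ∈ Y then J x else ∅)) := by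
      rintro x y hxy ⟨hx, hy⟩
      simp only [hx, if_true, R, Finset.mem_filter] at hy
      have := (hJ x hx).2.2 y (by simp [hxy, hy.1]) hy.2.1
      linarith [hy.2.2]
    intro x y hxy
    exact ⟨hH hxy, hstar x y hxy, hstar y x hxy.symm⟩
  · refine mul_le_mul_of_nonneg_right ?_ hK
    have : good.card ≤ 2 ^ Fintype.card V := by
      simpa using Finset.card_le_univ good
    exact_mod_cast this
  · rw [mul_pow]
    have h1 : F.card ≤ ((Fintype.card V + 1) ^ l) ^ Y.card := by
      rw [Fintype.card_piFinset]
      calc _ ≤ ∏ v : V, (if v ∈ Y then (Fintype.card V + 1) ^ l else 1) := by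
            refine Finset.prod_le_prod' fun v _ => ?_
            split_ifs
            · exact (Finset.card_filter_le _ _).trans (card_smallSets_le l)
            · simp
        _ = _ := by rw [Finset.prod_ite_mem, Finset.univ_inter, Finset.prod_const]
    have h2 : (2 : ℝ) ^ (-(κ * (Y.card * g))) = (2 ^ (-(κ * g))) ^ Y.card := by
      rw [← Real.rpow_natCast, ← Real.rpow_mul (by norm_num)]
      congr 1; ring
    rw [h2]
    gcongr
    exact_mod_cast h1

end Containers

section ContainerLevels

/-- Numerical parameters for the container theorem. -/
structure CParams (S r : ℕ) (e κ η β γ : ℝ) (Lg : ℕ) : Prop where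
  hr : 1 ≤ r
  e0 : 0 < e
  e1 : e ≤ 1 / 4
  κ0 : 0 < κ
  κ1 : κ ≤ 1
  η0 : 0 < η
  η1 : 3 * η * (r : ℝ) ^ 3 = e
  hS : S + 1 ≤ 2 ^ Lg
  Lg1 : 1 ≤ Lg
  β0 : 0 < β
  hβ : β * (16 * Lg) ≤ κ * η * e ^ 2
  γ0 : 0 < γ
  γ1 : γ ≤ 1
  hγ : γ ≤ e * η * β / 8
  h1 : 1 ≤ η * (γ ^ (r + 1) * S)
  h2 : 4 ≤ η * β * (γ ^ r * S)
  h3 : 16 * ((S + 1 : ℝ) * r) < κ * η ^ 2 * e ^ 2 * γ ^ (2 * r) * S ^ 2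

/-- The reciprocal of the relative non-degree threshold at level `m`. -/
noncomputable def xlev (e : ℝ) (r m : ℕ) : ℝ := m + e * (1 + m / r)

/-- The weight lost at each level. -/
noncomputable def qlev (S r : ℕ) (e κ η γ : ℝ) : ℝ :=
  2 ^ (-(κ * η ^ 2 * e ^ 2 * γ ^ (2 * r) * S ^ 2 / 16))

variable {V : Type*} [Fintype V]

lemma CParams.eta_le {S r Lg : ℕ} {e κ η β γ : ℝ} (hp : CParams S r e κ η β γ Lg) :
    η ≤ 1 / 12 := by
  have h1 := hp.η1
  have h2 := hp.e1
  have h3 : (1 : ℝ) ≤ (r : ℝ) ^ 3 := one_le_pow₀ (by exact_mod_cast hp.hr)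
  nlinarith [hp.η0]

lemma xlev_facts {S r Lg : ℕ} {e κ η β γ : ℝ} (hp : CParams S r e κ η β γ Lg) {m : ℕ}
    (hm1 : 1 ≤ m) (hmr : m ≤ r) :
    e ≤ xlev e r m - 1 ∧ 1 / (xlev e r m - 1) + 3 * η ≤ 1 / xlev e r (m - 1) := by
  have hr : (1 : ℝ) ≤ r := by exact_mod_cast hp.hr
  have hm1' : (1 : ℝ) ≤ m := by exact_mod_cast hm1
  have hmr' : (m : ℝ) ≤ r := by exact_mod_cast hmr
  have he := hp.e0
  have h1 : (m : ℝ) / r ≤ 1 := div_le_one_of_le₀ hmr' (by positivity)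
  have h0 : (0 : ℝ) ≤ (m : ℝ) / r := by positivity
  have hx : e ≤ xlev e r m - 1 := by unfold xlev; nlinarith
  refine ⟨hx, ?_⟩
  have hxr : xlev e r m - 1 ≤ r := by
    unfold xlev; nlinarith [hp.e1]
  have hy : xlev e r (m - 1) = xlev e r m - 1 - e / r := by
    unfold xlev
    rw [Nat.cast_sub hm1]
    field_simp
    push_cast; ring
  have hy0 : 0 < xlev e r (m - 1) := by unfold xlev; positivity
  have her : 0 < e / r := by positivity
  have hxp : 0 < xlev e r m - 1 := he.trans_le hx
  have hη : 3 * η = e / r ^ 3 := by rw [← hp.η1]; field_simp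
  have key : e / r ^ 3 ≤ 1 / xlev e r (m - 1) - 1 / (xlev e r m - 1) := by
    rw [div_sub_div _ _ hy0.ne' hxp.ne']
    have : 1 * (xlev e r m - 1) - xlev e r (m - 1) * 1 = e / r := by rw [hy]; ring
    rw [this, div_le_div_iff₀ (by positivity) (by positivity)]
    have h5 : xlev e r (m - 1) * (xlev e r m - 1) ≤ r * r := by
      gcongr; linarith
    calc e * (xlev e r (m - 1) * (xlev e r m - 1)) ≤ e * (r * r) := by gcongr
      _ = e / r * r ^ 3 := by field_simp
  linarith

lemma level_gain {e η σ d M β l : ℝ} (e0 : 0 < e) (η0 : 0 < η) (η1 : η ≤ 1 / 12) (e1 : e ≤ 1 / 4)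
    (hσ0 : 0 < σ) (hσe : σ ≤ 1 / e) (hd0 : 0 < d) (hβη : 16 * β ≤ η * e ^ 2) (hl1 : l ≤ β * d)
    (hM : e / 2 * d ≤ M) : η * e ^ 2 / 8 * d ≤ η / (σ + η) * M - l := by
  have h1 : η * e / 2 ≤ η / (σ + η) := by
    rw [le_div_iff₀ (by positivity)]
    have h2 : e * σ ≤ 1 := by
      calc e * σ ≤ e * (1 / e) := by gcongr
        _ = 1 := by field_simp
    have h3 : e * η ≤ 1 / 4 * (1 / 12) := by gcongr
    calc η * e / 2 * (σ + η) = η / 2 * (e * σ + e * η) := by ring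
      _ ≤ η / 2 * (1 + 1 / 4 * (1 / 12)) := by gcongr
      _ ≤ η := by linarith
  have h2 : η * e / 2 * (e / 2 * d) ≤ η / (σ + η) * M := by gcongr
  have h3 : 16 * β * d ≤ η * e ^ 2 * d := by gcongr
  have h4 : 0 ≤ η * e ^ 2 * d := by positivity
  linarith

lemma level_size {e η σ d w β l : ℝ} (e0 : 0 < e) (η0 : 0 < η) (η1 : η ≤ 1 / 12) (e1 : e ≤ 1 / 4)
    (hσ0 : 0 < σ) (hσe : σ ≤ 1 / e) (hw0 : 0 ≤ w) (hw : w ≤ (e * η * β / 8) * d)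
    (hd4 : 4 ≤ η * β * d) (hβd : 0 < β * d) (hl2 : β * d / 2 ≤ l) :
    (σ + 2 * η) * w ^ 2 ≤ η * l ^ 2 - l := by
  have h1e : 4 ≤ 1 / e := by rw [le_div_iff₀ e0]; linarith
  have h1 : (σ + 2 * η) ≤ 2 / e := by
    have : 2 / e = 1 / e + 1 / e := by ring
    linarith
  have h3 : (σ + 2 * η) * w ^ 2 ≤ 2 / e * ((e * η * β / 8) * d) ^ 2 := by gcongr
  have h4 : 2 / e * ((e * η * β / 8) * d) ^ 2 = e * η / 32 * (η * (β * d) ^ 2) := by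
    field_simp; ring
  have h5 : e * η / 32 * (η * (β * d) ^ 2) ≤ 1 / 8 * (η * (β * d) ^ 2) := by
    have : e * η ≤ 1 / 4 * (1 / 12) := by gcongr
    exact mul_le_mul_of_nonneg_right (by linarith) (by positivity)
  have h8 : 2 ≤ η * l := by
    have := mul_le_mul_of_nonneg_left hl2 η0.le
    linarith
  have h6 : η * l ^ 2 / 2 ≤ η * l ^ 2 - l := by
    have : 2 * l ≤ η * l * l := by gcongr; linarith
    linarith
  have h7 : η * (β * d / 2) ^ 2 ≤ η * l ^ 2 := by gcongr
  linarith

lemma cov_level {r Lg : ℕ} {e κ η β γ : ℝ} (hp : CParams (Fintype.card V) r e κ η β γ Lg) {m : ℕ}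
    (hm1 : 1 ≤ m) (hmr : m ≤ r) (P : SimpleGraph V) (Y : Finset V) (M : V → Finset V)
    (hM : ∀ v ∈ Y, M v ⊆ nb P v) {d K : ℝ}
    (hd : γ ^ (r + 1 - m) * Fintype.card V ≤ d)
    (hMd : ∀ v ∈ Y, e / 2 * d ≤ (M v).card)
    (hnd : ∀ v ∈ Y, ∀ y ∈ M v, (nd P (M v) y : ℝ) ≤ 1 / (xlev e r m - 1) * (M v).card)
    (hY : η * γ ^ (2 * r) * (Fintype.card V : ℝ) ^ 2 ≤ Y.card * d) (hK : 0 ≤ K)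
    (ih : ∀ W : Finset V, γ ^ (r + 2 - m) * Fintype.card V ≤ W.card →
      (∀ x ∈ W, (nd P W x : ℝ) ≤ 1 / xlev e r (m - 1) * W.card) →
      Cov κ P (fun H => H.CliqueFreeOn (W : Set V) m) K) :
    Cov κ P (fun H => ∀ v ∈ Y, H.CliqueFreeOn ((nb H v ∩ M v : Finset V) : Set V) m)
      (2 ^ (Fintype.card V) * K + qlev (Fintype.card V) r e κ η γ) := by
  obtain ⟨hx, hxη⟩ := xlev_facts hp hm1 hmr
  set S := Fintype.card V
  set σ := 1 / (xlev e r m - 1) with hσdef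
  have e0 := hp.e0
  have e1 := hp.e1
  have κ0 := hp.κ0
  have κ1 := hp.κ1
  have η0 := hp.η0
  have η1 := hp.eta_le
  have β0 := hp.β0
  have γ0 := hp.γ0
  have γ1 := hp.γ1
  have Lg1 : (1 : ℝ) ≤ Lg := by exact_mod_cast hp.Lg1
  have hσ0 : 0 < σ := by rw [hσdef]; exact one_div_pos.2 (by linarith)
  have hσe : σ ≤ 1 / e := one_div_le_one_div_of_le e0 hx
  have hS0 : (0 : ℝ) ≤ S := by positivity
  have hpow1 : γ ^ (r + 2 - m) = γ * γ ^ (r + 1 - m) := by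
    rw [← pow_succ']; congr 1; omega
  have hp1 : γ ^ (r + 1) ≤ γ ^ (r + 2 - m) := pow_le_pow_of_le_one γ0.le γ1 (by omega)
  have hp2 : γ ^ r ≤ γ ^ (r + 1 - m) := pow_le_pow_of_le_one γ0.le γ1 (by omega)
  have hw1 : 1 ≤ η * (γ ^ (r + 2 - m) * S) := hp.h1.trans (by gcongr)
  have hd4 : 4 ≤ η * β * d := hp.h2.trans (by gcongr; exact le_trans (by gcongr) hd)
  have hd0 : 0 < d := by
    by_contra hcon
    push Not at hcon
    have : η * β * d ≤ 0 := mul_nonpos_of_nonneg_of_nonpos (by positivity) hcon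
    linarith
  have hSpos : (0 : ℝ) < S := by
    rcases hS0.eq_or_lt with h | h
    · rw [← h] at hw1; norm_num at hw1
    · exact h
  set l := ⌊β * d⌋₊ with hl
  have hβd : 48 ≤ β * d := by
    have : η * (β * d) ≤ 1 / 12 * (β * d) := by gcongr
    linarith
  have hl1 : (l : ℝ) ≤ β * d := Nat.floor_le (by positivity)
  have hl2 : β * d / 2 ≤ l := by
    have := Nat.lt_floor_add_one (β * d)
    linarith
  have hβη : 16 * β ≤ η * e ^ 2 := by
    have h1 : β * (16 * 1) ≤ β * (16 * Lg) := by gcongr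
    have h2 : κ * η * e ^ 2 ≤ 1 * η * e ^ 2 := by gcongr
    linarith [hp.hβ]
  set g := η * e ^ 2 / 8 * d with hg
  refine Cov.mono (cov_step (σ := σ) (η := η) (g := g) (w₀ := γ ^ (r + 2 - m) * S) (l := l) κ0.le
    hσ0 η0 P Y M hM hnd ?_ hK ?_ (by positivity) (by linarith) ?_) (fun H _ h => h) ?_
  · intro v hv
    exact level_gain e0 η0 η1 e1 hσ0 hσe hd0 hβη hl1 (hMd v hv)
  · intro W hW hWnd
    refine ih W hW fun x hx => (hWnd x hx).trans ?_
    gcongr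
  · refine level_size e0 η0 η1 e1 hσ0 hσe (by positivity) ?_ hd4 (by positivity) hl2
    rw [hpow1, mul_assoc]
    have := hp.hγ
    gcongr
  · gcongr
    have h1 : ((S : ℝ) + 1) ^ l ≤ 2 ^ (Lg * (β * d)) := by
      calc ((S : ℝ) + 1) ^ l ≤ ((2 : ℝ) ^ Lg) ^ l := by
            gcongr; exact_mod_cast hp.hS
        _ = (2 : ℝ) ^ ((Lg : ℝ) * l) := by
            rw [← pow_mul, ← Real.rpow_natCast]; push_cast; rfl
        _ ≤ _ := by
            refine Real.rpow_le_rpow_of_exponent_le (by norm_num) (by gcongr)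
    have h2 : ((S : ℝ) + 1) ^ l * 2 ^ (-(κ * g)) ≤ 2 ^ (-(κ * η * e ^ 2 / 16 * d)) := by
      calc _ ≤ (2 : ℝ) ^ (Lg * (β * d)) * 2 ^ (-(κ * g)) := by gcongr
        _ = 2 ^ (Lg * (β * d) + -(κ * g)) := (Real.rpow_add (by norm_num) _ _).symm
        _ ≤ _ := by
            refine Real.rpow_le_rpow_of_exponent_le (by norm_num) ?_
            have : β * (16 * Lg) * d ≤ κ * η * e ^ 2 * d := by
              have := hp.hβ; gcongr
            rw [hg]; linarith
    calc _ ≤ ((2 : ℝ) ^ (-(κ * η * e ^ 2 / 16 * d))) ^ Y.card := by gcongr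
      _ = 2 ^ (-(κ * η * e ^ 2 / 16 * d) * Y.card) := by
          rw [← Real.rpow_natCast, ← Real.rpow_mul (by norm_num)]
      _ ≤ qlev S r e κ η γ := by
          refine Real.rpow_le_rpow_of_exponent_le (by norm_num) ?_
          have h4 : κ * η * e ^ 2 * (η * γ ^ (2 * r) * (S : ℝ) ^ 2) ≤
              κ * η * e ^ 2 * (Y.card * d) := by gcongr
          linarith

/-- If `P` is dense on a large set `D`, its `K_{m+1}`-free subgraphs have light containers. -/
lemma cov_dense {r Lg : ℕ} {e κ η β γ : ℝ} (hp : CParams (Fintype.card V) r e κ η β γ Lg)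
    (P : SimpleGraph V) (m : ℕ) (hmr : m ≤ r) :
    ∀ D : Finset V, γ ^ (r + 1 - m) * Fintype.card V ≤ D.card →
      (∀ x ∈ D, (nd P D x : ℝ) ≤ 1 / xlev e r m * D.card) →
      Cov κ P (fun H => H.CliqueFreeOn (D : Set V) (m + 1))
        (2 ^ ((Fintype.card V + 1) * m) * qlev (Fintype.card V) r e κ η γ) := by
  induction m with
  | zero =>
    intro D hD _
    have hDne : D.Nonempty := by
      rw [Finset.nonempty_iff_ne_empty]
      rintro rfl
      have := hp.h1
      simp only [Finset.card_empty, Nat.cast_zero, tsub_zero] at hD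
      have : η * (γ ^ (r + 1) * (Fintype.card V : ℝ)) ≤ 0 :=
        mul_nonpos_of_nonneg_of_nonpos hp.η0.le hD
      linarith
    obtain ⟨x, hx⟩ := hDne
    refine ⟨∅, by simp, fun H _ hH => ?_, ?_⟩
    · refine absurd ?_ (hH (t := {x}) (by simpa using hx))
      simp [SimpleGraph.isNClique_iff]
    · simp only [Finset.sum_empty]
      unfold qlev; positivity
  | succ m ih =>
    intro D hD hnd
    have hxlev := (xlev_facts hp (m := m + 1) (by omega) hmr).1
    set S := Fintype.card V
    set x := xlev e r (m + 1)
    have e0 := hp.e0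
    have γ0 := hp.γ0
    have hx0 : 0 < x := by linarith
    have hD1 : γ ^ r * (S : ℝ) ≤ D.card := le_trans (by
      gcongr ?_ * _
      exact pow_le_pow_of_le_one γ0.le hp.γ1 (by omega)) hD
    have hcard : ∀ v, ((nb P v ∩ D).card : ℝ) = D.card - nd P D v := by
      intro v
      have h1 : (D.filter fun y => P.Adj v y).card + nd P D v = D.card :=
        Finset.card_filter_add_card_filter_not _
      have h2 : nb P v ∩ D = D.filter fun y => P.Adj v y := by ext y; simp [and_comm]
      rw [h2, ← h1]; push_cast; ring
    have hMc : ∀ v ∈ D, (1 - 1 / x) * (D.card : ℝ) ≤ (nb P v ∩ D).card := by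
      intro v hv
      rw [hcard]
      linarith [hnd v hv]
    have hq : 0 ≤ qlev S r e κ η γ := by unfold qlev; positivity
    have hmain := cov_level hp (m := m + 1) (by omega) hmr P D (fun v => nb P v ∩ D)
      (fun v _ => Finset.inter_subset_left) (d := D.card)
      (K := 2 ^ ((S + 1) * m) * qlev S r e κ η γ) hD ?_ ?_ ?_ (by positivity) ?_
    · refine hmain.mono ?_ ?_
      · intro H hH hfree v hv t ht hcl
        refine hfree (t := insert v t) ?_ (hcl.insert ?_)
        · intro y hy
          rcases Finset.mem_insert.1 (by exact_mod_cast hy) with rfl | hy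
          · exact hv
          · have := ht hy
            simp only [Finset.coe_inter, Set.mem_inter_iff, Finset.mem_coe] at this
            exact this.2.2
        · intro y hy
          have := ht hy
          simp only [Finset.coe_inter, Set.mem_inter_iff, Finset.mem_coe, mem_nb] at this
          exact this.1
      · have h1 : (2 : ℝ) ^ ((S + 1) * (m + 1)) = 2 * (2 ^ S * 2 ^ ((S + 1) * m)) := by
          rw [← pow_add, ← pow_succ']; congr 1; ring
        have h2 : (1 : ℝ) ≤ 2 ^ S * 2 ^ ((S + 1) * m) := by
          rw [← pow_add]; exact one_le_pow₀ (by norm_num)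
        rw [h1]
        nlinarith
    · intro v hv
      refine le_trans ?_ (hMc v hv)
      gcongr
      rw [le_sub_iff_add_le, ← le_sub_iff_add_le', div_le_iff₀ hx0]
      nlinarith [hp.e1]
    · intro v hv y hy
      have hy' := (Finset.mem_inter.1 hy).2
      have h1 : (nd P (nb P v ∩ D) y : ℝ) ≤ nd P D y := by
        exact_mod_cast nd_mono P Finset.inter_subset_right y
      have h2 : 1 / (x - 1) * ((1 - 1 / x) * (D.card : ℝ)) = 1 / x * D.card := by
        have : x - 1 ≠ 0 := by linarith
        field_simp
      refine h1.trans ((hnd y hy').trans ?_)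
      rw [← h2]
      have : 0 < x - 1 := by linarith
      gcongr
      exact hMc v hv
    · have h1 : γ ^ (2 * r) = γ ^ r * γ ^ r := by rw [two_mul, pow_add]
      have h2 : (γ ^ r * (S : ℝ)) * (γ ^ r * S) ≤ (D.card : ℝ) * D.card := by gcongr
      have h3 : η * γ ^ (2 * r) * (S : ℝ) ^ 2 ≤ 1 * γ ^ (2 * r) * (S : ℝ) ^ 2 := by
        gcongr; linarith [hp.eta_le]
      calc _ ≤ 1 * γ ^ (2 * r) * (S : ℝ) ^ 2 := h3
        _ = (γ ^ r * (S : ℝ)) * (γ ^ r * S) := by rw [h1]; ring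
        _ ≤ _ := h2
    · intro W hW hWnd
      exact ih (by omega) W (by
        have : r + 1 - m = r + 2 - (m + 1) := by omega
        rw [this]; exact hW) hWnd

/-- No large set of vertices has large dense subsets inside their neighbourhoods. -/
def Stuck (r : ℕ) (e η γ : ℝ) (P : SimpleGraph V) : Prop :=
  ((Finset.univ.filter fun v => ∃ D ⊆ nb P v, γ * Fintype.card V ≤ D.card ∧
    ∀ x ∈ D, (nd P D x : ℝ) ≤ 1 / (r - 1 + 2 * e) * D.card).card : ℝ) ≤ η * Fintype.card V

/-- Container theorem for `K_{r+1}`-free graphs. -/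
lemma exists_containers {r Lg : ℕ} {e κ η β γ : ℝ}
    (hp : CParams (Fintype.card V) r e κ η β γ Lg) (P₀ : SimpleGraph V) :
    ∃ C : Finset (SimpleGraph V), (C.card : ℝ) ≤ 2 ^ (κ * ec P₀) ∧
      (∀ P ∈ C, P ≤ P₀ ∧ Stuck r e η γ P) ∧
      ∀ H ≤ P₀, H.CliqueFree (r + 1) → ∃ P ∈ C, H ≤ P := by
  induction hN : ec P₀ using Nat.strong_induction_on generalizing P₀ with
  | _ N ih =>
  by_cases hst : Stuck r e η γ P₀
  · refine ⟨{P₀}, ?_, by simpa using hst, fun H hH _ => ⟨P₀, by simp, hH⟩⟩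
    have := hp.κ0
    simpa using Real.one_le_rpow (x := 2) (by norm_num) (by positivity)
  have hr : (1 : ℝ) ≤ r := by exact_mod_cast hp.hr
  have hcov : Cov κ P₀ (fun H => H.CliqueFree (r + 1))
      (2 ^ ((Fintype.card V + 1) * r) * qlev (Fintype.card V) r e κ η γ) := by
    unfold Stuck at hst
    push Not at hst
    set Y := Finset.univ.filter fun v => ∃ D ⊆ nb P₀ v, γ * Fintype.card V ≤ D.card ∧
      ∀ x ∈ D, (nd P₀ D x : ℝ) ≤ 1 / (r - 1 + 2 * e) * D.card
    have hY : ∀ v, ∃ D : Finset V, v ∈ Y → D ⊆ nb P₀ v ∧ γ * Fintype.card V ≤ D.card ∧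
        ∀ x ∈ D, (nd P₀ D x : ℝ) ≤ 1 / (r - 1 + 2 * e) * D.card := by
      intro v
      by_cases hv : v ∈ Y
      · obtain ⟨D, hD⟩ := (Finset.mem_filter.1 hv).2
        exact ⟨D, fun _ => hD⟩
      · exact ⟨∅, fun h => absurd h hv⟩
    choose M hM using hY
    have hx : xlev e r r - 1 = r - 1 + 2 * e := by
      unfold xlev; rw [div_self (by positivity)]; ring
    have hq : 0 ≤ qlev (Fintype.card V) r e κ η γ := by unfold qlev; positivity
    have hmain := cov_level hp hp.hr le_rfl P₀ Y M (fun v hv => (hM v hv).1)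
      (d := γ * Fintype.card V)
      (K := 2 ^ ((Fintype.card V + 1) * (r - 1)) * qlev (Fintype.card V) r e κ η γ) (by simp)
      ?_ ?_ ?_ (by positivity) ?_
    · refine hmain.mono ?_ ?_
      · intro H hH hfree v hv t ht hcl
        refine hfree _ (hcl.insert (a := v) ?_)
        intro y hy
        have := ht hy
        simp only [Finset.coe_inter, Set.mem_inter_iff, Finset.mem_coe, mem_nb] at this
        exact this.1
      · set S := Fintype.card V
        have h0 : (S + 1) * r = S + (S + 1) * (r - 1) + 1 := by
          obtain ⟨t, ht⟩ : ∃ t, r = t + 1 := ⟨r - 1, by have := hp.hr; omega⟩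
          rw [ht]; simp; ring
        have h1 : (2 : ℝ) ^ ((S + 1) * r) = 2 * (2 ^ S * 2 ^ ((S + 1) * (r - 1))) := by
          rw [← pow_add, ← pow_succ', h0]
        have h2 : (1 : ℝ) ≤ 2 ^ S * 2 ^ ((S + 1) * (r - 1)) := by
          rw [← pow_add]; exact one_le_pow₀ (by norm_num)
        rw [h1]
        nlinarith
    · intro v hv
      have h1 := (hM v hv).2.1
      have h2 : 0 ≤ γ * (Fintype.card V : ℝ) := by have := hp.γ0; positivity
      nlinarith [hp.e1, hp.e0]
    · intro v hv y hy
      rw [hx]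
      exact (hM v hv).2.2 y hy
    · have h1 : γ ^ (2 * r) ≤ γ := by
        simpa using pow_le_pow_of_le_one hp.γ0.le hp.γ1 (show 1 ≤ 2 * r by have := hp.hr; omega)
      have h2 : η * γ ^ (2 * r) * (Fintype.card V : ℝ) ^ 2 ≤ η * γ * (Fintype.card V : ℝ) ^ 2 := by
        have := hp.η0; gcongr
      have h3 : η * Fintype.card V * (γ * Fintype.card V) ≤ Y.card * (γ * Fintype.card V) := by
        have := hp.γ0; gcongr
      nlinarith
    · intro W hW hWnd
      have := cov_dense hp P₀ (r - 1) (by omega) W (by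
        have h : r + 1 - (r - 1) = r + 2 - r := by have := hp.hr; omega
        rw [h]; exact hW) hWnd
      rwa [Nat.sub_add_cancel hp.hr] at this
  have hlt : (2 : ℝ) ^ ((Fintype.card V + 1) * r) * qlev (Fintype.card V) r e κ η γ < 1 := by
    unfold qlev
    rw [← Real.rpow_natCast, ← Real.rpow_add (by norm_num)]
    refine Real.rpow_lt_one_of_one_lt_of_neg (by norm_num) ?_
    have := hp.h3
    push_cast
    linarith
  obtain ⟨C, hC1, hC2, hC3⟩ := hcov
  have hec : ∀ P ∈ C, ec P < N := by
    intro P hP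
    refine lt_of_le_of_ne (hN ▸ ec_mono (hC1 P hP)) fun heq => ?_
    have h1 : (1 : ℝ) ≤ ∑ P' ∈ C, (2 : ℝ) ^ (-(κ * ((ec P₀ : ℝ) - ec P'))) := by
      calc (1 : ℝ) = (2 : ℝ) ^ (-(κ * ((ec P₀ : ℝ) - ec P))) := by rw [heq, hN]; simp
        _ ≤ _ := Finset.single_le_sum (f := fun P' => (2 : ℝ) ^ (-(κ * ((ec P₀ : ℝ) - ec P'))))
          (fun _ _ => by positivity) hP
    linarith
  have hsub : ∀ P, ∃ C' : Finset (SimpleGraph V), P ∈ C → (C'.card : ℝ) ≤ 2 ^ (κ * ec P) ∧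
      (∀ P' ∈ C', P' ≤ P ∧ Stuck r e η γ P') ∧
      ∀ H ≤ P, H.CliqueFree (r + 1) → ∃ P' ∈ C', H ≤ P' := by
    intro P
    by_cases hP : P ∈ C
    · obtain ⟨C', h⟩ := ih (ec P) (hec P hP) P rfl
      exact ⟨C', fun _ => h⟩
    · exact ⟨∅, fun h => absurd h hP⟩
  choose C' hC' using hsub
  refine ⟨C.biUnion C', ?_, ?_, ?_⟩
  · calc ((C.biUnion C').card : ℝ) ≤ ∑ P ∈ C, ((C' P).card : ℝ) := by
          exact_mod_cast Finset.card_biUnion_le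
      _ ≤ ∑ P ∈ C, (2 : ℝ) ^ (κ * ec P) := Finset.sum_le_sum fun P hP => (hC' P hP).1
      _ = 2 ^ (κ * N) * ∑ P ∈ C, (2 : ℝ) ^ (-(κ * ((ec P₀ : ℝ) - ec P))) := by
          rw [Finset.mul_sum]
          refine Finset.sum_congr rfl fun P _ => ?_
          rw [← Real.rpow_add (by norm_num), hN]
          congr 1; ring
      _ ≤ 2 ^ (κ * N) * 1 := by
          gcongr
          linarith
      _ = _ := mul_one _
  · intro P hP
    obtain ⟨P', hP', hP⟩ := Finset.mem_biUnion.1 hP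
    have := (hC' P' hP').2.1 P hP
    exact ⟨this.1.trans (hC1 P' hP'), this.2⟩
  · intro H hH hfree
    obtain ⟨P, hP, hle⟩ := hC2 H hH hfree
    obtain ⟨P', hP', hle'⟩ := (hC' P hP).2.2 H hle hfree
    exact ⟨P', Finset.mem_biUnion.2 ⟨P, hP, hP'⟩, hle'⟩

end ContainerLevels

section Stability

variable {V : Type*} [Fintype V]

/-- Number of ordered pairs adjacent in `P` and coloured alike. -/
noncomputable def intE {ι : Type*} (P : SimpleGraph V) (c : V → ι) : ℕ :=
  (Finset.univ.filter fun p : V × V => c p.1 = c p.2 ∧ P.Adj p.1 p.2).card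

/-- Edges of `P` inside the set of non-neighbours of `y`. -/
noncomputable def innE (P : SimpleGraph V) (y : V) : Finset (V × V) :=
  Finset.univ.filter fun p => P.Adj p.1 p.2 ∧ ¬ P.Adj p.1 y ∧ ¬ P.Adj p.2 y

/-- Non-adjacent pairs between the neighbours and the non-neighbours of `v`. -/
noncomputable def outE (P : SimpleGraph V) (v : V) : Finset (V × V) :=
  Finset.univ.filter fun p => P.Adj v p.1 ∧ ¬ P.Adj v p.2 ∧ ¬ P.Adj p.1 p.2

lemma sum_innE_eq (P : SimpleGraph V) : ∑ y, (innE P y).card = ∑ v, (outE P v).card := by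
  simp only [innE, outE, Finset.card_filter, Fintype.sum_prod_type]
  rw [Finset.sum_comm]
  exact Finset.sum_congr rfl fun v _ => by rw [Finset.sum_comm]

lemma card_outE_add (P : SimpleGraph V) (v : V) :
    (outE P v).card + ∑ x ∈ nb P v, nd P (nb P v) x + ∑ x ∈ nb P v, (nb P x).card =
      (nb P v).card * Fintype.card V := by
  have h1 : (outE P v).card = ∑ x ∈ nb P v,
      (Finset.univ.filter fun y => ¬ P.Adj v y ∧ ¬ P.Adj x y).card := by
    simp only [outE, nb, Finset.card_filter, Fintype.sum_prod_type, Finset.sum_filter]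
    refine Finset.sum_congr rfl fun x _ => ?_
    by_cases h : P.Adj v x <;> simp [h]
  rw [h1, ← Finset.sum_add_distrib, ← Finset.sum_add_distrib, ← smul_eq_mul, ← Finset.sum_const]
  refine Finset.sum_congr rfl fun x _ => ?_
  have h2 : (Finset.univ.filter fun y => ¬ P.Adj v y ∧ ¬ P.Adj x y).card + nd P (nb P v) x =
      (Finset.univ.filter fun y => ¬ P.Adj x y).card := by
    rw [← Finset.card_filter_add_card_filter_not (s := Finset.univ.filter fun y => ¬ P.Adj x y)
      (fun y => P.Adj v y), add_comm]
    unfold nd nb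
    simp only [Finset.filter_filter]
    congr 3
    · ext y; simp [and_comm]
    · ext y; simp [and_comm]
  rw [h2, add_comm]
  exact Finset.card_filter_add_card_filter_not _

lemma sum_nb_comm (P : SimpleGraph V) :
    ∑ v, ∑ x ∈ nb P v, (nb P x).card = ∑ v, (nb P v).card ^ 2 := by
  simp only [nb, Finset.sum_filter]
  rw [Finset.sum_comm]
  refine Finset.sum_congr rfl fun v _ => ?_
  rw [Finset.sum_congr rfl fun x _ => if_congr (P.adj_comm x v) rfl rfl, ← Finset.sum_filter]
  simp [sq]

lemma sum_outE (P : SimpleGraph V) :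
    ∑ v, (outE P v).card + ∑ v, ∑ x ∈ nb P v, nd P (nb P v) x + ∑ v, (nb P v).card ^ 2 =
      ec P * Fintype.card V := by
  rw [← sum_nb_comm, ec, Finset.sum_mul, ← Finset.sum_add_distrib, ← Finset.sum_add_distrib]
  exact Finset.sum_congr rfl fun v _ => card_outE_add P v

lemma card_bad_le {f : V → ℝ} (hf : ∀ v, 0 ≤ f v) {a b : ℝ} (hb : 0 < b) (h : ∑ v, f v ≤ a) :
    ((Finset.univ.filter fun v => b < f v).card : ℝ) ≤ a / b := by
  rw [le_div_iff₀ hb]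
  calc _ = ∑ v ∈ Finset.univ.filter fun v => b < f v, b := by simp
    _ ≤ ∑ v ∈ Finset.univ.filter fun v => b < f v, f v :=
      Finset.sum_le_sum fun v hv => (Finset.mem_filter.1 hv).2.le
    _ ≤ ∑ v, f v := Finset.sum_le_sum_of_subset_of_nonneg (Finset.filter_subset _ _)
      fun v _ _ => hf v
    _ ≤ a := h

/-- A nearly regular graph with few induced complement-cherries is nearly `r`-partite. -/
lemma exists_coloring (P : SimpleGraph V) {r : ℕ} (hr : 1 ≤ r) {ω : ℝ} (hω : 0 < ω) (hω1 : ω ≤ 1)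
    (hch : ∑ v, ((outE P v).card : ℝ) ≤ ω ^ 4 * (Fintype.card V : ℝ) ^ 3)
    (hdev : ∑ v, (((nb P v).card : ℝ) - (1 - 1 / r) * (Fintype.card V : ℝ)) ^ 2 ≤
      ω ^ 4 * (Fintype.card V : ℝ) ^ 3) :
    ∃ c : V → Fin r, (intE P c : ℝ) ≤ 9 * r * ω * (Fintype.card V : ℝ) ^ 2 := by
  set S : ℝ := (Fintype.card V : ℝ) with hS
  have hr' : (1 : ℝ) ≤ r := by exact_mod_cast hr
  rcases isEmpty_or_nonempty V with hV | hV
  · refine ⟨fun _ => ⟨0, hr⟩, ?_⟩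
    have : intE P (fun _ : V => (⟨0, hr⟩ : Fin r)) = 0 := by
      unfold intE
      rw [Finset.card_eq_zero, Finset.univ_eq_empty, Finset.filter_empty]
    rw [this]; simp only [Nat.cast_zero]; positivity
  have hS0 : 0 < S := by rw [hS]; exact_mod_cast Fintype.card_pos
  have step : ∀ i : ℕ, i ≤ r → ∃ (U : Finset V) (c : V → ℕ), (∀ x, x ∉ U → c x < i) ∧
      ((Finset.univ.filter fun p : V × V => p.1 ∉ U ∧ p.2 ∉ U ∧ c p.1 = c p.2 ∧
        P.Adj p.1 p.2).card : ℝ) ≤ i * (ω ^ 2 * S ^ 2) ∧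
      ((Finset.univ.filter fun p : V × V => p.1 ∈ U ∧ p.2 ∉ U ∧
        ¬ P.Adj p.1 p.2).card : ℝ) ≤ i * (ω ^ 2 * S ^ 2) ∧
      ((U.card : ℝ) ≤ 4 * r * ω * S ∨ (U.card : ℝ) ≤ S - i * (S / r - 2 * ω * S)) := by
    intro i
    induction i with
    | zero =>
      intro _
      refine ⟨Finset.univ, fun _ => 0, by simp, by simp, by simp, Or.inr ?_⟩
      simp [hS]
    | succ i ih =>
      intro hi
      obtain ⟨U, c, hc, h1, h2, h3⟩ := ih (by omega)
      have hir : (i : ℝ) ≤ r := by exact_mod_cast (by omega : i ≤ r)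
      by_cases hU : (U.card : ℝ) ≤ 4 * r * ω * S
      · refine ⟨U, c, fun x hx => (hc x hx).trans (by omega), h1.trans ?_, h2.trans ?_, Or.inl hU⟩
        all_goals gcongr; omega
      replace h3 := h3.resolve_left hU
      push Not at hU
      have hb1 := card_bad_le (f := fun v => ((outE P v).card : ℝ)) (fun v => by positivity)
        (b := ω ^ 2 * S ^ 2) (by positivity) hch
      have hb2 := card_bad_le (f := fun v => ((innE P v).card : ℝ)) (fun v => by positivity)
        (b := ω ^ 2 * S ^ 2) (by positivity) (a := ω ^ 4 * S ^ 3) (by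
          refine le_trans (le_of_eq ?_) hch
          exact_mod_cast sum_innE_eq P)
      have hb3 := card_bad_le (f := fun v => ((nb P v).card - (1 - 1 / r) * S : ℝ) ^ 2)
        (fun v => by positivity) (b := ω ^ 2 * S ^ 2) (by positivity) hdev
      have hb4 := card_bad_le (f := fun v => if v ∈ U then
          ((Finset.univ.filter fun y => y ∉ U ∧ ¬ P.Adj v y).card : ℝ) else 0)
        (fun v => by positivity) (b := ω * S) (by positivity) (a := r * (ω ^ 2 * S ^ 2)) (by
          refine le_trans (le_of_eq ?_) (h2.trans (by gcongr))
          simp only [Finset.card_filter, Fintype.sum_prod_type]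
          push_cast
          refine Finset.sum_congr rfl fun v _ => ?_
          by_cases hv : v ∈ U <;> simp [hv])
      have he1 : ω ^ 4 * S ^ 3 / (ω ^ 2 * S ^ 2) = ω ^ 2 * S := by field_simp
      have he2 : (r : ℝ) * (ω ^ 2 * S ^ 2) / (ω * S) = r * ω * S := by field_simp
      rw [he1] at hb1 hb2 hb3
      rw [he2] at hb4
      obtain ⟨v, hvU, hv⟩ : ∃ v ∈ U, (((outE P v).card : ℝ) ≤ ω ^ 2 * S ^ 2 ∧
          ((innE P v).card : ℝ) ≤ ω ^ 2 * S ^ 2 ∧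
          ((nb P v).card - (1 - 1 / r) * S : ℝ) ^ 2 ≤ ω ^ 2 * S ^ 2 ∧
          ((Finset.univ.filter fun y => y ∉ U ∧ ¬ P.Adj v y).card : ℝ) ≤ ω * S) := by
        by_contra hcon
        push Not at hcon
        have hsub : U ⊆ ((Finset.univ.filter fun v => ω ^ 2 * S ^ 2 < ((outE P v).card : ℝ)) ∪
            (Finset.univ.filter fun v => ω ^ 2 * S ^ 2 < ((innE P v).card : ℝ))) ∪
            ((Finset.univ.filter fun v => ω ^ 2 * S ^ 2 < ((nb P v).card - (1 - 1 / r) * S : ℝ) ^ 2)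
            ∪ (Finset.univ.filter fun v => ω * S < if v ∈ U then
              ((Finset.univ.filter fun y => y ∉ U ∧ ¬ P.Adj v y).card : ℝ) else 0)) := by
          intro v hv
          simp only [Finset.mem_union, Finset.mem_filter, Finset.mem_univ, true_and, hv, if_true]
          by_contra hcc
          push Not at hcc
          have := hcon v hv hcc.1.1 hcc.1.2 hcc.2.1
          linarith [hcc.2.2]
        have h5 := (Finset.card_le_card hsub).trans ((Finset.card_union_le _ _).trans
          (add_le_add (Finset.card_union_le _ _) (Finset.card_union_le _ _)))
        have h6 : (U.card : ℝ) ≤ (ω ^ 2 * S + ω ^ 2 * S) + (ω ^ 2 * S + r * ω * S) := by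
          refine le_trans (by exact_mod_cast h5) (add_le_add (add_le_add hb1 hb2) (add_le_add hb3 hb4))
        have h7 : ω ^ 2 * S ≤ r * ω * S := by
          have : ω ^ 2 ≤ r * ω := by nlinarith
          gcongr
        linarith
      obtain ⟨hout, hin, hdeg, hN⟩ := hv
      refine ⟨U.filter fun x => P.Adj v x, fun x => if x ∈ U then i else c x, ?_, ?_, ?_, Or.inr ?_⟩
      · intro x hx
        by_cases hxU : x ∈ U
        · simp [hxU]
        · simp only [hxU, if_false]; exact (hc x hxU).trans (by omega)
      · beta_reduce
        have hsub : (Finset.univ.filter fun p : V × V =>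
            p.1 ∉ U.filter (fun x => P.Adj v x) ∧ p.2 ∉ U.filter (fun x => P.Adj v x) ∧
            (if p.1 ∈ U then i else c p.1) = (if p.2 ∈ U then i else c p.2) ∧ P.Adj p.1 p.2) ⊆
            (Finset.univ.filter fun p : V × V => p.1 ∉ U ∧ p.2 ∉ U ∧ c p.1 = c p.2 ∧
              P.Adj p.1 p.2) ∪ innE P v := by
          rintro ⟨x, y⟩ hxy
          simp only [Finset.mem_filter, Finset.mem_univ, true_and, Finset.mem_union, innE] at hxy ⊢
          obtain ⟨hx, hy, hcc, hadj⟩ := hxy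
          by_cases hxU : x ∈ U <;> by_cases hyU : y ∈ U
          · right
            refine ⟨hadj, fun h => hx ⟨hxU, h.symm⟩, fun h => hy ⟨hyU, h.symm⟩⟩
          · simp only [hxU, hyU, if_true, if_false] at hcc
            exact absurd hcc (hc y hyU).ne'
          · simp only [hxU, hyU, if_true, if_false] at hcc
            exact absurd hcc (hc x hxU).ne
          · left
            simp only [hxU, hyU, if_false] at hcc
            exact ⟨hxU, hyU, hcc, hadj⟩
        have h5 := (Finset.card_le_card hsub).trans (Finset.card_union_le _ _)
        refine (Nat.cast_le.2 h5).trans ?_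
        rw [Nat.cast_add]
        push_cast
        linarith
      · beta_reduce
        have hsub : (Finset.univ.filter fun p : V × V =>
            p.1 ∈ U.filter (fun x => P.Adj v x) ∧ p.2 ∉ U.filter (fun x => P.Adj v x) ∧
            ¬ P.Adj p.1 p.2) ⊆
            (Finset.univ.filter fun p : V × V => p.1 ∈ U ∧ p.2 ∉ U ∧
              ¬ P.Adj p.1 p.2) ∪ outE P v := by
          rintro ⟨x, y⟩ hxy
          simp only [Finset.mem_filter, Finset.mem_univ, true_and, Finset.mem_union, outE] at hxy ⊢
          obtain ⟨hx, hy, hadj⟩ := hxy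
          by_cases hyU : y ∈ U
          · exact Or.inr ⟨hx.2, fun h => hy ⟨hyU, h⟩, hadj⟩
          · exact Or.inl ⟨hx.1, hyU, hadj⟩
        have h5 := (Finset.card_le_card hsub).trans (Finset.card_union_le _ _)
        refine (Nat.cast_le.2 h5).trans ?_
        rw [Nat.cast_add]
        push_cast
        linarith
      · have h5 : (U.filter fun x => P.Adj v x).card + (U.filter fun x => ¬ P.Adj v x).card = U.card :=
          Finset.card_filter_add_card_filter_not _
        have h6 : (U.filter fun x => ¬ P.Adj v x).card +
            (Finset.univ.filter fun y => y ∉ U ∧ ¬ P.Adj v y).card =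
            (Finset.univ.filter fun y => ¬ P.Adj v y).card := by
          rw [← Finset.card_filter_add_card_filter_not
            (s := Finset.univ.filter fun y => ¬ P.Adj v y) (fun y => y ∈ U)]
          simp only [Finset.filter_filter]
          congr 2
          · ext y; simp [and_comm]
          · ext y; simp [and_comm]
        have h7 : (nb P v).card + (Finset.univ.filter fun y => ¬ P.Adj v y).card = Fintype.card V :=
          Finset.card_filter_add_card_filter_not _
        have h8 : ((nb P v).card : ℝ) - (1 - 1 / r) * S ≤ ω * S := by
          refine (le_abs_self _).trans (abs_le_of_sq_le_sq (by rw [mul_pow]; exact hdeg) (by positivity))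
        have h5' : ((U.filter fun x => P.Adj v x).card : ℝ) + (U.filter fun x => ¬ P.Adj v x).card =
          U.card := by exact_mod_cast h5
        have h6' : ((U.filter fun x => ¬ P.Adj v x).card : ℝ) +
            (Finset.univ.filter fun y => y ∉ U ∧ ¬ P.Adj v y).card =
            (Finset.univ.filter fun y => ¬ P.Adj v y).card := by exact_mod_cast h6
        have h7' : ((nb P v).card : ℝ) + (Finset.univ.filter fun y => ¬ P.Adj v y).card = S := by
          rw [hS]; exact_mod_cast h7
        have h9 : (1 - 1 / (r : ℝ)) * S = S - S / r := by ring
        push_cast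
        rw [h9] at h8
        linarith
  obtain ⟨U, c, hc, h1, -, h3⟩ := step r le_rfl
  have hU : (U.card : ℝ) ≤ 4 * r * ω * S := by
    rcases h3 with h3 | h3
    · exact h3
    · have : S - r * (S / r - 2 * ω * S) = 2 * r * ω * S := by field_simp; ring
      rw [this] at h3
      have : 0 ≤ r * ω * S := by positivity
      linarith
  refine ⟨fun x => if h : x ∈ U then ⟨0, hr⟩ else ⟨c x, hc x h⟩, ?_⟩
  have hsub : (Finset.univ.filter fun p : V × V =>
      ((if h : p.1 ∈ U then (⟨0, hr⟩ : Fin r) else ⟨c p.1, hc p.1 h⟩) =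
        if h : p.2 ∈ U then (⟨0, hr⟩ : Fin r) else ⟨c p.2, hc p.2 h⟩) ∧ P.Adj p.1 p.2) ⊆
      (Finset.univ.filter fun p : V × V => p.1 ∉ U ∧ p.2 ∉ U ∧ c p.1 = c p.2 ∧
        P.Adj p.1 p.2) ∪ (U ×ˢ Finset.univ ∪ Finset.univ ×ˢ U) := by
    rintro ⟨x, y⟩ hxy
    simp only [Finset.mem_filter, Finset.mem_univ, true_and, Finset.mem_union,
      Finset.mem_product, and_true] at hxy ⊢
    by_cases hxU : x ∈ U
    · exact Or.inr (Or.inl hxU)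
    by_cases hyU : y ∈ U
    · exact Or.inr (Or.inr hyU)
    left
    simp only [hxU, hyU, dif_neg, not_false_eq_true, Fin.mk.injEq] at hxy
    exact ⟨hxU, hyU, hxy.1, hxy.2⟩
  have h5 := (Finset.card_le_card hsub).trans ((Finset.card_union_le _ _).trans
    (Nat.add_le_add_left (Finset.card_union_le _ _) _))
  rw [Finset.card_product, Finset.card_product, Finset.card_univ] at h5
  refine le_trans (Nat.cast_le.2 (le_trans (le_of_eq ?_) h5)) ?_
  · unfold intE
    congr!
  push_cast
  rw [← hS]
  have h6 : (U.card : ℝ) * S ≤ 4 * r * ω * S * S := by gcongr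
  have h7 : (r : ℝ) * (ω ^ 2 * S ^ 2) ≤ r * (ω * S ^ 2) := by
    gcongr
    calc ω ^ 2 ≤ ω ^ 1 := pow_le_pow_of_le_one hω.le hω1 (by norm_num)
      _ = ω := pow_one _
  nlinarith

lemma sum_const_univ (a : ℝ) : ∑ _v : V, a = (Fintype.card V : ℝ) * a := by
  rw [Finset.sum_const, Finset.card_univ, nsmul_eq_mul]

lemma sum_ite_mem_const (s : Finset V) (a : ℝ) :
    (∑ v, if v ∈ s then a else 0) = (s.card : ℝ) * a := by
  rw [Finset.sum_ite_mem, Finset.univ_inter, Finset.sum_const, nsmul_eq_mul]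

lemma div_sub_one_mul {r : ℝ} (hr : 2 ≤ r) : r / (r - 1) * (1 - 1 / r) = 1 := by
  have h1 : r ≠ 0 := by positivity
  have h2 : r - 1 ≠ 0 := ne_of_gt (by linarith)
  field_simp

lemma one_div_level_bounds {r : ℕ} (hr : 2 ≤ r) {e η : ℝ} (e0 : 0 < e) (e1 : e ≤ 1 / 4) (hη : 0 < η)
    (hη1 : 3 * η * (r : ℝ) ^ 3 = e) :
    0 ≤ 1 / ((r : ℝ) - 1 + 2 * e) - 2 * η ∧ 1 / ((r : ℝ) - 1 + 2 * e) - 2 * η ≤ 1 ∧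
      r / ((r : ℝ) - 1) ≤ 1 + (1 / ((r : ℝ) - 1 + 2 * e) - 2 * η) + 2 * e + 2 * η := by
  have hr' : (2 : ℝ) ≤ r := by exact_mod_cast hr
  have h3 : (4 : ℝ) * r ≤ (r : ℝ) ^ 3 := by
    nlinarith [mul_nonneg (mul_nonneg (by linarith : (0 : ℝ) ≤ r) (by linarith : (0 : ℝ) ≤ r - 2))
      (by linarith : (0 : ℝ) ≤ r + 2)]
  have h4 : η * (12 * r) ≤ 1 / 4 := by nlinarith
  refine ⟨?_, ?_, ?_⟩
  · rw [sub_nonneg, le_div_iff₀ (by linarith)]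
    nlinarith
  · have : 1 / ((r : ℝ) - 1 + 2 * e) ≤ 1 := by rw [div_le_one (by linarith)]; linarith
    linarith
  · have h5 : r / ((r : ℝ) - 1) = 1 + 1 / ((r : ℝ) - 1) := by
      rw [eq_comm, one_add_div (by linarith)]; ring
    have h6 : 1 / ((r : ℝ) - 1) ≤ 1 / ((r : ℝ) - 1 + 2 * e) + 2 * e := by
      rw [div_add' _ _ _ (by linarith), div_le_div_iff₀ (by linarith) (by linarith)]
      nlinarith [mul_nonneg e0.le e0.le, mul_nonneg e0.le (by linarith : (0 : ℝ) ≤ r - 2)]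
    linarith

/-- The codegree inequality satisfied by stuck graphs. -/
lemma Stuck.sum_outE_le {P : SimpleGraph V} {r : ℕ} (hr : 2 ≤ r) {e η γ : ℝ} (e0 : 0 < e)
    (e1 : e ≤ 1 / 4) (hη : 0 < η) (hη1 : 3 * η * (r : ℝ) ^ 3 = e) (hγ : 0 ≤ γ) (hγ1 : γ ^ 2 ≤ e)
    (hS : 1 ≤ 4 * (η * (γ * (Fintype.card V : ℝ)))) (hP : Stuck r e η γ P) :
    ∑ v, ((outE P v).card : ℝ) + r / ((r : ℝ) - 1) * ∑ v, ((nb P v).card : ℝ) ^ 2 ≤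
      (ec P : ℝ) * (Fintype.card V : ℝ) + 4 * e * (Fintype.card V : ℝ) ^ 3 := by
  set S : ℝ := (Fintype.card V : ℝ) with hSdef
  have hS0 : 0 ≤ S := by rw [hSdef]; positivity
  obtain ⟨hρ0, hρ1, hρ2⟩ := one_div_level_bounds hr e0 e1 hη hη1
  set ρ' : ℝ := 1 / ((r : ℝ) - 1 + 2 * e) - 2 * η with hρ'
  set bad := Finset.univ.filter fun v => ∃ D ⊆ nb P v, γ * Fintype.card V ≤ D.card ∧
    ∀ x ∈ D, (nd P D x : ℝ) ≤ 1 / (r - 1 + 2 * e) * D.card with hbad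
  have hbadc : (bad.card : ℝ) ≤ η * S := hP
  have hd : ∀ v, ((nb P v).card : ℝ) ≤ S := fun v => by
    rw [hSdef]; exact_mod_cast Finset.card_le_univ _
  have hv : ∀ v, ρ' * ((nb P v).card : ℝ) ^ 2 ≤ ∑ x ∈ nb P v, (nd P (nb P v) x : ℝ) + γ ^ 2 * S ^ 2 +
      if v ∈ bad then S ^ 2 else 0 := by
    intro v
    have hnn : (0 : ℝ) ≤ ∑ x ∈ nb P v, (nd P (nb P v) x : ℝ) :=
      Finset.sum_nonneg fun x _ => Nat.cast_nonneg _
    by_cases hvb : v ∈ bad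
    · rw [if_pos hvb]
      have h1 : ρ' * ((nb P v).card : ℝ) ^ 2 ≤ 1 * S ^ 2 := by gcongr; exact hd v
      have : 0 ≤ γ ^ 2 * S ^ 2 := by positivity
      linarith
    · rw [if_neg hvb]
      obtain ⟨W, hW, hW1, hW2⟩ := exists_trim P (nb P v) hρ0
      have hWc : (W.card : ℝ) < γ * S := by
        by_contra hcon
        push Not at hcon
        refine hvb (Finset.mem_filter.2 ⟨Finset.mem_univ _, W, hW, hcon, fun x hx => ?_⟩)
        have h2 := hW1 x hx
        have h3 : η * (γ * S) ≤ η * W.card := by gcongr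
        rw [hρ'] at h2
        linarith
      have h4 : ρ' * (W.card : ℝ) ^ 2 ≤ 1 * (γ * S) ^ 2 := by gcongr
      rw [mul_pow] at h4
      linarith
  have hsum := Finset.sum_le_sum fun v (_ : v ∈ Finset.univ) => hv v
  rw [Finset.sum_add_distrib, Finset.sum_add_distrib, sum_const_univ, sum_ite_mem_const,
    ← Finset.mul_sum, ← hSdef] at hsum
  have hB : (bad.card : ℝ) * S ^ 2 ≤ η * S * S ^ 2 := by gcongr
  have hmain : ∑ v, ((outE P v).card : ℝ) + ∑ v, ∑ x ∈ nb P v, (nd P (nb P v) x : ℝ) +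
      ∑ v, ((nb P v).card : ℝ) ^ 2 = ec P * S := by
    rw [hSdef]; exact_mod_cast sum_outE P
  have hd2 : ∑ v, ((nb P v).card : ℝ) ^ 2 ≤ S ^ 3 := by
    calc _ ≤ ∑ _v : V, S ^ 2 := Finset.sum_le_sum fun v _ => by gcongr; exact hd v
      _ = S ^ 3 := by rw [sum_const_univ, ← hSdef]; ring
  have hd0 : 0 ≤ ∑ v, ((nb P v).card : ℝ) ^ 2 := Finset.sum_nonneg fun v _ => sq_nonneg _
  have h5 : r / ((r : ℝ) - 1) * ∑ v, ((nb P v).card : ℝ) ^ 2 ≤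
      (1 + ρ' + 2 * e + 2 * η) * ∑ v, ((nb P v).card : ℝ) ^ 2 := mul_le_mul_of_nonneg_right hρ2 hd0
  have h6 : (2 * e + 2 * η) * ∑ v, ((nb P v).card : ℝ) ^ 2 ≤ (2 * e + 2 * η) * S ^ 3 :=
    mul_le_mul_of_nonneg_left hd2 (by linarith)
  have h7 : γ ^ 2 * S ^ 3 ≤ e * S ^ 3 := mul_le_mul_of_nonneg_right hγ1 (pow_nonneg hS0 3)
  have h8 : 3 * η * S ^ 3 ≤ e * S ^ 3 := by
    refine mul_le_mul_of_nonneg_right ?_ (pow_nonneg hS0 3)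
    rw [← hη1]
    have : (1 : ℝ) ≤ (r : ℝ) ^ 3 := one_le_pow₀ (by exact_mod_cast (by omega : 1 ≤ r))
    exact le_mul_of_one_le_right (by positivity) this
  linarith

/-- Turan-type bound for stuck graphs. -/
lemma Stuck.ec_le {P : SimpleGraph V} {r : ℕ} (hr : 1 ≤ r) {e η γ : ℝ} (e0 : 0 < e)
    (e1 : e ≤ 1 / 4) (hη : 0 < η) (hη1 : 3 * η * (r : ℝ) ^ 3 = e) (hγ : 0 ≤ γ) (hγ2 : γ ≤ e)
    (hS : 1 ≤ 4 * (η * (γ * (Fintype.card V : ℝ)))) (hP : Stuck r e η γ P) :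
    (ec P : ℝ) ≤ (1 - 1 / r + 8 * e) * (Fintype.card V : ℝ) ^ 2 := by
  have hγ1 : γ ^ 2 ≤ e := by nlinarith
  have hd : ∀ v, ((nb P v).card : ℝ) ≤ Fintype.card V := fun v => by
    exact_mod_cast Finset.card_le_univ _
  rcases hr.eq_or_lt with rfl | hr
  · have hη2 : 3 * η = e := by simpa using hη1
    set S : ℝ := (Fintype.card V : ℝ) with hSdef
    have hS0 : 0 ≤ S := by rw [hSdef]; positivity
    set bad := Finset.univ.filter fun v => ∃ D ⊆ nb P v, γ * Fintype.card V ≤ D.card ∧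
      ∀ x ∈ D, (nd P D x : ℝ) ≤ 1 / ((1 : ℕ) - 1 + 2 * e) * D.card with hbad
    have hbadc : (bad.card : ℝ) ≤ η * S := hP
    have hv : ∀ v, ((nb P v).card : ℝ) ≤ γ * S + if v ∈ bad then S else 0 := by
      intro v
      by_cases hvb : v ∈ bad
      · rw [if_pos hvb]
        have : 0 ≤ γ * S := by positivity
        linarith [hd v]
      · rw [if_neg hvb, add_zero]
        by_contra hcon
        push Not at hcon
        refine hvb (Finset.mem_filter.2 ⟨Finset.mem_univ _, nb P v, subset_rfl, hcon.le, fun x hx => ?_⟩)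
        calc (nd P (nb P v) x : ℝ) ≤ 1 * (nb P v).card := by
              rw [one_mul]; exact_mod_cast nd_le_card _ _ _
          _ ≤ _ := by
              refine mul_le_mul_of_nonneg_right ?_ (Nat.cast_nonneg _)
              rw [le_div_iff₀ (by push_cast; linarith)]
              push_cast; linarith
    have hsum := Finset.sum_le_sum fun v (_ : v ∈ Finset.univ) => hv v
    rw [Finset.sum_add_distrib, sum_const_univ, sum_ite_mem_const, ← hSdef] at hsum
    have hB : (bad.card : ℝ) * S ≤ η * S * S := by gcongr
    have h7 : γ * S ^ 2 ≤ e * S ^ 2 := by gcongr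
    have h8 : (ec P : ℝ) = ∑ v, ((nb P v).card : ℝ) := by unfold ec; push_cast; rfl
    have h9 : 0 ≤ e * S ^ 2 := by positivity
    rw [h8]
    have h10 : 3 * η * S ^ 2 = e * S ^ 2 := by rw [hη2]
    norm_num
    linarith
  · have hr' : (2 : ℝ) ≤ r := by exact_mod_cast hr
    have hmain := hP.sum_outE_le hr e0 e1 hη hη1 hγ hγ1 hS
    set S : ℝ := (Fintype.card V : ℝ) with hSdef
    have hS0 : 0 < S := by
      rcases (Nat.cast_nonneg (Fintype.card V) : (0 : ℝ) ≤ _).eq_or_lt with h | h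
      · rw [hSdef, ← h] at hS; norm_num at hS
      · exact h
    have hcs : (ec P : ℝ) ^ 2 ≤ S * ∑ v, ((nb P v).card : ℝ) ^ 2 := by
      have := sq_sum_le_card_mul_sum_sq (s := (Finset.univ : Finset V))
        (f := fun v => ((nb P v).card : ℝ))
      unfold ec; push_cast
      rwa [Finset.card_univ, ← hSdef] at this
    have hch0 : (0 : ℝ) ≤ ∑ v, ((outE P v).card : ℝ) :=
    Finset.sum_nonneg fun v _ => Nat.cast_nonneg _
    by_contra hcon
    push Not at hcon
    set m : ℝ := (ec P : ℝ) with hm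
    set D : ℝ := ∑ v, ((nb P v).card : ℝ) ^ 2 with hD
    have h1 : r / ((r : ℝ) - 1) * m ^ 2 ≤ m * S ^ 2 + 4 * e * S ^ 4 := by
      have h2 : r / ((r : ℝ) - 1) * m ^ 2 ≤ r / ((r : ℝ) - 1) * (S * D) :=
        mul_le_mul_of_nonneg_left hcs (div_nonneg (by linarith) (by linarith))
      have h3 : S * (r / ((r : ℝ) - 1) * D) ≤ S * (m * S + 4 * e * S ^ 3) :=
        mul_le_mul_of_nonneg_left (by linarith) hS0.le
      linarith
    set q : ℝ := r / ((r : ℝ) - 1) with hq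
    have hq1 : 1 ≤ q := by rw [hq, le_div_iff₀ (by linarith)]; linarith
    have hq2 : q * (1 - 1 / r) = 1 := div_sub_one_mul hr'
    have hhalf : (1 : ℝ) / 2 ≤ 1 - 1 / r := by
      have : (1 : ℝ) / r ≤ 1 / 2 := by gcongr
      linarith
    have hm1 : 1 / 2 * S ^ 2 ≤ m := by nlinarith [sq_nonneg S]
    have h4 : q * m - S ^ 2 > 8 * e * S ^ 2 := by
      have h5 : q * ((1 - 1 / r + 8 * e) * S ^ 2) < q * m := by gcongr
      have h6 : q * ((1 - 1 / r + 8 * e) * S ^ 2) = (q * (1 - 1 / r)) * S ^ 2 + q * (8 * e * S ^ 2) := by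
        ring
      have h7 : 1 * (8 * e * S ^ 2) ≤ q * (8 * e * S ^ 2) := by gcongr
      rw [h6, hq2] at h5
      linarith
    have hm0 : 0 < m := lt_of_lt_of_le (by positivity) hm1
    have h8 : m * (8 * e * S ^ 2) < m * (q * m - S ^ 2) := by gcongr
    have h9 : 1 / 2 * S ^ 2 * (8 * e * S ^ 2) ≤ m * (8 * e * S ^ 2) := by gcongr
    linarith

/-- Dense stuck graphs are nearly `r`-partite. -/
lemma Stuck.exists_coloring {P : SimpleGraph V} {r : ℕ} (hr : 2 ≤ r) {e η γ κ₀ ω : ℝ} (e0 : 0 < e)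
    (e1 : e ≤ 1 / 4) (hη : 0 < η) (hη1 : 3 * η * (r : ℝ) ^ 3 = e) (hγ : 0 ≤ γ) (hγ2 : γ ≤ e)
    (hS : 1 ≤ 4 * (η * (γ * (Fintype.card V : ℝ)))) (hP : Stuck r e η γ P) (hκ : 0 ≤ κ₀)
    (hω : 0 < ω) (hω1 : ω ≤ 1) (hωκ : 2 * κ₀ + 4 * e ≤ ω ^ 4)
    (hdense : (1 - 1 / r - κ₀) * (Fintype.card V : ℝ) ^ 2 ≤ ec P) :
    ∃ c : V → Fin r, (intE P c : ℝ) ≤ 9 * r * ω * (Fintype.card V : ℝ) ^ 2 := by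
  have hγ1 : γ ^ 2 ≤ e := by nlinarith
  have hr' : (2 : ℝ) ≤ r := by exact_mod_cast hr
  have hmain := hP.sum_outE_le hr e0 e1 hη hη1 hγ hγ1 hS
  have hch0 : (0 : ℝ) ≤ ∑ v, ((outE P v).card : ℝ) :=
    Finset.sum_nonneg fun v _ => Nat.cast_nonneg _
  set S : ℝ := (Fintype.card V : ℝ) with hSdef
  have hS0 : 0 < S := by
    rcases (Nat.cast_nonneg (Fintype.card V) : (0 : ℝ) ≤ _).eq_or_lt with h | h
    · rw [hSdef, ← h] at hS; norm_num at hS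
    · exact h
  have hcs : (ec P : ℝ) ^ 2 ≤ S * ∑ v, ((nb P v).card : ℝ) ^ 2 := by
    have := sq_sum_le_card_mul_sum_sq (s := (Finset.univ : Finset V))
      (f := fun v => ((nb P v).card : ℝ))
    unfold ec; push_cast
    rwa [Finset.card_univ, ← hSdef] at this
  have hmS : (ec P : ℝ) ≤ S ^ 2 := by
    unfold ec; push_cast
    calc _ ≤ ∑ _v : V, S := Finset.sum_le_sum fun v _ => by
            rw [hSdef]; exact_mod_cast Finset.card_le_univ _
      _ = S ^ 2 := by rw [sum_const_univ, ← hSdef]; ring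
  have hmd : (ec P : ℝ) = ∑ v, ((nb P v).card : ℝ) := by unfold ec; push_cast; rfl
  have hm0 : (0 : ℝ) ≤ ec P := by positivity
  set q : ℝ := r / ((r : ℝ) - 1) with hq
  have hq1 : 1 ≤ q := by rw [hq, le_div_iff₀ (by linarith)]; linarith
  have hq2 : q * (1 - 1 / r) = 1 := div_sub_one_mul hr'
  have hq3 : q ≤ 2 := by rw [hq, div_le_iff₀ (by linarith)]; linarith
  have hωS : (2 * κ₀ + 4 * e) * S ^ 3 ≤ ω ^ 4 * S ^ 3 := by gcongr
  refine _root_.exists_coloring P (by omega) hω hω1 ?_ ?_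
  all_goals rw [← hSdef]
  · set m : ℝ := (ec P : ℝ) with hm
    set D : ℝ := ∑ v, ((nb P v).card : ℝ) ^ 2 with hD
    have h1 : S * ∑ v, ((outE P v).card : ℝ) ≤ S * ((2 * κ₀ + 4 * e) * S ^ 3) := by
      have h2 : q * m ^ 2 ≤ q * (S * D) := mul_le_mul_of_nonneg_left hcs (by linarith)
      have h3 : S * (∑ v, ((outE P v).card : ℝ) + q * D) ≤ S * (m * S + 4 * e * S ^ 3) :=
        mul_le_mul_of_nonneg_left hmain hS0.le
      have h4 : q * ((1 - 1 / r - κ₀) * S ^ 2) ≤ q * m := by gcongr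
      have h5 : q * ((1 - 1 / r - κ₀) * S ^ 2) = (q * (1 - 1 / r)) * S ^ 2 - q * (κ₀ * S ^ 2) := by
        ring
      rw [h5, hq2] at h4
      have h6 : q * (κ₀ * S ^ 2) ≤ 2 * (κ₀ * S ^ 2) := by gcongr
      have h7 : m * (S ^ 2 - q * m) ≤ m * (2 * (κ₀ * S ^ 2)) := by gcongr; linarith
      have h8 : m * (2 * (κ₀ * S ^ 2)) ≤ S ^ 2 * (2 * (κ₀ * S ^ 2)) := by gcongr
      linarith
    exact (le_of_mul_le_mul_left h1 hS0).trans hωS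
  · have h0 : ∑ v, (((nb P v).card : ℝ) - (1 - 1 / r) * S) ^ 2 =
        ∑ v, ((nb P v).card : ℝ) ^ 2 - 2 * ((1 - 1 / r) * S) * ec P + ((1 - 1 / r) * S) ^ 2 * S := by
      rw [hmd, Finset.mul_sum, ← Finset.sum_sub_distrib]
      have : ((1 - 1 / (r : ℝ)) * S) ^ 2 * S = ∑ _v : V, ((1 - 1 / (r : ℝ)) * S) ^ 2 := by
        rw [sum_const_univ, ← hSdef]; ring
      rw [this, ← Finset.sum_add_distrib]
      exact Finset.sum_congr rfl fun v _ => by ring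
    rw [h0]
    set m : ℝ := (ec P : ℝ) with hm
    set D : ℝ := ∑ v, ((nb P v).card : ℝ) ^ 2 with hD
    have hρ0 : 0 ≤ 1 - 1 / (r : ℝ) := by
      rw [sub_nonneg, div_le_one (by linarith)]; linarith
    have hρ1 : 1 - 1 / (r : ℝ) ≤ 1 := by
      have : 0 ≤ 1 / (r : ℝ) := by positivity
      linarith
    set ρ : ℝ := 1 - 1 / (r : ℝ) with hρ
    have h1 : D ≤ ρ * (m * S + 4 * e * S ^ 3) := by
      have : ρ * (q * D) ≤ ρ * (m * S + 4 * e * S ^ 3) :=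
        mul_le_mul_of_nonneg_left (by linarith) hρ0
      calc D = q * ρ * D := by rw [hq2, one_mul]
        _ = ρ * (q * D) := by ring
        _ ≤ _ := this
    have h2 : ρ * (4 * e * S ^ 3) ≤ 1 * (4 * e * S ^ 3) := by gcongr
    have h3 : ρ * S * ((ρ - κ₀) * S ^ 2) ≤ ρ * S * m := by gcongr
    have h4 : ρ * (κ₀ * S ^ 3) ≤ 1 * (κ₀ * S ^ 3) := by gcongr
    have h5 : 0 ≤ κ₀ * S ^ 3 := by positivity
    nlinarith

end Stability

section ContainerUse

variable {V : Type*} [Fintype V]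

/-- The edges of `D` as a finset. -/
noncomputable def eS (D : SimpleGraph V) : Finset (Sym2 V) :=
  Finset.univ.filter fun e => e ∈ D.edgeSet

lemma mem_eS {D : SimpleGraph V} {e : Sym2 V} : e ∈ eS D ↔ e ∈ D.edgeSet := by simp [eS]

lemma not_isDiag_of_mem_eS (D : SimpleGraph V) : ∀ e ∈ eS D, ¬ e.IsDiag := fun _ he =>
  SimpleGraph.not_isDiag_of_mem_edgeSet _ (mem_eS.1 he)

lemma two_mul_card_eS (D : SimpleGraph V) : 2 * (eS D).card = ec D := by
  have h := SimpleGraph.sum_degrees_eq_twice_card_edges D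
  have h1 : eS D = D.edgeFinset := by ext e; simp [mem_eS]
  rw [h1, ← h]
  unfold ec
  refine Finset.sum_congr rfl fun v _ => ?_
  rw [← SimpleGraph.card_neighborFinset_eq_degree]
  congr 1
  ext w; simp

lemma eS_filter (D H : SimpleGraph V) :
    ((eS D).filter fun e => e ∈ H.edgeSet) = eS (H ⊓ D) := by
  ext e
  induction e with | _ x y =>
  simp [mem_eS, and_comm]

lemma pr_ec_inf_le (D : SimpleGraph V) (t : ℕ) :
    pr V (fun H => ec (H ⊓ D) ≤ 2 * t) ≤ ((eS D).card + 1) ^ t * (1 / 2) ^ (eS D).card := by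
  refine le_trans (pr_mono fun H h => ?_) (pr_card_le (eS D) (not_isDiag_of_mem_eS D) t)
  rw [eS_filter]
  have := two_mul_card_eS (H ⊓ D)
  omega

lemma depOn_ec_inf (D : SimpleGraph V) (t : ℕ) :
    DepOn (fun H : SimpleGraph V => ec (H ⊓ D) ≤ t) D.edgeSet := by
  intro G G' h
  have : G ⊓ D = G' ⊓ D := by
    ext x y
    simp only [SimpleGraph.inf_adj]
    constructor
    · rintro ⟨h1, h2⟩; exact ⟨(h x y h2).1 h1, h2⟩
    · rintro ⟨h1, h2⟩; exact ⟨(h x y h2).2 h1, h2⟩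
  simp only [this]

lemma pr_inf_le {P P₀ : SimpleGraph V} (hP : P ≤ P₀) :
    pr V (fun H => H ⊓ P₀ ≤ P) ≤ 2 ^ (-(((ec P₀ : ℝ) - ec P) / 2)) := by
  have h1 : pr V (fun H => H ⊓ P₀ ≤ P) ≤ (1 / 2) ^ (eS P₀ \ eS P).card := by
    rw [← pr_pattern (eS P₀ \ eS P) (fun e he => not_isDiag_of_mem_eS P₀ e (Finset.mem_sdiff.1 he).1) ∅]
    refine pr_mono fun H h e he => ?_
    induction e with | _ x y =>
    simp only [Finset.mem_sdiff, mem_eS, SimpleGraph.mem_edgeSet] at he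
    simp only [SimpleGraph.mem_edgeSet, Set.mem_empty_iff_false, iff_false]
    exact fun hxy => he.2 (h ⟨hxy, he.1⟩)
  refine h1.trans (le_of_eq ?_)
  have h2 : ((eS P₀ \ eS P).card : ℝ) = ((ec P₀ : ℝ) - ec P) / 2 := by
    rw [Finset.card_sdiff_of_subset, Nat.cast_sub]
    · rw [← two_mul_card_eS, ← two_mul_card_eS]; push_cast; ring
    · refine Finset.card_le_card fun e he => ?_
      rw [mem_eS] at *
      exact SimpleGraph.edgeSet_mono hP he
    · intro e he
      rw [mem_eS] at *
      exact SimpleGraph.edgeSet_mono hP he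
  rw [← h2, Real.rpow_neg (by norm_num), Real.rpow_natCast, one_div, inv_pow]

/-- Union bound over containers. -/
lemma pr_cliqueFree_container_le {r Lg : ℕ} {e κ η β γ : ℝ}
    (hp : CParams (Fintype.card V) r e κ η β γ Lg) (P₀ : SimpleGraph V) (E : ℝ) :
    pr V (fun H => (H ⊓ P₀).CliqueFree (r + 1) ∧
      ∀ P, Stuck r e η γ P → H ⊓ P₀ ≤ P → (ec P : ℝ) ≤ E) ≤
      2 ^ (κ * ec P₀ - ((ec P₀ : ℝ) - E) / 2) := by
  obtain ⟨C, hC, hC1, hC2⟩ := exists_containers hp P₀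
  calc _ ≤ pr V (fun H => ∃ P ∈ C.filter (fun P => (ec P : ℝ) ≤ E), H ⊓ P₀ ≤ P) := by
        refine pr_mono fun H ⟨h1, h2⟩ => ?_
        obtain ⟨P, hP, hle⟩ := hC2 (H ⊓ P₀) inf_le_right h1
        exact ⟨P, Finset.mem_filter.2 ⟨hP, h2 P (hC1 P hP).2 hle⟩, hle⟩
    _ ≤ (C.filter (fun P => (ec P : ℝ) ≤ E)).card * (2 : ℝ) ^ (-(((ec P₀ : ℝ) - E) / 2)) := by
        refine pr_exists_le_card _ _ _ fun P hP => ?_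
        rw [Finset.mem_filter] at hP
        refine (pr_inf_le (hC1 P hP.1).1).trans ?_
        refine Real.rpow_le_rpow_of_exponent_le (by norm_num) ?_
        linarith [hP.2]
    _ ≤ 2 ^ (κ * ec P₀) * (2 : ℝ) ^ (-(((ec P₀ : ℝ) - E) / 2)) := by
        gcongr
        exact le_trans (by exact_mod_cast Finset.card_filter_le _ _) hC
    _ = _ := by rw [← Real.rpow_add (by norm_num)]; ring_nf

/-- The sets `A i` contain no clique transversal. -/
def NoTrans {ι : Type*} (A : ι → Finset V) (G : SimpleGraph V) : Prop :=
  ¬ ∃ g : ι → V, (∀ i, g i ∈ A i) ∧ ∀ i i', i ≠ i' → G.Adj (g i) (g i')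

lemma depOn_noTrans {ι : Type*} (A : ι → Finset V) :
    DepOn (NoTrans A) {e | ∃ i i', i ≠ i' ∧ ∃ x ∈ A i, ∃ y ∈ A i', e = s(x, y)} := by
  refine DepOn.not (DepOn.exists fun g => ?_)
  intro G G' h
  refine and_congr_right fun hg => forall_congr' fun i => forall_congr' fun i' =>
    forall_congr' fun hi => h _ _ ⟨i, i', hi, _, hg i, _, hg i', rfl⟩

/-- The complete multipartite graph. -/
def multiG (ι : Type*) (a : ℕ) : SimpleGraph (ι × Fin a) where
  Adj p q := p.1 ≠ q.1
  symm := ⟨fun _ _ h => h.symm⟩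
  loopless := ⟨fun _ h => h rfl⟩

lemma ec_multiG (ι : Type*) [Fintype ι] (a : ℕ) :
    (ec (multiG ι a) : ℝ) = Fintype.card ι * (Fintype.card ι - 1) * (a : ℝ) ^ 2 := by
  have h : ∀ v : ι × Fin a, (nb (multiG ι a) v).card + a = Fintype.card ι * a := by
    intro v
    have h1 := Finset.card_filter_add_card_filter_not (s := (Finset.univ : Finset (ι × Fin a)))
      (fun w => v.1 ≠ w.1)
    have h2 : (Finset.univ.filter fun w : ι × Fin a => ¬ v.1 ≠ w.1) =
        ({v.1} : Finset ι) ×ˢ (Finset.univ : Finset (Fin a)) := by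
      ext w
      simp only [Finset.mem_filter, Finset.mem_univ, true_and, not_not, Finset.mem_product,
        Finset.mem_singleton, and_true]
      exact eq_comm
    rw [h2, Finset.card_product, Finset.card_singleton, one_mul, Finset.card_univ, Finset.card_univ,
      Fintype.card_prod, Fintype.card_fin] at h1
    rw [← h1]
    congr 2
    ext w; simp [multiG]
  have h' : ∀ v : ι × Fin a, ((nb (multiG ι a) v).card : ℝ) = Fintype.card ι * a - a := by
    intro v
    have := h v
    rw [eq_sub_iff_add_eq]
    exact_mod_cast this
  unfold ec
  push_cast
  rw [Finset.sum_congr rfl fun v _ => h' v, sum_const_univ, Fintype.card_prod, Fintype.card_fin]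
  push_cast
  ring

lemma multiG_noTrans {ι : Type*} [Fintype ι] {a : ℕ} {A : ι → Finset V} (hA : ∀ i, (A i).card = a)
    (f : ι × Fin a ↪ V) (hf : ∀ p, f p ∈ A p.1) {G : SimpleGraph V} (hG : NoTrans A G) :
    (G.comap f ⊓ multiG ι a).CliqueFree (Fintype.card ι) := by
  intro T hT
  refine hG ?_
  have hinj : Set.InjOn Prod.fst (T : Set (ι × Fin a)) := by
    intro p hp q hq hpq
    by_contra hne
    exact (hT.1 hp hq hne).2 hpq
  have himg : T.image Prod.fst = Finset.univ := by
    rw [← Finset.card_eq_iff_eq_univ, Finset.card_image_of_injOn hinj, hT.2]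
  have hex : ∀ i, ∃ p ∈ T, p.1 = i := fun i => by
    have : i ∈ T.image Prod.fst := by rw [himg]; simp
    simpa using this
  choose g hg hgi using hex
  refine ⟨fun i => f (g i), fun i => by simpa [hgi] using hf (g i), fun i i' hi => ?_⟩
  refine (hT.1 (hg i) (hg i') fun h => hi ?_).1
  rw [← hgi i, ← hgi i', h]

lemma pr_noTrans_le {ι : Type*} [Fintype ι] {m a Lg : ℕ} {e κ η β γ : ℝ} (hm : 1 ≤ m)
    (hι : Fintype.card ι = m + 1) (hp : CParams ((m + 1) * a) m e κ η β γ Lg)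
    (hγ2 : γ ≤ e) (hS : 1 ≤ 4 * (η * (γ * (((m + 1) * a : ℕ) : ℝ))))
    (hκ : κ ≤ 1 / (16 * ((m : ℝ) + 1) ^ 2)) (he : e ≤ 1 / (32 * ((m : ℝ) + 1) ^ 2))
    {A : ι → Finset V} (hA : ∀ i, (A i).card = a) (hdis : ∀ i i', i ≠ i' → Disjoint (A i) (A i')) :
    pr V (NoTrans A) ≤ 2 ^ (-((a : ℝ) ^ 2 / 4)) := by
  have hcard : Fintype.card (ι × Fin a) = (m + 1) * a := by simp [hι]
  let f : ι × Fin a ↪ V := ⟨fun p => ((A p.1).equivFinOfCardEq (hA p.1)).symm p.2, by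
    rintro ⟨i, t⟩ ⟨i', t'⟩ h
    simp only at h
    have hi : i = i' := by
      by_contra hne
      have h1 := Finset.coe_mem (((A i).equivFinOfCardEq (hA i)).symm t)
      have h2 := Finset.coe_mem (((A i').equivFinOfCardEq (hA i')).symm t')
      rw [← h] at h2
      exact Finset.disjoint_left.1 (hdis i i' hne) h1 h2
    subst hi
    simpa using h⟩
  have hf : ∀ p, f p ∈ A p.1 := fun p => Finset.coe_mem _
  rw [← hcard] at hp hS
  calc pr V (NoTrans A) ≤ pr V (fun G => (G.comap f ⊓ multiG ι a).CliqueFree (m + 1)) :=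
        pr_mono fun G hG => hι ▸ multiG_noTrans hA f hf hG
    _ = pr (ι × Fin a) (fun H => (H ⊓ multiG ι a).CliqueFree (m + 1)) :=
        pr_comap f (fun H => (H ⊓ multiG ι a).CliqueFree (m + 1))
    _ ≤ pr (ι × Fin a) (fun H => (H ⊓ multiG ι a).CliqueFree (m + 1) ∧
          ∀ P, Stuck m e η γ P → H ⊓ multiG ι a ≤ P → (ec P : ℝ) ≤
            (1 - 1 / m + 8 * e) * (Fintype.card (ι × Fin a) : ℝ) ^ 2) :=
        pr_mono fun H hH => ⟨hH, fun P hP _ => hP.ec_le hm hp.e0 hp.e1 hp.η0 hp.η1 hp.γ0.le hγ2 hS⟩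
    _ ≤ _ := pr_cliqueFree_container_le hp _ _
    _ ≤ _ := by
        refine Real.rpow_le_rpow_of_exponent_le (by norm_num) ?_
        rw [ec_multiG, hcard, hι]
        push_cast
        have hm0 : (1 : ℝ) ≤ m := by exact_mod_cast hm
        have h1 : ((m : ℝ) + 1) * (m + 1 - 1) - (m + 1) ^ 2 * (1 - 1 / m) = 1 + 1 / m := by
          field_simp; ring
        have h2 : (0 : ℝ) ≤ 1 / m := by positivity
        rw [le_div_iff₀ (by positivity)] at hκ he
        have ha : (0 : ℝ) ≤ (a : ℝ) ^ 2 := by positivity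
        have h4 : κ * (((m : ℝ) + 1) * (m + 1 - 1)) ≤ 1 / 16 := by
          refine le_trans ?_ (by linarith : κ * ((m : ℝ) + 1) ^ 2 ≤ 1 / 16)
          refine mul_le_mul_of_nonneg_left ?_ hp.κ0.le
          nlinarith
        have h5 : (κ * (((m : ℝ) + 1) * (m + 1 - 1)) - (((m : ℝ) + 1) * (m + 1 - 1) -
            (m + 1) ^ 2 * (1 - 1 / m)) / 2 + 4 * (e * ((m : ℝ) + 1) ^ 2)) * (a : ℝ) ^ 2 ≤
            (-(1 / 4)) * (a : ℝ) ^ 2 := by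
          refine mul_le_mul_of_nonneg_right ?_ ha
          rw [h1]; linarith
        linarith

end ContainerUse

section Parameters

lemma cparams_of {S R Lg : ℕ} {L e g : ℝ} (hR : 1 ≤ R) (hL : 32 ≤ L) (hRL : (R : ℝ) ≤ L)
    (hLg1 : 1 ≤ Lg) (hLg : (Lg : ℝ) ≤ 2 * L) (hS : S + 1 ≤ 2 ^ Lg) (e0 : 0 < e) (e1 : e ≤ 1 / 4)
    (g0 : 0 < g) (hg : g * L ^ 11 ≤ e ^ 6) (h1 : 4 ≤ g ^ (R + 2) * S)
    (h2 : 32 * (R : ℝ) < g ^ (2 * R + 5) * S) :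
    ∃ η β γ : ℝ, CParams S R e e η β γ Lg ∧ γ ≤ e ∧ 1 ≤ 4 * (η * (γ * S)) := by
  have hR' : (1 : ℝ) ≤ R := by exact_mod_cast hR
  have hLg' : (1 : ℝ) ≤ Lg := by exact_mod_cast hLg1
  have hL0 : (0 : ℝ) < L := by linarith
  have e11 : e ≤ 1 := by linarith
  set η := e / (3 * (R : ℝ) ^ 3) with hη
  set β := e * η * e ^ 2 / (16 * Lg) with hβ
  set γ := e * η * β / 8 with hγ
  have hη0 : 0 < η := by positivity
  have hβ0 : 0 < β := by positivity
  have hγ0 : 0 < γ := by positivity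
  have hS0 : (0 : ℝ) ≤ S := Nat.cast_nonneg S
  have hη_ge : e / L ^ 4 ≤ η := by
    rw [hη]
    refine div_le_div_of_nonneg_left e0.le (by positivity) ?_
    calc 3 * (R : ℝ) ^ 3 ≤ L * L ^ 3 := by gcongr; linarith
      _ = L ^ 4 := by ring
  have hη_le : η ≤ 1 := by
    rw [hη, div_le_one (by positivity)]
    have : (1 : ℝ) ≤ (R : ℝ) ^ 3 := one_le_pow₀ hR'
    linarith
  have hβ_ge : e ^ 4 / L ^ 6 ≤ β := by
    rw [hβ, le_div_iff₀ (by positivity)]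
    calc e ^ 4 / L ^ 6 * (16 * Lg) ≤ e ^ 4 / L ^ 6 * (L * L) :=
        mul_le_mul_of_nonneg_left (by nlinarith : 16 * (Lg : ℝ) ≤ L * L) (by positivity)
      _ = e * (e / L ^ 4) * e ^ 2 := by field_simp
      _ ≤ _ := by gcongr
  have hβ_le : β ≤ 1 := by
    rw [hβ, div_le_one (by positivity)]
    calc e * η * e ^ 2 ≤ (1 : ℝ) * 1 * 1 ^ 2 := by gcongr
      _ ≤ 16 * (Lg : ℝ) := by linarith
  have hγ_ge : g ≤ γ := by
    rw [hγ, le_div_iff₀ (by norm_num)]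
    have : g ≤ e ^ 6 / L ^ 11 := by rwa [le_div_iff₀ (by positivity)]
    calc g * 8 ≤ e ^ 6 / L ^ 11 * L := by gcongr; linarith
      _ = e * (e / L ^ 4) * (e ^ 4 / L ^ 6) := by field_simp
      _ ≤ _ := by gcongr
  have hγ_le : γ ≤ e := by
    rw [hγ]
    calc e * η * β / 8 ≤ e * 1 * 1 / 8 := by gcongr
      _ ≤ e := by linarith
  have hγβ : γ ≤ β := by
    rw [hγ]
    have : e * η * β ≤ 1 * 1 * β := by gcongr
    linarith
  have hγη : γ ≤ η := by
    rw [hγ]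
    have : e * η * β ≤ 1 * η * 1 := by gcongr
    linarith
  have hg1 : g ≤ 1 := by linarith
  refine ⟨η, β, γ, ⟨hR, e0, e1, e0, e11, hη0, ?_, hS, hLg1, hβ0, ?_, hγ0, by linarith, le_rfl,
    ?_, ?_, ?_⟩, hγ_le, ?_⟩
  · rw [hη]; field_simp
  · rw [hβ]; exact le_of_eq (by field_simp)
  · calc (1 : ℝ) ≤ g ^ (R + 2) * S := by linarith
      _ = g * (g ^ (R + 1) * S) := by ring
      _ ≤ η * (γ ^ (R + 1) * S) := by gcongr; linarith
  · calc (4 : ℝ) ≤ g ^ (R + 2) * S := h1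
      _ = g * g * (g ^ R * S) := by ring
      _ ≤ η * β * (γ ^ R * S) := by gcongr <;> linarith
  · have hS1 : (0 : ℝ) < S := by
      rcases hS0.eq_or_lt with h | h
      · rw [← h] at h1; norm_num at h1
      · exact h
    have hS1' : (1 : ℝ) ≤ S := by
      have : 0 < S := by exact_mod_cast hS1
      exact_mod_cast this
    calc 16 * (((S : ℝ) + 1) * R) ≤ S * (32 * R) := by nlinarith
      _ < S * (g ^ (2 * R + 5) * S) := by gcongr
      _ = g * g ^ 2 * g ^ 2 * g ^ (2 * R) * S ^ 2 := by ring
      _ ≤ e * η ^ 2 * e ^ 2 * γ ^ (2 * R) * S ^ 2 := by gcongr <;> linarith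
  · calc (1 : ℝ) ≤ g ^ (R + 2) * S := by linarith
      _ = g * g * (g ^ R * S) := by ring
      _ ≤ g * g * (1 * S) := by gcongr; exact pow_le_one₀ g0.le hg1
      _ = 1 * (g * (g * S)) := by ring
      _ ≤ 4 * (η * (γ * S)) := by gcongr <;> linarith

lemma cparams_pow {S R Lg L : ℕ} (hR : 1 ≤ R) (hL : 32 ≤ L) (hRL : R ≤ L)
    (hLg1 : 1 ≤ Lg) (hLg : Lg ≤ 2 * L) (hS : S + 1 ≤ 2 ^ Lg) (h : L ^ (5000 * (R + 1)) ≤ S) :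
    ∃ η β γ : ℝ, CParams S R (1 / (L : ℝ) ^ 114) (1 / (L : ℝ) ^ 114) η β γ Lg ∧
      γ ≤ 1 / (L : ℝ) ^ 114 ∧ 1 ≤ 4 * (η * (γ * S)) := by
  have hL' : (32 : ℝ) ≤ L := by exact_mod_cast hL
  have hRL' : (R : ℝ) ≤ L := by exact_mod_cast hRL
  have hL0 : (0 : ℝ) < L := by linarith
  have hL1 : (1 : ℝ) ≤ L := by linarith
  have h' : (L : ℝ) ^ (5000 * (R + 1)) ≤ S := by exact_mod_cast h
  have key : ∀ m p : ℕ, 695 * m + p ≤ 5000 * (R + 1) →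
      (L : ℝ) ^ p ≤ (1 / (L : ℝ) ^ 695) ^ m * S := by
    intro m p hmp
    rw [div_pow, one_pow, ← pow_mul, one_div, ← div_eq_inv_mul, le_div_iff₀ (by positivity),
      ← pow_add]
    exact (pow_le_pow_right₀ hL1 (by omega)).trans h'
  refine cparams_of (L := L) (g := 1 / (L : ℝ) ^ 695) hR hL' hRL' hLg1 (by exact_mod_cast hLg) hS
    (by positivity) ?_ (by positivity) ?_ ?_ ?_
  · rw [div_le_div_iff₀ (by positivity) (by norm_num)]
    have : (L : ℝ) ^ 1 ≤ (L : ℝ) ^ 114 := pow_le_pow_right₀ hL1 (by norm_num)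
    rw [pow_one] at this
    linarith
  · rw [div_pow, one_pow, ← pow_mul, div_mul_eq_mul_div, one_mul,
      div_le_div_iff₀ (by positivity) (by positivity), one_mul, ← pow_add]
  · refine le_trans ?_ (key (R + 2) 1 (by omega))
    rw [pow_one]; linarith
  · refine lt_of_lt_of_le ?_ (key (2 * R + 5) 3 (by omega))
    calc 32 * (R : ℝ) ≤ L * L := by gcongr
      _ < L ^ 3 := by nlinarith

end Parameters

section FewEvents

variable {V : Type*} [Fintype V]

/-- A lower tail bound for a sum of independent indicators. -/
lemma pr_few_le {ι : Type*} (W : Finset ι) (Φ : ι → SimpleGraph V → Prop)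
    (Q : ι → Set (Sym2 V)) (hΦ : ∀ i ∈ W, DepOn (Φ i) (Q i))
    (hQ : (W : Set ι).PairwiseDisjoint Q) {p : ℝ} (p0 : 0 ≤ p) (p1 : p ≤ 1)
    (hp : ∀ i ∈ W, pr V (fun G => ¬ Φ i G) ≤ p) (t : ℕ) :
    pr V (fun G => (W.filter fun i => Φ i G).card ≤ t) ≤ (W.card + 1) ^ t * p ^ (W.card - t) := by
  have hFc : (W.powerset.filter fun F => F.card ≤ t).card ≤ (W.card + 1) ^ t := by
    refine le_trans ?_ (sum_range_choose_le W.card t)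
    calc (W.powerset.filter fun F => F.card ≤ t).card
        ≤ ((Finset.range (t + 1)).biUnion fun i => W.powersetCard i).card := by
          refine Finset.card_le_card fun F hF => ?_
          rw [Finset.mem_filter, Finset.mem_powerset] at hF
          rw [Finset.mem_biUnion]
          exact ⟨F.card, Finset.mem_range.2 (by omega), Finset.mem_powersetCard.2 ⟨hF.1, rfl⟩⟩
      _ ≤ ∑ i ∈ Finset.range (t + 1), (W.powersetCard i).card := Finset.card_biUnion_le
      _ = _ := by simp
  calc pr V (fun G => (W.filter fun i => Φ i G).card ≤ t)
      ≤ pr V (fun G => ∃ F ∈ W.powerset.filter fun F => F.card ≤ t, ∀ i ∈ W \ F, ¬ Φ i G) := by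
        refine pr_mono fun G h => ⟨W.filter fun i => Φ i G, ?_, fun i hi hΦi => ?_⟩
        · exact Finset.mem_filter.2 ⟨Finset.mem_powerset.2 (Finset.filter_subset _ _), h⟩
        · rw [Finset.mem_sdiff, Finset.mem_filter] at hi
          exact hi.2 ⟨hi.1, hΦi⟩
    _ ≤ (W.powerset.filter fun F => F.card ≤ t).card * p ^ (W.card - t) := by
        refine pr_exists_le_card _ _ _ fun F hF => ?_
        rw [Finset.mem_filter, Finset.mem_powerset] at hF
        rw [pr_forall_of_indep (W \ F) (fun i G => ¬ Φ i G) Q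
          (fun i hi => (hΦ i (Finset.mem_sdiff.1 hi).1).not)
          (hQ.subset (by exact_mod_cast Finset.sdiff_subset))]
        calc ∏ i ∈ W \ F, pr V (fun G => ¬ Φ i G) ≤ ∏ i ∈ W \ F, p :=
              Finset.prod_le_prod (fun i _ => pr_nonneg _)
                fun i hi => hp i (Finset.mem_sdiff.1 hi).1
          _ = p ^ (W \ F).card := by rw [Finset.prod_const]
          _ ≤ p ^ (W.card - t) := by
              refine pow_le_pow_of_le_one p0 p1 ?_
              rw [Finset.card_sdiff_of_subset hF.1]
              omega
    _ ≤ _ := by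
        gcongr
        exact_mod_cast hFc

end FewEvents

section Colorings

variable {V : Type*} [Fintype V] {ι : Type*}

/-- The graph of pairs coloured alike. -/
def sameG (c : V → ι) : SimpleGraph V where
  Adj x y := x ≠ y ∧ c x = c y
  symm := ⟨fun _ _ h => ⟨h.1.symm, h.2.symm⟩⟩
  loopless := ⟨fun _ h => h.1 rfl⟩

/-- A colour class. -/
noncomputable def cls (c : V → ι) (l : ι) : Finset V := Finset.univ.filter fun v => c v = l

@[simp] lemma mem_cls {c : V → ι} {l : ι} {v : V} : v ∈ cls c l ↔ c v = l := by simp [cls]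

lemma ec_eq_card (P : SimpleGraph V) :
    ec P = ((Finset.univ : Finset (V × V)).filter fun p => P.Adj p.1 p.2).card := by
  unfold ec nb
  simp_rw [Finset.card_filter]
  rw [← Finset.univ_product_univ, Finset.sum_product]

lemma intE_eq_ec (P : SimpleGraph V) (c : V → ι) : intE P c = ec (P ⊓ sameG c) := by
  rw [ec_eq_card]
  unfold intE
  congr 1
  ext p
  simp only [Finset.mem_filter, Finset.mem_univ, true_and, SimpleGraph.inf_adj, sameG]
  exact ⟨fun h => ⟨h.2, h.2.ne, h.1⟩, fun h => ⟨h.2.2, h.1⟩⟩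

lemma sum_card_cls [Fintype ι] (c : V → ι) : ∑ l, (cls c l).card = Fintype.card V := by
  rw [← Finset.card_univ]
  exact (Finset.card_eq_sum_card_fiberwise (f := c) (t := Finset.univ) fun _ _ => by simp).symm

lemma ec_sameG [Fintype ι] (c : V → ι) :
    ec (sameG c) + Fintype.card V = ∑ l, (cls c l).card ^ 2 := by
  have h1 : ∀ v, (nb (sameG c) v).card + 1 = (cls c (c v)).card := by
    intro v
    have : cls c (c v) = insert v (nb (sameG c) v) := by
      ext w
      simp only [mem_cls, Finset.mem_insert, mem_nb, sameG]
      constructor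
      · intro h
        by_cases hw : w = v
        · exact Or.inl hw
        · exact Or.inr ⟨fun h' => hw h'.symm, h.symm⟩
      · rintro (rfl | h)
        · rfl
        · exact h.2.symm
    rw [this, Finset.card_insert_of_notMem (by simp)]
  have h2 : ec (sameG c) + Fintype.card V = ∑ v, (cls c (c v)).card := by
    rw [← Finset.sum_congr rfl fun v _ => h1 v, Finset.sum_add_distrib]
    simp [ec]
  rw [h2, ← Finset.sum_fiberwise (s := Finset.univ) (g := c)]
  refine Finset.sum_congr rfl fun l _ => ?_
  rw [Finset.sum_congr rfl (g := fun _ => (cls c l).card) fun v hv => by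
    rw [(Finset.mem_filter.1 hv).2]]
  rw [Finset.sum_const, smul_eq_mul, sq]
  rfl

/-- A convexity bound on the number of like-coloured pairs. -/
lemma ec_sameG_ge {r : ℕ} (hr : 1 ≤ r) (c : V → Fin r) (l : Fin r) :
    (Fintype.card V : ℝ) ^ 2 / r + ((Fintype.card V : ℝ) / r - (cls c l).card) ^ 2 -
      Fintype.card V ≤ ec (sameG c) := by
  have hr' : (0 : ℝ) < r := by exact_mod_cast hr
  set S : ℝ := (Fintype.card V : ℝ) with hS
  have h1 : (ec (sameG c) : ℝ) + S = ∑ l, ((cls c l).card : ℝ) ^ 2 := by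
    rw [hS]; exact_mod_cast ec_sameG c
  have h2 : ∑ l, ((cls c l).card : ℝ) = S := by rw [hS]; exact_mod_cast sum_card_cls c
  have h3 : ∑ l, (S / r - ((cls c l).card : ℝ)) ^ 2 =
      ∑ l, ((cls c l).card : ℝ) ^ 2 - S ^ 2 / r := by
    have : ∀ l, (S / r - ((cls c l).card : ℝ)) ^ 2 =
        (S / r) ^ 2 - 2 * (S / r) * (cls c l).card + ((cls c l).card : ℝ) ^ 2 := fun l => by ring
    rw [Finset.sum_congr rfl fun l _ => this l, Finset.sum_add_distrib, Finset.sum_sub_distrib,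
      ← Finset.mul_sum, h2]
    simp only [Finset.sum_const, Finset.card_univ, Fintype.card_fin, nsmul_eq_mul]
    field_simp
    ring
  have h4 := Finset.single_le_sum (f := fun l => (S / r - ((cls c l).card : ℝ)) ^ 2)
    (fun i _ => sq_nonneg _) (Finset.mem_univ l)
  beta_reduce at h4
  linarith

end Colorings

section Structure

variable {V : Type*} [Fintype V]

/-- Neighbours of `x` of colour `l`. -/
noncomputable def nbc {ι : Type*} (H : SimpleGraph V) (c : V → ι) (x : V) (l : ι) : Finset V :=
  Finset.univ.filter fun w => c w = l ∧ H.Adj x w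

/-- Common neighbours of `x` and `y` of colour `l`. -/
noncomputable def conb {ι : Type*} (H : SimpleGraph V) (c : V → ι) (x y : V) (l : ι) : Finset V :=
  Finset.univ.filter fun w => c w = l ∧ H.Adj x w ∧ H.Adj y w

@[simp] lemma mem_nbc {ι : Type*} {H : SimpleGraph V} {c : V → ι} {x w : V} {l : ι} :
    w ∈ nbc H c x l ↔ c w = l ∧ H.Adj x w := by simp [nbc]

@[simp] lemma mem_conb {ι : Type*} {H : SimpleGraph V} {c : V → ι} {x y w : V} {l : ι} :
    w ∈ conb H c x y l ↔ c w = l ∧ H.Adj x w ∧ H.Adj y w := by simp [conb]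

/-- `c` is a colouring in `r` colours with few like-coloured adjacent pairs, each of which has few
common neighbours in some other class. -/
def NiceCol {r : ℕ} (H : SimpleGraph V) (c : V → Fin r) (T a : ℕ) : Prop :=
  intE H c ≤ 2 * T ∧ ∀ x y, H.Adj x y → c x = c y → ∃ l, l ≠ c x ∧ (conb H c x y l).card < a

/-- A matching of like-coloured adjacent pairs. -/
def IntMatch {ι : Type*} (H : SimpleGraph V) (c : V → ι) (q : ℕ) (x y : Fin q → V) : Prop :=
  Function.Injective (Sum.elim x y) ∧ ∀ i, H.Adj (x i) (y i) ∧ c (x i) = c (y i)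

/-- Many like-coloured adjacent pairs in every colouring. -/
def NoCol (r tt : ℕ) (H : SimpleGraph V) : Prop := ∀ c : V → Fin r, 2 * tt < intE H c

/-- An unbalanced good colouring. -/
def BadCls (r tt k : ℕ) (H : SimpleGraph V) : Prop :=
  ∃ c : V → Fin r, intE H c ≤ 2 * tt ∧ ∃ l, 10 * (cls c l).card < 9 * k

/-- A good colouring having large sets in different classes without transversal clique. -/
def BadTrans (r tt a : ℕ) (H : SimpleGraph V) : Prop :=
  ∃ (c : V → Fin r) (A : Fin r → Finset V) (B : Finset (Fin r)), 2 ≤ B.card ∧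
    (∀ l ∈ B, A l ⊆ cls c l ∧ (A l).card = a) ∧ intE H c ≤ 2 * tt ∧
      NoTrans (fun l : B => A l) H

/-- A large matching of like-coloured pairs having few common neighbours in some class. -/
def BadMatch (r k a q : ℕ) (H : SimpleGraph V) : Prop :=
  ∃ (c : V → Fin r) (x y : Fin q → V) (l : Fin q → Fin r), Function.Injective (Sum.elim x y) ∧
    (∀ l, 9 * k ≤ 10 * (cls c l).card) ∧ (∀ i, c (x i) = c (y i) ∧ l i ≠ c (x i)) ∧
      intE H c ≤ 2 * (2 * q * a) ∧ ∀ i, (conb H c (x i) (y i) (l i)).card < a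

lemma intE_eq_add {ι : Type*} (H : SimpleGraph V) (c : V → ι) (x : V) :
    intE H c = (Finset.univ.filter fun p : V × V => (p.1 ≠ x ∧ p.2 ≠ x) ∧ c p.1 = c p.2 ∧
      H.Adj p.1 p.2).card + 2 * (nbc H c x (c x)).card := by
  have h1 : (Finset.univ.filter fun p : V × V => p.1 = x ∧ c p.1 = c p.2 ∧ H.Adj p.1 p.2) =
      (nbc H c x (c x)).image fun w => (x, w) := by
    ext ⟨u, w⟩
    simp only [Finset.mem_filter, Finset.mem_univ, true_and, Finset.mem_image, nbc, Prod.mk.injEq]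
    constructor
    · rintro ⟨rfl, h, h'⟩; exact ⟨w, ⟨h.symm, h'⟩, rfl, rfl⟩
    · rintro ⟨w, ⟨h, h'⟩, rfl, rfl⟩; exact ⟨rfl, h.symm, h'⟩
  have h2 : (Finset.univ.filter fun p : V × V => p.2 = x ∧ c p.1 = c p.2 ∧ H.Adj p.1 p.2) =
      (nbc H c x (c x)).image fun w => (w, x) := by
    ext ⟨w, u⟩
    simp only [Finset.mem_filter, Finset.mem_univ, true_and, Finset.mem_image, nbc, Prod.mk.injEq]
    constructor
    · rintro ⟨rfl, h, h'⟩; exact ⟨w, ⟨h, h'.symm⟩, rfl, rfl⟩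
    · rintro ⟨w, ⟨h, h'⟩, rfl, rfl⟩; exact ⟨rfl, h, h'.symm⟩
  have c1 := congrArg Finset.card h1
  have c2 := congrArg Finset.card h2
  rw [Finset.card_image_of_injective _ fun _ _ h => (Prod.mk.inj h).2] at c1
  rw [Finset.card_image_of_injective _ fun _ _ h => (Prod.mk.inj h).1] at c2
  have e : (Finset.univ.filter fun p : V × V => c p.1 = c p.2 ∧ H.Adj p.1 p.2) =
      (Finset.univ.filter fun p : V × V => (p.1 ≠ x ∧ p.2 ≠ x) ∧ c p.1 = c p.2 ∧
        H.Adj p.1 p.2) ∪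
      ((Finset.univ.filter fun p : V × V => p.1 = x ∧ c p.1 = c p.2 ∧ H.Adj p.1 p.2) ∪
        (Finset.univ.filter fun p : V × V => p.2 = x ∧ c p.1 = c p.2 ∧ H.Adj p.1 p.2)) := by
    ext p
    simp only [Finset.mem_filter, Finset.mem_univ, true_and, Finset.mem_union]
    tauto
  unfold intE
  rw [e, Finset.card_union_of_disjoint, Finset.card_union_of_disjoint, c1, c2]
  · ring
  · rw [Finset.disjoint_left]
    intro p hp hp'
    simp only [Finset.mem_filter, Finset.mem_univ, true_and] at hp hp'
    exact hp.2.2.ne (hp.1.trans hp'.1.symm)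
  · rw [Finset.disjoint_left]
    intro p hp hp'
    simp only [Finset.mem_filter, Finset.mem_univ, true_and, Finset.mem_union] at hp hp'
    tauto

lemma card_nbc_le_of_min {r : ℕ} {H : SimpleGraph V} {c : V → Fin r}
    (hmin : ∀ c' : V → Fin r, intE H c ≤ intE H c') (x : V) (l : Fin r) :
    (nbc H c x (c x)).card ≤ (nbc H c x l).card := by
  have h := hmin (Function.update c x l)
  rw [intE_eq_add H c x, intE_eq_add H (Function.update c x l) x] at h
  have h1 : (nbc H (Function.update c x l) x (Function.update c x l x)) = nbc H c x l := by
    ext w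
    simp only [nbc, Finset.mem_filter, Finset.mem_univ, true_and, Function.update_self]
    refine and_congr_left fun hw => ?_
    rw [Function.update_of_ne hw.ne']
  have h2 : (Finset.univ.filter fun p : V × V => (p.1 ≠ x ∧ p.2 ≠ x) ∧
      Function.update c x l p.1 = Function.update c x l p.2 ∧ H.Adj p.1 p.2) =
      (Finset.univ.filter fun p : V × V => (p.1 ≠ x ∧ p.2 ≠ x) ∧ c p.1 = c p.2 ∧
        H.Adj p.1 p.2) := by
    ext p
    simp only [Finset.mem_filter, Finset.mem_univ, true_and]
    refine and_congr_right fun hp => ?_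
    rw [Function.update_of_ne hp.1, Function.update_of_ne hp.2]
  rw [h1] at h
  have h3 := congrArg Finset.card h2
  have h4 : ∀ a b d e : ℕ, a + 2 * d ≤ b + 2 * e → b = a → d ≤ e := by omega
  refine h4 _ _ _ _ h ?_
  convert h3

lemma intE_le_of_cover {ι : Type*} {H : SimpleGraph V} {c : V → ι} {a : ℕ} (M : Finset V)
    (hM : ∀ u v, H.Adj u v → c u = c v → u ∈ M ∨ v ∈ M)
    (hd : ∀ u, (nbc H c u (c u)).card ≤ a) : intE H c ≤ 2 * (M.card * a) := by
  have hb : (M.biUnion fun u => (nbc H c u (c u)).image fun w => (u, w)).card ≤ M.card * a :=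
    Finset.card_biUnion_le_card_mul _ _ _ fun u _ => Finset.card_image_le.trans (hd u)
  have hb' : (M.biUnion fun u => (nbc H c u (c u)).image fun w => (w, u)).card ≤ M.card * a :=
    Finset.card_biUnion_le_card_mul _ _ _ fun u _ => Finset.card_image_le.trans (hd u)
  unfold intE
  refine (Finset.card_le_card (t := (M.biUnion fun u => (nbc H c u (c u)).image fun w => (u, w)) ∪
    (M.biUnion fun u => (nbc H c u (c u)).image fun w => (w, u))) ?_).trans
    ((Finset.card_union_le _ _).trans (by omega))
  rintro ⟨u, v⟩ h
  simp only [Finset.mem_filter, Finset.mem_univ, true_and] at h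
  simp only [Finset.mem_union, Finset.mem_biUnion, Finset.mem_image, nbc, Finset.mem_filter,
    Finset.mem_univ, true_and, Prod.mk.injEq]
  rcases hM u v h.2 h.1 with hu | hv
  · exact Or.inl ⟨u, hu, v, ⟨h.1.symm, h.2⟩, rfl, rfl⟩
  · exact Or.inr ⟨v, hv, u, ⟨h.1, h.2.symm⟩, rfl, rfl⟩

lemma exists_transversal {r tt a : ℕ} (ha : 1 ≤ a) {H : SimpleGraph V}
    (h2 : ¬ BadTrans r tt a H) {c : V → Fin r} (hc : intE H c ≤ 2 * tt) (B : Finset (Fin r))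
    (A : Fin r → Finset V) (hA : ∀ l ∈ B, A l ⊆ cls c l ∧ a ≤ (A l).card) :
    ∃ K : Finset V, H.IsNClique B.card K ∧ ∀ x ∈ K, ∃ l ∈ B, x ∈ A l := by
  have hex : ∃ g : B → V, (∀ i : B, g i ∈ A i) ∧ ∀ i i' : B, i ≠ i' → H.Adj (g i) (g i') := by
    by_cases hB : 2 ≤ B.card
    · have hA' : ∀ l, ∃ A' ⊆ A l, l ∈ B → A'.card = a := by
        intro l
        by_cases hl : l ∈ B
        · obtain ⟨A', h1, h2⟩ := Finset.exists_subset_card_eq (hA l hl).2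
          exact ⟨A', h1, fun _ => h2⟩
        · exact ⟨∅, by simp, fun h => absurd h hl⟩
      choose A' hA'1 hA'2 using hA'
      by_contra hno
      refine h2 ⟨c, A', B, hB, fun l hl => ⟨(hA'1 l).trans (hA l hl).1, hA'2 l hl⟩, hc, ?_⟩
      rintro ⟨g, hg, hg'⟩
      exact hno ⟨g, fun i => hA'1 _ (hg i), hg'⟩
    · have hne : ∀ i : B, (A (i : Fin r)).Nonempty := fun i =>
        Finset.card_pos.1 (lt_of_lt_of_le ha (hA i i.2).2)
      choose g hg using hne
      refine ⟨g, fun i => hg i, fun i i' hi => ?_⟩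
      have : B.card ≤ 1 := by omega
      exact absurd (Subtype.ext (Finset.card_le_one.1 this _ i.2 _ i'.2)) hi
  obtain ⟨g, hg, hg'⟩ := hex
  have hinj : Function.Injective g := fun i i' h => by
    by_contra hne
    exact (hg' i i' hne).ne h
  refine ⟨Finset.univ.image g, ⟨?_, ?_⟩, ?_⟩
  · intro x hx y hy hxy
    simp only [Finset.coe_image, Finset.coe_univ, Set.image_univ, Set.mem_range] at hx hy
    obtain ⟨i, rfl⟩ := hx
    obtain ⟨i', rfl⟩ := hy
    exact hg' i i' fun h => hxy (by rw [h])
  · rw [Finset.card_image_of_injective _ hinj]; simp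
  · intro x hx
    rw [Finset.mem_image] at hx
    obtain ⟨i, -, rfl⟩ := hx
    exact ⟨i, i.2, hg i⟩

lemma exists_niceCol {r tt a k q₀ q₃ : ℕ} (ha : 1 ≤ a) (hq : tt ≤ 2 * q₃ * a)
    (hq₀ : q₀ ≤ q₃) {H : SimpleGraph V} (hH : H.CliqueFree (r + 1)) (h0 : ¬ NoCol r tt H)
    (h1 : ¬ BadCls r tt k H) (h2 : ¬ BadTrans r tt a H)
    (h4 : ∀ q, q₀ ≤ q → q ≤ q₃ → ¬ BadMatch r k a q H) :
    ∃ c : V → Fin r, NiceCol H c (2 * q₀ * a) a := by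
  unfold NoCol at h0
  push Not at h0
  obtain ⟨c₀, hc₀⟩ := h0
  haveI : Nonempty (V → Fin r) := ⟨c₀⟩
  obtain ⟨c, hmin⟩ := Finite.exists_min fun c : V → Fin r => intE H c
  have hc : intE H c ≤ 2 * tt := (hmin c₀).trans hc₀
  have hcls : ∀ l, 9 * k ≤ 10 * (cls c l).card := by
    by_contra! h
    exact h1 ⟨c, hc, h⟩
  have hdeg : ∀ x, (nbc H c x (c x)).card ≤ a := by
    intro x
    by_contra! hx
    obtain ⟨K, hK, hK'⟩ := exists_transversal ha h2 hc Finset.univ (nbc H c x) fun l _ =>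
      ⟨fun w hw => mem_cls.2 (mem_nbc.1 hw).1,
        hx.le.trans (card_nbc_le_of_min hmin x l)⟩
    refine hH (insert x K) ?_
    have := hK.insert (a := x) fun y hy => by
      obtain ⟨l, -, hl⟩ := hK' y hy
      exact (mem_nbc.1 hl).2
    simpa using this
  have hcov : ∀ x y, H.Adj x y → c x = c y → ∃ l, l ≠ c x ∧ (conb H c x y l).card < a := by
    intro x y hxy hcxy
    by_contra! hno
    obtain ⟨K, hK, hK'⟩ := exists_transversal ha h2 hc (Finset.univ.erase (c x)) (conb H c x y)
      fun l hl => ⟨fun w hw => mem_cls.2 (mem_conb.1 hw).1,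
        hno l (Finset.ne_of_mem_erase hl)⟩
    have hK1 : ∀ z ∈ K, H.Adj x z ∧ H.Adj y z := fun z hz => by
      obtain ⟨l, -, hl⟩ := hK' z hz
      exact (mem_conb.1 hl).2
    have hy := hK.insert (a := y) fun z hz => (hK1 z hz).2
    have hx := hy.insert (a := x) fun z hz => by
      rw [Finset.mem_insert] at hz
      rcases hz with rfl | hz
      · exact hxy
      · exact (hK1 z hz).1
    have hr : (Finset.univ.erase (c x)).card + 1 = r := by
      rw [Finset.card_erase_add_one (Finset.mem_univ _)]; simp
    rw [hr] at hx
    exact hH _ hx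
  let M : ℕ → Prop := fun q => ∃ x y : Fin q → V, IntMatch H c q x y
  have hM0 : M 0 := ⟨Fin.elim0, Fin.elim0, fun i => by rcases i with i | i <;> exact i.elim0,
    fun i => i.elim0⟩
  set q := Nat.findGreatest M q₃ with hqdef
  have hMq : M q := Nat.findGreatest_spec (Nat.zero_le _) hM0
  have hqle : q ≤ q₃ := Nat.findGreatest_le _
  obtain ⟨x, y, hinj, hxy⟩ := hMq
  have hbad : intE H c ≤ 2 * (2 * q * a) → q < q₀ := by
    intro hle
    by_contra! hq0
    refine h4 q hq0 hqle ?_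
    choose l hl hl' using fun i => hcov (x i) (y i) (hxy i).1 (hxy i).2
    exact ⟨c, x, y, l, hinj, hcls, fun i => ⟨(hxy i).2, hl i⟩, hle, hl'⟩
  have hle : intE H c ≤ 2 * (2 * q * a) := by
    rcases hqle.lt_or_eq with hlt | heq
    · have hno : ¬ M (q + 1) := Nat.findGreatest_is_greatest (Nat.lt_succ_self _) hlt
      refine (intE_le_of_cover (Finset.univ.image (Sum.elim x y)) ?_ hdeg).trans ?_
      · intro u v huv hcuv
        by_contra! hn
        simp only [Finset.mem_image, Finset.mem_univ, true_and, not_exists, Sum.forall,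
          Sum.elim_inl, Sum.elim_inr] at hn
        refine hno ⟨Fin.snoc x u, Fin.snoc y v, ?_, ?_⟩
        · have hx : Function.Injective x := fun i i' h => by
            simpa using @hinj (Sum.inl i) (Sum.inl i') h
          have hy : Function.Injective y := fun i i' h => by
            simpa using @hinj (Sum.inr i) (Sum.inr i') h
          have hne : ∀ i i', x i ≠ y i' := fun i i' h => by
            simpa using @hinj (Sum.inl i) (Sum.inr i') h
          refine Function.Injective.sumElim ?_ ?_ ?_
          · rw [Fin.snoc_injective_iff]
            exact ⟨hx, fun ⟨i, hi⟩ => hn.1.1 i hi⟩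
          · rw [Fin.snoc_injective_iff]
            exact ⟨hy, fun ⟨i, hi⟩ => hn.2.2 i hi⟩
          · intro i i'
            refine Fin.lastCases ?_ (fun i => ?_) i <;>
              refine Fin.lastCases ?_ (fun i' => ?_) i' <;>
              simp only [Fin.snoc_last, Fin.snoc_castSucc]
            · exact huv.ne
            · exact fun h => hn.1.2 i' h.symm
            · exact hn.2.1 i
            · exact hne i i'
        · intro i
          refine Fin.lastCases ?_ (fun i => ?_) i <;> simp only [Fin.snoc_last, Fin.snoc_castSucc]
          · exact ⟨huv, hcuv⟩
          · exact hxy i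
      · rw [Finset.card_image_of_injective _ hinj]
        simp only [Finset.card_univ, Fintype.card_sum, Fintype.card_fin]
        exact le_of_eq (by ring)
    · rw [heq]
      exact hc.trans (by omega)
  have hlt := hbad hle
  refine ⟨c, hle.trans ?_, hcov⟩
  gcongr

end Structure

section Bounds

variable {V : Type*} [Fintype V]

lemma pr_adj_and_adj {x y w : V} (hxw : x ≠ w) (hyw : y ≠ w) (hxy : x ≠ y) :
    pr V (fun G => G.Adj x w ∧ G.Adj y w) = 1 / 4 := by
  rw [pr_and_of_indep (depOn_adj (Set.mem_singleton s(x, w))) (depOn_adj (Set.mem_singleton s(y, w))),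
    pr_adj hxw, pr_adj hyw]
  · norm_num
  · simp only [Set.disjoint_singleton, ne_eq, Sym2.eq_iff]
    tauto

/-- Two vertices rarely have few common neighbours in `W`. -/
lemma pr_common_le (W : Finset V) {x y : V} (hx : x ∉ W) (hy : y ∉ W) (hxy : x ≠ y) (t : ℕ) :
    pr V (fun G => (W.filter fun w => G.Adj x w ∧ G.Adj y w).card ≤ t) ≤
      (W.card + 1) ^ t * (3 / 4) ^ (W.card - t) := by
  have hne : ∀ w ∈ W, x ≠ w ∧ y ≠ w := fun w hw =>
    ⟨fun h => hx (h ▸ hw), fun h => hy (h ▸ hw)⟩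
  refine le_trans (le_of_eq ?_) (pr_few_le W (fun w G => G.Adj x w ∧ G.Adj y w) (fun w => {s(x, w), s(y, w)})
    (fun w _ => (depOn_adj (by simp)).and (depOn_adj (by simp))) ?_
    (by norm_num : (0 : ℝ) ≤ 3 / 4) (by norm_num) (fun w hw => ?_) t)
  · congr!
  · intro w hw w' hw' hww
    have h1 := hne w hw
    have h2 := hne w' hw'
    simp only [Function.onFun, Set.disjoint_left, Set.mem_insert_iff, Set.mem_singleton_iff]
    rintro e (rfl | rfl) <;> simp only [Sym2.eq_iff] <;> tauto
  · rw [pr_not, pr_adj_and_adj (hne w hw).1 (hne w hw).2 hxy]; norm_num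

lemma depOn_common (W : Finset V) (x y : V) (t : ℕ) :
    DepOn (fun G : SimpleGraph V => (W.filter fun w => G.Adj x w ∧ G.Adj y w).card ≤ t)
      {e | ∃ w ∈ W, e = s(x, w) ∨ e = s(y, w)} := by
  intro G G' h
  have : (W.filter fun w => G.Adj x w ∧ G.Adj y w) = W.filter fun w => G'.Adj x w ∧ G'.Adj y w :=
    Finset.filter_congr fun w hw => by
      rw [h x w ⟨w, hw, Or.inl rfl⟩, h y w ⟨w, hw, Or.inr rfl⟩]
  beta_reduce
  rw [this]

lemma ec_sameG_le {r : ℕ} (c : V → Fin r) :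
    ec (sameG c) + Fintype.card V ≤ Fintype.card V ^ 2 := by
  rw [ec_sameG, ← sum_card_cls c]
  exact Finset.sum_sq_le_sq_sum_of_nonneg fun i _ => Nat.zero_le _

lemma depOn_intE {ι : Type*} (c : V → ι) (t : ℕ) :
    DepOn (fun H : SimpleGraph V => intE H c ≤ t) (sameG c).edgeSet := by
  simp_rw [intE_eq_ec]
  exact depOn_ec_inf _ t

lemma pr_intE_le {r L : ℕ} (hs : (Fintype.card V : ℝ) ≤ 2 ^ (2 * L)) (c : V → Fin r) (t : ℕ) :
    pr V (fun H => intE H c ≤ 2 * t) ≤ 2 ^ (4 * (L : ℝ) * t - (ec (sameG c) : ℝ) / 2) := by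
  simp_rw [intE_eq_ec]
  refine (pr_ec_inf_le (sameG c) t).trans ?_
  have h1 := two_mul_card_eS (sameG c)
  have h2 := ec_sameG_le c
  set I := (eS (sameG c)).card
  have h3 : (I : ℝ) + 1 ≤ 2 ^ (4 * (L : ℝ)) := by
    rcases Nat.eq_zero_or_pos I with h | h
    · rw [h]; simp only [Nat.cast_zero, zero_add]
      exact Real.one_le_rpow (by norm_num) (by positivity)
    · have : I + 1 ≤ Fintype.card V ^ 2 := by omega
      calc (I : ℝ) + 1 ≤ (Fintype.card V : ℝ) ^ 2 := by exact_mod_cast this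
        _ ≤ (2 ^ (2 * L)) ^ 2 := by gcongr
        _ = 2 ^ (4 * (L : ℝ)) := by
          rw [← pow_mul, ← Real.rpow_natCast]; push_cast; ring_nf
  calc ((I : ℝ) + 1) ^ t * (1 / 2) ^ I ≤ (2 ^ (4 * (L : ℝ))) ^ t * (1 / 2) ^ I := by gcongr
    _ = _ := by
      rw [← Real.rpow_natCast, ← Real.rpow_mul (by norm_num), ← h1, sub_eq_add_neg,
        Real.rpow_add (by norm_num), Real.rpow_neg (by norm_num)]
      push_cast
      rw [mul_div_cancel_left₀ _ (by norm_num), Real.rpow_natCast, one_div, inv_pow]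

/-- Bound on the probability that there is no good colouring. -/
lemma pr_noCol_le {r tt Lg : ℕ} {e η β γ ω : ℝ} (hr : 2 ≤ r)
    (hp : CParams (Fintype.card V) r e e η β γ Lg) (hγ2 : γ ≤ e)
    (hS : 1 ≤ 4 * (η * (γ * (Fintype.card V : ℝ)))) (hω : 0 < ω) (hω1 : ω ≤ 1)
    (hωe : 12 * e ≤ ω ^ 4) (htt : 9 * r * ω * (Fintype.card V : ℝ) ^ 2 ≤ 2 * tt) :
    pr V (fun H => H.CliqueFree (r + 1) ∧ NoCol r tt H) ≤
      2 ^ (-((Fintype.card V : ℝ) ^ 2 / (2 * r)) + (Fintype.card V : ℝ) / 2 -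
        e * (Fintype.card V : ℝ) ^ 2) := by
  set S : ℝ := (Fintype.card V : ℝ) with hSdef
  refine (pr_mono fun H h => ?_).trans ((pr_cliqueFree_container_le hp ⊤
    ((1 - 1 / r - 4 * e) * S ^ 2)).trans (Real.rpow_le_rpow_of_exponent_le (by norm_num) ?_))
  · rw [inf_top_eq]
    refine ⟨h.1, fun P hP hle => ?_⟩
    by_contra! hlt
    have e0 := hp.e0
    obtain ⟨c, hc⟩ := hP.exists_coloring hr hp.e0 hp.e1 hp.η0 hp.η1 hp.γ0.le hγ2 hS
      (by linarith : (0 : ℝ) ≤ 4 * e) hω hω1 (by linarith) hlt.le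
    have h1 : intE H c ≤ intE P c := by
      refine Finset.card_le_card fun p hp => ?_
      simp only [Finset.mem_filter, Finset.mem_univ, true_and] at hp ⊢
      exact ⟨hp.1, hle hp.2⟩
    have h2 : intE P c ≤ 2 * tt := by
      have := hc.trans htt
      exact_mod_cast this
    exact absurd (h.2 c) (by omega)
  · have h1 : (ec (⊤ : SimpleGraph V) : ℝ) = S ^ 2 - S := by
      have h : ∀ v : V, (nb (⊤ : SimpleGraph V) v).card + 1 = Fintype.card V := by
        intro v
        have : nb (⊤ : SimpleGraph V) v = Finset.univ.erase v := by
          ext w; simp [eq_comm]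
        rw [this, Finset.card_erase_add_one (Finset.mem_univ _), Finset.card_univ]
      have h' : ∀ v : V, ((nb (⊤ : SimpleGraph V) v).card : ℝ) = S - 1 := fun v => by
        rw [eq_sub_iff_add_eq, hSdef]; exact_mod_cast h v
      unfold ec
      push_cast
      rw [Finset.sum_congr rfl fun v _ => h' v, sum_const_univ]
      ring
    rw [h1]
    have h2 : 0 ≤ e * S := mul_nonneg hp.e0.le (by rw [hSdef]; positivity)
    have h3 : S ^ 2 / (2 * r) = S ^ 2 * (1 / r) / 2 := by ring
    rw [h3]
    linarith

lemma pr_badCls_le {r tt k L : ℕ} (hr : 1 ≤ r) (hs : (Fintype.card V : ℝ) ≤ 2 ^ (2 * L))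
    (hk : (k : ℝ) * r ≤ Fintype.card V) :
    pr V (BadCls r tt k) ≤ r ^ (Fintype.card V) *
      2 ^ (4 * (L : ℝ) * tt - (Fintype.card V : ℝ) ^ 2 / (2 * r) + (Fintype.card V : ℝ) / 2 -
        (k : ℝ) ^ 2 / 200) := by
  have hr' : (0 : ℝ) < r := by exact_mod_cast hr
  calc pr V (BadCls r tt k)
      ≤ pr V (fun H => ∃ c ∈ (Finset.univ : Finset (V → Fin r)),
          intE H c ≤ 2 * tt ∧ ∃ l, 10 * (cls c l).card < 9 * k) :=
        pr_mono fun H ⟨c, h⟩ => ⟨c, Finset.mem_univ _, h⟩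
    _ ≤ (Finset.univ : Finset (V → Fin r)).card * _ := pr_exists_le_card _ _ _ ?_
    _ = _ := by
      rw [Finset.card_univ, Fintype.card_fun, Fintype.card_fin]; push_cast; rfl
  intro c _
  by_cases hl : ∃ l, 10 * (cls c l).card < 9 * k
  · obtain ⟨l, hl⟩ := hl
    refine (pr_mono fun H h => h.1).trans ((pr_intE_le hs c tt).trans
      (Real.rpow_le_rpow_of_exponent_le (by norm_num) ?_))
    have h1 := ec_sameG_ge hr c l
    have h2 : (cls c l).card ≤ (9 / 10 : ℝ) * k := by
      have : (10 * (cls c l).card : ℝ) < 9 * k := by exact_mod_cast hl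
      linarith
    have h3 : (k : ℝ) ≤ (Fintype.card V : ℝ) / r := by rwa [le_div_iff₀ hr']
    have h4 : ((k : ℝ) / 10) ^ 2 ≤ ((Fintype.card V : ℝ) / r - (cls c l).card) ^ 2 := by
      gcongr; linarith
    have h5 : (Fintype.card V : ℝ) ^ 2 / (2 * r) = (Fintype.card V : ℝ) ^ 2 / r / 2 := by
      field_simp
    rw [h5]
    linarith
  · refine le_trans (le_of_eq ?_) (Real.rpow_nonneg (by norm_num) _)
    simp only [hl, and_false]
    exact pr_false

lemma pr_badTrans_le {r tt a L : ℕ} (hr : 1 ≤ r) (hs : (Fintype.card V : ℝ) ≤ 2 ^ (2 * L))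
    (hT : ∀ (B : Finset (Fin r)) (A : B → Finset V), 2 ≤ B.card → (∀ i, (A i).card = a) →
      (∀ i i', i ≠ i' → Disjoint (A i) (A i')) → pr V (NoTrans A) ≤ 2 ^ (-((a : ℝ) ^ 2 / 4))) :
    pr V (BadTrans r tt a) ≤ (r ^ (Fintype.card V) * ((2 ^ Fintype.card V) ^ r * 2 ^ r)) *
      2 ^ (4 * (L : ℝ) * tt - (Fintype.card V : ℝ) ^ 2 / (2 * r) + (Fintype.card V : ℝ) / 2 -
        (a : ℝ) ^ 2 / 4) := by
  have hr' : (0 : ℝ) < r := by exact_mod_cast hr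
  calc pr V (BadTrans r tt a)
      ≤ pr V (fun H => ∃ p ∈ (Finset.univ : Finset ((V → Fin r) × (Fin r → Finset V) ×
          Finset (Fin r))), (2 ≤ p.2.2.card ∧
            (∀ l ∈ p.2.2, p.2.1 l ⊆ cls p.1 l ∧ (p.2.1 l).card = a)) ∧ intE H p.1 ≤ 2 * tt ∧
            NoTrans (fun l : p.2.2 => p.2.1 l) H) :=
        pr_mono fun H ⟨c, A, B, h1, h2, h3⟩ => ⟨(c, A, B), Finset.mem_univ _, ⟨h1, h2⟩, h3⟩
    _ ≤ (Finset.univ : Finset ((V → Fin r) × (Fin r → Finset V) ×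
          Finset (Fin r))).card * _ := pr_exists_le_card _ _ _ ?_
    _ = _ := by
      rw [Finset.card_univ, Fintype.card_prod, Fintype.card_prod, Fintype.card_fun,
        Fintype.card_fun, Fintype.card_finset, Fintype.card_finset, Fintype.card_fin]
      push_cast; rfl
  rintro ⟨c, A, B⟩ -
  by_cases hl : 2 ≤ B.card ∧ (∀ l ∈ B, A l ⊆ cls c l ∧ (A l).card = a)
  · have hdis : ∀ i i' : B, i ≠ i' → Disjoint (A i) (A i') := by
      intro i i' hi
      rw [Finset.disjoint_left]
      intro x hx hx'
      have h1 := mem_cls.1 ((hl.2 i i.2).1 hx)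
      have h2 := mem_cls.1 ((hl.2 i' i'.2).1 hx')
      exact hi (Subtype.ext (h1.symm.trans h2))
    refine (pr_mono (Ψ := fun H => intE H c ≤ 2 * tt ∧ NoTrans (fun l : B => A l) H)
      fun H h => h.2).trans ?_
    rw [pr_and_of_indep (depOn_intE c _) (depOn_noTrans _)]
    · have h1 := pr_intE_le hs c tt
      have h2 := hT B (fun l => A l) hl.1 (fun i => (hl.2 i i.2).2) hdis
      refine (mul_le_mul h1 h2 (pr_nonneg _) (Real.rpow_nonneg (by norm_num) _)).trans ?_
      rw [← Real.rpow_add (by norm_num)]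
      refine Real.rpow_le_rpow_of_exponent_le (by norm_num) ?_
      obtain ⟨l, hlB⟩ := Finset.card_pos.1 (lt_of_lt_of_le two_pos hl.1)
      have h3 := ec_sameG_ge hr c l
      have h4 := sq_nonneg ((Fintype.card V : ℝ) / r - (cls c l).card)
      have h5 : (Fintype.card V : ℝ) ^ 2 / (2 * r) = (Fintype.card V : ℝ) ^ 2 / r / 2 := by
        field_simp
      rw [h5]
      linarith
    · rw [Set.disjoint_left]
      rintro e he ⟨i, i', hi, x, hx, y, hy, rfl⟩
      have h1 := mem_cls.1 ((hl.2 i i.2).1 hx)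
      have h2 := mem_cls.1 ((hl.2 i' i'.2).1 hy)
      exact hi (Subtype.ext (h1.symm.trans (he.2.trans h2)))
  · refine le_trans (le_of_eq ?_) (Real.rpow_nonneg (by norm_num) _)
    simp only [hl, false_and]
    exact pr_false

lemma pr_common_pow_le {k a L q : ℕ} (hs : (Fintype.card V : ℝ) + 1 ≤ 2 ^ (2 * L)) (W : Finset V)
    {x y : V} (hx : x ∉ W) (hy : y ∉ W) (hxy : x ≠ y) (hq : 100 * q ≤ k)
    (haL : 100 * (L * a) ≤ 2 * k) (ha : 100 * a ≤ k) (hW : 9 * k ≤ 10 * (W.card + 2 * q)) :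
    pr V (fun G => (W.filter fun w => G.Adj x w ∧ G.Adj y w).card ≤ a) ≤
      2 ^ (-(3 / 10 * (k : ℝ))) := by
  have h34 : (3 / 4 : ℝ) ≤ 2 ^ (-(2 / 5) : ℝ) := by
    rw [Real.rpow_neg (by norm_num), ← one_div, le_div_iff₀ (by positivity)]
    have : (2 : ℝ) ^ (2 / 5 : ℝ) ≤ 4 / 3 := by
      rw [← Real.rpow_le_rpow_iff (z := 5) (by positivity) (by norm_num) (by norm_num),
        ← Real.rpow_mul (by norm_num)]
      norm_num
    linarith
  refine (pr_common_le W hx hy hxy a).trans ?_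
  have h1 : (W.card : ℝ) + 1 ≤ 2 ^ (2 * (L : ℝ)) := by
    calc (W.card : ℝ) + 1 ≤ (Fintype.card V : ℝ) + 1 := by
          gcongr; exact_mod_cast Finset.card_le_univ W
      _ ≤ 2 ^ (2 * L) := hs
      _ = _ := by rw [← Real.rpow_natCast]; push_cast; rfl
  calc ((W.card : ℝ) + 1) ^ a * (3 / 4) ^ (W.card - a)
      ≤ (2 ^ (2 * (L : ℝ))) ^ a * (2 ^ (-(2 / 5) : ℝ)) ^ (W.card - a) := by gcongr
    _ = 2 ^ (2 * (L : ℝ) * a + -(2 / 5) * ((W.card - a : ℕ) : ℝ)) := by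
      rw [← Real.rpow_natCast, ← Real.rpow_natCast, ← Real.rpow_mul (by norm_num),
        ← Real.rpow_mul (by norm_num), ← Real.rpow_add (by norm_num)]
    _ ≤ _ := by
      refine Real.rpow_le_rpow_of_exponent_le (by norm_num) ?_
      have h2 : 87 * k ≤ 100 * (W.card - a) := by omega
      have h3 : 87 * (k : ℝ) ≤ 100 * ((W.card - a : ℕ) : ℝ) := by exact_mod_cast h2
      have h4 : 100 * ((L : ℝ) * a) ≤ 2 * k := by exact_mod_cast haL
      have : (0 : ℝ) ≤ k := by positivity
      linarith

lemma pr_badMatch_le {r k a q L : ℕ} (hr : 1 ≤ r) (hq0 : 1 ≤ q)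
    (hs : (Fintype.card V : ℝ) + 1 ≤ 2 ^ (2 * L)) (hq : 100 * q ≤ k)
    (haL : 100 * (L * a) ≤ 2 * k) (ha : 100 * a ≤ k) :
    pr V (BadMatch r k a q) ≤ (r ^ (Fintype.card V) * (((Fintype.card V : ℝ) ^ q) *
      (((Fintype.card V : ℝ) ^ q) * r ^ q))) *
      2 ^ (4 * (L : ℝ) * ((2 * q * a : ℕ) : ℝ) - (Fintype.card V : ℝ) ^ 2 / (2 * r) +
        (Fintype.card V : ℝ) / 2 - 3 / 10 * (k : ℝ) * q) := by
  have hr' : (0 : ℝ) < r := by exact_mod_cast hr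
  calc pr V (BadMatch r k a q)
      ≤ pr V (fun H => ∃ p ∈ (Finset.univ : Finset ((V → Fin r) × (Fin q → V) × (Fin q → V) ×
          (Fin q → Fin r))), (Function.Injective (Sum.elim p.2.1 p.2.2.1) ∧
          (∀ l, 9 * k ≤ 10 * (cls p.1 l).card) ∧
          (∀ i, p.1 (p.2.1 i) = p.1 (p.2.2.1 i) ∧ p.2.2.2 i ≠ p.1 (p.2.1 i))) ∧
          intE H p.1 ≤ 2 * (2 * q * a) ∧
            ∀ i, (conb H p.1 (p.2.1 i) (p.2.2.1 i) (p.2.2.2 i)).card < a) :=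
        pr_mono fun H ⟨c, x, y, l, h1, h2, h3, h4⟩ =>
          ⟨(c, x, y, l), Finset.mem_univ _, ⟨h1, h2, h3⟩, h4⟩
    _ ≤ (Finset.univ : Finset ((V → Fin r) × (Fin q → V) × (Fin q → V) ×
          (Fin q → Fin r))).card * _ := pr_exists_le_card _ _ _ ?_
    _ = _ := by
      rw [Finset.card_univ, Fintype.card_prod, Fintype.card_prod, Fintype.card_prod]
      simp only [Fintype.card_fun, Fintype.card_fin]
      push_cast; rfl
  rintro ⟨c, x, y, l⟩ -
  by_cases hl : Function.Injective (Sum.elim x y) ∧ (∀ l, 9 * k ≤ 10 * (cls c l).card) ∧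
      (∀ i, c (x i) = c (y i) ∧ l i ≠ c (x i))
  · obtain ⟨hinj, hcl, hc⟩ := hl
    have hxi : ∀ i i', x i = x i' → i = i' := fun i i' h => by
      simpa using @hinj (Sum.inl i) (Sum.inl i') h
    have hyi : ∀ i i', y i = y i' → i = i' := fun i i' h => by
      simpa using @hinj (Sum.inr i) (Sum.inr i') h
    have hxyi : ∀ i i', x i ≠ y i' := fun i i' h => by
      simpa using @hinj (Sum.inl i) (Sum.inr i') h
    set U : Finset V := Finset.univ.image (Sum.elim x y) with hU
    have hUc : U.card = 2 * q := by
      rw [hU, Finset.card_image_of_injective _ hinj]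
      simp only [Finset.card_univ, Fintype.card_sum, Fintype.card_fin]; ring
    have hxU : ∀ i, x i ∈ U := fun i => Finset.mem_image.2 ⟨Sum.inl i, Finset.mem_univ _, rfl⟩
    have hyU : ∀ i, y i ∈ U := fun i => Finset.mem_image.2 ⟨Sum.inr i, Finset.mem_univ _, rfl⟩
    set W : Fin q → Finset V := fun i => cls c (l i) \ U with hW
    have hWU : ∀ i, ∀ w ∈ W i, w ∉ U := fun i w hw => (Finset.mem_sdiff.1 hw).2
    have hWc : ∀ i, ∀ w ∈ W i, c w = l i := fun i w hw => mem_cls.1 (Finset.mem_sdiff.1 hw).1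
    refine (pr_mono (Ψ := fun H => intE H c ≤ 2 * (2 * q * a) ∧
      ∀ i ∈ (Finset.univ : Finset (Fin q)), ((W i).filter fun w => H.Adj (x i) w ∧ H.Adj (y i) w).card ≤ a)
      fun H h => ⟨h.2.1, fun i _ => ?_⟩).trans ?_
    · refine (Finset.card_le_card fun w hw => ?_).trans (h.2.2 i).le
      rw [Finset.mem_filter] at hw
      exact mem_conb.2 ⟨hWc i w hw.1, hw.2⟩
    set Q : Fin q → Set (Sym2 V) := fun i => {e | ∃ w ∈ W i, e = s(x i, w) ∨ e = s(y i, w)} with hQ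
    rw [pr_and_of_indep (Q' := ⋃ i, Q i) (depOn_intE c _)
      (DepOn.forall fun i => DepOn.forall fun _ =>
        (depOn_common (W i) (x i) (y i) a).mono (Set.subset_iUnion Q i)),
      pr_forall_of_indep Finset.univ _ Q (fun i _ => depOn_common (W i) (x i) (y i) a)]
    · have h1 := pr_intE_le ((by linarith : (Fintype.card V : ℝ) ≤ 2 ^ (2 * L))) c (2 * q * a)
      have h2 : ∏ i, pr V (fun H => ((W i).filter fun w => H.Adj (x i) w ∧ H.Adj (y i) w).card ≤ a)
          ≤ ∏ i : Fin q, (2 : ℝ) ^ (-(3 / 10 * (k : ℝ))) := by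
        refine Finset.prod_le_prod (fun i _ => pr_nonneg _) fun i _ => ?_
        refine pr_common_pow_le (q := q) hs (W i) (fun h => hWU i _ h (hxU i))
          (fun h => hWU i _ h (hyU i)) (hxyi i i) hq haL ha ?_
        have h3 : (cls c (l i)).card ≤ (W i).card + U.card :=
          Finset.card_le_card_sdiff_add_card
        have := hcl (l i)
        omega
      rw [Finset.prod_const, Finset.card_univ, Fintype.card_fin, ← Real.rpow_natCast,
        ← Real.rpow_mul (by norm_num)] at h2
      refine (mul_le_mul h1 h2 (Finset.prod_nonneg fun i _ => pr_nonneg _)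
        (Real.rpow_nonneg (by norm_num) _)).trans ?_
      rw [← Real.rpow_add (by norm_num)]
      refine Real.rpow_le_rpow_of_exponent_le (by norm_num) ?_
      have h3 := ec_sameG_ge hr c (l ⟨0, hq0⟩)
      have h4 := sq_nonneg ((Fintype.card V : ℝ) / r - (cls c (l ⟨0, hq0⟩)).card)
      have h5 : (Fintype.card V : ℝ) ^ 2 / (2 * r) = (Fintype.card V : ℝ) ^ 2 / r / 2 := by
        field_simp
      rw [h5]
      push_cast
      linarith
    · intro i _ i' _ hii
      rw [Function.onFun, Set.disjoint_left]
      rintro e ⟨w, hw, he⟩ ⟨w', hw', he'⟩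
      have n1 : ∀ j, x j ≠ w := fun j h => hWU i w hw (h ▸ hxU j)
      have n2 : ∀ j, y j ≠ w := fun j h => hWU i w hw (h ▸ hyU j)
      rcases he with rfl | rfl <;> rcases he' with he' | he' <;> rw [Sym2.eq_iff] at he' <;>
        rcases he' with he' | he'
      · exact hii (hxi _ _ he'.1)
      · exact n1 _ he'.2.symm
      · exact hxyi _ _ he'.1
      · exact n2 _ he'.2.symm
      · exact hxyi _ _ he'.1.symm
      · exact n1 _ he'.2.symm
      · exact hii (hyi _ _ he'.1)
      · exact n2 _ he'.2.symm
    · rw [Set.disjoint_left]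
      intro e he he'
      rw [Set.mem_iUnion] at he'
      obtain ⟨i, w, hw, rfl | rfl⟩ := he'
      · exact (hc i).2 ((hWc i w hw).symm.trans he.2.symm)
      · exact (hc i).2 ((hWc i w hw).symm.trans (he.2.symm.trans (hc i).1.symm))
  · refine le_trans (le_of_eq ?_) (Real.rpow_nonneg (by norm_num) _)
    simp only [hl, false_and]
    exact pr_false

end Bounds

/-- The standing size assumptions: `k` is at least a power of `L`, an upper bound for its binary
logarithm, with exponent linear in `r`. -/
structure Scale (k r L : ℕ) : Prop where
  hr : 1 ≤ r
  hL : 10 ^ 6 ≤ L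
  hk : k < 2 ^ L
  hH : L ^ (5100 * (r + 1)) ≤ k

namespace Scale

variable {k r L : ℕ} (h : Scale k r L)
include h

lemma r_lt : 5100 * (r + 1) < L := by
  have h1 : 2 ^ (5100 * (r + 1)) < 2 ^ L :=
    lt_of_le_of_lt ((Nat.pow_le_pow_left (by have := h.hL; omega) _).trans h.hH) h.hk
  exact (Nat.pow_lt_pow_iff_right (by norm_num)).1 h1

lemma pow_le {m : ℕ} (hm : m ≤ 5100 * (r + 1)) : (L : ℝ) ^ m ≤ k := by
  have : L ^ m ≤ k := (Nat.pow_le_pow_right (by have := h.hL; omega) hm).trans h.hH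
  exact_mod_cast this

lemma L_ge : (10 : ℝ) ^ 6 ≤ L := by exact_mod_cast h.hL

lemma r_le : 5100 * ((r : ℝ) + 1) ≤ L := by exact_mod_cast h.r_lt.le

lemma r_ge : (1 : ℝ) ≤ r := by exact_mod_cast h.hr

lemma a_le : ((k / L ^ 10 : ℕ) : ℝ) * L ^ 10 ≤ k := by
  exact_mod_cast Nat.div_mul_le_self k (L ^ 10)

lemma a_ge : (k : ℝ) ≤ 2 * ((k / L ^ 10 : ℕ) : ℝ) * L ^ 10 := by
  have hL := h.L_ge
  have h0 : 0 < L ^ 10 := Nat.pow_pos (by have := h.hL; omega)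
  have h1 : (k : ℝ) < (k / L ^ 10 : ℕ) * L ^ 10 + L ^ 10 := by
    have := Nat.lt_div_mul_add (a := k) h0
    exact_mod_cast this
  have h2 : 1 ≤ k / L ^ 10 := by
    rw [Nat.one_le_div_iff h0]
    exact (Nat.pow_le_pow_right (by have := h.hL; omega) (by omega)).trans h.hH
  have h3 : (1 : ℝ) ≤ (k / L ^ 10 : ℕ) := by exact_mod_cast h2
  have h4 : 1 * (L : ℝ) ^ 10 ≤ (k / L ^ 10 : ℕ) * L ^ 10 := by gcongr
  linarith

lemma a_pow {m : ℕ} (hm : m ≤ r) : L ^ (5000 * (m + 1)) ≤ k / L ^ 10 := by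
  have hL : 0 < L := by have := h.hL; omega
  rw [Nat.le_div_iff_mul_le (Nat.pow_pos hL), ← pow_add]
  exact (Nat.pow_le_pow_right hL (by omega)).trans h.hH

lemma a_pos : 1 ≤ k / L ^ 10 :=
  (Nat.one_le_pow _ _ (by have := h.hL; omega)).trans (h.a_pow (m := 0) (by omega))

lemma s_facts {s : ℕ} (h1 : k * r ≤ s) (h2 : s ≤ k * r + r) :
    (k : ℝ) * r ≤ s ∧ (s : ℝ) ≤ 2 * (k * r) ∧ (s : ℝ) ≤ k * L ∧ (k : ℝ) ≤ s ∧
      (s : ℝ) + 1 ≤ 2 ^ (2 * L) := by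
  have hr := h.r_ge
  have hrl := h.r_le
  have hk1 : (1 : ℝ) ≤ k := by simpa using h.pow_le (m := 0) (by omega)
  have e1 : (k : ℝ) * r ≤ s := by exact_mod_cast h1
  have e2 : (s : ℝ) ≤ 2 * (k * r) := by
    have : (s : ℝ) ≤ k * r + r := by exact_mod_cast h2
    have : 1 * (r : ℝ) ≤ k * r := by gcongr
    linarith
  have e3 : (s : ℝ) + 1 ≤ k * L := by
    have : (k : ℝ) * (2 * r + 1) ≤ k * L := by gcongr; linarith
    linarith
  refine ⟨e1, e2, by linarith, ?_, ?_⟩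
  · refine le_trans ?_ e1
    exact le_mul_of_one_le_right (by linarith) hr
  · have h3 : (k : ℝ) ≤ 2 ^ L := by exact_mod_cast h.hk.le
    have h4 : (L : ℝ) ≤ 2 ^ L := by exact_mod_cast Nat.lt_two_pow_self.le
    calc (s : ℝ) + 1 ≤ k * L := e3
      _ ≤ 2 ^ L * 2 ^ L := by gcongr
      _ = 2 ^ (2 * L) := by rw [← pow_add]; ring_nf

lemma pow_r_le (m : ℕ) : (r : ℝ) ^ m ≤ 2 ^ ((L : ℝ) * m) := by
  have h1 : (r : ℝ) ≤ 2 ^ (L : ℝ) := by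
    rw [Real.rpow_natCast]
    have h4 : (L : ℝ) ≤ 2 ^ L := by exact_mod_cast Nat.lt_two_pow_self.le
    have := h.r_le
    have := h.r_ge
    linarith
  calc (r : ℝ) ^ m ≤ (2 ^ (L : ℝ)) ^ m := by gcongr
    _ = _ := by rw [← Real.rpow_natCast, ← Real.rpow_mul (by norm_num)]

end Scale

section Numeric

variable {k r L s : ℝ}

lemma tt_bound (hL : 10 ^ 6 ≤ L) (hrL : 5100 * (r + 1) ≤ L) (hr : 1 ≤ r) (k0 : 0 ≤ k) (s0 : 0 ≤ s)
    (hs : s ≤ 2 * (k * r)) {t : ℝ} (ht : t * (2 * L ^ 26) ≤ s ^ 2) : t * L ^ 24 ≤ k ^ 2 := by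
  have hL0 : 0 < L := by linarith
  have h1 : s ^ 2 ≤ (2 * (k * r)) ^ 2 := by gcongr
  have h2 : k ^ 2 * (4 * r ^ 2) ≤ k ^ 2 * (2 * L ^ 2) := by
    refine mul_le_mul_of_nonneg_left ?_ (sq_nonneg k)
    have : r ^ 2 ≤ (L / 5100) ^ 2 := by gcongr; linarith
    have : 0 ≤ L ^ 2 := by positivity
    linarith
  have h3 : t * L ^ 24 * (2 * L ^ 2) ≤ k ^ 2 * (2 * L ^ 2) := by
    calc t * L ^ 24 * (2 * L ^ 2) = t * (2 * L ^ 26) := by ring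
      _ ≤ _ := by linarith
  exact le_of_mul_le_mul_right h3 (by positivity)

lemma lin_bound (hL : 10 ^ 6 ≤ L) (k0 : 0 ≤ k) (hk : L ^ 200 ≤ k) (hs : s ≤ k * L) :
    s * L * L ^ 26 ≤ k ^ 2 := by
  have hL0 : 0 < L := by linarith
  calc s * L * L ^ 26 ≤ (k * L) * L * L ^ 26 := by gcongr
    _ = k * L ^ 28 := by ring
    _ ≤ k * L ^ 200 := by gcongr <;> linarith
    _ ≤ k * k := by gcongr
    _ = k ^ 2 := by ring

end Numeric

section Assembly

variable {V : Type*} [Fintype V] {k r L : ℕ}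

lemma pr_noTrans_scale (h : Scale k r L) (B : Finset (Fin r)) (A : B → Finset V) (hB : 2 ≤ B.card)
    (hA : ∀ i, (A i).card = k / L ^ 10) (hdis : ∀ i i', i ≠ i' → Disjoint (A i) (A i')) :
    pr V (NoTrans A) ≤ 2 ^ (-(((k / L ^ 10 : ℕ) : ℝ) ^ 2 / 4)) := by
  have hL := h.hL
  have hL' := h.L_ge
  have hrL := h.r_lt
  have hBr : B.card ≤ r := by simpa using B.card_le_univ
  obtain ⟨m, hm⟩ : ∃ m, B.card = m + 1 := ⟨B.card - 1, by omega⟩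
  set a := k / L ^ 10 with ha
  have hap : L ^ (5000 * (m + 1)) ≤ (m + 1) * a :=
    (h.a_pow (by omega)).trans (Nat.le_mul_of_pos_left _ (by omega))
  have hS : (m + 1) * a + 1 ≤ 2 ^ (2 * L) := by
    have h1 : a ≤ k := Nat.div_le_self _ _
    have h2 : (m + 1) * a ≤ r * k := Nat.mul_le_mul (by omega) h1
    have h3 : (s : ℕ) → s = k * r → s + 1 ≤ 2 ^ (2 * L) := by
      rintro s rfl
      have := (h.s_facts le_rfl (by omega : k * r ≤ k * r + r)).2.2.2.2
      exact_mod_cast this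
    have := h3 _ rfl
    have e : k * r = r * k := mul_comm _ _
    omega
  obtain ⟨η, β, γ, hp, hγ2, hS2⟩ := cparams_pow (S := (m + 1) * a) (R := m) (Lg := 2 * L) (L := L)
    (by omega) (by omega) (by omega) (by omega) le_rfl hS hap
  have hm1 : ((m : ℝ) + 1) ≤ L := by exact_mod_cast (by omega : m + 1 ≤ L)
  have hpow : 32 * ((m : ℝ) + 1) ^ 2 ≤ (L : ℝ) ^ 114 := by
    calc 32 * ((m : ℝ) + 1) ^ 2 ≤ (L : ℝ) * (L : ℝ) ^ 2 := by gcongr; linarith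
      _ = (L : ℝ) ^ 3 := by ring
      _ ≤ (L : ℝ) ^ 114 := pow_le_pow_right₀ (by linarith) (by norm_num)
  refine pr_noTrans_le (m := m) (by omega) (by simpa using hm) hp hγ2 (by exact_mod_cast hS2) ?_ ?_
    hA hdis
  · refine one_div_le_one_div_of_le (by positivity) (le_trans ?_ hpow)
    gcongr; norm_num
  · exact one_div_le_one_div_of_le (by positivity) hpow

variable (h : Scale k r L) (hs1 : k * r ≤ Fintype.card V) (hs2 : Fintype.card V ≤ k * r + r)
include h hs1 hs2

lemma half_le : (Fintype.card V : ℝ) * k / 2 ≤ (Fintype.card V : ℝ) ^ 2 / (2 * r) := by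
  have hr := h.r_ge
  obtain ⟨e1, -⟩ := h.s_facts hs1 hs2
  rw [div_le_div_iff₀ (by norm_num) (by positivity)]
  have : (Fintype.card V : ℝ) * (k * r) ≤ Fintype.card V * Fintype.card V := by gcongr
  linarith

lemma pr_noCol_scale (hr2 : 2 ≤ r) :
    pr V (fun H => H.CliqueFree (r + 1) ∧ NoCol r (Fintype.card V ^ 2 / (2 * L ^ 26)) H) ≤
      2 ^ (-((Fintype.card V : ℝ) * k / 2 + 4 * (Fintype.card V * L))) := by
  have hL := h.hL
  have hL' := h.L_ge
  have hrL := h.r_lt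
  have hrL' := h.r_le
  have hr := h.r_ge
  have hhalf := half_le h hs1 hs2
  obtain ⟨e1, e2, e3, e4, e5⟩ := h.s_facts hs1 hs2
  have hk := h.pow_le (m := 200) (by omega)
  have hkS : k ≤ Fintype.card V := by exact_mod_cast e4
  have hS : L ^ (5000 * (r + 1)) ≤ Fintype.card V :=
    ((Nat.pow_le_pow_right (by omega) (by omega)).trans h.hH).trans hkS
  obtain ⟨η, β, γ, hp, hγ2, hS2⟩ := cparams_pow (S := Fintype.card V) (R := r) (Lg := 2 * L) (L := L)
    h.hr (by omega) (by omega) (by omega) le_rfl (by exact_mod_cast e5) hS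
  have htt : (Fintype.card V : ℝ) ^ 2 ≤ ((Fintype.card V ^ 2 / (2 * L ^ 26) : ℕ) : ℝ) *
      (2 * L ^ 26) + 2 * L ^ 26 := by
    have := Nat.lt_div_mul_add (a := Fintype.card V ^ 2) (b := 2 * L ^ 26) (by positivity)
    exact_mod_cast this.le
  set tt := Fintype.card V ^ 2 / (2 * L ^ 26)
  set S : ℝ := (Fintype.card V : ℝ) with hSdef
  have hL0 : (0 : ℝ) < L := by linarith
  have hSL : (L : ℝ) ^ 200 ≤ S := hk.trans e4
  refine (pr_noCol_le (tt := tt) (ω := 1 / (L : ℝ) ^ 28) hr2 hp hγ2 hS2 (by positivity) ?_ ?_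
    ?_).trans (Real.rpow_le_rpow_of_exponent_le (by norm_num) ?_)
  · rw [div_le_one (by positivity)]; exact one_le_pow₀ (by linarith)
  · rw [div_pow, one_pow, ← pow_mul, mul_one_div, div_le_div_iff₀ (by positivity) (by positivity),
      one_mul]
    calc 12 * (L : ℝ) ^ (28 * 4) ≤ (L : ℝ) ^ 2 * (L : ℝ) ^ (28 * 4) := by gcongr; nlinarith
      _ = (L : ℝ) ^ 114 := by ring
  · rw [← hSdef]
    have h1 : 9 * (r : ℝ) * (1 / L ^ 28) * S ^ 2 * L ^ 28 = 9 * r * S ^ 2 := by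
      field_simp
    have h2 : 9 * (r : ℝ) * S ^ 2 ≤ 1 / 2 * (L ^ 2 * S ^ 2) := by
      rw [← mul_assoc]
      exact mul_le_mul_of_nonneg_right (by nlinarith) (sq_nonneg S)
    have h3 : (L : ℝ) ^ 28 * 4 ≤ L ^ 2 * S ^ 2 := by
      have a1 : (L : ℝ) ^ 27 * 4 ≤ S := by
        calc (L : ℝ) ^ 27 * 4 ≤ (L : ℝ) ^ 27 * (L : ℝ) := by gcongr; linarith
          _ = (L : ℝ) ^ 28 := by ring
          _ ≤ (L : ℝ) ^ 200 := pow_le_pow_right₀ (by linarith) (by norm_num)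
          _ ≤ S := hSL
      have a2 : (1 : ℝ) ≤ S := by
        have : (1 : ℝ) ≤ L ^ 200 := one_le_pow₀ (by linarith)
        linarith
      calc (L : ℝ) ^ 28 * 4 = L * 1 * (L ^ 27 * 4) := by ring
        _ ≤ L ^ 2 * S * S := by
          refine mul_le_mul ?_ a1 (by positivity) (by positivity)
          refine mul_le_mul ?_ a2 (by norm_num) (by positivity)
          nlinarith
        _ = _ := by ring
    have h4 : L ^ 2 * S ^ 2 ≤ L ^ 2 * (tt * (2 * L ^ 26) + 2 * L ^ 26) := by gcongr
    have h5 : 9 * (r : ℝ) * (1 / L ^ 28) * S ^ 2 * L ^ 28 ≤ 2 * tt * L ^ 28 := by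
      rw [h1]; nlinarith
    exact le_of_mul_le_mul_right h5 (by positivity)
  · rw [← hSdef]
    have h1 : (5 * L : ℝ) ≤ 1 / L ^ 114 * S := by
      rw [div_mul_eq_mul_div, one_mul, le_div_iff₀ (by positivity)]
      calc 5 * (L : ℝ) * L ^ 114 ≤ (L : ℝ) * L * L ^ 114 := by gcongr; linarith
        _ = (L : ℝ) ^ 116 := by ring
        _ ≤ (L : ℝ) ^ 200 := pow_le_pow_right₀ (by linarith) (by norm_num)
        _ ≤ S := hSL
    have h2 : 5 * L * S ≤ 1 / L ^ 114 * S * S := by gcongr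
    have h3 : S * 1 ≤ S * L := by gcongr; linarith
    have h4 : 1 / (L : ℝ) ^ 114 * S ^ 2 = 1 / L ^ 114 * S * S := by ring
    rw [h4]
    linarith

lemma pr_badCls_scale :
    pr V (BadCls r (Fintype.card V ^ 2 / (2 * L ^ 26)) k) ≤
      2 ^ (-((Fintype.card V : ℝ) * k / 2 + 4 * (Fintype.card V * L))) := by
  have hL' := h.L_ge
  have hhalf := half_le h hs1 hs2
  obtain ⟨e1, e2, e3, e4, e5⟩ := h.s_facts hs1 hs2
  have hk := h.pow_le (m := 200) (by omega)
  have htt : ((Fintype.card V ^ 2 / (2 * L ^ 26) : ℕ) : ℝ) * (2 * L ^ 26) ≤ (Fintype.card V : ℝ) ^ 2 := by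
    exact_mod_cast Nat.div_mul_le_self _ _
  have h1 := pr_badCls_le (tt := Fintype.card V ^ 2 / (2 * L ^ 26)) (k := k) h.hr (by linarith) e1
  set tt := Fintype.card V ^ 2 / (2 * L ^ 26)
  set S : ℝ := (Fintype.card V : ℝ) with hSdef
  have hb1 := tt_bound hL' h.r_le h.r_ge (Nat.cast_nonneg k) (Nat.cast_nonneg _) e2 htt
  have hb2 := lin_bound hL' (Nat.cast_nonneg k) hk e3
  refine h1.trans ((mul_le_mul_of_nonneg_right (h.pow_r_le _) (by positivity)).trans ?_)
  rw [← Real.rpow_add (by norm_num)]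
  refine Real.rpow_le_rpow_of_exponent_le (by norm_num) ?_
  rw [← hSdef]
  have hS0 : 0 ≤ S := by linarith
  have c1 : (L : ℝ) * tt * 10 ^ 6 ≤ k ^ 2 := by
    refine le_trans ?_ hb1
    calc (L : ℝ) * tt * 10 ^ 6 ≤ L * tt * L ^ 23 := by
          gcongr
          exact hL'.trans (le_self_pow₀ (by linarith) (by norm_num))
      _ = _ := by ring
  have c2 : S * L * 10 ^ 6 ≤ k ^ 2 := by
    refine le_trans ?_ hb2
    gcongr
    exact hL'.trans (le_self_pow₀ (by linarith) (by norm_num))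
  have c3 : S * 1 ≤ S * L := by gcongr; linarith
  linarith

lemma pr_badTrans_scale :
    pr V (BadTrans r (Fintype.card V ^ 2 / (2 * L ^ 26)) (k / L ^ 10)) ≤
      2 ^ (-((Fintype.card V : ℝ) * k / 2 + 4 * (Fintype.card V * L))) := by
  have hL' := h.L_ge
  have hrL' := h.r_le
  have hr := h.r_ge
  have hhalf := half_le h hs1 hs2
  have hage := h.a_ge
  obtain ⟨e1, e2, e3, e4, e5⟩ := h.s_facts hs1 hs2
  have hk := h.pow_le (m := 200) (by omega)
  have hk1 : (1 : ℝ) ≤ k := by simpa using h.pow_le (m := 0) (by omega)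
  have htt : ((Fintype.card V ^ 2 / (2 * L ^ 26) : ℕ) : ℝ) * (2 * L ^ 26) ≤ (Fintype.card V : ℝ) ^ 2 := by
    exact_mod_cast Nat.div_mul_le_self _ _
  have h1 := pr_badTrans_le (V := V) (tt := Fintype.card V ^ 2 / (2 * L ^ 26)) (a := k / L ^ 10)
    (L := L) h.hr (by linarith) (pr_noTrans_scale h)
  set tt := Fintype.card V ^ 2 / (2 * L ^ 26)
  set a := k / L ^ 10
  set S : ℝ := (Fintype.card V : ℝ) with hSdef
  have hb1 := tt_bound hL' h.r_le h.r_ge (Nat.cast_nonneg k) (Nat.cast_nonneg _) e2 htt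
  have hb2 := lin_bound hL' (Nat.cast_nonneg k) hk e3
  have hL0 : (0 : ℝ) < L := by linarith
  have hS0 : 0 ≤ S := by linarith
  have hcount : (r : ℝ) ^ (Fintype.card V) * ((2 ^ Fintype.card V) ^ r * 2 ^ r) ≤
      2 ^ (L * S + (S * r + r)) := by
    rw [Real.rpow_add (by norm_num)]
    refine mul_le_mul (h.pow_r_le _) (le_of_eq ?_) (by positivity) (by positivity)
    rw [Real.rpow_add (by norm_num), Real.rpow_mul (by norm_num)]
    simp only [S, Real.rpow_natCast]
  refine h1.trans ((mul_le_mul_of_nonneg_right hcount (by positivity)).trans ?_)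
  rw [← Real.rpow_add (by norm_num)]
  refine Real.rpow_le_rpow_of_exponent_le (by norm_num) ?_
  have ha2 : (k : ℝ) ^ 2 ≤ 4 * a ^ 2 * L ^ 20 := by
    calc (k : ℝ) ^ 2 ≤ (2 * a * L ^ 10) ^ 2 := by gcongr
      _ = _ := by ring
  have c1 : (L : ℝ) * tt * 10 ^ 6 ≤ 4 * a ^ 2 := by
    have : (L : ℝ) * tt * 10 ^ 6 * L ^ 20 ≤ 4 * a ^ 2 * L ^ 20 := by
      refine le_trans ?_ (hb1.trans ha2)
      calc (L : ℝ) * tt * 10 ^ 6 * L ^ 20 ≤ L * tt * L ^ 3 * L ^ 20 := by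
            gcongr
            exact hL'.trans (le_self_pow₀ (by linarith) (by norm_num))
        _ = _ := by ring
    exact le_of_mul_le_mul_right this (by positivity)
  have c2 : S * L * 10 ^ 6 ≤ 4 * a ^ 2 := by
    have : S * L * 10 ^ 6 * L ^ 20 ≤ 4 * a ^ 2 * L ^ 20 := by
      refine le_trans ?_ (hb2.trans ha2)
      calc S * L * 10 ^ 6 * L ^ 20 ≤ S * L * L ^ 6 * L ^ 20 := by
            gcongr
            linarith
        _ = _ := by ring
    exact le_of_mul_le_mul_right this (by positivity)
  have c3 : S * 1 ≤ S * L := by gcongr; linarith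
  have c4 : S * (r + 1) ≤ S * L := by gcongr; linarith
  have c5 : (r : ℝ) ≤ S := by
    have : 1 * (r : ℝ) ≤ k * r := by gcongr
    linarith
  linarith

lemma pr_badMatch_scale {q : ℕ} (hq0 : 100 * (r * L) ≤ q) (hq1 : q ≤ k / 100) :
    pr V (BadMatch r k (k / L ^ 10) q) ≤
      2 ^ (-((Fintype.card V : ℝ) * k / 2 + 4 * (Fintype.card V * L))) := by
  have hL := h.hL
  have hL' := h.L_ge
  have hrL' := h.r_le
  have hr := h.r_ge
  have hhalf := half_le h hs1 hs2
  have hale := h.a_le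
  obtain ⟨e1, e2, e3, e4, e5⟩ := h.s_facts hs1 hs2
  have hk := h.pow_le (m := 200) (by omega)
  have hL0 : (0 : ℝ) < L := by linarith
  set a := k / L ^ 10
  have hLa : 1000 * ((L : ℝ) * a) ≤ k := by
    refine le_trans ?_ hale
    calc 1000 * ((L : ℝ) * a) = a * (L * 1000) := by ring
      _ ≤ a * (L * L ^ 9) := by
        gcongr
        exact le_trans (by linarith) (le_self_pow₀ (by linarith : (1 : ℝ) ≤ L) (by norm_num))
      _ = _ := by ring
  have hLan : 1000 * (L * a) ≤ k := by exact_mod_cast hLa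
  have hLan2 : a ≤ L * a := Nat.le_mul_of_pos_left _ (by omega)
  have hq1' : 1 ≤ q := le_trans (Nat.mul_pos (by norm_num) (Nat.mul_pos h.hr (by omega))) hq0
  have h1 := pr_badMatch_le (V := V) (k := k) (a := a) (q := q) (L := L) h.hr hq1' e5 (by omega)
    (by omega) (by omega)
  set S : ℝ := (Fintype.card V : ℝ) with hSdef
  have hS0 : 0 ≤ S := by linarith
  have hSq : S ^ q ≤ 2 ^ (2 * (L : ℝ) * q) := by
    calc S ^ q ≤ (2 ^ (2 * L)) ^ q := by gcongr; linarith
      _ = _ := by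
        rw [Real.rpow_mul (by norm_num), Real.rpow_natCast]
        congr 1
        rw [← Real.rpow_natCast]; push_cast; rfl
  have hcount : (r : ℝ) ^ (Fintype.card V) * (S ^ q * (S ^ q * r ^ q)) ≤
      2 ^ (L * S + (2 * (L : ℝ) * q + (2 * (L : ℝ) * q + L * q))) := by
    rw [Real.rpow_add (by norm_num), Real.rpow_add (by norm_num), Real.rpow_add (by norm_num)]
    have := h.pow_r_le q
    have := h.pow_r_le (Fintype.card V)
    rw [← hSdef] at this
    gcongr
  refine h1.trans ((mul_le_mul_of_nonneg_right hcount (by positivity)).trans ?_)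
  rw [← Real.rpow_add (by norm_num)]
  refine Real.rpow_le_rpow_of_exponent_le (by norm_num) ?_
  push_cast
  have hq0' : 100 * ((r : ℝ) * L) ≤ q := by exact_mod_cast hq0
  have c1 : 1000 * ((L : ℝ) * a) * q ≤ k * q := by gcongr
  have c2 : (1000 * L : ℝ) * q ≤ k * q := by
    gcongr
    calc (1000 * L : ℝ) ≤ (L : ℝ) * L := by gcongr; linarith
      _ = (L : ℝ) ^ 2 := by ring
      _ ≤ (L : ℝ) ^ 200 := pow_le_pow_right₀ (by linarith) (by norm_num)
      _ ≤ k := hk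
  have c3 : S * 1 ≤ S * L := by gcongr; linarith
  have c4 : S * L ≤ 2 * (k * r) * L := by gcongr
  have c5 : (k : ℝ) * (100 * (r * L)) ≤ k * q := by gcongr
  linarith

/-- Almost every `(r+1)`-clique free graph is nearly `r`-partite. -/
theorem pr_not_nice_le :
    pr V (fun H => H.CliqueFree (r + 1) ∧
      ¬ ∃ c : V → Fin r, NiceCol H c (200 * (r * L) * (k / L ^ 10)) (k / L ^ 10)) ≤
      2 ^ (-((Fintype.card V : ℝ) * k / 2 + 3 * (Fintype.card V * L))) := by
  have hL := h.hL
  have hL' := h.L_ge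
  have hr := h.r_ge
  have hrL' := h.r_le
  have hage := h.a_ge
  obtain ⟨e1, e2, e3, e4, e5⟩ := h.s_facts hs1 hs2
  have hk := h.pow_le (m := 200) (by omega)
  have hL0 : (0 : ℝ) < L := by linarith
  rcases h.hr.eq_or_lt with rfl | hr2
  · refine le_trans (le_of_eq ?_) (Real.rpow_nonneg (by norm_num) _)
    rw [← pr_false (V := V)]
    refine pr_congr fun H => iff_of_false ?_ (by simp)
    rintro ⟨h1, h2⟩
    have hbot : ∀ x y, ¬ H.Adj x y := fun x y hxy => by
      have : H = ⊥ := by simpa using h1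
      rw [this] at hxy; exact hxy
    refine h2 ⟨fun _ => 0, ?_, fun x y hxy => absurd hxy (hbot x y)⟩
    simp [intE, hbot]
  set a := k / L ^ 10 with ha
  set tt := Fintype.card V ^ 2 / (2 * L ^ 26) with htt
  have hq30 : 100 * (r * L) ≤ k / 100 := by
    rw [Nat.le_div_iff_mul_le (by norm_num)]
    have : (100 * (r * L) * 100 : ℝ) ≤ k := by
      calc (100 * (r * L) * 100 : ℝ) ≤ 100 * ((L : ℝ) * L) * 100 := by
            gcongr
            have := h.r_lt
            omega
        _ = 10000 * (L : ℝ) ^ 2 := by ring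
        _ ≤ (L : ℝ) * (L : ℝ) ^ 2 := by gcongr; linarith
        _ = (L : ℝ) ^ 3 := by ring
        _ ≤ (L : ℝ) ^ 200 := pow_le_pow_right₀ (by linarith) (by norm_num)
        _ ≤ k := hk
    exact_mod_cast this
  have hq3 : tt ≤ 2 * (k / 100) * a := by
    have ht : (tt : ℝ) * (2 * L ^ 26) ≤ (Fintype.card V : ℝ) ^ 2 := by
      exact_mod_cast Nat.div_mul_le_self _ _
    have hb1 := tt_bound hL' h.r_le h.r_ge (Nat.cast_nonneg k) (Nat.cast_nonneg _) e2 ht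
    have h100 : (k : ℝ) ≤ 200 * ((k / 100 : ℕ) : ℝ) := by
      have h2 : 100 ≤ k := by
        have : (100 : ℝ) ≤ k := by
          refine le_trans ?_ hk
          exact le_trans (by linarith) (le_self_pow₀ (by linarith : (1 : ℝ) ≤ L) (by norm_num))
        exact_mod_cast this
      exact_mod_cast (by omega : k ≤ 200 * (k / 100))
    have h3 : (tt : ℝ) * (400 * L ^ 10) ≤ 2 * ((k / 100 : ℕ) : ℝ) * a * (400 * L ^ 10) := by
      calc (tt : ℝ) * (400 * L ^ 10) ≤ (tt : ℝ) * ((L : ℝ) ^ 14 * (L : ℝ) ^ 10) := by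
            gcongr
            exact le_trans (by linarith) (le_self_pow₀ (by linarith : (1 : ℝ) ≤ L) (by norm_num))
        _ = (tt : ℝ) * L ^ 24 := by ring
        _ ≤ (k : ℝ) * k := by rw [← sq]; exact hb1
        _ ≤ (200 * ((k / 100 : ℕ) : ℝ)) * (2 * a * L ^ 10) := by gcongr
        _ ≤ 2 * ((200 * ((k / 100 : ℕ) : ℝ)) * (2 * a * L ^ 10)) := by
          have : (0 : ℝ) ≤ (200 * ((k / 100 : ℕ) : ℝ)) * (2 * a * L ^ 10) := by positivity
          linarith
        _ = _ := by ring
    have h4 := le_of_mul_le_mul_right h3 (by positivity)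
    exact_mod_cast h4
  set b : ℝ := 2 ^ (-((Fintype.card V : ℝ) * k / 2 + 4 * (Fintype.card V * L))) with hb
  have hb0 : 0 ≤ b := by positivity
  have hbd : pr V (fun H => H.CliqueFree (r + 1) ∧
      ¬ ∃ c : V → Fin r, NiceCol H c (200 * (r * L) * a) a) ≤
      b + (b + (b + (Finset.Icc (100 * (r * L)) (k / 100)).card * b)) := by
    refine (pr_mono (Ψ := fun H => (H.CliqueFree (r + 1) ∧ NoCol r tt H) ∨ BadCls r tt k H ∨
      BadTrans r tt a H ∨ ∃ q ∈ Finset.Icc (100 * (r * L)) (k / 100), BadMatch r k a q H)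
      fun H hH => ?_).trans ?_
    · by_contra! hno
      refine hH.2 ?_
      have e : 200 * (r * L) * a = 2 * (100 * (r * L)) * a := by ring
      rw [e]
      exact exists_niceCol h.a_pos hq3 hq30 hH.1 (hno.1 hH.1) hno.2.1 hno.2.2.1
        fun q h1 h2 => hno.2.2.2 q (Finset.mem_Icc.2 ⟨h1, h2⟩)
    · refine (pr_or_le _ _).trans (add_le_add (pr_noCol_scale h hs1 hs2 hr2) ?_)
      refine (pr_or_le _ _).trans (add_le_add (pr_badCls_scale h hs1 hs2) ?_)
      refine (pr_or_le _ _).trans (add_le_add (pr_badTrans_scale h hs1 hs2) ?_)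
      refine pr_exists_le_card _ _ _ fun q hq => ?_
      rw [Finset.mem_Icc] at hq
      exact pr_badMatch_scale h hs1 hs2 hq.1 hq.2
  refine hbd.trans ?_
  have hcard : ((Finset.Icc (100 * (r * L)) (k / 100)).card : ℝ) ≤ k := by
    have : (Finset.Icc (100 * (r * L)) (k / 100)).card ≤ k := by
      rw [Nat.card_Icc]
      have : 1 ≤ 100 * (r * L) := Nat.mul_pos (by norm_num) (Nat.mul_pos h.hr (by omega))
      omega
    exact_mod_cast this
  have h5 : (k : ℝ) + 3 ≤ 2 ^ ((Fintype.card V : ℝ) * L) := by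
    have : (k : ℝ) + 3 ≤ 2 ^ (2 * L) := by
      have h3 : (k : ℝ) ≤ 2 ^ L := by exact_mod_cast h.hk.le
      have h4 : (L : ℝ) ≤ 2 ^ L := by exact_mod_cast Nat.lt_two_pow_self.le
      have h6 : (2 : ℝ) ^ (2 * L) = 2 ^ L * 2 ^ L := by rw [← pow_add]; ring_nf
      rw [h6]; nlinarith
    refine this.trans ?_
    rw [← Real.rpow_natCast]
    refine Real.rpow_le_rpow_of_exponent_le (by norm_num) ?_
    push_cast
    have : (2 : ℝ) ≤ Fintype.card V := by
      refine le_trans ?_ (hk.trans e4)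
      exact le_trans (by linarith) (le_self_pow₀ (by linarith : (1 : ℝ) ≤ L) (by norm_num))
    gcongr
  calc b + (b + (b + (Finset.Icc (100 * (r * L)) (k / 100)).card * b)) ≤ (k + 3) * b := by
        have : ((Finset.Icc (100 * (r * L)) (k / 100)).card : ℝ) * b ≤ k * b := by gcongr
        linarith
    _ ≤ 2 ^ ((Fintype.card V : ℝ) * L) * b := by gcongr
    _ = _ := by
      rw [hb, ← Real.rpow_add (by norm_num)]; ring_nf

end Assembly

section Pairs

variable {V : Type*} [Fintype V]

/-- The set of pairs of distinct elements of `A`. -/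
noncomputable def prs (A : Finset V) : Finset (Sym2 V) := A.sym2.filter fun e => ¬ e.IsDiag

lemma mem_prs {A : Finset V} {e : Sym2 V} : e ∈ prs A ↔ (∀ v ∈ e, v ∈ A) ∧ ¬ e.IsDiag := by
  rw [prs, Finset.mem_filter, Finset.mem_sym2_iff]

lemma mk_mem_prs {A : Finset V} {x y : V} : s(x, y) ∈ prs A ↔ x ∈ A ∧ y ∈ A ∧ x ≠ y := by
  simp [mem_prs, and_assoc]

lemma card_prs (A : Finset V) : (prs A).card = A.card.choose 2 := by
  rw [← Sym2.card_image_offDiag]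
  congr 1
  ext e
  induction e with
  | h x y =>
    rw [mk_mem_prs]
    simp only [Finset.mem_image, Finset.mem_offDiag, Prod.exists, Function.uncurry_apply_pair, Sym2.eq_iff]
    constructor
    · rintro ⟨h1, h2, h3⟩; exact ⟨x, y, ⟨h1, h2, h3⟩, Or.inl ⟨rfl, rfl⟩⟩
    · rintro ⟨a, b, ⟨h1, h2, h3⟩, ⟨rfl, rfl⟩ | ⟨rfl, rfl⟩⟩
      · exact ⟨h1, h2, h3⟩
      · exact ⟨h2, h1, h3.symm⟩

lemma not_isDiag_of_mem_prs {A : Finset V} : ∀ e ∈ prs A, ¬ e.IsDiag := fun _ he => (mem_prs.1 he).2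

lemma prs_inter (A B : Finset V) : prs (A ∩ B) = prs A ∩ prs B := by
  ext e
  simp only [mem_prs, Finset.mem_inter]
  exact ⟨fun h => ⟨⟨fun v hv => (h.1 v hv).1, h.2⟩, fun v hv => (h.1 v hv).2, h.2⟩,
    fun h => ⟨fun v hv => ⟨h.1.1 v hv, h.2.1 v hv⟩, h.1.2⟩⟩

lemma prs_mono {A B : Finset V} (h : A ⊆ B) : prs A ⊆ prs B := fun e he => by
  rw [mem_prs] at he ⊢
  exact ⟨fun v hv => h (he.1 v hv), he.2⟩

lemma disjoint_prs {A B : Finset V} (h : Disjoint A B) : Disjoint (prs A) (prs B) := by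
  rw [Finset.disjoint_left]
  intro e
  induction e with
  | h x y =>
    rw [mk_mem_prs, mk_mem_prs]
    intro h1 h2
    exact Finset.disjoint_left.1 h h1.1 h2.1

/-- The set of edges of `G` inside `A`. -/
noncomputable def eF (G : SimpleGraph V) (A : Finset V) : Finset (Sym2 V) :=
  (prs A).filter fun e => e ∈ G.edgeSet

lemma mem_eF {G : SimpleGraph V} {A : Finset V} {e : Sym2 V} :
    e ∈ eF G A ↔ e ∈ prs A ∧ e ∈ G.edgeSet := by simp [eF]

lemma eF_mono (G : SimpleGraph V) {A B : Finset V} (h : A ⊆ B) : eF G A ⊆ eF G B := fun e he => by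
  rw [mem_eF] at he ⊢
  exact ⟨prs_mono h he.1, he.2⟩

lemma depOn_eF (A : Finset V) (p : Finset (Sym2 V) → Prop) :
    DepOn (fun G : SimpleGraph V => p (eF G A)) (prs A : Set (Sym2 V)) := by
  intro G G' h
  have : eF G A = eF G' A := by
    ext e
    induction e with
    | h x y =>
      rw [mem_eF, mem_eF]
      refine and_congr_right fun he => ?_
      exact h x y he
  show p _ ↔ p _
  rw [this]

lemma pr_eF_card_eq (A : Finset V) (t : ℕ) :
    pr V (fun G => (eF G A).card = t) =
      (A.card.choose 2).choose t * (1 / 2) ^ (A.card.choose 2) := by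
  have := pr_card_eq (prs A) not_isDiag_of_mem_prs t
  rwa [card_prs] at this

lemma pr_eF_card_le (A : Finset V) (t : ℕ) :
    pr V (fun G => (eF G A).card ≤ t) ≤
      ((A.card.choose 2 : ℕ) + 1) ^ t * (1 / 2) ^ (A.card.choose 2) := by
  have := pr_card_le (prs A) not_isDiag_of_mem_prs t
  rwa [card_prs] at this

end Pairs

section Cover

variable {V : Type*} [Fintype V]

/-- At most `a` vertices of `W` are adjacent to both ends of the pair `e`. -/
def Few (a : ℕ) (W : Finset V) (e : Sym2 V) (G : SimpleGraph V) : Prop :=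
  (W.filter fun w => ∀ v ∈ e, G.Adj v w).card ≤ a

/-- Some pair of `S` (two pairs of `S`, if `d` holds) has few common neighbours in `W`. -/
def FewPair (a : ℕ) (W S : Finset V) (d : Prop) (G : SimpleGraph V) : Prop :=
  ∃ e ∈ prs S, ∃ e' ∈ prs S, (d → e ≠ e') ∧ Few a W e G ∧ Few a W e' G

lemma depOn_fewPair (a : ℕ) (W S : Finset V) (d : Prop) :
    DepOn (FewPair a W S d) {f | ∃ v ∈ S, ∃ w ∈ W, f = s(v, w)} := by
  intro G G' h
  have key : ∀ e ∈ prs S, (Few a W e G ↔ Few a W e G') := by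
    intro e he
    unfold Few
    have : (W.filter fun w => ∀ v ∈ e, G.Adj v w) = W.filter fun w => ∀ v ∈ e, G'.Adj v w := by
      refine Finset.filter_congr fun w hw => ?_
      refine forall_congr' fun v => imp_congr_right fun hv => ?_
      exact h v w ⟨v, (mem_prs.1 he).1 v hv, w, hw, rfl⟩
    rw [this]
  constructor
  · rintro ⟨e, he, e', he', hd, h1, h2⟩
    exact ⟨e, he, e', he', hd, (key e he).1 h1, (key e' he').1 h2⟩
  · rintro ⟨e, he, e', he', hd, h1, h2⟩
    exact ⟨e, he, e', he', hd, (key e he).2 h1, (key e' he').2 h2⟩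

lemma pr_few_le_single {W S : Finset V} (hWS : Disjoint S W) {e : Sym2 V} (he : e ∈ prs S) (a : ℕ) :
    pr V (Few a W e) ≤ (W.card + 1) ^ a * (3 / 4) ^ (W.card - a) := by
  induction e with
  | h x y =>
    rw [mk_mem_prs] at he
    refine le_trans (le_of_eq ?_) (pr_common_le W (Finset.disjoint_left.1 hWS he.1)
      (Finset.disjoint_left.1 hWS he.2.1) he.2.2 a)
    refine pr_congr fun G => ?_
    simp [Few]

lemma pr_adj_and_adj_and_adj {x y z w : V} (hxw : x ≠ w) (hyw : y ≠ w) (hzw : z ≠ w) (hxy : x ≠ y)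
    (hxz : x ≠ z) (hyz : y ≠ z) :
    pr V (fun G => (G.Adj x w ∧ G.Adj y w) ∧ G.Adj z w) = 1 / 8 := by
  rw [pr_and_of_indep (Q := {s(x, w), s(y, w)}) (Q' := {s(z, w)})
    ((depOn_adj (by simp)).and (depOn_adj (by simp))) (depOn_adj (by simp)),
    pr_adj_and_adj hxw hyw hxy, pr_adj hzw]
  · norm_num
  · rw [Set.disjoint_singleton_right]
    simp only [Set.mem_insert_iff, Set.mem_singleton_iff, Sym2.eq_iff]
    rintro ((⟨h, -⟩ | ⟨-, h⟩) | (⟨h, -⟩ | ⟨-, h⟩))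
    · exact hxz h.symm
    · exact hxw h.symm
    · exact hyz h.symm
    · exact hyw h.symm

lemma pr_or_eq (Φ Ψ : SimpleGraph V → Prop) :
    pr V (fun G => Φ G ∨ Ψ G) = pr V Φ + pr V Ψ - pr V (fun G => Φ G ∧ Ψ G) := by
  unfold pr
  rw [← ex_add, ← ex_sub]
  congr 1
  ext G
  by_cases h1 : Φ G <;> by_cases h2 : Ψ G <;> simp [ind, h1, h2]

lemma pr_not_common_two {x y x' y' w : V} (hx : x ≠ w) (hy : y ≠ w) (hx' : x' ≠ w) (hy' : y' ≠ w)
    (hxy : x ≠ y) (hxy' : x' ≠ y') (hne : s(x, y) ≠ s(x', y')) :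
    pr V (fun G => ¬ ((∀ v ∈ s(x, y), G.Adj v w) ∨ ∀ v ∈ s(x', y'), G.Adj v w)) ≤ 5 / 8 := by
  rw [pr_not, pr_or_eq]
  have e1 : pr V (fun G => ∀ v ∈ s(x, y), G.Adj v w) = 1 / 4 := by
    rw [← pr_adj_and_adj hx hy hxy]; exact pr_congr fun G => by simp
  have e2 : pr V (fun G => ∀ v ∈ s(x', y'), G.Adj v w) = 1 / 4 := by
    rw [← pr_adj_and_adj hx' hy' hxy']; exact pr_congr fun G => by simp
  have e3 : pr V (fun G => (∀ v ∈ s(x, y), G.Adj v w) ∧ ∀ v ∈ s(x', y'), G.Adj v w) ≤ 1 / 8 := by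
    obtain ⟨z, hz, hzw, h1, h2⟩ : ∃ z ∈ s(x', y'), z ≠ w ∧ x ≠ z ∧ y ≠ z := by
      by_contra! hno
      refine hne ?_
      have h1 := hno x' (by simp) hx'
      have h2 := hno y' (by simp) hy'
      rw [Sym2.eq_iff]
      by_cases c1 : x = x'
      · refine Or.inl ⟨c1, h2 fun c => hxy' ?_⟩
        rw [← c1, ← c]
      · refine Or.inr ⟨?_, h1 c1⟩
        by_contra c
        exact hxy' ((h1 c1).symm.trans (h2 c))
    rw [← pr_adj_and_adj_and_adj hx hy hzw hxy h1 h2]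
    refine pr_mono fun G hG => ⟨⟨hG.1 x (by simp), hG.1 y (by simp)⟩, hG.2 z hz⟩
  rw [e1, e2]
  linarith

lemma pr_few_le_double {W S : Finset V} (hWS : Disjoint S W) {e e' : Sym2 V} (he : e ∈ prs S)
    (he' : e' ∈ prs S) (hne : e ≠ e') (a : ℕ) :
    pr V (fun G => Few a W e G ∧ Few a W e' G) ≤
      (W.card + 1) ^ (2 * a) * (5 / 8) ^ (W.card - 2 * a) := by
  obtain ⟨Φ, hΦ⟩ : ∃ Φ : V → SimpleGraph V → Prop, ∀ w G,
      Φ w G ↔ ((∀ v ∈ e, G.Adj v w) ∨ ∀ v ∈ e', G.Adj v w) := ⟨_, fun _ _ => Iff.rfl⟩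
  refine le_trans (pr_mono (Ψ := fun G => (W.filter fun w => Φ w G).card ≤ 2 * a) ?_) ?_
  · rintro G ⟨h1, h2⟩
    simp only [hΦ]
    rw [Finset.filter_or]
    refine (Finset.card_union_le _ _).trans ?_
    unfold Few at h1 h2
    omega
  · refine pr_few_le W Φ
      (fun w => {f | ∃ v ∈ S, f = s(v, w)}) ?_ ?_ (by norm_num) (by norm_num) ?_ (2 * a)
    · intro w hw G G' h
      have key : ∀ e ∈ prs S, (∀ v ∈ e, G.Adj v w) ↔ ∀ v ∈ e, G'.Adj v w := fun e he =>
        forall_congr' fun v => imp_congr_right fun hv => h v w ⟨v, (mem_prs.1 he).1 v hv, rfl⟩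
      rw [hΦ, hΦ]
      exact or_congr (key e he) (key e' he')
    · intro w hw w' hw' hww
      rw [Function.onFun, Set.disjoint_left]
      rintro f ⟨v, hv, rfl⟩ ⟨v', hv', h⟩
      rw [Sym2.eq_iff] at h
      rcases h with ⟨-, h⟩ | ⟨h, -⟩
      · exact hww h
      · exact Finset.disjoint_left.1 hWS hv (h ▸ hw')
    · intro w hw
      have hS : ∀ v ∈ S, v ≠ w := fun v hv h => Finset.disjoint_left.1 hWS hv (h ▸ hw)
      simp only [hΦ]
      induction e with
      | h x y =>
        induction e' with
        | h x' y' =>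
          rw [mk_mem_prs] at he he'
          exact pr_not_common_two (hS _ he.1) (hS _ he.2.1) (hS _ he'.1) (hS _ he'.2.1) he.2.2
            he'.2.2 hne

lemma rpow_three_quarters_le (m : ℕ) : (3 / 4 : ℝ) ^ m ≤ 2 ^ (-(2 / 5 * (m : ℝ))) := by
  have h : (3 / 4 : ℝ) ≤ 2 ^ (-(2 / 5) : ℝ) := by
    refine le_of_pow_le_pow_left₀ (n := 5) (by norm_num) (by positivity) ?_
    rw [← Real.rpow_natCast (2 ^ _), ← Real.rpow_mul (by norm_num)]
    norm_num
  calc (3 / 4 : ℝ) ^ m ≤ (2 ^ (-(2 / 5) : ℝ)) ^ m := by gcongr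
    _ = _ := by rw [← Real.rpow_natCast, ← Real.rpow_mul (by norm_num)]; ring_nf

lemma rpow_five_eighths_le (m : ℕ) : (5 / 8 : ℝ) ^ m ≤ 2 ^ (-(3 / 5 * (m : ℝ))) := by
  have h : (5 / 8 : ℝ) ≤ 2 ^ (-(3 / 5) : ℝ) := by
    refine le_of_pow_le_pow_left₀ (n := 5) (by norm_num) (by positivity) ?_
    rw [← Real.rpow_natCast (2 ^ _), ← Real.rpow_mul (by norm_num)]
    norm_num
  calc (5 / 8 : ℝ) ^ m ≤ (2 ^ (-(3 / 5) : ℝ)) ^ m := by gcongr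
    _ = _ := by rw [← Real.rpow_natCast, ← Real.rpow_mul (by norm_num)]; ring_nf

lemma pr_fewPair_le {W S : Finset V} (hWS : Disjoint S W) (a : ℕ) (d : Prop) {m b : ℕ}
    (hW : W.card + 1 ≤ m) (hS : S.card ≤ m) (hb : b + 2 * a ≤ W.card) :
    pr V (FewPair a W S d) ≤ (m : ℝ) ^ (4 + 2 * a) *
      2 ^ (-((if d then 3 / 5 else 2 / 5) * (b : ℝ))) := by
  have hm : 1 ≤ (m : ℝ) := by exact_mod_cast (by omega : 1 ≤ m)
  have hWm : (W.card : ℝ) + 1 ≤ m := by exact_mod_cast hW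
  have hp : ∀ e ∈ prs S ×ˢ prs S, pr V (fun G => (d → e.1 ≠ e.2) ∧ Few a W e.1 G ∧ Few a W e.2 G) ≤
      (m : ℝ) ^ (2 * a) * 2 ^ (-((if d then 3 / 5 else 2 / 5) * (b : ℝ))) := by
    rintro ⟨e, e'⟩ he
    rw [Finset.mem_product] at he
    have hb2 : (b : ℝ) ≤ ((W.card - 2 * a : ℕ) : ℝ) := by exact_mod_cast (by omega)
    have hb1 : (b : ℝ) ≤ ((W.card - a : ℕ) : ℝ) := by exact_mod_cast (by omega)
    by_cases hd : d
    · by_cases hne : e = e'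
      · rw [pr_congr (Ψ := fun _ => False) fun G => by simp [hd, hne], pr_false]
        positivity
      · refine (pr_mono fun G hG => hG.2).trans ((pr_few_le_double hWS he.1 he.2 hne a).trans ?_)
        rw [if_pos hd]
        refine mul_le_mul (by gcongr) ((rpow_five_eighths_le _).trans ?_) (by positivity)
          (by positivity)
        exact Real.rpow_le_rpow_of_exponent_le (by norm_num) (by linarith)
    · refine (pr_mono fun G hG => hG.2.1).trans ((pr_few_le_single hWS he.1 a).trans ?_)
      rw [if_neg hd]
      refine mul_le_mul ?_ ((rpow_three_quarters_le _).trans ?_) (by positivity) (by positivity)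
      · calc ((W.card : ℝ) + 1) ^ a ≤ (m : ℝ) ^ a := by gcongr
          _ ≤ (m : ℝ) ^ (2 * a) := pow_le_pow_right₀ hm (by omega)
      · exact Real.rpow_le_rpow_of_exponent_le (by norm_num) (by linarith)
  have h1 := pr_exists_le_card (prs S ×ˢ prs S) _ _ hp
  have h2 : (((prs S ×ˢ prs S).card : ℕ) : ℝ) ≤ (m : ℝ) ^ 4 := by
    rw [Finset.card_product, card_prs]
    have : S.card.choose 2 ≤ m ^ 2 := (Nat.choose_le_pow _ _).trans (Nat.pow_le_pow_left hS 2)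
    have h3 := Nat.mul_le_mul this this
    have : S.card.choose 2 * S.card.choose 2 ≤ m ^ 4 := by
      calc _ ≤ _ := h3
        _ = _ := by ring
    exact_mod_cast this
  refine (pr_mono fun G hG => ?_).trans (h1.trans ?_)
  · obtain ⟨e, he, e', he', h⟩ := hG
    exact ⟨(e, e'), Finset.mem_product.2 ⟨he, he'⟩, h⟩
  · rw [pow_add, mul_assoc]
    exact mul_le_mul_of_nonneg_right h2 (by positivity)

end Cover

section Deterministic

variable {V : Type*} [Fintype V]

lemma mu_xi {r j : ℕ} (h1 : 1 ≤ j) (hj : j ≤ r) :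
    r + xiD r j = j * (muD r j + 2) ∧ 1 ≤ xiD r j ∧ xiD r j ≤ j ∧ muD r j ≤ r := by
  have e1 := Nat.div_add_mod (r - j) j
  have e2 := Nat.mod_lt (r - j) h1
  have e3 : muD r j = (r - j) / j := rfl
  have e4 : xiD r j = j * (muD r j + 2) - r := rfl
  have e5 : j * (muD r j + 2) = j * muD r j + 2 * j := by ring
  rw [← e3] at e1
  refine ⟨by omega, by omega, by omega, ?_⟩
  rw [e3]
  exact (Nat.div_le_self _ _).trans (Nat.sub_le _ _)

/-- A part of size `k + 1 - τ` together with disjoint parts of size `k + 1`, all nearly independent,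
so that too many pairs inside the latter have few common neighbours in the former. -/
def BadTuple (r k T a : ℕ) (G : SimpleGraph V) : Prop :=
  ∃ Z D : Finset (Fin r), ∃ τ : ℕ, D ⊆ Z ∧ τ ≤ r ∧ 5 * τ < 4 * (Z \ D).card + 6 * D.card ∧
    ∃ W : Finset V, W.card = k + 1 - τ ∧ ∃ S : Z → Finset V, (∀ i, (S i).card = k + 1) ∧
      (∀ i i', i ≠ i' → Disjoint (S i) (S i')) ∧ (∀ i, Disjoint (S i) W) ∧
      (eF G W).card ≤ T ∧ ∀ i, (eF G (S i)).card ≤ T ∧ FewPair a W (S i) (i.1 ∈ D) G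

lemma arith_part {a c t : ℕ} (h : 4 * a + 6 * c ≤ 5 * t) :
    a + 2 * c + (if t = 0 then 0 else 1) ≤ 2 * t ∧ c + (if t = 0 then 0 else 1) ≤ t := by
  split_ifs <;> omega

theorem no_large_partite {r j k T a : ℕ} (h1 : 1 ≤ j) (hj : j ≤ r) {G : SimpleGraph V}
    (P : Fin r → Finset V) (hdis : ∀ l l', l ≠ l' → Disjoint (P l) (P l'))
    (hcard : ∑ l, (P l).card = k * r + j) (hT : ∀ l, (eF G (P l)).card ≤ T)
    (hcov : ∀ l, ∀ e ∈ eF G (P l), ∃ l', l' ≠ l ∧ Few a (P l') e G)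
    (hG1 : ∀ A : Finset V, A.card = k + 2 → T < (eF G A).card)
    (hG2 : ∀ A : Finset V, A.card = k + 1 → muD r j ≤ (eF G A).card)
    (hG3 : ¬ BadTuple r k T a G) :
    xiD r j ≤ ((Finset.univ.powersetCard (k + 1)).filter
      fun A : Finset V => (eF G A).card = muD r j).card := by
  by_contra! hB
  obtain ⟨m1, m2, m3, m4⟩ := mu_xi h1 hj
  set μ := muD r j with hμ
  set ξ := xiD r j with hξ
  have hle : ∀ l, (P l).card ≤ k + 1 := by
    intro l
    by_contra! hlt
    obtain ⟨A, hA, hAc⟩ := Finset.exists_subset_card_eq (show k + 2 ≤ (P l).card by omega)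
    have := hG1 A hAc
    have := Finset.card_le_card (eF_mono G hA)
    have := hT l
    omega
  obtain ⟨τ, hτ⟩ : ∃ τ : Fin r → ℕ, ∀ l, (P l).card + τ l = k + 1 :=
    ⟨fun l => k + 1 - (P l).card, fun l => Nat.add_sub_cancel' (hle l)⟩
  have hτs : ∑ l, τ l + j = r := by
    have : ∑ l, ((P l).card + τ l) = r * (k + 1) := by simp [hτ]
    rw [Finset.sum_add_distrib, hcard] at this
    have e : r * (k + 1) = k * r + r := by ring
    omega
  have hτr : ∀ l, τ l ≤ r := fun l => by
    have := Finset.single_le_sum (f := τ) (fun _ _ => Nat.zero_le _) (Finset.mem_univ l)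
    omega
  have hg : ∀ l e, ∃ l', e ∈ eF G (P l) → l' ≠ l ∧ Few a (P l') e G := by
    intro l e
    by_cases he : e ∈ eF G (P l)
    · obtain ⟨l', h⟩ := hcov l e he
      exact ⟨l', fun _ => h⟩
    · exact ⟨l, fun h => absurd h he⟩
  choose g hg using hg
  obtain ⟨I, hI⟩ : ∃ I : Finset (Fin r), ∀ l, l ∈ I ↔ τ l = 0 :=
    ⟨Finset.univ.filter fun l => τ l = 0, by simp⟩
  have hIc : ∀ l ∈ I, (P l).card = k + 1 := fun l hl => by
    have := hτ l
    rw [hI] at hl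
    omega
  obtain ⟨R, hR⟩ : ∃ R : Finset (Fin r), ∀ i, i ∈ R ↔ i ∈ I ∧
      ∃ l, ∃ e ∈ eF G (P i), ∃ e' ∈ eF G (P i), e ≠ e' ∧ g i e = l ∧ g i e' = l :=
    ⟨I.filter fun i => ∃ l, ∃ e ∈ eF G (P i), ∃ e' ∈ eF G (P i), e ≠ e' ∧ g i e = l ∧ g i e' = l,
      by simp⟩
  have hRI : R ⊆ I := fun i hi => ((hR i).1 hi).1
  have hd : ∀ i, ∃ l, i ∈ R → ∃ e ∈ eF G (P i), ∃ e' ∈ eF G (P i), e ≠ e' ∧ g i e = l ∧ g i e' = l := by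
    intro i
    by_cases hi : i ∈ R
    · obtain ⟨-, l, h⟩ := (hR i).1 hi
      exact ⟨l, fun _ => h⟩
    · exact ⟨i, fun h => absurd h hi⟩
  choose d hd using hd
  obtain ⟨D, hD⟩ : ∃ D : Fin r → Finset (Fin r), ∀ l i, i ∈ D l ↔ i ∈ R ∧ d i = l :=
    ⟨fun l => R.filter fun i => d i = l, by simp⟩
  obtain ⟨A, hA⟩ : ∃ A : Fin r → Finset (Fin r), ∀ l i, i ∈ A l ↔ i ∈ I \ R ∧
      ∃ e ∈ eF G (P i), g i e = l :=
    ⟨fun l => (I \ R).filter fun i => ∃ e ∈ eF G (P i), g i e = l, fun l i => Finset.mem_filter⟩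
  have hAD : ∀ l, Disjoint (A l) (D l) := fun l => by
    rw [Finset.disjoint_left]
    intro i h1 h2
    rw [hA, Finset.mem_sdiff] at h1
    exact h1.1.2 ((hD l i).1 h2).1
  have key : ∀ l, 4 * (A l).card + 6 * (D l).card ≤ 5 * τ l := by
    intro l
    by_contra! hlt
    have hmem : ∀ i ∈ A l ∪ D l, i ∈ I ∧ i ≠ l ∧ FewPair a (P l) (P i) (i ∈ D l) G := by
      intro i hi
      rw [Finset.mem_union] at hi
      rcases hi with hi | hi
      · have hi' := (hA l i).1 hi
        obtain ⟨hIR, e, he, hge⟩ := hi'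
        obtain ⟨h1, h2⟩ := hg i e he
        rw [hge] at h1 h2
        exact ⟨(Finset.mem_sdiff.1 hIR).1, h1.symm, e, (mem_eF.1 he).1, e, (mem_eF.1 he).1,
          fun h => absurd h (Finset.disjoint_left.1 (hAD l) hi), h2, h2⟩
      · obtain ⟨hiR, hdi⟩ := (hD l i).1 hi
        obtain ⟨e, he, e', he', hne, h1, h2⟩ := hd i hiR
        have c1 := hg i e he
        have c2 := hg i e' he'
        rw [h1, hdi] at c1
        rw [h2, hdi] at c2
        exact ⟨hRI hiR, c1.1.symm, e, (mem_eF.1 he).1, e', (mem_eF.1 he').1, fun _ => hne, c1.2, c2.2⟩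
    refine hG3 ⟨A l ∪ D l, D l, τ l, Finset.subset_union_right, hτr l, ?_, P l, ?_,
      fun i => P i.1, ?_, ?_, ?_, hT l, ?_⟩
    · rw [Finset.union_sdiff_cancel_right (hAD l)]
      exact hlt
    · have := hτ l
      omega
    · exact fun i => hIc _ (hmem i.1 i.2).1
    · exact fun i i' hii => hdis _ _ fun h => hii (Subtype.ext h)
    · exact fun i => hdis _ _ (hmem i.1 i.2).2.1
    · exact fun i => ⟨hT _, (hmem i.1 i.2).2.2⟩
  have hsumD : ∑ l, (D l).card = R.card := by
    rw [Finset.card_eq_sum_card_fiberwise (f := d) (t := Finset.univ) (fun _ _ => by simp)]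
    refine Finset.sum_congr rfl fun l _ => ?_
    congr 1
    ext i
    rw [hD, Finset.mem_filter]
  have hsumA : ∑ l, (A l).card = ∑ i ∈ I \ R, (eF G (P i)).card := by
    have e1 : ∀ i ∈ I \ R, (eF G (P i)).card = ((eF G (P i)).image (g i)).card := by
      intro i hi
      rw [Finset.card_image_of_injOn]
      intro e he e' he' hee
      by_contra hne
      rw [Finset.mem_sdiff] at hi
      exact hi.2 ((hR i).2 ⟨hi.1, g i e, e, he, e', he', hne, rfl, hee.symm⟩)
    rw [Finset.sum_congr rfl e1]
    simp only [Finset.card_eq_sum_ones]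
    refine Finset.sum_comm' fun l i => ?_
    rw [hA, Finset.mem_image]
    simp [and_comm]
  have hlow : (I \ R).card * (μ + 1) < ∑ i ∈ I \ R, (eF G (P i)).card + ξ := by
    have e1 : ((I \ R).filter fun i => (eF G (P i)).card = μ).card < ξ := by
      refine lt_of_le_of_lt ?_ hB
      refine Finset.card_le_card_of_injOn P ?_ ?_
      · intro i hi
        have hi := Finset.mem_filter.1 hi
        simp only [Finset.coe_filter, Finset.mem_powersetCard_univ, Set.mem_ofPred_eq]
        exact ⟨hIc i (Finset.mem_sdiff.1 hi.1).1, hi.2⟩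
      · intro i hi i' hi' hii
        by_contra hne
        have hi := Finset.mem_filter.1 hi
        have h3 := hdis i i' hne
        rw [← hii, disjoint_self, Finset.bot_eq_empty] at h3
        have := hIc i (Finset.mem_sdiff.1 hi.1).1
        rw [h3] at this
        simp at this
    have e2 : ∑ i ∈ I \ R, (μ + 1) ≤ ∑ i ∈ I \ R, ((eF G (P i)).card +
        if (eF G (P i)).card = μ then 1 else 0) := by
      refine Finset.sum_le_sum fun i hi => ?_
      have := hG2 (P i) (hIc i (Finset.mem_sdiff.1 hi).1)
      split_ifs <;> omega
    rw [Finset.sum_const, smul_eq_mul, Finset.sum_add_distrib, ← Finset.card_filter] at e2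
    omega
  have hσ : ∑ l, (if τ l = 0 then 0 else 1) + I.card = r := by
    have : I = Finset.univ.filter fun l => τ l = 0 := by ext l; simp [hI]
    rw [this, Finset.card_filter, ← Finset.sum_add_distrib]
    rw [Finset.sum_congr rfl (g := fun _ => 1) fun l _ => by split_ifs <;> rfl]
    simp
  have s1 : ∑ l, ((A l).card + 2 * (D l).card + if τ l = 0 then 0 else 1) ≤ ∑ l, 2 * τ l :=
    Finset.sum_le_sum fun l _ => (arith_part (key l)).1
  have s2 : ∑ l, ((D l).card + if τ l = 0 then 0 else 1) ≤ ∑ l, τ l :=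
    Finset.sum_le_sum fun l _ => (arith_part (key l)).2
  rw [Finset.sum_add_distrib, Finset.sum_add_distrib, ← Finset.mul_sum, ← Finset.mul_sum, hsumD]
    at s1
  rw [Finset.sum_add_distrib, hsumD] at s2
  rw [← hsumA] at hlow
  have hIR : (I \ R).card + R.card = I.card := Finset.card_sdiff_add_card_eq_card hRI
  obtain ⟨x, hx⟩ : ∃ x, (I \ R).card = j + x := ⟨(I \ R).card - j, by omega⟩
  rw [hx] at hlow
  have e1 : (j + x) * (μ + 1) = j * (μ + 2) - j + x * (μ + 1) := by
    have : j * (μ + 2) = j * (μ + 1) + j := by ring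
    rw [this, Nat.add_sub_cancel]; ring
  have e2 : x ≤ x * (μ + 1) := Nat.le_mul_of_pos_right _ (by omega)
  have e3 : j ≤ j * (μ + 2) := Nat.le_mul_of_pos_right _ (by omega)
  omega

end Deterministic

/-- The expected number of independent sets of size `m` in the random graph on `n` vertices. -/
noncomputable def eInd (n m : ℕ) : ℝ := (n.choose m : ℝ) * (1 / 2) ^ (m.choose 2)

lemma eInd_nonneg (n m : ℕ) : 0 ≤ eInd n m := by unfold eInd; positivity

/-- The number of vertices is in the range where `k`-sets are about to become independent. -/
structure Win (k r L n : ℕ) : Prop extends Scale k r L where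
  hc : eInd n (k + 1) ≤ k
  hlo : (2 : ℝ) ^ ((k : ℝ) / 2) ≤ n
  hup : (n : ℝ) ≤ 2 ^ ((k : ℝ) / 2 + 2 * L)

namespace Scale

variable {k r L : ℕ} (h : Scale k r L)
include h

lemma k_le : (k : ℝ) ≤ 2 ^ (L : ℝ) := by
  rw [Real.rpow_natCast]
  exact_mod_cast h.hk.le

lemma k_big : (10 : ℝ) ^ 60 ≤ k ∧ (L : ℝ) ^ 10 ≤ k ∧ 10 ^ 12 * (L : ℝ) ^ 2 ≤ k := by
  have hL := h.L_ge
  have h10 := h.pow_le (m := 10) (by omega)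
  refine ⟨le_trans ?_ h10, h10, le_trans ?_ h10⟩
  · calc (10 : ℝ) ^ 60 = (10 ^ 6) ^ 10 := by norm_num
      _ ≤ (L : ℝ) ^ 10 := pow_le_pow_left₀ (by norm_num) hL 10
  · calc 10 ^ 12 * (L : ℝ) ^ 2 ≤ (10 ^ 6) ^ 8 * (L : ℝ) ^ 2 := by
          refine mul_le_mul_of_nonneg_right (by norm_num) (by positivity)
      _ ≤ (L : ℝ) ^ 8 * (L : ℝ) ^ 2 :=
          mul_le_mul_of_nonneg_right (pow_le_pow_left₀ (by norm_num) hL 8) (by positivity)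
      _ = (L : ℝ) ^ 10 := by ring

lemma r_lt_k : 10 * r < k := by
  have h1 := h.k_big.2.2
  have h2 := h.r_le
  have h3 := h.L_ge
  have : ((10 * r : ℕ) : ℝ) < k := by
    push_cast
    nlinarith
  exact_mod_cast this

end Scale

lemma eInd_step {n m : ℕ} (hm : 2 * m ≤ n) (hn : 0 < n) :
    eInd n m ≤ eInd n (m + 1) * (2 * ((m : ℝ) + 1) * 2 ^ m / n) := by
  have h1 := Nat.choose_succ_right_eq n m
  have h1' : (n.choose (m + 1) : ℝ) * (m + 1) = n.choose m * (n - m) := by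
    have h2 : ((n - m : ℕ) : ℝ) = n - m := by rw [Nat.cast_sub (by omega)]
    rw [← h2]; exact_mod_cast h1
  have h3 : (m + 1).choose 2 = m + m.choose 2 := by
    rw [Nat.choose_succ_succ' m 1, Nat.choose_one_right]
  have hn' : (0 : ℝ) < n := by exact_mod_cast hn
  have hm' : 2 * (m : ℝ) ≤ n := by exact_mod_cast hm
  unfold eInd
  rw [h3, pow_add, mul_div_assoc', le_div_iff₀ hn']
  have h4 : (1 / 2 : ℝ) ^ m * 2 ^ m = 1 := by rw [← mul_pow]; norm_num
  calc (n.choose m : ℝ) * (1 / 2) ^ m.choose 2 * n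
      ≤ (n.choose m : ℝ) * (1 / 2) ^ m.choose 2 * (2 * (n - m)) := by
        refine mul_le_mul_of_nonneg_left (by linarith) (by positivity)
    _ = 2 * (n.choose m * (n - m)) * (1 / 2) ^ m.choose 2 * ((1 / 2 : ℝ) ^ m * 2 ^ m) := by
        rw [h4]; ring
    _ = _ := by rw [← h1']; ring

namespace Win

variable {k r L n : ℕ} (h : Win k r L n)
include h

lemma n_big : 10 * k ≤ n := by
  have hL := h.L_ge
  have hkb := h.k_big.2.2
  have hk := h.k_le
  have : ((10 * k : ℕ) : ℝ) ≤ n := by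
    refine le_trans ?_ h.hlo
    push_cast
    calc 10 * (k : ℝ) ≤ 2 ^ (4 : ℝ) * 2 ^ (L : ℝ) := by
          refine mul_le_mul (by norm_num) hk (by positivity) (by positivity)
      _ = 2 ^ (4 + (L : ℝ)) := by rw [Real.rpow_add (by norm_num)]
      _ ≤ _ := Real.rpow_le_rpow_of_exponent_le (by norm_num) (by nlinarith)
  exact_mod_cast this

lemma eInd_le (τ : ℕ) (hτ : τ ≤ k) :
    eInd n (k + 1 - τ) ≤ 2 ^ (L + τ * ((k : ℝ) / 2 + 2 * L)) := by
  have hL := h.L_ge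
  have hn := h.n_big
  have hkb := h.k_big.1
  have hk0 : 0 < k := by
    have : (0 : ℝ) < k := by linarith [show (0 : ℝ) < 10 ^ 60 by norm_num]
    exact_mod_cast this
  induction τ with
  | zero =>
    simp only [Nat.sub_zero, Nat.cast_zero, zero_mul, add_zero]
    exact h.hc.trans h.k_le
  | succ τ ih =>
    obtain ⟨m, hm⟩ : ∃ m, k + 1 - τ = m + 1 := ⟨k - τ, by omega⟩
    have hm' : k + 1 - (τ + 1) = m := by omega
    have hmk : m ≤ k := by omega
    specialize ih (by omega)
    rw [hm'] at *
    rw [hm] at ih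
    have hmk' : (m : ℝ) ≤ k := by exact_mod_cast hmk
    have hn0 : (0 : ℝ) < n := by exact_mod_cast (show 0 < n by omega)
    refine (eInd_step (by omega) (by omega)).trans ?_
    have e1 : 2 * ((m : ℝ) + 1) * 2 ^ m / n ≤ 2 ^ ((k : ℝ) / 2 + 2 * L) := by
      rw [div_le_iff₀ hn0]
      calc 2 * ((m : ℝ) + 1) * 2 ^ m ≤ 2 ^ (2 * L : ℝ) * 2 ^ (k : ℝ) := by
            rw [← Real.rpow_natCast 2 m]
            refine mul_le_mul ?_ (Real.rpow_le_rpow_of_exponent_le (by norm_num) hmk')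
              (by positivity) (by positivity)
            calc 2 * ((m : ℝ) + 1) ≤ 2 ^ (2 : ℝ) * 2 ^ (L : ℝ) := by
                  have := h.k_le
                  norm_num
                  norm_num at this
                  linarith
              _ = 2 ^ (2 + L : ℝ) := by rw [Real.rpow_add (by norm_num)]
              _ ≤ _ := Real.rpow_le_rpow_of_exponent_le (by norm_num) (by linarith)
        _ = 2 ^ ((k : ℝ) / 2 + 2 * L) * 2 ^ ((k : ℝ) / 2) := by
            rw [← Real.rpow_add (by norm_num), ← Real.rpow_add (by norm_num)]; ring_nf
        _ ≤ _ := mul_le_mul_of_nonneg_left h.hlo (by positivity)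
    calc eInd n (m + 1) * (2 * ((m : ℝ) + 1) * 2 ^ m / n)
        ≤ 2 ^ (L + τ * ((k : ℝ) / 2 + 2 * L)) * 2 ^ ((k : ℝ) / 2 + 2 * L) :=
          mul_le_mul ih e1 (by positivity) (by positivity)
      _ = _ := by rw [← Real.rpow_add (by norm_num)]; push_cast; ring_nf

end Win

section Bad

variable {V : Type*} [Fintype V] {k r L : ℕ}

lemma pr_eF_le_scale (h : Scale k r L) {A : Finset V} (hA : A.card ≤ k + 2) (T : ℕ) :
    pr V (fun G => (eF G A).card ≤ T) ≤ 2 ^ (2 * L * T : ℝ) * (1 / 2) ^ (A.card.choose 2) := by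
  refine (pr_eF_card_le A T).trans ?_
  refine mul_le_mul_of_nonneg_right ?_ (by positivity)
  have h1 : ((A.card.choose 2 : ℕ) : ℝ) + 1 ≤ 2 ^ (2 * L : ℝ) := by
    have h2 : A.card.choose 2 ≤ (k + 2).choose 2 := Nat.choose_le_choose 2 hA
    have h3 : (((k + 2).choose 2 : ℕ) : ℝ) = (k + 2) * (k + 2 - 1) / 2 := by
      rw [Nat.cast_choose_two]; push_cast; ring
    have h4 : ((A.card.choose 2 : ℕ) : ℝ) ≤ ((k + 2).choose 2 : ℕ) := by exact_mod_cast h2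
    have h5 := h.k_le
    have h6 := h.k_big.1
    have h7 : (2 : ℝ) ^ (2 * L : ℝ) = 2 ^ (L : ℝ) * 2 ^ (L : ℝ) := by
      rw [← Real.rpow_add (by norm_num)]; ring_nf
    have h8 : (k : ℝ) * k ≤ 2 ^ (L : ℝ) * 2 ^ (L : ℝ) := mul_le_mul h5 h5 (by positivity) (by positivity)
    rw [h7]
    rw [h3] at h4
    have h9 : (10 : ℝ) ≤ k := le_trans (by norm_num) h6
    nlinarith
  calc (((A.card.choose 2 : ℕ) : ℝ) + 1) ^ T ≤ (2 ^ (2 * L : ℝ)) ^ T :=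
        pow_le_pow_left₀ (by positivity) h1 T
    _ = _ := by rw [← Real.rpow_natCast, ← Real.rpow_mul (by norm_num)]

/-- The bad tuples with a given shape. -/
def BadShape (k T a : ℕ) (Z D : Finset (Fin r)) (τ : ℕ) (W : Finset V) (S : Z → Finset V)
    (G : SimpleGraph V) : Prop :=
  (eF G W).card ≤ T ∧ ∀ i ∈ (Finset.univ : Finset Z),
    ((eF G (S i)).card ≤ T ∧ FewPair a W (S i) (i.1 ∈ D) G)

lemma pr_badShape_le (h : Scale k r L) {T a : ℕ} (Z D : Finset (Fin r)) {τ b : ℕ}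
    {W : Finset V} {S : Z → Finset V} (hW : W.card = k + 1 - τ) (hS : ∀ i, (S i).card = k + 1)
    (hdis : ∀ i i', i ≠ i' → Disjoint (S i) (S i')) (hSW : ∀ i, Disjoint (S i) W)
    (hb : b + 2 * a ≤ k + 1 - τ) :
    pr V (BadShape k T a Z D τ W S) ≤ 2 ^ (2 * L * T : ℝ) * (1 / 2) ^ ((k + 1 - τ).choose 2) *
      ∏ i : Z, ((1 / 2) ^ ((k + 1).choose 2) * 2 ^ (2 * L * T + 2 * L * (4 + 2 * a) -
        (if i.1 ∈ D then 3 / 5 else 2 / 5) * b : ℝ)) := by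
  have hcross : ∀ i, Disjoint (prs (S i) : Set (Sym2 V)) {f | ∃ v ∈ S i, ∃ w ∈ W, f = s(v, w)} := by
    intro i
    rw [Set.disjoint_left]
    rintro e he ⟨v, hv, w, hw, rfl⟩
    rw [Finset.mem_coe, mk_mem_prs] at he
    exact Finset.disjoint_left.1 (hSW i) he.2.1 hw
  have hdep : ∀ i, DepOn (fun G : SimpleGraph V => (eF G (S i)).card ≤ T ∧ FewPair a W (S i) (i.1 ∈ D) G)
      ((prs (S i) : Set (Sym2 V)) ∪ {f | ∃ v ∈ S i, ∃ w ∈ W, f = s(v, w)}) := fun i =>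
    ((depOn_eF (S i) fun p => p.card ≤ T).mono Set.subset_union_left).and
      ((depOn_fewPair a W (S i) _).mono Set.subset_union_right)
  unfold BadShape
  rw [pr_and_of_indep (Q := (prs W : Set (Sym2 V))) (Q' := {e | ¬ ∀ v ∈ e, v ∈ W})
    (depOn_eF W fun p => p.card ≤ T)]
  · refine mul_le_mul ?_ ?_ (pr_nonneg _) (by positivity)
    · have := pr_eF_le_scale h (A := W) (by omega) T
      rwa [hW] at this
    · rw [pr_forall_of_indep _ _ _ (fun i _ => hdep i)]
      · refine Finset.prod_le_prod (fun i _ => pr_nonneg _) fun i _ => ?_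
        rw [pr_and_of_indep (depOn_eF (S i) fun p => p.card ≤ T) (depOn_fewPair a W (S i) _) (hcross i)]
        have e1 := pr_eF_le_scale h (A := S i) (by rw [hS i]; omega) T
        rw [hS i] at e1
        have e2 : pr V (FewPair a W (S i) (i.1 ∈ D)) ≤ ((k + 2 : ℕ) : ℝ) ^ (4 + 2 * a) *
            2 ^ (-((if i.1 ∈ D then 3 / 5 else 2 / 5) * (b : ℝ))) := by
          convert pr_fewPair_le (hSW i) a (i.1 ∈ D) (m := k + 2) (b := b) (by omega)
            (by rw [hS i]; omega) (by omega)
        have e3 : ((k + 2 : ℕ) : ℝ) ^ (4 + 2 * a) ≤ 2 ^ (2 * L * (4 + 2 * a) : ℝ) := by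
          have h1 : ((k + 2 : ℕ) : ℝ) ≤ 2 ^ (2 * L : ℝ) := by
            have h2 := h.k_le
            have h3 := h.k_big.1
            have h4 : (2 : ℝ) ^ (2 * L : ℝ) = 2 ^ (L : ℝ) * 2 ^ (L : ℝ) := by
              rw [← Real.rpow_add (by norm_num)]; ring_nf
            have h9 : (10 : ℝ) ≤ k := le_trans (by norm_num) h3
            rw [h4]; push_cast; nlinarith
          calc ((k + 2 : ℕ) : ℝ) ^ (4 + 2 * a) ≤ (2 ^ (2 * L : ℝ)) ^ (4 + 2 * a) :=
                pow_le_pow_left₀ (by positivity) h1 _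
            _ = _ := by rw [← Real.rpow_natCast, ← Real.rpow_mul (by norm_num)]; push_cast; ring_nf
        calc _ ≤ (2 ^ (2 * L * T : ℝ) * (1 / 2) ^ ((k + 1).choose 2)) *
              (2 ^ (2 * L * (4 + 2 * a) : ℝ) *
                2 ^ (-((if i.1 ∈ D then 3 / 5 else 2 / 5) * (b : ℝ)))) :=
              mul_le_mul e1 (e2.trans (mul_le_mul_of_nonneg_right e3 (Real.rpow_nonneg (zero_le_two) _)))
                (pr_nonneg _) (by positivity)
          _ = _ := by
              rw [sub_eq_add_neg, Real.rpow_add (by norm_num), Real.rpow_add (by norm_num)]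
              ring
      · intro i _ i' _ hii
        have d1 := hdis i i' hii
        rw [Function.onFun, Set.disjoint_left]
        rintro e (he | ⟨v, hv, w, hw, rfl⟩) (he' | ⟨v', hv', w', hw', h'⟩)
        · exact Finset.disjoint_left.1 (disjoint_prs d1) he he'
        · subst h'
          rw [Finset.mem_coe, mk_mem_prs] at he
          exact Finset.disjoint_left.1 (hSW i) he.2.1 hw'
        · rw [Finset.mem_coe, mk_mem_prs] at he'
          exact Finset.disjoint_left.1 (hSW i') he'.2.1 hw
        · rw [Sym2.eq_iff] at h'
          rcases h' with ⟨rfl, rfl⟩ | ⟨rfl, rfl⟩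
          · exact Finset.disjoint_left.1 d1 hv hv'
          · exact Finset.disjoint_left.1 (hSW i) hv hw'
  · refine DepOn.forall fun i => DepOn.forall fun _ => (hdep i).mono ?_
    rintro e (he | ⟨v, hv, w, hw, rfl⟩) hall
    · induction e with
      | h x y =>
        rw [Finset.mem_coe, mk_mem_prs] at he
        exact Finset.disjoint_left.1 (hSW i) he.1 (hall x (by simp))
    · exact Finset.disjoint_left.1 (hSW i) hv (hall v (by simp))
  · rw [Set.disjoint_left]
    intro e he hall
    exact hall (mem_prs.1 he).1

end Bad

lemma Scale.overhead {k r L : ℕ} (h : Scale k r L) :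
    (L : ℝ) + 2 * L * r + (r + 1) * (L + 2 * L * (200 * (r * L) * (k / L ^ 10 : ℕ) : ℕ) +
      2 * L * (4 + 2 * (k / L ^ 10 : ℕ))) + (r + 2 * (k / L ^ 10 : ℕ)) * (r + 1) + 4 * r ≤ k / 40 := by
  have hL := h.L_ge
  have hr := h.r_ge
  have hrL := h.r_le
  have hal := h.a_le
  obtain ⟨h1, h2, h3⟩ := h.k_big
  set a : ℝ := ((k / L ^ 10 : ℕ) : ℝ) with ha
  have ha0 : 0 ≤ a := by positivity
  have hL0 : (0 : ℝ) < L := by linarith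
  push_cast
  rw [← ha]
  have e1 : a * L ^ 4 * 1000 ≤ k := by
    refine le_trans ?_ hal
    rw [show a * (L : ℝ) ^ 10 = a * L ^ 4 * L ^ 6 by ring]
    refine mul_le_mul_of_nonneg_left ?_ (by positivity)
    calc (1000 : ℝ) ≤ (10 ^ 6) ^ 6 := by norm_num
      _ ≤ (L : ℝ) ^ 6 := pow_le_pow_left₀ (by norm_num) hL 6
  have hr1 : (r : ℝ) + 1 ≤ L := by linarith
  have e2 : 2 * L * (200 * (r * L) * a) ≤ a * L ^ 3 := by
    have : 400 * (r : ℝ) ≤ L := by linarith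
    calc 2 * L * (200 * (r * L) * a) = (400 * r) * (L ^ 2 * a) := by ring
      _ ≤ L * (L ^ 2 * a) := mul_le_mul_of_nonneg_right this (by positivity)
      _ = _ := by ring
  have e3 : 2 * (L : ℝ) * (2 * a) ≤ a * L ^ 3 := by
    have : 4 * (L : ℝ) ≤ L ^ 3 := by nlinarith
    nlinarith
  have e4 : ((r : ℝ) + 1) * (L + 2 * L * (200 * (r * L) * a) + 2 * L * (4 + 2 * a)) ≤
      L * (9 * L + 2 * (a * L ^ 3)) :=
    mul_le_mul hr1 (by linarith) (by positivity) (by positivity)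
  have e5 : ((r : ℝ) + 2 * a) * (r + 1) ≤ (L + 2 * a) * L :=
    mul_le_mul (by linarith) hr1 (by positivity) (by positivity)
  have e6 : 2 * a * L ≤ a * L ^ 4 := by
    have : 2 * (L : ℝ) ≤ L ^ 4 := by
      calc 2 * (L : ℝ) ≤ L ^ 3 * L := by
            refine mul_le_mul_of_nonneg_right ?_ hL0.le
            calc (2 : ℝ) ≤ (10 ^ 6) ^ 3 := by norm_num
              _ ≤ (L : ℝ) ^ 3 := pow_le_pow_left₀ (by norm_num) hL 3
        _ = _ := by ring
    nlinarith
  have e7 : 2 * (L : ℝ) * r ≤ 2 * L * L := mul_le_mul_of_nonneg_left (by linarith) (by positivity)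
  nlinarith

section

variable {V : Type*} [Fintype V] {k r L : ℕ}

lemma sum_weights (Z D : Finset (Fin r)) (hD : D ⊆ Z) :
    ∑ i : Z, (if i.1 ∈ D then (3 / 5 : ℝ) else 2 / 5) = 2 / 5 * (Z \ D).card + 3 / 5 * D.card := by
  rw [Finset.sum_coe_sort Z (fun i => if i ∈ D then (3 / 5 : ℝ) else 2 / 5),
    ← Finset.sum_sdiff hD]
  congr 1
  · rw [Finset.sum_congr rfl (g := fun _ => (2 / 5 : ℝ))
      (fun i hi => if_neg (Finset.mem_sdiff.1 hi).2)]
    simp [mul_comm]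
  · rw [Finset.sum_congr rfl (g := fun _ => (3 / 5 : ℝ)) (fun i hi => if_pos hi)]
    simp [mul_comm]

lemma pr_exists_badShape_le (h : Win k r L (Fintype.card V)) (Z D : Finset (Fin r)) (hD : D ⊆ Z)
    {τ : ℕ} (hτ : τ ≤ r) (hw : 5 * τ < 4 * (Z \ D).card + 6 * D.card) :
    pr V (fun G => ∃ W : Finset V, W.card = k + 1 - τ ∧ ∃ S : Z → Finset V,
      (∀ i, (S i).card = k + 1) ∧ (∀ i i', i ≠ i' → Disjoint (S i) (S i')) ∧
      (∀ i, Disjoint (S i) W) ∧ (eF G W).card ≤ 200 * (r * L) * (k / L ^ 10) ∧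
      ∀ i, (eF G (S i)).card ≤ 200 * (r * L) * (k / L ^ 10) ∧
        FewPair (k / L ^ 10) W (S i) (i.1 ∈ D) G) ≤ 2 ^ (-(3 / 40 * (k : ℝ)) - 4 * r) := by
  have hov := h.overhead
  have hrk := h.r_lt_k
  have hr := h.r_ge
  have hal := h.a_le
  have hL := h.L_ge
  have hkb := h.k_big.1
  set a := k / L ^ 10 with ha
  set T := 200 * (r * L) * a with hT
  have h10a : 10 * a ≤ k := by
    have : ((10 * a : ℕ) : ℝ) ≤ k := by
      push_cast
      refine le_trans ?_ hal
      rw [mul_comm]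
      refine mul_le_mul_of_nonneg_left ?_ (by positivity)
      calc (10 : ℝ) ≤ (10 ^ 6) ^ 10 := by norm_num
        _ ≤ (L : ℝ) ^ 10 := pow_le_pow_left₀ (by norm_num) hL 10
    exact_mod_cast this
  set b := k - r - 2 * a with hb
  have hbR : (b : ℝ) = k - r - 2 * a := by
    rw [hb, Nat.cast_sub (by omega), Nat.cast_sub (by omega)]; push_cast; ring
  set I := (((Finset.univ : Finset V).powersetCard (k + 1 - τ)) ×ˢ
    (Fintype.piFinset fun _ : Z => (Finset.univ : Finset V).powersetCard (k + 1))).filter fun q =>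
      (∀ i i', i ≠ i' → Disjoint (q.2 i) (q.2 i')) ∧ ∀ i, Disjoint (q.2 i) q.1 with hI
  set β : ℝ := 2 ^ (2 * L * T : ℝ) * (1 / 2) ^ ((k + 1 - τ).choose 2) *
      ∏ i : Z, ((1 / 2) ^ ((k + 1).choose 2) * 2 ^ (2 * L * T + 2 * L * (4 + 2 * a) -
        (if i.1 ∈ D then 3 / 5 else 2 / 5) * b : ℝ)) with hβ
  have hβ0 : 0 ≤ β := by
    rw [hβ]
    exact mul_nonneg (by positivity) (Finset.prod_nonneg fun i _ =>
      mul_nonneg (by positivity) (Real.rpow_nonneg (by norm_num) _))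
  have step : pr V (fun G => ∃ q ∈ I, BadShape k T a Z D τ q.1 q.2 G) ≤ I.card * β := by
    refine pr_exists_le_card I _ β fun q hq => ?_
    rw [hI, Finset.mem_filter, Finset.mem_product, Fintype.mem_piFinset] at hq
    obtain ⟨⟨q1, q2⟩, q3, q4⟩ := hq
    exact pr_badShape_le h.toScale Z D (Finset.mem_powersetCard.1 q1).2
      (fun i => (Finset.mem_powersetCard.1 (q2 i)).2) q3 q4 (by omega)
  have hIc : (I.card : ℝ) ≤ (Fintype.card V).choose (k + 1 - τ) *
      ((Fintype.card V).choose (k + 1)) ^ Z.card := by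
    have : I.card ≤ (Fintype.card V).choose (k + 1 - τ) * ((Fintype.card V).choose (k + 1)) ^ Z.card := by
      refine (Finset.card_filter_le _ _).trans_eq ?_
      rw [Finset.card_product, Fintype.card_piFinset]
      simp
    exact_mod_cast this
  refine (pr_mono (Ψ := fun G => ∃ q ∈ I, BadShape k T a Z D τ q.1 q.2 G) ?_).trans (step.trans ?_)
  · rintro G ⟨W, hW, S, hS, hd, hSW, hWT, hST⟩
    refine ⟨(W, S), ?_, hWT, fun i _ => hST i⟩
    rw [hI, Finset.mem_filter, Finset.mem_product, Fintype.mem_piFinset]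
    exact ⟨⟨by simp [hW], fun i => by simp [hS i]⟩, hd, hSW⟩
  · refine (mul_le_mul_of_nonneg_right hIc hβ0).trans ?_
    have e1 : (((Fintype.card V).choose (k + 1 - τ) : ℝ) *
        ((Fintype.card V).choose (k + 1) : ℝ) ^ Z.card) * β =
        eInd (Fintype.card V) (k + 1 - τ) * 2 ^ (2 * L * T : ℝ) *
        ∏ i : Z, (eInd (Fintype.card V) (k + 1) * 2 ^ (2 * L * T + 2 * L * (4 + 2 * a) -
        (if i.1 ∈ D then 3 / 5 else 2 / 5) * b : ℝ)) := by
      rw [hβ]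
      simp only [Finset.prod_mul_distrib, Finset.prod_const, Finset.card_univ, Fintype.card_coe, eInd,
        mul_pow]
      ring
    rw [e1]
    have e2 : ∏ i : Z, (eInd (Fintype.card V) (k + 1) * 2 ^ (2 * L * T + 2 * L * (4 + 2 * a) -
        (if i.1 ∈ D then 3 / 5 else 2 / 5) * b : ℝ)) ≤
        ∏ i : Z, (2 : ℝ) ^ ((L + 2 * L * T + 2 * L * (4 + 2 * a)) -
        (if i.1 ∈ D then 3 / 5 else 2 / 5) * b : ℝ) := by
      refine Finset.prod_le_prod (fun i _ => mul_nonneg (eInd_nonneg _ _)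
        (Real.rpow_nonneg (by norm_num) _)) fun i _ => ?_
      refine (mul_le_mul_of_nonneg_right (h.hc.trans h.k_le) (Real.rpow_nonneg (by norm_num) _)).trans ?_
      rw [← Real.rpow_add (by norm_num)]
      exact le_of_eq (congrArg _ (by ring))
    rw [← Real.rpow_sum_of_pos (by norm_num), Finset.sum_sub_distrib, ← Finset.sum_mul,
      sum_weights Z D hD, Finset.sum_const, Finset.card_univ, Fintype.card_coe, nsmul_eq_mul] at e2
    have hZ : (Z.card : ℝ) ≤ r := by
      have := Z.card_le_univ
      rw [Fintype.card_fin] at this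
      exact_mod_cast this
    have hwR : 5 * (τ : ℝ) + 1 ≤ 4 * (Z \ D).card + 6 * D.card := by exact_mod_cast hw
    have hτR : (τ : ℝ) ≤ r := by exact_mod_cast hτ
    calc _ ≤ (2 : ℝ) ^ (L + τ * ((k : ℝ) / 2 + 2 * L)) * 2 ^ (2 * L * T : ℝ) *
          2 ^ (Z.card * (L + 2 * L * T + 2 * L * (4 + 2 * a)) -
            (2 / 5 * (Z \ D).card + 3 / 5 * D.card) * b : ℝ) := by
          refine mul_le_mul (mul_le_mul_of_nonneg_right (h.eInd_le τ (by omega)) (by positivity)) e2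
            ?_ (by positivity)
          exact Finset.prod_nonneg fun i _ => mul_nonneg (eInd_nonneg _ _)
            (Real.rpow_nonneg (by norm_num) _)
      _ = (2 : ℝ) ^ ((L + τ * ((k : ℝ) / 2 + 2 * L)) + 2 * L * T + (Z.card * (L + 2 * L * T + 2 * L * (4 + 2 * a)) -
            (2 / 5 * (Z \ D).card + 3 / 5 * D.card) * b) : ℝ) := by
          rw [← Real.rpow_add (by norm_num), ← Real.rpow_add (by norm_num)]
      _ ≤ _ := by
          refine Real.rpow_le_rpow_of_exponent_le (by norm_num) ?_
          set X : ℝ := L + 2 * L * T + 2 * L * (4 + 2 * a) with hX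
          have hX0 : 0 ≤ X := by positivity
          have f1 : (Z.card : ℝ) * X ≤ r * X := mul_le_mul_of_nonneg_right hZ hX0
          have f2 : (τ / 2 + 1 / 10 : ℝ) * b ≤ (2 / 5 * (Z \ D).card + 3 / 5 * D.card) * b :=
            mul_le_mul_of_nonneg_right (by linarith) (by positivity)
          have f3 : (τ : ℝ) * (2 * L) ≤ r * (2 * L) := mul_le_mul_of_nonneg_right hτR (by positivity)
          have f4 : (τ / 2 + 1 / 10 : ℝ) * (r + 2 * a) ≤ (r + 1) * (r + 2 * a) :=
            mul_le_mul_of_nonneg_right (by linarith) (by positivity)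
          have f5 : 2 * (L : ℝ) * T ≤ X := by
            have : (0 : ℝ) ≤ L + 2 * L * (4 + 2 * a) := by positivity
            linarith
          rw [hbR] at f2 ⊢
          nlinarith

theorem pr_badTuple_le (h : Win k r L (Fintype.card V)) :
    pr V (BadTuple r k (200 * (r * L) * (k / L ^ 10)) (k / L ^ 10)) ≤
      2 ^ (-(3 / 40 * (k : ℝ))) := by
  obtain ⟨I, hI⟩ : ∃ I : Finset (Finset (Fin r) × Finset (Fin r) × Fin (r + 1)), ∀ q, q ∈ I ↔
      q.2.1 ⊆ q.1 ∧ 5 * q.2.2.1 < 4 * (q.1 \ q.2.1).card + 6 * q.2.1.card :=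
    ⟨Finset.univ.filter fun q => q.2.1 ⊆ q.1 ∧ 5 * q.2.2.1 < 4 * (q.1 \ q.2.1).card + 6 * q.2.1.card,
      fun q => by simp⟩
  have hIc : (I.card : ℝ) ≤ 2 ^ (4 * r : ℝ) := by
    have h1 : I.card ≤ 2 ^ r * (2 ^ r * (r + 1)) := by
      refine (Finset.card_le_univ _).trans_eq ?_
      simp
    have h2 : r + 1 ≤ 2 ^ r := Nat.lt_two_pow_self
    have h3 : I.card ≤ 2 ^ (4 * r) := by
      calc I.card ≤ 2 ^ r * (2 ^ r * (r + 1)) := h1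
        _ ≤ 2 ^ r * (2 ^ r * 2 ^ r) := by gcongr
        _ = 2 ^ (3 * r) := by ring
        _ ≤ _ := Nat.pow_le_pow_right (by norm_num) (by omega)
    have h4 : (2 : ℝ) ^ (4 * r : ℝ) = ((2 ^ (4 * r) : ℕ) : ℝ) := by
      rw [show (4 * r : ℝ) = ((4 * r : ℕ) : ℝ) by push_cast; ring, Real.rpow_natCast]; push_cast; ring
    rw [h4]
    exact_mod_cast h3
  refine (pr_mono (Ψ := fun G => ∃ q ∈ I, ∃ W : Finset V, W.card = k + 1 - q.2.2.1 ∧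
      ∃ S : q.1 → Finset V,
      (∀ i, (S i).card = k + 1) ∧ (∀ i i', i ≠ i' → Disjoint (S i) (S i')) ∧
      (∀ i, Disjoint (S i) W) ∧ (eF G W).card ≤ 200 * (r * L) * (k / L ^ 10) ∧
      ∀ i, (eF G (S i)).card ≤ 200 * (r * L) * (k / L ^ 10) ∧
        FewPair (k / L ^ 10) W (S i) (i.1 ∈ q.2.1) G) ?_).trans
    ((pr_exists_le_card I _ (2 ^ (-(3 / 40 * (k : ℝ)) - 4 * r)) ?_).trans ?_)
  · rintro G ⟨Z, D, τ, hD, hτ, hw, hG⟩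
    exact ⟨(Z, D, ⟨τ, by omega⟩), (hI _).2 ⟨hD, hw⟩, hG⟩
  · intro q hq
    obtain ⟨q1, q2⟩ := (hI q).1 hq
    exact pr_exists_badShape_le h q.1 q.2.1 q1 (by have := q.2.2.2; omega) q2
  · refine (mul_le_mul_of_nonneg_right hIc (by positivity)).trans ?_
    rw [← Real.rpow_add (by norm_num)]
    exact le_of_eq (congrArg _ (by ring))

end

section

variable {V : Type*} [Fintype V]

lemma two_mul_card_eF_le (G : SimpleGraph V) (A : Finset V) :
    2 * (eF G A).card ≤
      (Finset.univ.filter fun p : V × V => (p.1 ∈ A ∧ p.2 ∈ A) ∧ G.Adj p.1 p.2).card := by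
  set D := Finset.univ.filter fun p : V × V => (p.1 ∈ A ∧ p.2 ∈ A) ∧ G.Adj p.1 p.2 with hD
  have hmem : ∀ x y, (x, y) ∈ D ↔ (x ∈ A ∧ y ∈ A) ∧ G.Adj x y := fun x y => by simp [hD]
  have hmaps : ∀ p ∈ D, s(p.1, p.2) ∈ eF G A := by
    rintro ⟨x, y⟩ hp
    rw [hmem] at hp
    rw [mem_eF, mk_mem_prs, SimpleGraph.mem_edgeSet]
    exact ⟨⟨hp.1.1, hp.1.2, hp.2.ne⟩, hp.2⟩
  rw [Finset.card_eq_sum_card_fiberwise hmaps, mul_comm, ← smul_eq_mul]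
  refine Finset.card_nsmul_le_sum _ _ _ fun e he => ?_
  induction e with
  | h x y =>
    rw [mem_eF, mk_mem_prs, SimpleGraph.mem_edgeSet] at he
    have hne : (x, y) ≠ (y, x) := fun h => he.1.2.2 (Prod.ext_iff.1 h).1
    rw [← Finset.card_pair hne]
    refine Finset.card_le_card fun p hp => ?_
    rw [Finset.mem_insert, Finset.mem_singleton] at hp
    rw [Finset.mem_filter]
    rcases hp with rfl | rfl
    · exact ⟨(hmem _ _).2 ⟨⟨he.1.1, he.1.2.1⟩, he.2⟩, rfl⟩
    · exact ⟨(hmem _ _).2 ⟨⟨he.1.2.1, he.1.1⟩, he.2.symm⟩, Sym2.eq_swap⟩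

/-- Some `s` vertices induce a graph without `K_{r+1}`. -/
def Large (s r : ℕ) (G : SimpleGraph V) : Prop := ∃ f : Fin s ↪ V, (G.comap f).CliqueFree (r + 1)

/-- At least `ξ` sets of size `m` induce exactly `i` edges. -/
def Many (ξ m i : ℕ) (G : SimpleGraph V) : Prop :=
  ξ ≤ ((Finset.univ.powersetCard m).filter fun A : Finset V => (eF G A).card = i).card

theorem many_of_nice {r j k T a : ℕ} (h1 : 1 ≤ j) (hj : j ≤ r) {G : SimpleGraph V}
    (f : Fin (k * r + j) ↪ V) (c : Fin (k * r + j) → Fin r) (hc : NiceCol (G.comap f) c T a)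
    (hG1 : ∀ A : Finset V, A.card = k + 2 → T < (eF G A).card)
    (hG2 : ∀ A : Finset V, A.card = k + 1 → muD r j ≤ (eF G A).card)
    (hG3 : ¬ BadTuple r k T a G) : Many (xiD r j) (k + 1) (muD r j) G := by
  have hmem : ∀ l v, v ∈ (cls c l).map f ↔ ∃ u, c u = l ∧ f u = v := by simp
  refine no_large_partite h1 hj (fun l => (cls c l).map f) ?_ ?_ ?_ ?_ hG1 hG2 hG3
  · intro l l' hl
    rw [Finset.disjoint_left]
    intro v hv hv'
    rw [hmem] at hv hv'
    obtain ⟨u, rfl, rfl⟩ := hv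
    obtain ⟨u', rfl, h'⟩ := hv'
    exact hl (congrArg c (f.injective h').symm)
  · simp only [Finset.card_map, sum_card_cls, Fintype.card_fin]
  · intro l
    have e1 := two_mul_card_eF_le G ((cls c l).map f)
    have e2 : (Finset.univ.filter fun p : V × V => (p.1 ∈ (cls c l).map f ∧ p.2 ∈ (cls c l).map f) ∧
        G.Adj p.1 p.2).card ≤ intE (G.comap f) c := by
      unfold intE
      rw [← Finset.card_map (f.prodMap f)]
      refine Finset.card_le_card ?_
      rintro ⟨x, y⟩ hp
      simp only [Finset.mem_filter, Finset.mem_univ, true_and, hmem] at hp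
      obtain ⟨⟨⟨u, hu, rfl⟩, ⟨v, hv, rfl⟩⟩, hadj⟩ := hp
      rw [Finset.mem_map]
      exact ⟨(u, v), by simp [hu, hv, hadj], rfl⟩
    have := hc.1
    omega
  · intro l e he
    induction e with
    | h x y =>
      rw [mem_eF, mk_mem_prs, SimpleGraph.mem_edgeSet, hmem, hmem] at he
      obtain ⟨⟨⟨u, hu, rfl⟩, ⟨v, hv, rfl⟩, -⟩, hadj⟩ := he
      obtain ⟨l', hl', hlt⟩ := hc.2 u v hadj (hu.trans hv.symm)
      refine ⟨l', hu ▸ hl', ?_⟩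
      unfold Few
      refine le_trans ?_ hlt.le
      rw [← Finset.card_map f]
      refine Finset.card_le_card fun w hw => ?_
      rw [Finset.mem_filter, hmem] at hw
      obtain ⟨⟨z, hz, rfl⟩, hall⟩ := hw
      rw [Finset.mem_map]
      exact ⟨z, by rw [mem_conb]; exact ⟨hz, hall _ (by simp), hall _ (by simp)⟩, rfl⟩

lemma pr_exists_sparse_le {k r L : ℕ} (h : Win k r L (Fintype.card V)) :
    pr V (fun G => ∃ A ∈ (Finset.univ : Finset V).powersetCard (k + 2),
      (eF G A).card ≤ 200 * (r * L) * (k / L ^ 10)) ≤ 2 ^ (-(k : ℝ) / 4) := by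
  have hov := h.overhead
  have hr := h.r_ge
  have hL := h.L_ge
  set a := k / L ^ 10 with ha
  set T := 200 * (r * L) * a with hT
  set n := Fintype.card V with hn
  have hov2 : 4 * (L : ℝ) + 2 * L * T ≤ k / 40 := by
    have e1 : (0 : ℝ) ≤ (L + 2 * L * T + 2 * L * (4 + 2 * a)) := by positivity
    have e2 : (L + 2 * L * T + 2 * L * (4 + 2 * a) : ℝ) ≤ (r + 1) * (L + 2 * L * T + 2 * L * (4 + 2 * a)) :=
      le_mul_of_one_le_left e1 (by linarith)
    have e3 : (0 : ℝ) ≤ (r + 2 * a) * (r + 1) + 4 * r + 2 * L * r + 2 * L * (2 * a) := by positivity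
    linarith
  have e1 : eInd n (k + 2) ≤ eInd n (k + 1) * (n * (1 / 2) ^ (k + 1)) := by
    unfold eInd
    have h3 : (k + 2).choose 2 = (k + 1) + (k + 1).choose 2 := by
      rw [Nat.choose_succ_succ' (k + 1) 1, Nat.choose_one_right]
    have h4 : (n.choose (k + 2) : ℝ) ≤ n.choose (k + 1) * n := by
      have h5 := Nat.choose_succ_right_eq n (k + 1)
      have h6 : n.choose (k + 2) ≤ n.choose (k + 1) * n := by
        calc n.choose (k + 1 + 1) ≤ n.choose (k + 1 + 1) * (k + 1 + 1) :=
              Nat.le_mul_of_pos_right _ (by omega)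
          _ = _ := h5
          _ ≤ _ := Nat.mul_le_mul_left _ (Nat.sub_le _ _)
      exact_mod_cast h6
    rw [h3, pow_add]
    calc _ ≤ (n.choose (k + 1) * n : ℝ) * ((1 / 2) ^ (k + 1) * (1 / 2) ^ (k + 1).choose 2) :=
          mul_le_mul_of_nonneg_right h4 (by positivity)
      _ = _ := by ring
  have e2 : (n : ℝ) * (1 / 2) ^ (k + 1) ≤ 2 ^ (-(k : ℝ) / 2 + 2 * L) := by
    have : ((1 / 2 : ℝ)) ^ (k + 1) ≤ 2 ^ (-(k : ℝ)) := by
      rw [Real.rpow_neg (by norm_num), Real.rpow_natCast, one_div, inv_pow]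
      gcongr
      · norm_num
      · omega
    calc (n : ℝ) * (1 / 2) ^ (k + 1) ≤ 2 ^ ((k : ℝ) / 2 + 2 * L) * 2 ^ (-(k : ℝ)) :=
          mul_le_mul h.hup this (by positivity) (by positivity)
      _ = _ := by rw [← Real.rpow_add (by norm_num)]; ring_nf
  refine (pr_exists_le_card _ _ (2 ^ (2 * L * T : ℝ) * (1 / 2) ^ ((k + 2).choose 2)) ?_).trans ?_
  · intro A hA
    have hc := (Finset.mem_powersetCard.1 hA).2
    have := pr_eF_le_scale h.toScale (A := A) (by omega) T
    rwa [hc] at this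
  · rw [Finset.card_powersetCard, Finset.card_univ, ← hn]
    calc _ = eInd n (k + 2) * 2 ^ (2 * L * T : ℝ) := by unfold eInd; ring
      _ ≤ (2 ^ (L : ℝ) * 2 ^ (-(k : ℝ) / 2 + 2 * L)) * 2 ^ (2 * L * T : ℝ) := by
          refine mul_le_mul_of_nonneg_right (e1.trans ?_) (by positivity)
          exact mul_le_mul (h.hc.trans h.k_le) e2 (by positivity) (by positivity)
      _ = 2 ^ ((L : ℝ) + (-(k : ℝ) / 2 + 2 * L) + 2 * L * T) := by
          rw [← Real.rpow_add (by norm_num), ← Real.rpow_add (by norm_num)]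
      _ ≤ _ := Real.rpow_le_rpow_of_exponent_le (by norm_num) (by
          have : (0 : ℝ) ≤ k := by positivity
          linarith)

/-- The expected number of `(k+1)`-sets inducing exactly `i` edges. -/
noncomputable def lam (n k i : ℕ) : ℝ := eInd n (k + 1) * ((k + 1).choose 2).choose i

lemma lam_nonneg (n k i : ℕ) : 0 ≤ lam n k i := mul_nonneg (eInd_nonneg _ _) (by positivity)

lemma pr_exists_edges_le (k i : ℕ) :
    pr V (fun G => ∃ A ∈ (Finset.univ : Finset V).powersetCard (k + 1), (eF G A).card = i) ≤
      lam (Fintype.card V) k i := by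
  refine (pr_exists_le_card _ _ ((((k + 1).choose 2).choose i : ℝ) * (1 / 2) ^ ((k + 1).choose 2)) ?_).trans ?_
  · intro A hA
    have hc := (Finset.mem_powersetCard.1 hA).2
    rw [pr_eF_card_eq, hc]
  · rw [Finset.card_powersetCard, Finset.card_univ]
    unfold lam eInd
    exact le_of_eq (by ring)

lemma Scale.lam_succ {k r L : ℕ} (h : Scale k r L) (n : ℕ) {i : ℕ} (hi : i ≤ r) :
    lam n k i * k ^ 2 ≤ lam n k (i + 1) * (4 * (i + 1)) := by
  have hrk := h.r_lt_k
  unfold lam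
  have h1 := Nat.choose_succ_right_eq ((k + 1).choose 2) i
  have h2 : (((k + 1).choose 2 : ℕ) : ℝ) = (k + 1) * k / 2 := by
    rw [Nat.cast_choose_two]; push_cast; ring
  have h3 : i ≤ (k + 1).choose 2 := by
    have : (k + 1).choose 2 = k + k.choose 2 := by
      rw [Nat.choose_succ_succ' k 1, Nat.choose_one_right]
    omega
  set K := (k + 1).choose 2 with hK
  have h4 : (K.choose (i + 1) : ℝ) * (i + 1) = K.choose i * (K - i) := by
    have h5 : ((K - i : ℕ) : ℝ) = K - i := by rw [Nat.cast_sub h3]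
    rw [← h5]; exact_mod_cast h1
  have h6 : (k : ℝ) ^ 2 ≤ 4 * (K - i) := by
    have h7 : (i : ℝ) ≤ r := by exact_mod_cast hi
    have h8 : 10 * (r : ℝ) ≤ k := by exact_mod_cast hrk.le
    have h9 : (1 : ℝ) ≤ k := le_trans (by norm_num) h.k_big.1
    rw [h2]
    nlinarith
  calc eInd n (k + 1) * K.choose i * k ^ 2 ≤ eInd n (k + 1) * K.choose i * (4 * (K - i)) :=
        mul_le_mul_of_nonneg_left h6 (mul_nonneg (eInd_nonneg _ _) (by positivity))
    _ = 4 * eInd n (k + 1) * (K.choose i * (K - i)) := by ring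
    _ = _ := by rw [← h4]; ring

lemma Scale.lam_le {k r L : ℕ} (h : Scale k r L) (n : ℕ) {i μ : ℕ} (hi : i < μ) (hμ : μ ≤ r) :
    lam n k i * k ^ 2 ≤ lam n k μ * (4 * r) := by
  have hk1 : (1 : ℝ) ≤ k := le_trans (by norm_num) h.k_big.1
  have step : ∀ i, i < r → lam n k i * k ^ 2 ≤ lam n k (i + 1) * (4 * r) := fun i hi => by
    refine (h.lam_succ n hi.le).trans (mul_le_mul_of_nonneg_left ?_ (lam_nonneg _ _ _))
    have : (i : ℝ) + 1 ≤ r := by exact_mod_cast hi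
    linarith
  have hrk : 4 * (r : ℝ) ≤ k ^ 2 := by
    have : 10 * (r : ℝ) ≤ k := by exact_mod_cast h.r_lt_k.le
    nlinarith
  obtain ⟨d, rfl⟩ : ∃ d, μ = i + 1 + d := ⟨μ - i - 1, by omega⟩
  induction d with
  | zero => exact step i (by omega)
  | succ d ih =>
    refine (ih (by omega) (by omega)).trans (mul_le_mul_of_nonneg_right ?_ (by positivity))
    have h1 := step (i + 1 + d) (by omega)
    have h2 := lam_nonneg n k (i + 1 + d)
    have h3 := lam_nonneg n k (i + 1 + d + 1)
    have h4 : lam n k (i + 1 + d) * k ^ 2 ≤ lam n k (i + 1 + d + 1) * k ^ 2 :=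
      h1.trans (mul_le_mul_of_nonneg_left hrk h3)
    exact le_of_mul_le_mul_right h4 (by positivity)

theorem pr_large_not_many_le {k r L j : ℕ} (h : Win k r L (Fintype.card V)) (h1 : 1 ≤ j) (hj : j ≤ r)
    (hlam : lam (Fintype.card V) k (muD r j) ≤ k) :
    pr V (fun G => Large (k * r + j) r G ∧ ¬ Many (xiD r j) (k + 1) (muD r j) G) ≤
      2 ^ (-(k : ℝ)) + 2 ^ (-(k : ℝ) / 4) + 4 * r ^ 2 / k + 2 ^ (-(3 / 40 * (k : ℝ))) := by
  set T := 200 * (r * L) * (k / L ^ 10) with hT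
  set a := k / L ^ 10 with ha
  set n := Fintype.card V with hn
  set s := k * r + j with hs
  have hk1 : (1 : ℝ) ≤ k := le_trans (by norm_num) h.k_big.1
  have hr := h.r_ge
  have hL := h.L_ge
  have b1 : pr V (fun G => ∃ f ∈ (Finset.univ : Finset (Fin s ↪ V)), (G.comap f).CliqueFree (r + 1) ∧
      ¬ ∃ c : Fin s → Fin r, NiceCol (G.comap f) c T a) ≤ 2 ^ (-(k : ℝ)) := by
    refine (pr_exists_le_card _ _ (2 ^ (-((s : ℝ) * k / 2 + 3 * (s * L)))) fun f _ => ?_).trans ?_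
    · rw [pr_comap f (fun H => H.CliqueFree (r + 1) ∧ ¬ ∃ c : Fin s → Fin r, NiceCol H c T a)]
      have := pr_not_nice_le (V := Fin s) h.toScale (by rw [Fintype.card_fin]; omega)
        (by rw [Fintype.card_fin]; omega)
      rwa [Fintype.card_fin] at this
    · have hc : ((Finset.univ : Finset (Fin s ↪ V)).card : ℝ) ≤ 2 ^ (((k : ℝ) / 2 + 2 * L) * s) := by
        have e1 : (Finset.univ : Finset (Fin s ↪ V)).card ≤ n ^ s := by
          rw [Finset.card_univ, Fintype.card_embedding_eq, Fintype.card_fin]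
          exact Nat.descFactorial_le_pow _ _
        calc ((Finset.univ : Finset (Fin s ↪ V)).card : ℝ) ≤ (n : ℝ) ^ s := by exact_mod_cast e1
          _ ≤ (2 ^ ((k : ℝ) / 2 + 2 * L)) ^ s := pow_le_pow_left₀ (by positivity) h.hup s
          _ = _ := by rw [← Real.rpow_natCast, ← Real.rpow_mul (by norm_num)]
      refine (mul_le_mul_of_nonneg_right hc (by positivity)).trans ?_
      rw [← Real.rpow_add (by norm_num)]
      refine Real.rpow_le_rpow_of_exponent_le (by norm_num) ?_
      have hks : (k : ℝ) ≤ s := by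
        have : k ≤ s := by have := h.hr; nlinarith
        exact_mod_cast this
      nlinarith
  have b2 := pr_exists_sparse_le h
  have b3 : pr V (fun G => ∃ i ∈ Finset.range (muD r j), ∃ A ∈ (Finset.univ : Finset V).powersetCard (k + 1),
      (eF G A).card = i) ≤ 4 * r ^ 2 / k := by
    have hμ := (mu_xi h1 hj).2.2.2
    refine (pr_exists_le_card _ _ (4 * r / k) fun i hi => ?_).trans ?_
    · refine (pr_exists_edges_le k i).trans ?_
      have := h.lam_le n (Finset.mem_range.1 hi) hμ
      rw [le_div_iff₀ (by linarith)]
      have h5 : lam n k (muD r j) * (4 * r) ≤ k * (4 * r) := mul_le_mul_of_nonneg_right hlam (by positivity)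
      refine le_of_mul_le_mul_right (a := (k : ℝ)) ?_ (by linarith)
      calc _ = lam n k i * k ^ 2 := by ring
        _ ≤ _ := this.trans h5
        _ = _ := by ring
    · rw [Finset.card_range]
      calc (muD r j : ℝ) * (4 * r / k) ≤ r * (4 * r / k) :=
            mul_le_mul_of_nonneg_right (by exact_mod_cast hμ) (by positivity)
        _ = _ := by ring
  have b4 := pr_badTuple_le h
  have key : ∀ G : SimpleGraph V, Large s r G ∧ ¬ Many (xiD r j) (k + 1) (muD r j) G →
      (((∃ f ∈ (Finset.univ : Finset (Fin s ↪ V)), (G.comap f).CliqueFree (r + 1) ∧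
      ¬ ∃ c : Fin s → Fin r, NiceCol (G.comap f) c T a) ∨
      (∃ A ∈ (Finset.univ : Finset V).powersetCard (k + 2), (eF G A).card ≤ T)) ∨
      ∃ i ∈ Finset.range (muD r j), ∃ A ∈ (Finset.univ : Finset V).powersetCard (k + 1),
        (eF G A).card = i) ∨ BadTuple r k T a G := by
    rintro G ⟨⟨f, hf⟩, hG⟩
    by_contra! hcon
    obtain ⟨⟨⟨c1, c2⟩, c3⟩, c4⟩ := hcon
    obtain ⟨c, hc⟩ := c1 f (Finset.mem_univ _) hf
    refine hG (many_of_nice h1 hj f c hc (fun A hA => c2 A (by simp [hA])) (fun A hA => ?_) c4)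
    by_contra! hlt
    exact c3 _ (Finset.mem_range.2 hlt) A (by simp [hA]) rfl
  refine (pr_mono key).trans ((pr_or_le _ _).trans (add_le_add ((pr_or_le _ _).trans
    (add_le_add ((pr_or_le _ _).trans (add_le_add b1 b2)) b3)) b4))

end

lemma card_rel_mul {ι α : Type*} [Fintype ι] [DecidableEq ι] (Y : ι → Finset α) (rel : α → α → Prop) {i i' : ι}
    (hii : i ≠ i') :
    ((Fintype.piFinset Y).filter fun t => rel (t i) (t i')).card * ((Y i).card * (Y i').card) =
      ((Y i ×ˢ Y i').filter fun p => rel p.1 p.2).card * ∏ l, (Y l).card := by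
  have hmaps : ∀ t ∈ (Fintype.piFinset Y).filter fun t => rel (t i) (t i'),
      (t i, t i') ∈ (Y i ×ˢ Y i').filter fun p => rel p.1 p.2 := by
    intro t ht
    rw [Finset.mem_filter, Fintype.mem_piFinset] at ht
    rw [Finset.mem_filter, Finset.mem_product]
    exact ⟨⟨ht.1 i, ht.1 i'⟩, ht.2⟩
  rw [Finset.card_eq_sum_card_fiberwise hmaps, Finset.sum_mul]
  rw [Finset.sum_congr rfl (g := fun _ => ∏ l, (Y l).card)]
  · rw [Finset.sum_const, smul_eq_mul]
  · rintro ⟨x, y⟩ hp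
    rw [Finset.mem_filter, Finset.mem_product] at hp
    have hset : (((Fintype.piFinset Y).filter fun t => rel (t i) (t i')).filter
        fun t => (t i, t i') = (x, y)) =
        Fintype.piFinset fun l => if l = i then {x} else if l = i' then {y} else Y l := by
      ext t
      simp only [Finset.mem_filter, Fintype.mem_piFinset, Prod.mk.injEq]
      constructor
      · rintro ⟨⟨h1, -⟩, h2, h3⟩ l
        split_ifs with e1 e2
        · subst e1; simpa using h2
        · subst e2; simpa using h3
        · exact h1 l
      · intro h
        have h2 : t i = x := by simpa using h i
        have h3 : t i' = y := by simpa [hii.symm] using h i'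
        refine ⟨⟨fun l => ?_, by rw [h2, h3]; exact hp.2⟩, h2, h3⟩
        have := h l
        split_ifs at this with e1 e2
        · subst e1; rw [h2]; exact hp.1.1
        · subst e2; rw [h3]; exact hp.1.2
        · exact this
    rw [hset, Fintype.card_piFinset]
    have hi' : i' ∈ Finset.univ.erase i := Finset.mem_erase.2 ⟨hii.symm, Finset.mem_univ _⟩
    rw [← Finset.mul_prod_erase _ _ (Finset.mem_univ i), ← Finset.mul_prod_erase _ _ hi',
      ← Finset.mul_prod_erase _ (fun l => (Y l).card) (Finset.mem_univ i),
      ← Finset.mul_prod_erase _ (fun l => (Y l).card) hi']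
    rw [Finset.prod_congr rfl (g := fun l => (Y l).card)]
    · simp only [if_true, Finset.card_singleton, if_neg hii.symm]
      ring
    · intro l hl
      rw [Finset.mem_erase, Finset.mem_erase] at hl
      rw [if_neg hl.2.1, if_neg hl.1]

/-- Families with few related pairs have a transversal without related pairs. -/
lemma exists_unrelated_transversal {α : Type*} {m : ℕ} (Y : Fin m → Finset α) (rel : α → α → Prop)
    (hne : ∀ i, (Y i).Nonempty)
    (hX : ∀ i i', i ≠ i' → ((Y i ×ˢ Y i').filter fun p => rel p.1 p.2).card * m ^ 2 <
      (Y i).card * (Y i').card) :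
    ∃ t : Fin m → α, (∀ i, t i ∈ Y i) ∧ ∀ i i', i ≠ i' → ¬ rel (t i) (t i') := by
  by_contra! hcon
  set P := ∏ l, (Y l).card with hP
  have hP0 : 0 < P := Finset.prod_pos fun l _ => (hne l).card_pos
  set O := (Finset.univ : Finset (Fin m)).offDiag with hO
  have hOc : O.card ≤ m ^ 2 := by
    rw [hO, Finset.offDiag_card, Finset.card_univ, Fintype.card_fin, sq]
    exact Nat.sub_le _ _
  have hlt : ∀ q ∈ O, ((Fintype.piFinset Y).filter fun t => rel (t q.1) (t q.2)).card * m ^ 2 < P := by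
    intro q hq
    rw [hO, Finset.mem_offDiag] at hq
    have h1 := card_rel_mul Y rel hq.2.2
    have h2 := hX q.1 q.2 hq.2.2
    have h3 : 0 < (Y q.1).card * (Y q.2).card := Nat.mul_pos (hne _).card_pos (hne _).card_pos
    refine Nat.lt_of_mul_lt_mul_right (a := (Y q.1).card * (Y q.2).card) ?_
    calc _ = (((Fintype.piFinset Y).filter fun t => rel (t q.1) (t q.2)).card *
          ((Y q.1).card * (Y q.2).card)) * m ^ 2 := by ring
      _ = (((Y q.1 ×ˢ Y q.2).filter fun p => rel p.1 p.2).card * m ^ 2) * P := by rw [h1]; ring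
      _ < ((Y q.1).card * (Y q.2).card) * P := Nat.mul_lt_mul_of_pos_right h2 hP0
      _ = _ := by ring
  have hcov : Fintype.piFinset Y ⊆ O.biUnion fun q =>
      (Fintype.piFinset Y).filter fun t => rel (t q.1) (t q.2) := by
    intro t ht
    obtain ⟨i, i', h1, h2⟩ := hcon t (Fintype.mem_piFinset.1 ht)
    rw [Finset.mem_biUnion]
    exact ⟨(i, i'), by simp [hO, h1], by rw [Finset.mem_filter]; exact ⟨ht, h2⟩⟩
  have hc : P ≤ ∑ q ∈ O, ((Fintype.piFinset Y).filter fun t => rel (t q.1) (t q.2)).card := by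
    rw [hP, ← Fintype.card_piFinset]
    exact (Finset.card_le_card hcov).trans Finset.card_biUnion_le
  have hne' : O.Nonempty := by
    rw [Finset.nonempty_iff_ne_empty]
    intro h
    rw [h, Finset.sum_empty] at hc
    omega
  have : P * m ^ 2 < m ^ 2 * P := by
    calc P * m ^ 2 ≤ (∑ q ∈ O, ((Fintype.piFinset Y).filter fun t => rel (t q.1) (t q.2)).card) * m ^ 2 :=
          Nat.mul_le_mul_right _ hc
      _ = ∑ q ∈ O, ((Fintype.piFinset Y).filter fun t => rel (t q.1) (t q.2)).card * m ^ 2 :=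
          Finset.sum_mul _ _ _
      _ < ∑ q ∈ O, P := Finset.sum_lt_sum_of_nonempty hne' hlt
      _ = O.card * P := by rw [Finset.sum_const, smul_eq_mul]
      _ ≤ _ := Nat.mul_le_mul_right _ hOc
  rw [mul_comm] at this
  exact lt_irrefl _ this

section

variable {V : Type*} [Fintype V]

lemma ex_sq_card_filter {ι : Type*} (s : Finset ι) (Φ : ι → SimpleGraph V → Prop) :
    ex V (fun G => (((s.filter fun i => Φ i G).card : ℕ) : ℝ) ^ 2) =
      ∑ i ∈ s, ∑ i' ∈ s, pr V (fun G => Φ i G ∧ Φ i' G) := by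
  unfold pr
  simp_rw [← ex_sum]
  congr 1
  ext G
  rw [card_filter_eq_sum_ind, sq, Finset.sum_mul_sum]
  simp_rw [ind_and]

/-- Chebyshev's inequality for a count of events, pairs of which are independent unless related. -/
lemma pr_count_le {ι : Type*} (s : Finset ι) (Φ : ι → SimpleGraph V → Prop) (R : ι → ι → Prop)
    (hind : ∀ i ∈ s, ∀ i' ∈ s, ¬ R i i' → pr V (fun G => Φ i G ∧ Φ i' G) ≤ pr V (Φ i) * pr V (Φ i'))
    {t : ℝ} (ht : 0 < t) :
    pr V (fun G => ((s.filter fun i => Φ i G).card : ℝ) ≤ (∑ i ∈ s, pr V (Φ i)) - t) ≤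
      (∑ i ∈ s, ∑ i' ∈ s, if R i i' then pr V (fun G => Φ i G ∧ Φ i' G) else 0) / t ^ 2 := by
  set c := ∑ i ∈ s, pr V (Φ i) with hc
  have e1 : ex V (fun G => (((s.filter fun i => Φ i G).card : ℝ) - c) ^ 2) =
      ∑ i ∈ s, ∑ i' ∈ s, pr V (fun G => Φ i G ∧ Φ i' G) - c ^ 2 := by
    have : ∀ G : SimpleGraph V, (((s.filter fun i => Φ i G).card : ℝ) - c) ^ 2 =
        ((((s.filter fun i => Φ i G).card : ℕ) : ℝ) ^ 2 + c ^ 2) -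
          (2 * c) * ((s.filter fun i => Φ i G).card : ℝ) := fun G => by ring
    simp_rw [this]
    rw [ex_sub, ex_add, ex_const, ex_mul_left, ex_card_filter, ex_sq_card_filter]
    ring
  have e2 : ∑ i ∈ s, ∑ i' ∈ s, pr V (fun G => Φ i G ∧ Φ i' G) - c ^ 2 ≤
      ∑ i ∈ s, ∑ i' ∈ s, if R i i' then pr V (fun G => Φ i G ∧ Φ i' G) else 0 := by
    rw [sq, hc, Finset.sum_mul_sum, ← Finset.sum_sub_distrib]
    refine Finset.sum_le_sum fun i hi => ?_
    rw [← Finset.sum_sub_distrib]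
    refine Finset.sum_le_sum fun i' hi' => ?_
    split_ifs with hR
    · have := mul_nonneg (pr_nonneg (Φ i)) (pr_nonneg (Φ i'))
      linarith
    · have := hind i hi i' hi' hR
      linarith
  refine (pr_mono (Ψ := fun G => t ^ 2 ≤ (((s.filter fun i => Φ i G).card : ℝ) - c) ^ 2) ?_).trans
    ((markov (fun G => sq_nonneg _) (by positivity)).trans ?_)
  · intro G hG
    nlinarith
  · rw [e1]
    exact div_le_div_of_nonneg_right e2 (by positivity)

/-- Summing over pairs of `m`-sets according to the size of their intersection. -/
lemma sum_pairs_le (U : Finset V) (m : ℕ) (I : Finset ℕ) (q : ℕ → ℝ) (hq : ∀ l, 0 ≤ q l) :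
    ∑ W ∈ U.powersetCard m, ∑ W' ∈ U.powersetCard m,
        (if (W ∩ W').card ∈ I then q (W ∩ W').card else 0) ≤
      U.card.choose m * ∑ l ∈ I, (m.choose l * U.card.choose (m - l) : ℝ) * q l := by
  rw [← Finset.card_powersetCard, ← nsmul_eq_mul]
  refine Finset.sum_le_card_nsmul _ _ _ fun W hW => ?_
  have hWc := (Finset.mem_powersetCard.1 hW).2
  have e1 : ∀ W' : Finset V, (if (W ∩ W').card ∈ I then q (W ∩ W').card else 0) =
      ∑ l ∈ I, if (W ∩ W').card = l then q l else 0 := fun W' => by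
    rw [Finset.sum_ite_eq]
  simp_rw [e1]
  rw [Finset.sum_comm]
  refine Finset.sum_le_sum fun l _ => ?_
  rw [← Finset.sum_filter, Finset.sum_const, nsmul_eq_mul]
  refine mul_le_mul_of_nonneg_right ?_ (hq l)
  have : ((U.powersetCard m).filter fun W' => (W ∩ W').card = l).card ≤
      (W.powersetCard l ×ˢ U.powersetCard (m - l)).card := by
    refine Finset.card_le_card_of_injOn (fun W' => (W ∩ W', W' \ W)) ?_ ?_
    · intro W' hW'
      rw [Finset.mem_coe, Finset.mem_filter, Finset.mem_powersetCard] at hW'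
      obtain ⟨⟨h1, h2⟩, h3⟩ := hW'
      rw [Finset.mem_coe, Finset.mem_product, Finset.mem_powersetCard, Finset.mem_powersetCard]
      refine ⟨⟨Finset.inter_subset_left, h3⟩, Finset.sdiff_subset.trans h1, ?_⟩
      have := Finset.card_sdiff_add_card_inter W' W
      rw [Finset.inter_comm W' W] at this
      show (W' \ W).card = m - l
      omega
    · intro A _ B _ hAB
      have h1 : W ∩ A = W ∩ B := (Prod.ext_iff.1 hAB).1
      have h2 : A \ W = B \ W := (Prod.ext_iff.1 hAB).2
      rw [← Finset.sdiff_union_inter A W, ← Finset.sdiff_union_inter B W, h2, Finset.inter_comm A,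
        Finset.inter_comm B, h1]
  rw [Finset.card_product, Finset.card_powersetCard, Finset.card_powersetCard, hWc] at this
  exact_mod_cast this

/-- Disjoint independent `k`-sets outside `T`, one for each given pair, no vertex of which is
adjacent to both ends of its pair. -/
def HasExt (k : ℕ) (T : Finset V) {m : ℕ} (e : Fin m → Sym2 V) (G : SimpleGraph V) : Prop :=
  ∃ W : Fin m → Finset V, (∀ i, (W i).card = k) ∧ (∀ i i', i ≠ i' → Disjoint (W i) (W i')) ∧
    ∀ i, Disjoint (W i) T ∧ eF G (W i) = ∅ ∧ ∀ w ∈ W i, ¬ ∀ v ∈ e i, G.Adj v w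

theorem large_of_hasExt {ι : Type*} [Fintype ι] {k r m s : ℕ} {G : SimpleGraph V} (S : ι → Finset V)
    (hS : ∀ i, (S i).card = k + 1) (hdis : ∀ i i', i ≠ i' → Disjoint (S i) (S i')) (e : Fin m → Sym2 V)
    (he : ∀ i, ∀ f ∈ eF G (S i), ∃ l, e l = f) (hext : HasExt k (Finset.univ.biUnion S) e G)
    (hr : Fintype.card ι + m = r) (hs : Fintype.card ι * (k + 1) + m * k = s) : Large s r G := by
  obtain ⟨W, hW, hWd, hWe⟩ := hext
  have hST : ∀ i, S i ⊆ Finset.univ.biUnion S := fun i => Finset.subset_biUnion_of_mem S (Finset.mem_univ i)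
  set T := Finset.univ.biUnion S with hT
  set U := T ∪ Finset.univ.biUnion W with hU
  have hTW : Disjoint T (Finset.univ.biUnion W) := by
    rw [Finset.disjoint_biUnion_right]
    exact fun i _ => (hWe i).1.symm
  have hUc : U.card = s := by
    rw [hU, Finset.card_union_of_disjoint hTW, hT,
      Finset.card_biUnion fun i _ i' _ h => hdis i i' h,
      Finset.card_biUnion fun i _ i' _ h => hWd i i' h]
    simp only [hS, hW, Finset.sum_const, Finset.card_univ, Fintype.card_fin, smul_eq_mul]
    exact hs
  refine ⟨(U.equivFinOfCardEq hUc).symm.toEmbedding.trans (Function.Embedding.subtype _), ?_⟩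
  intro Q hQ
  have hQ' := hQ.map (f := (U.equivFinOfCardEq hUc).symm.toEmbedding.trans (Function.Embedding.subtype _))
  set Q' := Q.map ((U.equivFinOfCardEq hUc).symm.toEmbedding.trans (Function.Embedding.subtype _)) with hQdef
  have hQG : G.IsNClique (r + 1) Q' := hQ'.mono (SimpleGraph.map_comap_le _ _)
  have hQU : Q' ⊆ U := by
    intro v hv
    rw [hQdef, Finset.mem_map] at hv
    obtain ⟨x, -, rfl⟩ := hv
    exact ((U.equivFinOfCardEq hUc).symm x).2
  have hclq := hQG.isClique
  set E := Finset.univ.biUnion fun i => prs (Q' ∩ S i) with hE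
  set O := Finset.univ.filter fun l => Q' ∩ W l = ∅ with hO
  have hEc : E.card = ∑ i, (Q' ∩ S i).card.choose 2 := by
    rw [hE, Finset.card_biUnion]
    · exact Finset.sum_congr rfl fun i _ => card_prs _
    · exact fun i _ i' _ h => disjoint_prs ((hdis i i' h).mono Finset.inter_subset_right Finset.inter_subset_right)
  have hEO : E ⊆ O.image e := by
    intro f hf
    rw [hE, Finset.mem_biUnion] at hf
    obtain ⟨i, -, hf⟩ := hf
    have hfG : f ∈ eF G (S i) := by
      rw [mem_eF]
      refine ⟨prs_mono Finset.inter_subset_right hf, ?_⟩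
      induction f with
      | h x y =>
        rw [mk_mem_prs, Finset.mem_inter, Finset.mem_inter] at hf
        exact hclq hf.1.1 hf.2.1.1 hf.2.2
    obtain ⟨l, hl⟩ := he i f hfG
    rw [Finset.mem_image]
    refine ⟨l, ?_, hl⟩
    rw [hO, Finset.mem_filter]
    refine ⟨Finset.mem_univ _, ?_⟩
    rw [Finset.eq_empty_iff_forall_notMem]
    intro w hw
    rw [Finset.mem_inter] at hw
    refine (hWe l).2.2 w hw.2 fun v hv => ?_
    rw [hl] at hv
    have hv' := (mem_prs.1 hf).1 v hv
    rw [Finset.mem_inter] at hv'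
    refine hclq hv'.1 hw.1 ?_
    rintro rfl
    exact Finset.disjoint_left.1 (hWe l).1 hw.2 (hST i hv'.2)
  have hEO' : E.card ≤ O.card := (Finset.card_le_card hEO).trans Finset.card_image_le
  have hWle : ∀ l, (Q' ∩ W l).card ≤ if Q' ∩ W l = ∅ then 0 else 1 := by
    intro l
    split_ifs with h
    · simp [h]
    · rw [Finset.card_le_one]
      intro x hx y hy
      rw [Finset.mem_inter] at hx hy
      by_contra hxy
      have : s(x, y) ∈ eF G (W l) := by
        rw [mem_eF, mk_mem_prs]
        exact ⟨⟨hx.2, hy.2, hxy⟩, hclq hx.1 hy.1 hxy⟩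
      rw [(hWe l).2.1] at this
      exact absurd this (Finset.notMem_empty _)
  have hcount : r + 1 ≤ ∑ i, (Q' ∩ S i).card + ∑ l, (Q' ∩ W l).card := by
    rw [← hQG.card_eq]
    calc Q'.card ≤ ((Finset.univ.biUnion fun i => Q' ∩ S i) ∪ Finset.univ.biUnion fun l => Q' ∩ W l).card := by
          refine Finset.card_le_card fun v hv => ?_
          have := hQU hv
          rw [hU, hT] at this
          simp only [Finset.mem_union, Finset.mem_biUnion, Finset.mem_univ, true_and, Finset.mem_inter] at this ⊢
          rcases this with ⟨i, hi⟩ | ⟨i, hi⟩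
          · exact Or.inl ⟨i, hv, hi⟩
          · exact Or.inr ⟨i, hv, hi⟩
      _ ≤ _ := (Finset.card_union_le _ _).trans (add_le_add Finset.card_biUnion_le Finset.card_biUnion_le)
  have h1 : ∑ i, (Q' ∩ S i).card ≤ E.card + Fintype.card ι := by
    rw [hEc, ← Finset.card_univ, Finset.card_eq_sum_ones, ← Finset.sum_add_distrib]
    refine Finset.sum_le_sum fun i _ => ?_
    rcases Nat.eq_zero_or_pos (Q' ∩ S i).card with h | h
    · omega
    · obtain ⟨c, hc⟩ : ∃ c, (Q' ∩ S i).card = c + 1 := ⟨_, (Nat.succ_pred_eq_of_pos h).symm⟩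
      rw [hc, Nat.choose_succ_succ' c 1, Nat.choose_one_right]
      omega
  have h2 : ∑ l, (Q' ∩ W l).card + O.card ≤ m := by
    have : O.card = ∑ l, if Q' ∩ W l = ∅ then 1 else 0 := by rw [hO, Finset.card_filter]
    rw [this, ← Finset.sum_add_distrib]
    calc _ ≤ ∑ l : Fin m, 1 := Finset.sum_le_sum fun l _ => by
            have := hWle l
            split_ifs at this ⊢ <;> omega
      _ = m := by simp
  omega

end

/-- The expected number of independent `m`-sets meeting a given independent `m`-set in `l` vertices,
up to the choice of the intersection. -/
noncomputable def eMeet (N m l : ℕ) : ℝ :=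
  (m.choose l * N.choose (m - l) : ℝ) * ((2 : ℝ) ^ (l.choose 2) * (1 / 2) ^ (m.choose 2))

lemma eMeet_nonneg (N m l : ℕ) : 0 ≤ eMeet N m l := by unfold eMeet; positivity

lemma two_mul_cast_choose_two (l : ℕ) : ((l.choose 2 : ℕ) : ℝ) = l * (l - 1) / 2 := by
  rw [Nat.cast_choose_two]

/-- The bound on `eMeet` for small intersections. -/
lemma eMeet_le_of_small {N m l : ℕ} {θ : ℝ} (hl : 1 ≤ l) (hlm : 2 * l ≤ m) (hN : m ≤ N)
    (hθ : (m : ℝ) ^ 2 * 2 ^ ((m : ℝ) / 4) ≤ θ * ((N : ℝ) - m)) (hθ0 : 0 ≤ θ) :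
    eMeet N m l ≤ eInd N m * θ ^ l := by
  have h1 : N.choose m * m.choose l = N.choose (m - l) * (N - (m - l)).choose l := by
    have := Nat.choose_mul (n := N) (k := m) (s := m - l) (by omega)
    rw [Nat.choose_symm (by omega)] at this
    rw [this]
    congr 2
    omega
  have h1' : (N.choose m : ℝ) * m.choose l = N.choose (m - l) * (N - (m - l)).choose l := by
    exact_mod_cast h1
  have h2 : ((N : ℝ) - m) ^ l ≤ (N - (m - l)).choose l * l.factorial := by
    have := Nat.pow_le_choose (α := ℝ) l (N - (m - l))
    rw [div_le_iff₀ (by positivity)] at this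
    refine le_trans ?_ this
    have hc : ((N : ℝ) - m) = ((N - m : ℕ) : ℝ) := by rw [Nat.cast_sub hN]
    rw [hc]
    refine pow_le_pow_left₀ (by positivity) ?_ l
    exact_mod_cast (by omega : N - m ≤ N - (m - l) + 1 - l)
  have h3 : (m.choose l : ℝ) * l.factorial ≤ (m : ℝ) ^ l := by
    have := Nat.choose_le_pow_div (α := ℝ) l m
    rwa [le_div_iff₀ (by positivity)] at this
  have h4 : (m.choose l : ℝ) ≤ (m : ℝ) ^ l := by
    refine le_trans ?_ h3
    refine le_mul_of_one_le_right (by positivity) ?_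
    exact_mod_cast Nat.one_le_iff_ne_zero.2 (Nat.factorial_ne_zero l)
  have h5 : (2 : ℝ) ^ (l.choose 2) ≤ (2 ^ ((m : ℝ) / 4)) ^ l := by
    rw [← Real.rpow_natCast 2, ← Real.rpow_natCast (2 ^ _ : ℝ), ← Real.rpow_mul (by norm_num)]
    refine Real.rpow_le_rpow_of_exponent_le (by norm_num) ?_
    rw [two_mul_cast_choose_two]
    have : 2 * (l : ℝ) ≤ m := by exact_mod_cast hlm
    have : (0 : ℝ) ≤ l := by positivity
    nlinarith
  have hC0 : (0 : ℝ) < (N - (m - l)).choose l := by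
    exact_mod_cast Nat.choose_pos (by omega)
  have key : (m.choose l : ℝ) * m.choose l * 2 ^ (l.choose 2) ≤ θ ^ l * (N - (m - l)).choose l := by
    have hf : (0 : ℝ) < l.factorial := by exact_mod_cast Nat.factorial_pos l
    refine le_of_mul_le_mul_right ?_ hf
    calc (m.choose l : ℝ) * m.choose l * 2 ^ (l.choose 2) * l.factorial
        = m.choose l * (m.choose l * l.factorial) * 2 ^ (l.choose 2) := by ring
      _ ≤ (m : ℝ) ^ l * (m : ℝ) ^ l * (2 ^ ((m : ℝ) / 4)) ^ l :=
          mul_le_mul (mul_le_mul h4 h3 (by positivity) (by positivity)) h5 (by positivity) (by positivity)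
      _ = ((m : ℝ) ^ 2 * 2 ^ ((m : ℝ) / 4)) ^ l := by rw [mul_pow, ← pow_mul, ← pow_add]; ring_nf
      _ ≤ (θ * ((N : ℝ) - m)) ^ l := pow_le_pow_left₀ (by positivity) hθ l
      _ = θ ^ l * ((N : ℝ) - m) ^ l := mul_pow _ _ _
      _ ≤ θ ^ l * ((N - (m - l)).choose l * l.factorial) :=
          mul_le_mul_of_nonneg_left h2 (by positivity)
      _ = _ := by ring
  unfold eMeet eInd
  refine le_of_mul_le_mul_right ?_ hC0
  calc (m.choose l * N.choose (m - l) : ℝ) * (2 ^ (l.choose 2) * (1 / 2) ^ (m.choose 2)) *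
        (N - (m - l)).choose l
      = m.choose l * (N.choose (m - l) * (N - (m - l)).choose l) * (2 ^ (l.choose 2) * (1 / 2) ^ (m.choose 2)) := by
        ring
    _ = (N.choose m * (1 / 2) ^ (m.choose 2)) * (m.choose l * m.choose l * 2 ^ (l.choose 2)) := by
        rw [← h1']; ring
    _ ≤ (N.choose m * (1 / 2) ^ (m.choose 2)) * (θ ^ l * (N - (m - l)).choose l) :=
        mul_le_mul_of_nonneg_left key (by positivity)
    _ = _ := by ring

/-- The bound on `eMeet` for large intersections. -/
lemma eMeet_le_of_large {N m d : ℕ} {θ : ℝ} (hdm : 2 * d ≤ m)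
    (hθ : (m : ℝ) * N ≤ θ * 2 ^ (3 * (m : ℝ) / 4 - 1 / 2)) :
    eMeet N m (m - d) ≤ θ ^ d := by
  have h1 : (2 : ℝ) ^ ((m - d).choose 2) * (1 / 2) ^ (m.choose 2) * (2 ^ (3 * (m : ℝ) / 4 - 1 / 2)) ^ d ≤ 1 := by
    rw [← Real.rpow_natCast 2, one_div, inv_pow, ← Real.rpow_natCast 2, ← Real.rpow_neg (by norm_num),
      ← Real.rpow_natCast (2 ^ _ : ℝ), ← Real.rpow_mul (by norm_num), ← Real.rpow_add (by norm_num),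
      ← Real.rpow_add (by norm_num)]
    refine Real.rpow_le_one_of_one_le_of_nonpos (by norm_num) ?_
    rw [two_mul_cast_choose_two, two_mul_cast_choose_two, Nat.cast_sub (by omega)]
    have : 2 * (d : ℝ) ≤ m := by exact_mod_cast hdm
    have : (0 : ℝ) ≤ d := by positivity
    nlinarith
  have hcm : ∀ a : ℕ, (a.choose d : ℝ) ≤ (a : ℝ) ^ d := fun a => by
    exact_mod_cast Nat.choose_le_pow a d
  have hP : (0 : ℝ) < (2 ^ (3 * (m : ℝ) / 4 - 1 / 2)) ^ d := by positivity
  unfold eMeet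
  rw [Nat.choose_symm (by omega), show m - (m - d) = d by omega]
  refine le_of_mul_le_mul_right ?_ hP
  calc (m.choose d * N.choose d : ℝ) * (2 ^ ((m - d).choose 2) * (1 / 2) ^ (m.choose 2)) *
        (2 ^ (3 * (m : ℝ) / 4 - 1 / 2)) ^ d
      = (m.choose d * N.choose d : ℝ) * (2 ^ ((m - d).choose 2) * (1 / 2) ^ (m.choose 2) *
        (2 ^ (3 * (m : ℝ) / 4 - 1 / 2)) ^ d) := by ring
    _ ≤ ((m : ℝ) ^ d * (N : ℝ) ^ d) * 1 :=
        mul_le_mul (mul_le_mul (hcm m) (hcm N) (by positivity) (by positivity)) h1 (by positivity)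
          (by positivity)
    _ = (m * N : ℝ) ^ d := by rw [mul_one, mul_pow]
    _ ≤ (θ * 2 ^ (3 * (m : ℝ) / 4 - 1 / 2)) ^ d := pow_le_pow_left₀ (by positivity) hθ d
    _ = _ := mul_pow _ _ _

namespace Win

variable {k r L n : ℕ} (h : Win k r L n)
include h

/-- Intersections of positive size contribute little to the second moment. -/
lemma eMeet_le {N m l : ℕ} (hN : N ≤ n) (hN' : n ≤ 2 * N) (hm : k ≤ m) (hm' : m ≤ k + 1) (hl : 1 ≤ l)
    (hlm : l ≤ m) :
    eMeet N m l ≤ (if 2 * l ≤ m then eInd N m * (2 ^ (-(k : ℝ) / 5)) ^ l else 0) +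
      (2 ^ (-(k : ℝ) / 5)) ^ (m - l) := by
  have hL := h.L_ge
  have hn := h.n_big
  have hkL := h.k_le
  have hkb := h.k_big.2.2
  have hk0 : (0 : ℝ) ≤ k := by positivity
  have hL0 : (0 : ℝ) ≤ L := by positivity
  have hkl : 10 ^ 18 * (L : ℝ) ≤ k := by nlinarith
  have hm1 : (m : ℝ) ≤ k + 1 := by exact_mod_cast hm'
  have hm2 : (k : ℝ) ≤ m := by exact_mod_cast hm
  have hk1 : (1 : ℝ) ≤ k := by nlinarith
  have hmL : (m : ℝ) ≤ 2 ^ ((L : ℝ) + 1) := by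
    rw [Real.rpow_add (by norm_num), Real.rpow_one]; linarith
  have hθ0 : (0 : ℝ) < 2 ^ (-(k : ℝ) / 5) := by positivity
  have hNr : (N : ℝ) ≤ n := by exact_mod_cast hN
  have hNr' : (n : ℝ) ≤ 2 * N := by exact_mod_cast hN'
  have hnr : 10 * (k : ℝ) ≤ n := by exact_mod_cast hn
  split_ifs with hs
  · refine (eMeet_le_of_small hl hs (by omega) ?_ hθ0.le).trans (le_add_of_nonneg_right (by positivity))
    calc (m : ℝ) ^ 2 * 2 ^ ((m : ℝ) / 4) ≤ (2 ^ ((L : ℝ) + 1)) ^ 2 * 2 ^ (((k : ℝ) + 1) / 4) := by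
          refine mul_le_mul (pow_le_pow_left₀ (by positivity) hmL 2)
            (Real.rpow_le_rpow_of_exponent_le (by norm_num) (by linarith)) (by positivity) (by positivity)
      _ = 2 ^ (((L : ℝ) + 1) * 2 + ((k : ℝ) + 1) / 4) := by
          rw [← Real.rpow_natCast (2 ^ _ : ℝ), ← Real.rpow_mul (by norm_num), ← Real.rpow_add (by norm_num)]
          norm_num
      _ ≤ 2 ^ (-(k : ℝ) / 5 + ((k : ℝ) / 2 - 2)) :=
          Real.rpow_le_rpow_of_exponent_le (by norm_num) (by linarith)
      _ = 2 ^ (-(k : ℝ) / 5) * (2 ^ ((k : ℝ) / 2) / 4) := by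
          rw [Real.rpow_add (by norm_num), Real.rpow_sub (by norm_num)]; norm_num
      _ ≤ _ := by
          refine mul_le_mul_of_nonneg_left ?_ hθ0.le
          have := h.hlo
          linarith
  · obtain ⟨d, hd, rfl⟩ : ∃ d, 2 * d ≤ m ∧ l = m - d := ⟨m - l, by omega, by omega⟩
    rw [show m - (m - d) = d by omega, zero_add]
    refine eMeet_le_of_large hd ?_
    calc (m : ℝ) * N ≤ 2 ^ ((L : ℝ) + 1) * 2 ^ ((k : ℝ) / 2 + 2 * L) :=
          mul_le_mul hmL (hNr.trans h.hup) (by positivity) (by positivity)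
      _ = 2 ^ ((L : ℝ) + 1 + ((k : ℝ) / 2 + 2 * L)) := by rw [← Real.rpow_add (by norm_num)]
      _ ≤ 2 ^ (-(k : ℝ) / 5 + (3 * (m : ℝ) / 4 - 1 / 2)) :=
          Real.rpow_le_rpow_of_exponent_le (by norm_num) (by linarith)
      _ = _ := by rw [← Real.rpow_add (by norm_num)]

end Win

section Pairs

variable {V : Type*} [Fintype V] {k r L : ℕ}

lemma pr_eF_two_card_le (W W' : Finset V) (t : ℕ) {m : ℕ} (hW : W.card = m) (hW' : W'.card = m) :
    pr V (fun G => (eF G W).card ≤ t ∧ (eF G W').card ≤ t) ≤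
      ((m.choose 2 : ℕ) + 1 : ℝ) ^ (2 * t) * ((1 / 2) ^ (m.choose 2) *
        (2 ^ ((W ∩ W').card.choose 2) * (1 / 2) ^ (m.choose 2))) := by
  set Q := prs W' \ prs W with hQ
  have hQc : Q.card + (W ∩ W').card.choose 2 = m.choose 2 := by
    have := Finset.card_sdiff_add_card_inter (prs W') (prs W)
    rw [← prs_inter, card_prs, card_prs, hW', Finset.inter_comm W' W] at this
    exact this
  have hQd : ∀ e ∈ Q, ¬ e.IsDiag := fun e he => not_isDiag_of_mem_prs e (Finset.mem_sdiff.1 he).1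
  have hdisj : Disjoint (prs W : Set (Sym2 V)) (Q : Set (Sym2 V)) := by
    rw [Finset.disjoint_coe]
    exact Finset.disjoint_sdiff
  have hdep : DepOn (fun G : SimpleGraph V => (Q.filter fun e => e ∈ G.edgeSet).card ≤ t)
      (Q : Set (Sym2 V)) := by
    intro G G' hG
    have : (Q.filter fun e => e ∈ G.edgeSet) = Q.filter fun e => e ∈ G'.edgeSet :=
      Finset.filter_congr fun e he => depOn_mem (Q := (Q : Set (Sym2 V))) he G G' hG
    show _ ≤ _ ↔ _ ≤ _
    rw [this]
  calc pr V (fun G => (eF G W).card ≤ t ∧ (eF G W').card ≤ t)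
      ≤ pr V (fun G => (eF G W).card ≤ t ∧ (Q.filter fun e => e ∈ G.edgeSet).card ≤ t) := by
        refine pr_mono fun G hG => ⟨hG.1, (Finset.card_le_card ?_).trans hG.2⟩
        exact Finset.filter_subset_filter _ Finset.sdiff_subset
    _ = pr V (fun G => (eF G W).card ≤ t) * pr V (fun G => (Q.filter fun e => e ∈ G.edgeSet).card ≤ t) :=
        pr_and_of_indep (depOn_eF W fun E => E.card ≤ t) hdep hdisj
    _ ≤ (((m.choose 2 : ℕ) + 1 : ℝ) ^ t * (1 / 2) ^ (m.choose 2)) *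
        (((m.choose 2 : ℕ) + 1 : ℝ) ^ t * (1 / 2) ^ Q.card) := by
        refine mul_le_mul ?_ ?_ (pr_nonneg _) (by positivity)
        · have := pr_eF_card_le W t
          rwa [hW] at this
        · refine (pr_card_le Q hQd t).trans (mul_le_mul_of_nonneg_right ?_ (by positivity))
          refine pow_le_pow_left₀ (by positivity) ?_ t
          have : (Q.card : ℝ) ≤ (m.choose 2 : ℕ) := by exact_mod_cast (by omega : Q.card ≤ m.choose 2)
          linarith
    _ = _ := by
        have : (1 / 2 : ℝ) ^ Q.card = 2 ^ ((W ∩ W').card.choose 2) * (1 / 2) ^ (m.choose 2) := by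
          rw [← hQc, pow_add, mul_comm, mul_assoc, ← mul_pow]
          norm_num
        rw [this, two_mul, pow_add]
        ring

lemma ite_not_disjoint_le {W W' : Finset V} (hW : W.card = k + 1) (hW' : W'.card = k + 1) {x p q : ℝ}
    {R : Prop} (hR : R → ¬ Disjoint W W') (hp : 0 ≤ p) (hq : 0 ≤ q) (h1 : x ≤ p) (h2 : x ≤ q) :
    (if R then x else 0) ≤
      (if W' = W then p else 0) + if (W ∩ W').card ∈ Finset.Icc 1 k then q else 0 := by
  have n1 : (0 : ℝ) ≤ if W' = W then p else 0 := by split_ifs <;> simp [hp]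
  have n2 : (0 : ℝ) ≤ if (W ∩ W').card ∈ Finset.Icc 1 k then q else 0 := by split_ifs <;> simp [hq]
  by_cases hd : R
  swap
  · rw [if_neg hd]
    exact add_nonneg n1 n2
  rw [if_pos hd]
  by_cases hWW : W' = W
  · rw [if_pos hWW]
    exact h1.trans (le_add_of_nonneg_right n2)
  · rw [if_neg hWW, if_pos, zero_add]
    · exact h2
    · rw [Finset.mem_Icc]
      constructor
      · rw [Nat.one_le_iff_ne_zero, Ne, Finset.card_eq_zero, ← Finset.disjoint_iff_inter_eq_empty]
        exact hR hd
      · by_contra! hlt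
        have e1 : W ∩ W' = W := Finset.eq_of_subset_of_card_le Finset.inter_subset_left (by omega)
        have e2 : W ∩ W' = W' := Finset.eq_of_subset_of_card_le Finset.inter_subset_right (by omega)
        exact hWW (e2.symm.trans e1)

namespace Win

lemma sum_two_sparse_le (h : Win k r L (Fintype.card V)) {t : ℕ} (ht : t ≤ r + 1) :
    ∑ W ∈ (Finset.univ : Finset V).powersetCard (k + 1),
      ∑ W' ∈ (Finset.univ : Finset V).powersetCard (k + 1),
        (if (W ∩ W').card ∈ Finset.Icc 1 k then
          pr V (fun G => (eF G W).card ≤ t ∧ (eF G W').card ≤ t) else 0) ≤ 2 ^ (-(k : ℝ) / 10) := by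
  set n := Fintype.card V with hn
  set c : ℝ := (((k + 1).choose 2 : ℕ) + 1 : ℝ) ^ (2 * t) with hc
  set θ : ℝ := 2 ^ (-(k : ℝ) / 5) with hθ
  have hkL := h.k_le
  have hL := h.L_ge
  have hk1 : (1 : ℝ) ≤ k := le_trans (by norm_num) h.k_big.1
  have hθ0 : 0 < θ := by rw [hθ]; positivity
  have hθ1 : θ ≤ 1 := Real.rpow_le_one_of_one_le_of_nonpos (by norm_num) (by linarith)
  have hnb := h.n_big
  have step : ∀ l ∈ Finset.Icc 1 k, eMeet n (k + 1) l ≤ (k + 1) * θ := by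
    intro l hl
    rw [Finset.mem_Icc] at hl
    refine (h.eMeet_le le_rfl (by omega) (by omega) le_rfl hl.1 (by omega)).trans ?_
    have e1 : (2 ^ (-(k : ℝ) / 5) : ℝ) ^ (k + 1 - l) ≤ θ :=
      pow_le_of_le_one hθ0.le hθ1 (by omega)
    have e2 : (2 ^ (-(k : ℝ) / 5) : ℝ) ^ l ≤ θ := pow_le_of_le_one hθ0.le hθ1 (by omega)
    have e3 : (if 2 * l ≤ k + 1 then eInd n (k + 1) * (2 ^ (-(k : ℝ) / 5)) ^ l else 0) ≤ k * θ := by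
      split_ifs
      · exact mul_le_mul h.hc e2 (by positivity) (by positivity)
      · positivity
    linarith
  have hcb : c ≤ 2 ^ (4 * L * (r + 1) : ℝ) := by
    have h1 : (((k + 1).choose 2 : ℕ) + 1 : ℝ) ≤ 2 ^ (2 * L : ℝ) := by
      rw [two_mul_cast_choose_two, two_mul, Real.rpow_add (by norm_num)]
      push_cast
      have hk2 : (2 : ℝ) ≤ k := le_trans (by norm_num) h.k_big.1
      have := mul_le_mul hkL hkL (by linarith) (by linarith)
      nlinarith
    have h1' : (1 : ℝ) ≤ 2 ^ (2 * L : ℝ) := Real.one_le_rpow (by norm_num) (by positivity)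
    calc c ≤ (2 ^ (2 * L : ℝ)) ^ (2 * t) := pow_le_pow_left₀ (by positivity) h1 _
      _ ≤ (2 ^ (2 * L : ℝ)) ^ (2 * (r + 1)) := pow_le_pow_right₀ h1' (by omega)
      _ = _ := by
        rw [← Real.rpow_natCast (2 ^ _ : ℝ), ← Real.rpow_mul (by norm_num)]
        push_cast
        ring_nf
  calc _ ≤ ∑ W ∈ (Finset.univ : Finset V).powersetCard (k + 1),
      ∑ W' ∈ (Finset.univ : Finset V).powersetCard (k + 1),
        (if (W ∩ W').card ∈ Finset.Icc 1 k then c * ((1 / 2) ^ ((k + 1).choose 2) *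
        (2 ^ ((W ∩ W').card.choose 2) * (1 / 2) ^ ((k + 1).choose 2))) else 0) := by
        refine Finset.sum_le_sum fun W hW => Finset.sum_le_sum fun W' hW' => ?_
        split_ifs
        · exact pr_eF_two_card_le W W' t (Finset.mem_powersetCard.1 hW).2 (Finset.mem_powersetCard.1 hW').2
        · exact le_rfl
    _ ≤ _ := sum_pairs_le _ _ _ (fun l => c * ((1 / 2) ^ ((k + 1).choose 2) *
        (2 ^ (l.choose 2) * (1 / 2) ^ ((k + 1).choose 2)))) (fun l => by positivity)
    _ = (eInd n (k + 1) * c) * ∑ l ∈ Finset.Icc 1 k, eMeet n (k + 1) l := by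
        rw [Finset.mul_sum, Finset.mul_sum, Finset.card_univ]
        refine Finset.sum_congr rfl fun l _ => ?_
        unfold eMeet eInd
        ring
    _ ≤ (k * 2 ^ (4 * L * (r + 1) : ℝ)) * (k * ((k + 1) * θ)) := by
        refine mul_le_mul (mul_le_mul h.hc hcb (by positivity) (by positivity)) ?_
          (Finset.sum_nonneg fun l _ => eMeet_nonneg _ _ _) (by positivity)
        refine (Finset.sum_le_card_nsmul _ _ _ step).trans_eq ?_
        rw [Nat.card_Icc, nsmul_eq_mul]
        simp
    _ ≤ (2 ^ (L : ℝ) * 2 ^ (4 * L * (r + 1) : ℝ)) * (2 ^ (L : ℝ) * (2 ^ ((L : ℝ) + 1) * θ)) := by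
        have : (k : ℝ) + 1 ≤ 2 ^ ((L : ℝ) + 1) := by
          rw [Real.rpow_add (by norm_num), Real.rpow_one]; linarith
        refine mul_le_mul (mul_le_mul_of_nonneg_right hkL (by positivity)) ?_ (by positivity) (by positivity)
        exact mul_le_mul hkL (mul_le_mul_of_nonneg_right this hθ0.le) (by positivity) (by positivity)
    _ = 2 ^ (L + 4 * L * (r + 1) + (L + (L + 1 + -(k : ℝ) / 5))) := by
        rw [hθ, ← Real.rpow_add (by norm_num), ← Real.rpow_add (by norm_num), ← Real.rpow_add (by norm_num),
          ← Real.rpow_add (by norm_num)]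
    _ ≤ _ := by
        refine Real.rpow_le_rpow_of_exponent_le (by norm_num) ?_
        have h2 := h.r_le
        have h3 := h.k_big.2.2
        nlinarith

lemma pr_exists_meeting_sparse_le (h : Win k r L (Fintype.card V)) {t : ℕ} (ht : t ≤ r + 1) :
    pr V (fun G => ∃ W W' : Finset V, W ≠ W' ∧ ¬ Disjoint W W' ∧ W.card = k + 1 ∧ W'.card = k + 1 ∧
      (eF G W).card ≤ t ∧ (eF G W').card ≤ t) ≤ 2 ^ (-(k : ℝ) / 10) := by
  refine le_trans ?_ (h.sum_two_sparse_le ht)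
  refine le_trans (pr_mono (Ψ := fun G => ∃ W ∈ (Finset.univ : Finset V).powersetCard (k + 1),
    ∃ W' ∈ (Finset.univ : Finset V).powersetCard (k + 1), (W ∩ W').card ∈ Finset.Icc 1 k ∧
      ((eF G W).card ≤ t ∧ (eF G W').card ≤ t)) ?_) ?_
  · rintro G ⟨W, W', h1, h2, h3, h4, h5⟩
    refine ⟨W, by simp [h3], W', by simp [h4], ?_, h5⟩
    rw [Finset.mem_Icc]
    constructor
    · rw [Nat.one_le_iff_ne_zero, Ne, Finset.card_eq_zero, ← Finset.disjoint_iff_inter_eq_empty]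
      exact h2
    · by_contra! hlt
      have e1 : W ∩ W' = W := Finset.eq_of_subset_of_card_le Finset.inter_subset_left (by omega)
      have e2 : W ∩ W' = W' := Finset.eq_of_subset_of_card_le Finset.inter_subset_right (by omega)
      exact h1 (e1.symm.trans e2)
  · refine (pr_exists_le _ _).trans (Finset.sum_le_sum fun W _ => (pr_exists_le _ _).trans
      (Finset.sum_le_sum fun W' _ => ?_))
    split_ifs with hI
    · exact pr_mono fun G hG => hG.2
    · refine (pr_mono (Ψ := fun _ => False) fun G hG => hI hG.1).trans ?_
      rw [pr_false]

lemma pr_not_many_le (h : Win k r L (Fintype.card V)) {i ξ : ℕ} (hi : i ≤ r + 1)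
    (hlam : 1 / (k : ℝ) ≤ lam (Fintype.card V) k i) (hξ : 2 * (ξ : ℝ) ≤ lam (Fintype.card V) k i) :
    pr V (fun G => ¬ Many ξ (k + 1) i G) ≤ 8 / lam (Fintype.card V) k i := by
  set n := Fintype.card V with hn
  set lm := lam n k i with hlm
  have hk1 : (1 : ℝ) ≤ k := le_trans (by norm_num) h.k_big.1
  have hlm0 : 0 < lm := lt_of_lt_of_le (by positivity) hlam
  set s := (Finset.univ : Finset V).powersetCard (k + 1) with hs
  have hpr : ∀ W ∈ s, pr V (fun G => (eF G W).card = i) =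
      (((k + 1).choose 2).choose i : ℝ) * (1 / 2) ^ ((k + 1).choose 2) := by
    intro W hW
    rw [pr_eF_card_eq, (Finset.mem_powersetCard.1 hW).2]
  have hsum : ∑ W ∈ s, pr V (fun G => (eF G W).card = i) = lm := by
    rw [Finset.sum_congr rfl hpr, Finset.sum_const, hs, Finset.card_powersetCard, Finset.card_univ,
      nsmul_eq_mul, hlm]
    unfold lam eInd
    ring
  obtain ⟨R, hR⟩ : ∃ R : Finset V → Finset V → Prop, ∀ W W', R W W' ↔ ¬ Disjoint W W' :=
    ⟨_, fun _ _ => Iff.rfl⟩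
  have hch := pr_count_le s (fun W G => (eF G W).card = i) R
    (fun W _ W' _ hd => by
      rw [hR, not_not] at hd
      refine (pr_and_of_indep (depOn_eF W fun E => E.card = i) (depOn_eF W' fun E => E.card = i) ?_).le
      rw [Finset.disjoint_coe]
      exact disjoint_prs hd) (half_pos hlm0)
  rw [hsum] at hch
  have hsig : ∑ W ∈ s, ∑ W' ∈ s, (if R W W' then
      pr V (fun G => (eF G W).card = i ∧ (eF G W').card = i) else 0) ≤ lm + lm := by
    have e1 : ∀ W ∈ s, ∑ W' ∈ s, (if R W W' then
        pr V (fun G => (eF G W).card = i ∧ (eF G W').card = i) else 0) ≤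
        pr V (fun G => (eF G W).card = i) + ∑ W' ∈ s, (if (W ∩ W').card ∈ Finset.Icc 1 k then
          pr V (fun G => (eF G W).card ≤ r + 1 ∧ (eF G W').card ≤ r + 1) else 0) := by
      intro W hW
      have e2 : pr V (fun G => (eF G W).card = i) =
          ∑ W' ∈ s, if W' = W then pr V (fun G => (eF G W).card = i) else 0 := by
        rw [Finset.sum_ite_eq' s W, if_pos hW]
      rw [e2, ← Finset.sum_add_distrib]
      refine Finset.sum_le_sum fun W' hW' => ?_
      rw [hs, Finset.mem_powersetCard] at hW hW'
      exact ite_not_disjoint_le hW.2 hW'.2 (hR W W').1 (pr_nonneg _) (pr_nonneg _) (pr_mono fun G hG => hG.1)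
        (pr_mono fun G hG => ⟨hG.1.le.trans hi, hG.2.le.trans hi⟩)
    refine (Finset.sum_le_sum e1).trans ?_
    rw [Finset.sum_add_distrib, hsum]
    refine add_le_add le_rfl ((h.sum_two_sparse_le le_rfl).trans (le_trans ?_ hlam))
    rw [neg_div, Real.rpow_neg (by norm_num), one_div]
    refine inv_anti₀ (by linarith) (h.k_le.trans ?_)
    refine Real.rpow_le_rpow_of_exponent_le (by norm_num) ?_
    have h3 := h.k_big.2.2
    have hL := h.L_ge
    nlinarith
  refine (pr_mono fun G hG => ?_).trans ((hch.trans (div_le_div_of_nonneg_right hsig (by positivity))).trans_eq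
    (by field_simp; norm_num))
  unfold Many at hG
  rw [not_le] at hG
  have : ((s.filter fun W => (eF G W).card = i).card : ℝ) < ξ := by exact_mod_cast hG
  have : ((s.filter fun W => (eF G W).card = i).card : ℝ) ≤ lm - lm / 2 := by linarith
  convert this

end Win

end Pairs

section Extension

variable {V : Type*} [Fintype V]

/-- `W` is independent and no vertex of `W` is adjacent to both ends of the pair `f`. -/
def Avoids (f : Sym2 V) (W : Finset V) (G : SimpleGraph V) : Prop :=
  eF G W = ∅ ∧ ∀ w ∈ W, ¬ ∀ v ∈ f, G.Adj v w

lemma pr_no_edge_and_avoid {T U : Finset V} (hTU : Disjoint U T) {Q : Finset (Sym2 V)} (hQ : Q ⊆ prs U)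
    (g : V → Sym2 V) (hg : ∀ w ∈ U, g w ∈ prs T) :
    pr V (fun G => (∀ f ∈ Q, f ∉ G.edgeSet) ∧ ∀ w ∈ U, ¬ ∀ v ∈ g w, G.Adj v w) =
      (1 / 2) ^ Q.card * (3 / 4) ^ U.card := by
  have h1 : pr V (fun G => ∀ f ∈ Q, f ∉ G.edgeSet) = (1 / 2) ^ Q.card := by
    rw [← pr_pattern Q (fun e he => not_isDiag_of_mem_prs e (hQ he)) ∅]
    simp
  have hdep : ∀ w ∈ U, DepOn (fun G : SimpleGraph V => ¬ ∀ v ∈ g w, G.Adj v w) {f | ∃ v ∈ T, f = s(v, w)} := by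
    intro w hw
    refine DepOn.not (DepOn.forall fun v => ?_)
    by_cases hv : v ∈ g w
    · have : v ∈ T := (mem_prs.1 (hg w hw)).1 v hv
      have hd : DepOn (fun G : SimpleGraph V => G.Adj v w) {f | ∃ v ∈ T, f = s(v, w)} :=
        depOn_adj ⟨v, this, rfl⟩
      intro G G' hG
      exact forall_congr' fun _ => hd G G' hG
    · intro G G' _
      exact ⟨fun _ h => absurd h hv, fun _ h => absurd h hv⟩
  have hpd : (U : Set V).PairwiseDisjoint fun w => {f : Sym2 V | ∃ v ∈ T, f = s(v, w)} := by
    intro w hw w' hw' hne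
    refine Set.disjoint_left.2 ?_
    rintro f ⟨v, hv, rfl⟩ ⟨v', hv', hf⟩
    rw [Sym2.eq_iff] at hf
    rcases hf with ⟨-, h⟩ | ⟨-, h⟩
    · exact hne h
    · rw [h] at hw
      exact Finset.disjoint_left.1 hTU hw hv'
  have h2 : pr V (fun G => ∀ w ∈ U, ¬ ∀ v ∈ g w, G.Adj v w) = (3 / 4) ^ U.card := by
    rw [pr_forall_of_indep U (fun w G => ¬ ∀ v ∈ g w, G.Adj v w) _ hdep hpd, ← Finset.prod_const]
    refine Finset.prod_congr rfl fun w hw => ?_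
    have hgw := hg w hw
    revert hgw
    induction g w with
    | h x y =>
      intro hgw
      rw [mk_mem_prs] at hgw
      have hwT := Finset.disjoint_left.1 hTU hw
      have := pr_adj_and_adj (x := x) (y := y) (w := w) (fun h => hwT (h ▸ hgw.1))
        (fun h => hwT (h ▸ hgw.2.1)) hgw.2.2
      rw [pr_not]
      simp only [Sym2.mem_iff, forall_eq_or_imp, forall_eq]
      rw [this]
      norm_num
  rw [pr_and_of_indep (Q := (Q : Set (Sym2 V))) (Q' := {f | ∃ v ∈ T, ∃ w ∈ U, f = s(v, w)}) ?_ ?_ ?_, h1, h2]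
  · intro G G' hG
    exact forall₂_congr fun f hf => (depOn_mem (Q := (Q : Set (Sym2 V))) hf).not G G' hG
  · intro G G' hG
    exact forall₂_congr fun w hw => hdep w hw G G' fun x y hxy => by
      obtain ⟨v, hv, e⟩ := hxy
      exact hG x y ⟨v, hv, w, hw, e⟩
  · refine Set.disjoint_left.2 ?_
    rintro f hf ⟨v, hv, w, hw, rfl⟩
    have := hQ hf
    rw [mk_mem_prs] at this
    exact Finset.disjoint_left.1 hTU this.1 hv

lemma eF_eq_empty_iff {G : SimpleGraph V} {W : Finset V} :
    eF G W = ∅ ↔ ∀ f ∈ prs W, f ∉ G.edgeSet := by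
  unfold eF
  rw [Finset.filter_eq_empty_iff]

lemma pr_avoids {T W : Finset V} (hW : Disjoint W T) {f : Sym2 V} (hf : f ∈ prs T) :
    pr V (Avoids f W) = (1 / 2) ^ (W.card.choose 2) * (3 / 4) ^ W.card := by
  rw [← card_prs, ← pr_no_edge_and_avoid hW (Finset.Subset.refl (prs W)) (fun _ => f) fun _ _ => hf]
  unfold Avoids
  simp_rw [eF_eq_empty_iff]

lemma pr_avoids_two_le {T W W' : Finset V} (hW : Disjoint W T) (hW' : Disjoint W' T) {f f' : Sym2 V}
    (hf : f ∈ prs T) (hf' : f' ∈ prs T) {k : ℕ} (hk : W.card = k) (hk' : W'.card = k) :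
    pr V (fun G => Avoids f W G ∧ Avoids f' W' G) ≤
      ((1 / 2) ^ (k.choose 2) * (3 / 4) ^ k) *
        ((2 ^ ((W ∩ W').card.choose 2) * (1 / 2) ^ (k.choose 2)) * (3 / 4) ^ (k - (W ∩ W').card)) := by
  have hU : Disjoint (W ∪ W') T := Finset.disjoint_union_left.2 ⟨hW, hW'⟩
  have hQ : prs W ∪ prs W' ⊆ prs (W ∪ W') :=
    Finset.union_subset (prs_mono Finset.subset_union_left) (prs_mono Finset.subset_union_right)
  have h1 := pr_no_edge_and_avoid hU hQ (fun w => if w ∈ W then f else f')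
    (fun w _ => by
      by_cases hw : w ∈ W
      · rw [if_pos hw]; exact hf
      · rw [if_neg hw]; exact hf')
  refine (pr_mono (fun G hG => ?_)).trans (h1.le.trans_eq ?_)
  · obtain ⟨⟨h2, h3⟩, h4, h5⟩ := hG
    rw [eF_eq_empty_iff] at h2 h4
    refine ⟨fun f hf => (Finset.mem_union.1 hf).elim (h2 f) (h4 f), fun w hw => ?_⟩
    by_cases hwW : w ∈ W
    · rw [if_pos hwW]; exact h3 w hwW
    · rw [if_neg hwW]; exact h5 w ((Finset.mem_union.1 hw).resolve_left hwW)
  · have e1 : (prs W ∪ prs W').card + (W ∩ W').card.choose 2 = k.choose 2 + k.choose 2 := by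
      have := Finset.card_union_add_card_inter (prs W) (prs W')
      rw [← prs_inter, card_prs, card_prs, card_prs, hk, hk'] at this
      exact this
    have e2 : (W ∪ W').card = k + (k - (W ∩ W').card) := by
      have := Finset.card_union_add_card_inter W W'
      have : (W ∩ W').card ≤ W.card := Finset.card_le_card Finset.inter_subset_left
      omega
    have e3 : (1 / 2 : ℝ) ^ (prs W ∪ prs W').card =
        (1 / 2) ^ (k.choose 2) * (2 ^ ((W ∩ W').card.choose 2) * (1 / 2) ^ (k.choose 2)) := by
      have : (1 / 2 : ℝ) ^ (k.choose 2) * (1 / 2 : ℝ) ^ (k.choose 2) =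
          (1 / 2) ^ (prs W ∪ prs W').card * (1 / 2) ^ ((W ∩ W').card.choose 2) := by
        rw [← pow_add, ← pow_add, e1]
      calc (1 / 2 : ℝ) ^ (prs W ∪ prs W').card
          = (1 / 2) ^ (prs W ∪ prs W').card * ((1 / 2) ^ ((W ∩ W').card.choose 2) *
              2 ^ ((W ∩ W').card.choose 2)) := by rw [← mul_pow]; norm_num
        _ = ((1 / 2 : ℝ) ^ (k.choose 2) * (1 / 2 : ℝ) ^ (k.choose 2)) *
              2 ^ ((W ∩ W').card.choose 2) := by rw [this]; ring
        _ = _ := by ring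
    rw [e3, e2, pow_add]
    ring

/-- Disjoint avoiding sets exist if the number of intersecting pairs of avoiding sets is small on
average. -/
lemma pr_not_hasExt_le {T : Finset V} {k m : ℕ} (hk : 1 ≤ k) (hm : 1 ≤ m) (e : Fin m → Sym2 V)
    (he : ∀ i, e i ∈ prs T) {N : ℕ} (hN : (Finset.univ \ T).card = N) {y δ : ℝ}
    (hy : y = eInd N k * (3 / 4) ^ k) (hy0 : 0 < y)
    (hδ : ∑ l ∈ Finset.Icc 1 k, eMeet N k l * (3 / 4) ^ (k - l) ≤ y * δ) :
    pr V (fun G => ¬ HasExt k T e G) ≤ 8 * m ^ 4 * δ := by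
  set s := ((Finset.univ : Finset V) \ T).powersetCard k with hs
  have hsT : ∀ W ∈ s, Disjoint W T ∧ W.card = k := fun W hW => by
    rw [hs, Finset.mem_powersetCard] at hW
    exact ⟨Finset.disjoint_of_subset_left hW.1 Finset.sdiff_disjoint, hW.2⟩
  obtain ⟨R, hR⟩ : ∃ R : Finset V → Finset V → Prop, ∀ W W', R W W' ↔ (W ∩ W').card ∈ Finset.Icc 1 k :=
    ⟨_, fun _ _ => Iff.rfl⟩
  have hRd : ∀ W ∈ s, ∀ W' ∈ s, ¬ R W W' → Disjoint W W' := by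
    intro W hW W' _ h
    rw [hR, Finset.mem_Icc] at h
    have : (W ∩ W').card ≤ W.card := Finset.card_le_card Finset.inter_subset_left
    rw [(hsT W hW).2] at this
    rw [Finset.disjoint_iff_inter_eq_empty, ← Finset.card_eq_zero]
    omega
  have hsum : ∀ i, ∑ W ∈ s, pr V (Avoids (e i) W) = y := by
    intro i
    rw [Finset.sum_congr rfl (g := fun _ => (1 / 2 : ℝ) ^ (k.choose 2) * (3 / 4) ^ k), Finset.sum_const, hs,
      Finset.card_powersetCard, hN, nsmul_eq_mul, hy]
    · unfold eInd; ring
    · intro W hW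
      rw [pr_avoids (hsT W hW).1 (he i), (hsT W hW).2]
  have hD : ∀ i i', ∑ W ∈ s, ∑ W' ∈ s, (if R W W' then
      pr V (fun G => Avoids (e i) W G ∧ Avoids (e i') W' G) else 0) ≤ y ^ 2 * δ := by
    intro i i'
    calc _ ≤ ∑ W ∈ s, ∑ W' ∈ s, (if (W ∩ W').card ∈ Finset.Icc 1 k then
        ((1 / 2 : ℝ) ^ (k.choose 2) * (3 / 4) ^ k) *
        ((2 ^ ((W ∩ W').card.choose 2) * (1 / 2) ^ (k.choose 2)) * (3 / 4) ^ (k - (W ∩ W').card)) else 0) := by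
          refine Finset.sum_le_sum fun W hW => Finset.sum_le_sum fun W' hW' => ?_
          by_cases h : R W W'
          · rw [if_pos h, if_pos ((hR _ _).1 h)]
            exact pr_avoids_two_le (hsT W hW).1 (hsT W' hW').1 (he i) (he i') (hsT W hW).2 (hsT W' hW').2
          · rw [if_neg h, if_neg (fun h' => h ((hR _ _).2 h'))]
      _ ≤ _ := sum_pairs_le _ _ _ (fun l => ((1 / 2 : ℝ) ^ (k.choose 2) * (3 / 4) ^ k) *
        ((2 ^ (l.choose 2) * (1 / 2) ^ (k.choose 2)) * (3 / 4) ^ (k - l))) (fun l => by positivity)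
      _ = y * ∑ l ∈ Finset.Icc 1 k, eMeet N k l * (3 / 4) ^ (k - l) := by
          rw [hy, hN, Finset.mul_sum, Finset.mul_sum]
          refine Finset.sum_congr rfl fun l _ => ?_
          unfold eMeet eInd
          ring
      _ ≤ y * (y * δ) := mul_le_mul_of_nonneg_left hδ hy0.le
      _ = _ := by ring
  have hδ0 : 0 ≤ δ := by
    have : 0 ≤ y * δ := le_trans (Finset.sum_nonneg fun l _ => mul_nonneg (eMeet_nonneg _ _ _) (by positivity)) hδ
    exact nonneg_of_mul_nonneg_right this hy0
  have hm' : (1 : ℝ) ≤ m := by exact_mod_cast hm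
  have b1 : ∀ i, pr V (fun G => ((s.filter fun W => Avoids (e i) W G).card : ℝ) ≤ y / 2) ≤ 4 * δ := by
    intro i
    have := pr_count_le s (fun W => Avoids (e i) W) R (fun W hW W' hW' h => by
      refine (pr_avoids_two_le (hsT W hW).1 (hsT W' hW').1 (he i) (he i) (hsT W hW).2 (hsT W' hW').2).trans_eq ?_
      rw [pr_avoids (hsT W hW).1 (he i), pr_avoids (hsT W' hW').1 (he i), (hsT W hW).2, (hsT W' hW').2,
        Finset.disjoint_iff_inter_eq_empty.1 (hRd W hW W' hW' h)]
      simp) (half_pos hy0)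
    rw [hsum i, sub_half] at this
    refine this.trans ((div_le_div_of_nonneg_right (hD i i) (by positivity)).trans_eq ?_)
    field_simp
    norm_num
  have b2 : ∀ q : Fin m × Fin m, pr V (fun G => y ^ 2 / (4 * m ^ 2) ≤
      (((s ×ˢ s).filter fun p => R p.1 p.2 ∧ Avoids (e q.1) p.1 G ∧ Avoids (e q.2) p.2 G).card : ℝ)) ≤
      4 * m ^ 2 * δ := by
    intro q
    refine (markov (fun G => Nat.cast_nonneg _) (by positivity)).trans ?_
    have hex := ex_card_filter (V := V) (s ×ˢ s)
      (fun p G => R p.1 p.2 ∧ Avoids (e q.1) p.1 G ∧ Avoids (e q.2) p.2 G)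
    have : ∑ p ∈ s ×ˢ s, pr V (fun G => R p.1 p.2 ∧ Avoids (e q.1) p.1 G ∧ Avoids (e q.2) p.2 G) ≤ y ^ 2 * δ := by
      rw [Finset.sum_product]
      refine le_trans (Finset.sum_le_sum fun W hW => Finset.sum_le_sum fun W' hW' => ?_) (hD q.1 q.2)
      by_cases h : R W W'
      · rw [if_pos h]; exact pr_mono fun G hG => hG.2
      · rw [if_neg h]
        refine (pr_mono (Ψ := fun _ => False) fun G hG => h hG.1).trans ?_
        rw [pr_false]
    have hex' : ex V (fun G => (((s ×ˢ s).filter fun p => R p.1 p.2 ∧ Avoids (e q.1) p.1 G ∧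
        Avoids (e q.2) p.2 G).card : ℝ)) ≤ y ^ 2 * δ := by
      refine le_trans (le_of_eq ?_) (hex.le.trans this)
      congr!
    refine (div_le_div_of_nonneg_right hex' (by positivity)).trans_eq ?_
    field_simp
  have key : ∀ G : SimpleGraph V, ¬ HasExt k T e G →
      (∃ i ∈ (Finset.univ : Finset (Fin m)), ((s.filter fun W => Avoids (e i) W G).card : ℝ) ≤ y / 2) ∨
      ∃ q ∈ (Finset.univ : Finset (Fin m × Fin m)), y ^ 2 / (4 * m ^ 2) ≤
      (((s ×ˢ s).filter fun p => R p.1 p.2 ∧ Avoids (e q.1) p.1 G ∧ Avoids (e q.2) p.2 G).card : ℝ) := by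
    intro G hG
    by_contra! hcon
    obtain ⟨c1, c2⟩ := hcon
    obtain ⟨t, ht1, ht2⟩ := exists_unrelated_transversal (fun i => s.filter fun W => Avoids (e i) W G) R
      (fun i => by
        rw [← Finset.card_pos]
        have := c1 i (Finset.mem_univ _)
        have : (0 : ℝ) < (s.filter fun W => Avoids (e i) W G).card := by linarith
        exact_mod_cast this)
      (fun i i' _ => by
        have d1 := c1 i (Finset.mem_univ _)
        have d2 := c1 i' (Finset.mem_univ _)
        have d3 := c2 (i, i') (Finset.mem_univ _)
        set X := ((s.filter fun W => Avoids (e i) W G) ×ˢ (s.filter fun W => Avoids (e i') W G)).filter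
          fun p => R p.1 p.2 with hX
        have d4 : X.card ≤ ((s ×ˢ s).filter fun p => R p.1 p.2 ∧ Avoids (e i) p.1 G ∧ Avoids (e i') p.2 G).card := by
          refine Finset.card_le_card fun p hp => ?_
          rw [hX, Finset.mem_filter, Finset.mem_product, Finset.mem_filter, Finset.mem_filter] at hp
          rw [Finset.mem_filter, Finset.mem_product]
          exact ⟨⟨hp.1.1.1, hp.1.2.1⟩, hp.2, hp.1.1.2, hp.1.2.2⟩
        have d5 : (X.card : ℝ) < y ^ 2 / (4 * m ^ 2) := lt_of_le_of_lt (by exact_mod_cast d4) d3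
        rw [lt_div_iff₀ (by positivity)] at d5
        have d6 : (y / 2) * (y / 2) < ((s.filter fun W => Avoids (e i) W G).card : ℝ) *
            (s.filter fun W => Avoids (e i') W G).card := mul_lt_mul'' d1 d2 (by positivity) (by positivity)
        have : (X.card : ℝ) * m ^ 2 < ((s.filter fun W => Avoids (e i) W G).card : ℝ) *
            (s.filter fun W => Avoids (e i') W G).card := by nlinarith
        exact_mod_cast this)
    refine hG ⟨t, fun i => ?_, fun i i' hii => ?_, fun i => ?_⟩
    · exact (hsT _ (Finset.mem_filter.1 (ht1 i)).1).2
    · exact hRd _ (Finset.mem_filter.1 (ht1 i)).1 _ (Finset.mem_filter.1 (ht1 i')).1 (ht2 i i' hii)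
    · have := Finset.mem_filter.1 (ht1 i)
      exact ⟨(hsT _ this.1).1, this.2⟩
  refine (pr_mono key).trans ((pr_or_le _ _).trans ?_)
  refine (add_le_add (pr_exists_le_card _ _ _ fun i _ => b1 i) (pr_exists_le_card _ _ _ fun q _ => b2 q)).trans ?_
  rw [Finset.card_univ, Finset.card_univ, Fintype.card_prod, Fintype.card_fin]
  push_cast
  have : (m : ℝ) ≤ (m : ℝ) ^ 4 := le_self_pow₀ hm' (by norm_num)
  nlinarith [mul_le_mul_of_nonneg_right this hδ0]

end Extension

lemma eInd_succ_le {n m : ℕ} : eInd n (m + 1) * 2 ^ m ≤ eInd n m * n := by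
  have h1 := Nat.choose_succ_right_eq n m
  have h1' : (n.choose (m + 1) : ℝ) ≤ n.choose m * n := by
    have : n.choose (m + 1) ≤ n.choose m * n := by
      calc n.choose (m + 1) ≤ n.choose (m + 1) * (m + 1) := Nat.le_mul_of_pos_right _ (Nat.succ_pos m)
        _ = n.choose m * (n - m) := h1
        _ ≤ _ := Nat.mul_le_mul_left _ (Nat.sub_le _ _)
    exact_mod_cast this
  have h3 : (m + 1).choose 2 = m + m.choose 2 := by
    rw [Nat.choose_succ_succ' m 1, Nat.choose_one_right]
  have h4 : (1 / 2 : ℝ) ^ m * 2 ^ m = 1 := by rw [← mul_pow]; norm_num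
  unfold eInd
  rw [h3, pow_add]
  calc (n.choose (m + 1) : ℝ) * ((1 / 2) ^ m * (1 / 2) ^ m.choose 2) * 2 ^ m
      = (n.choose (m + 1) : ℝ) * (1 / 2) ^ m.choose 2 * ((1 / 2) ^ m * 2 ^ m) := by ring
    _ ≤ (n.choose m * n) * (1 / 2) ^ m.choose 2 * 1 := by
        rw [h4]
        exact mul_le_mul_of_nonneg_right (mul_le_mul_of_nonneg_right h1' (by positivity)) (by norm_num)
    _ = _ := by ring

/-- Removing few vertices does not change `eInd` much. -/
lemma eInd_le_two_mul {n N k : ℕ} (hn : 0 < n) (hkN : k ≤ N) (hN : N ≤ n)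
    (h : 2 * ((k : ℝ) * (n - N + k)) ≤ n) : eInd n k ≤ 2 * eInd N k := by
  have hn' : (0 : ℝ) < n := by exact_mod_cast hn
  have hNr : (N : ℝ) ≤ n := by exact_mod_cast hN
  have hkr : (k : ℝ) ≤ N := by exact_mod_cast hkN
  have hf : (0 : ℝ) < k.factorial := by exact_mod_cast Nat.factorial_pos k
  have h1 : ((N : ℝ) - k) ^ k ≤ N.choose k * k.factorial := by
    have := Nat.pow_le_choose (α := ℝ) k N
    rw [div_le_iff₀ hf] at this
    refine le_trans (pow_le_pow_left₀ (by linarith) ?_ k) this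
    rw [← Nat.cast_sub hkN]
    exact_mod_cast (by omega : N - k ≤ N + 1 - k)
  have h2 : (n.choose k : ℝ) * k.factorial ≤ (n : ℝ) ^ k := by
    have := Nat.choose_le_pow_div (α := ℝ) k n
    rwa [le_div_iff₀ hf] at this
  have h3 : (n : ℝ) ^ k ≤ 2 * ((N : ℝ) - k) ^ k := by
    set x := ((n : ℝ) - N + k) / n with hx
    have hx1 : (k : ℝ) * x ≤ 1 / 2 := by
      rw [hx, ← mul_div_assoc, div_le_iff₀ hn']; linarith
    have hx2 : x ≤ 1 := by
      rw [hx, div_le_one hn']; linarith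
    have hb := one_add_mul_le_pow (a := -x) (by linarith) k
    have e : (N : ℝ) - k = (1 + -x) * n := by rw [hx]; field_simp; ring
    rw [e, mul_pow]
    have hp : (0 : ℝ) < (n : ℝ) ^ k := by positivity
    nlinarith
  have h4 : (n.choose k : ℝ) ≤ 2 * N.choose k := by
    refine le_of_mul_le_mul_right ?_ hf
    linarith
  unfold eInd
  rw [← mul_assoc]
  exact mul_le_mul_of_nonneg_right h4 (by positivity)

lemma three_fourths_pow_ge (k : ℕ) : (2 : ℝ) ^ (-(21 / 50 : ℝ) * k) ≤ (3 / 4) ^ k := by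
  rw [Real.rpow_mul (by norm_num), Real.rpow_natCast]
  refine pow_le_pow_left₀ (by positivity) ?_ k
  refine le_of_pow_le_pow_left₀ (n := 50) (by norm_num) (by norm_num) ?_
  rw [← Real.rpow_natCast, ← Real.rpow_mul (by norm_num)]
  norm_num

section

variable {V : Type*} [Fintype V] {k r L : ℕ}

/-- Extensions exist with high probability. -/
theorem Win.pr_not_hasExt_le (h : Win k r L (Fintype.card V))
    (hlow : (2 : ℝ) ^ (-(L * (2 * r + 2) : ℝ)) ≤ eInd (Fintype.card V) (k + 1)) {T : Finset V}
    (hT : T.card ≤ r * (k + 1)) {m : ℕ} (hm : m ≤ r) (e : Fin m → Sym2 V) (he : ∀ i, e i ∈ prs T) :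
    pr V (fun G => ¬ HasExt k T e G) ≤ 2 ^ (-(k : ℝ) / 20) := by
  rcases Nat.eq_zero_or_pos m with rfl | hm0
  · refine (pr_mono (Ψ := fun _ => False) fun G hG => hG ⟨fun i => i.elim0, fun i => i.elim0,
      fun i => i.elim0, fun i => i.elim0⟩).trans ?_
    rw [pr_false]
    positivity
  set n := Fintype.card V with hn
  have hkL := h.k_le
  have hL := h.L_ge
  have hrL := h.r_le
  have hkb := h.k_big.2.2
  have hk2 : (2 : ℝ) ≤ k := le_trans (by norm_num) h.k_big.1
  have hk1 : 1 ≤ k := by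
    have : (1 : ℝ) ≤ k := by linarith
    exact_mod_cast this
  have hrk : 10 * (r : ℝ) < k := by exact_mod_cast h.r_lt_k
  have hnb := h.n_big
  have hr0 : (0 : ℝ) ≤ r := Nat.cast_nonneg r
  have hrLk : 10 ^ 6 * ((L : ℝ) * (2 * r + 10)) ≤ k := by nlinarith
  have hkl : 10 ^ 7 * (L : ℝ) ≤ k := by nlinarith
  have hn4 : 4 * (k : ℝ) ^ 3 ≤ n := by
    refine le_trans ?_ h.hlo
    calc 4 * (k : ℝ) ^ 3 ≤ 2 ^ (2 : ℝ) * (2 ^ (L : ℝ)) ^ 3 :=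
          mul_le_mul (by norm_num) (pow_le_pow_left₀ (by positivity) hkL 3) (by positivity) (by positivity)
      _ = 2 ^ (2 + (L : ℝ) * 3) := by
          rw [← Real.rpow_natCast (2 ^ _ : ℝ), ← Real.rpow_mul (by norm_num), ← Real.rpow_add (by norm_num)]
          norm_num
      _ ≤ _ := Real.rpow_le_rpow_of_exponent_le (by norm_num) (by linarith)
  have hTk : (T.card : ℝ) ≤ k ^ 2 / 5 := by
    have : (T.card : ℝ) ≤ r * (k + 1) := by exact_mod_cast hT
    nlinarith
  have hTn : T.card ≤ n := Finset.card_le_univ T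
  obtain ⟨N, hN⟩ : ∃ N, (Finset.univ \ T).card = N := ⟨_, rfl⟩
  have hNT : N + T.card = n := by
    rw [← hN, Finset.card_sdiff_of_subset (Finset.subset_univ T), Finset.card_univ]
    omega
  have hNTr : (N : ℝ) + T.card = n := by exact_mod_cast hNT
  have hk3 : (k : ℝ) ^ 2 * 2 ≤ k ^ 3 := by nlinarith [sq_nonneg (k : ℝ)]
  have hn0 : (0 : ℝ) < n := lt_of_lt_of_le (by positivity) hn4
  have hN2 : n ≤ 2 * N := by
    have : (n : ℝ) ≤ 2 * N := by nlinarith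
    exact_mod_cast this
  have hk0 : (0 : ℝ) < k := by linarith
  set y := eInd N k * (3 / 4) ^ k with hy
  have hyl : (2 : ℝ) ^ (7 / 100 * (k : ℝ)) ≤ y := by
    have e1 : eInd n k ≤ 2 * eInd N k := by
      refine eInd_le_two_mul (by exact_mod_cast hn0) (by omega) (by omega) ?_
      have : (n : ℝ) - N = T.card := by linarith
      rw [this]
      nlinarith
    have e2 : (2 : ℝ) ^ ((k : ℝ) / 2 - L * (2 * r + 4)) ≤ eInd n k := by
      refine le_of_mul_le_mul_right ?_ hn0
      calc (2 : ℝ) ^ ((k : ℝ) / 2 - L * (2 * r + 4)) * n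
          ≤ 2 ^ ((k : ℝ) / 2 - L * (2 * r + 4)) * 2 ^ ((k : ℝ) / 2 + 2 * L) :=
            mul_le_mul_of_nonneg_left h.hup (by positivity)
        _ = 2 ^ (-(L * (2 * r + 2) : ℝ)) * 2 ^ (k : ℝ) := by
            rw [← Real.rpow_add (by norm_num), ← Real.rpow_add (by norm_num)]
            ring_nf
        _ ≤ eInd n (k + 1) * 2 ^ k := by
            rw [Real.rpow_natCast]
            exact mul_le_mul_of_nonneg_right hlow (by positivity)
        _ ≤ _ := eInd_succ_le
    calc (2 : ℝ) ^ (7 / 100 * (k : ℝ))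
        ≤ 2 ^ ((-1) + ((k : ℝ) / 2 - L * (2 * r + 4)) + -(21 / 50 : ℝ) * k) :=
          Real.rpow_le_rpow_of_exponent_le (by norm_num) (by linarith)
      _ = (2 ^ (-1 : ℝ) * 2 ^ ((k : ℝ) / 2 - L * (2 * r + 4))) * 2 ^ (-(21 / 50 : ℝ) * k) := by
          rw [← Real.rpow_add (by norm_num), ← Real.rpow_add (by norm_num)]
      _ ≤ eInd N k * (3 / 4) ^ k := by
          refine mul_le_mul ?_ (three_fourths_pow_ge k) (by positivity) (eInd_nonneg _ _)
          rw [Real.rpow_neg_one]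
          linarith
  have hy0 : 0 < y := lt_of_lt_of_le (by positivity) hyl
  set θ : ℝ := 2 ^ (-(k : ℝ) / 5) with hθ
  have hθ0 : 0 < θ := by rw [hθ]; positivity
  set δ : ℝ := 2 ^ (-(6 / 100 * (k : ℝ))) with hδ
  have hδ0 : 0 < δ := by rw [hδ]; positivity
  have hθ34 : θ * (4 / 3) ≤ 1 := by
    have : θ ≤ 2 ^ (-1 : ℝ) := Real.rpow_le_rpow_of_exponent_le (by norm_num) (by linarith)
    rw [Real.rpow_neg_one] at this
    linarith
  have hθ1 : θ ≤ 1 := by linarith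
  have step : ∀ l ∈ Finset.Icc 1 k, eMeet N k l * (3 / 4) ^ (k - l) ≤ y * (θ * (4 / 3)) + 1 := by
    intro l hl
    rw [Finset.mem_Icc] at hl
    have hb := h.eMeet_le (N := N) (m := k) (by omega) hN2 le_rfl (by omega) hl.1 hl.2
    have q0 : (0 : ℝ) < (3 / 4) ^ (k - l) := by positivity
    have q1 : ((3 : ℝ) / 4) ^ (k - l) ≤ 1 := pow_le_one₀ (by norm_num) (by norm_num)
    have q2 : (θ : ℝ) ^ (k - l) ≤ 1 := pow_le_one₀ hθ0.le hθ1
    have q3 : (if 2 * l ≤ k then eInd N k * θ ^ l else 0) * (3 / 4) ^ (k - l) ≤ y * (θ * (4 / 3)) := by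
      split_ifs
      · have e3 : ((3 : ℝ) / 4) ^ (k - l) = (3 / 4) ^ k * (4 / 3) ^ l := by
          have : ((3 : ℝ) / 4) ^ k = (3 / 4) ^ (k - l) * (3 / 4) ^ l := by rw [← pow_add]; congr 1; omega
          rw [this, mul_assoc, ← mul_pow]
          norm_num
        rw [e3]
        calc eInd N k * θ ^ l * ((3 / 4) ^ k * (4 / 3) ^ l) = y * (θ * (4 / 3)) ^ l := by
              rw [hy, mul_pow]; ring
          _ ≤ _ := mul_le_mul_of_nonneg_left
              (pow_le_of_le_one (by positivity) hθ34 (by omega)) hy0.le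
      · rw [zero_mul]
        exact mul_nonneg hy0.le (by positivity)
    calc eMeet N k l * (3 / 4) ^ (k - l)
        ≤ ((if 2 * l ≤ k then eInd N k * θ ^ l else 0) + θ ^ (k - l)) * (3 / 4) ^ (k - l) :=
          mul_le_mul_of_nonneg_right hb q0.le
      _ ≤ _ := by
          rw [add_mul]
          exact add_le_add q3 (mul_le_one₀ q2 q0.le q1)
  have hsum : ∑ l ∈ Finset.Icc 1 k, eMeet N k l * (3 / 4) ^ (k - l) ≤ y * δ := by
    refine (Finset.sum_le_card_nsmul _ _ _ step).trans ?_
    rw [Nat.card_Icc, nsmul_eq_mul, Nat.add_sub_cancel]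
    have f1 : (k : ℝ) * (θ * (4 / 3)) ≤ δ / 2 := by
      have : (k : ℝ) * θ * 4 ≤ δ := by
        calc (k : ℝ) * θ * 4 ≤ 2 ^ (L : ℝ) * θ * 2 ^ (2 : ℝ) := by
              refine mul_le_mul (mul_le_mul_of_nonneg_right hkL hθ0.le) (by norm_num) (by norm_num) (by positivity)
          _ = 2 ^ ((L : ℝ) + -(k : ℝ) / 5 + 2) := by
              rw [hθ, ← Real.rpow_add (by norm_num), ← Real.rpow_add (by norm_num)]
          _ ≤ _ := Real.rpow_le_rpow_of_exponent_le (by norm_num) (by linarith)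
      linarith [mul_pos hk0 hθ0]
    have f2 : (k : ℝ) ≤ y * (δ / 2) := by
      calc (k : ℝ) ≤ 2 ^ (L : ℝ) := hkL
        _ ≤ 2 ^ (7 / 100 * (k : ℝ) + -(6 / 100 * (k : ℝ)) + -1) :=
            Real.rpow_le_rpow_of_exponent_le (by norm_num) (by linarith)
        _ = 2 ^ (7 / 100 * (k : ℝ)) * δ * 2⁻¹ := by
            rw [hδ, Real.rpow_add (by norm_num), Real.rpow_add (by norm_num), Real.rpow_neg_one]
        _ ≤ y * δ * 2⁻¹ := mul_le_mul_of_nonneg_right (mul_le_mul_of_nonneg_right hyl hδ0.le) (by norm_num)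
        _ = _ := by ring
    calc (k : ℝ) * (y * (θ * (4 / 3)) + 1) = y * (k * (θ * (4 / 3))) + k := by ring
      _ ≤ y * (δ / 2) + y * (δ / 2) := add_le_add (mul_le_mul_of_nonneg_left f1 hy0.le) f2
      _ = _ := by ring
  refine (_root_.pr_not_hasExt_le hk1 hm0 e he hN hy hy0 hsum).trans ?_
  have hmk : (m : ℝ) ≤ 2 ^ (L : ℝ) := by
    have : (m : ℝ) ≤ r := by exact_mod_cast hm
    linarith
  calc 8 * (m : ℝ) ^ 4 * δ ≤ 2 ^ (3 : ℝ) * (2 ^ (L : ℝ)) ^ 4 * δ := by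
        refine mul_le_mul_of_nonneg_right ?_ hδ0.le
        exact mul_le_mul (by norm_num) (pow_le_pow_left₀ (by positivity) hmk 4) (by positivity) (by positivity)
    _ = 2 ^ (3 + (L : ℝ) * 4 + -(6 / 100 * (k : ℝ))) := by
        rw [hδ, ← Real.rpow_natCast (2 ^ _ : ℝ), ← Real.rpow_mul (by norm_num), ← Real.rpow_add (by norm_num),
          ← Real.rpow_add (by norm_num)]
        norm_num
    _ ≤ _ := Real.rpow_le_rpow_of_exponent_le (by norm_num) (by linarith)

end

section Combine

variable {V : Type*} [Fintype V]

lemma depOn_hasExt (k : ℕ) (T : Finset V) {m : ℕ} (e : Fin m → Sym2 V) (he : ∀ i, e i ∈ prs T) :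
    DepOn (HasExt k T e) {f | f ∉ prs T} := by
  intro G G' hG
  unfold HasExt
  refine exists_congr fun W => and_congr_right fun _ => and_congr_right fun _ =>
    forall_congr' fun i => and_congr_right fun hd => ?_
  refine and_congr ?_ ?_
  · refine (depOn_eF (W i) (fun E => E = ∅)) G G' fun x y hxy => hG x y ?_
    exact Finset.disjoint_left.1 (disjoint_prs hd) hxy
  · refine forall₂_congr fun w hw => not_congr (forall_congr' fun v => imp_congr_right fun _ => hG v w ?_)
    intro h
    exact Finset.disjoint_left.1 hd hw (mk_mem_prs.1 h).2.1

lemma exists_enum {ι : Type*} [Fintype ι] {G : SimpleGraph V} (S : ι → Finset V) {m : ℕ}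
    (hm : ∑ i, (eF G (S i)).card = m) :
    ∃ e ∈ Fintype.piFinset fun _ : Fin m => prs (Finset.univ.biUnion S),
      ∀ i, ∀ f ∈ eF G (S i), ∃ l, e l = f := by
  let q : (Σ i, (eF G (S i) : Set (Sym2 V))) ≃ Fin m := by
    refine Fintype.equivFinOfCardEq ?_
    rw [Fintype.card_sigma, ← hm]
    simp
  refine ⟨fun l => (q.symm l).2.1, ?_, fun i f hf => ⟨q ⟨i, f, hf⟩, by
    show ((q.symm (q _)).2 : Sym2 V) = f
    rw [Equiv.symm_apply_apply]⟩⟩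
  rw [Fintype.mem_piFinset]
  intro l
  exact prs_mono (Finset.subset_biUnion_of_mem S (Finset.mem_univ (q.symm l).1))
    (mem_eF.1 (q.symm l).2.2).1

lemma pr_pattern_eq {ι : Type*} [Fintype ι] {m : ℕ} (S : ι → Finset V) (hS : ∀ i, (S i).card = m)
    (hd : ∀ i i', i ≠ i' → Disjoint (S i) (S i')) (ν : ι → ℕ) :
    pr V (fun G => ∀ i, (eF G (S i)).card = ν i) =
      ∏ i, (((m.choose 2).choose (ν i) : ℝ) * (1 / 2) ^ m.choose 2) := by
  have := pr_forall_of_indep Finset.univ (fun i (G : SimpleGraph V) => (eF G (S i)).card = ν i)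
    (fun i => (prs (S i) : Set (Sym2 V))) (fun i _ => depOn_eF (S i) fun E => E.card = ν i)
    (fun i _ i' _ hi => by
      show Disjoint (prs (S i) : Set (Sym2 V)) (prs (S i'))
      exact_mod_cast disjoint_prs (hd i i' hi))
  simp only [Finset.mem_univ, forall_const] at this
  rw [this]
  refine Finset.prod_congr rfl fun i _ => ?_
  rw [pr_eF_card_eq, hS]

lemma Scale.choose_le {k r L : ℕ} (h : Scale k r L) {i : ℕ} (hi : i ≤ r) : (((k + 1).choose 2).choose i : ℝ) ≤ 2 ^ (2 * L * r) := by
  have hK : (k + 1).choose 2 ≤ (2 ^ L) ^ 2 := by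
    have h1 : (k + 1).choose 2 ≤ (k + 1) ^ 2 := Nat.choose_le_pow _ _
    exact h1.trans (Nat.pow_le_pow_left h.hk 2)
  have h2 : ((k + 1).choose 2).choose i ≤ ((2 ^ L) ^ 2) ^ r :=
    (Nat.choose_le_pow _ _).trans ((Nat.pow_le_pow_left hK i).trans
      (Nat.pow_le_pow_right (by positivity) hi))
  have h2' : (((k + 1).choose 2).choose i : ℝ) ≤ ((2 ^ L) ^ 2) ^ r := by exact_mod_cast h2
  exact h2'.trans_eq (by ring)

lemma lam_le_two_pow {k r L n : ℕ} (h : Win k r L n) {i : ℕ} (hi : i ≤ r) :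
    lam n k i ≤ 2 ^ (L * (2 * r + 1)) := by
  have hk : (k : ℝ) ≤ 2 ^ L := by exact_mod_cast h.hk.le
  unfold lam
  calc _ ≤ (2 : ℝ) ^ L * 2 ^ (2 * L * r) :=
        mul_le_mul (h.hc.trans hk) (h.toScale.choose_le hi) (by positivity) (by positivity)
    _ = _ := by ring

theorem Win.pr_pattern_not_large_le {k r L : ℕ} (h : Win k r L (Fintype.card V))
    (hlow : (2 : ℝ) ^ (-(L * (2 * r + 2) : ℝ)) ≤ eInd (Fintype.card V) (k + 1))
    {ι : Type*} [Fintype ι] (ν : ι → ℕ) {m s : ℕ} (hm : ∑ i, ν i = m) (hr : Fintype.card ι + m = r)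
    (hs : Fintype.card ι * (k + 1) + m * k = s) :
    pr V (fun G => (∃ S : ι → Finset V, (∀ i, (S i).card = k + 1) ∧
      (∀ i i', i ≠ i' → Disjoint (S i) (S i')) ∧ ∀ i, (eF G (S i)).card = ν i) ∧ ¬ Large s r G) ≤
      2 ^ (-(k : ℝ) / 40) := by
  set P := Fintype.piFinset fun _ : ι => (Finset.univ : Finset V).powersetCard (k + 1) with hP
  set θ : ℝ := 2 ^ (-(k : ℝ) / 20) with hθ
  have hθ0 : 0 ≤ θ := by rw [hθ]; positivity
  have hLr := h.r_lt
  have hk := h.hk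
  set K := (k + 1).choose 2 with hK
  have hcard : ∀ S : ι → Finset V, (∀ i, (S i).card = k + 1) →
      (Finset.univ.biUnion S).card ≤ r * (k + 1) := by
    intro S hS
    refine Finset.card_biUnion_le.trans ?_
    rw [Finset.sum_congr rfl fun i _ => hS i, Finset.sum_const, smul_eq_mul, Finset.card_univ]
    exact Nat.mul_le_mul_right _ (by omega)
  have step : ∀ S ∈ P, pr V (fun G => ((∀ i i', i ≠ i' → Disjoint (S i) (S i')) ∧
      ∀ i, (eF G (S i)).card = ν i) ∧ ¬ Large s r G) ≤
      (∏ i, ((K.choose (ν i) : ℝ) * (1 / 2) ^ K)) * (2 ^ (4 * L * r) * θ) := by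
    intro S hS
    have hS' : ∀ i, (S i).card = k + 1 := fun i =>
      (Finset.mem_powersetCard.1 (Fintype.mem_piFinset.1 hS i)).2
    by_cases hd : ∀ i i', i ≠ i' → Disjoint (S i) (S i')
    swap
    · rw [pr_congr (Ψ := fun _ => False) (fun G => by tauto), pr_false]
      positivity
    set T := Finset.univ.biUnion S with hT
    set Q := Fintype.piFinset fun _ : Fin m => prs T with hQ
    have hQmem : ∀ e ∈ Q, ∀ i, e i ∈ prs T := fun e he => Fintype.mem_piFinset.1 he
    have hmono : pr V (fun G => ((∀ i i', i ≠ i' → Disjoint (S i) (S i')) ∧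
        ∀ i, (eF G (S i)).card = ν i) ∧ ¬ Large s r G) ≤
        pr V (fun G => (∀ i, (eF G (S i)).card = ν i) ∧ ∃ e, e ∈ Q ∧ ¬ HasExt k T e G) := by
      refine pr_mono fun G hG => ⟨hG.1.2, ?_⟩
      obtain ⟨e, he, hcov⟩ := exists_enum (G := G) S (m := m)
        (by rw [← hm]; exact Finset.sum_congr rfl fun i _ => hG.1.2 i)
      exact ⟨e, he, fun hx => hG.2 (large_of_hasExt S hS' hd e hcov hx hr hs)⟩
    refine hmono.trans ?_
    rw [pr_and_of_indep (Q := (prs T : Set (Sym2 V))) (Q' := {f | f ∉ prs T}), pr_pattern_eq S hS' hd ν]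
    · refine mul_le_mul_of_nonneg_left ?_ (by positivity)
      refine (pr_exists_le_card Q (fun e G => ¬ HasExt k T e G) θ fun e he =>
        h.pr_not_hasExt_le hlow (hcard S hS') (by omega) e (hQmem e he)).trans ?_
      refine mul_le_mul_of_nonneg_right ?_ hθ0
      have c1 : Q.card ≤ 2 ^ (4 * L * r) := by
        rw [hQ, Fintype.card_piFinset_const, card_prs]
        have c2 : T.card ≤ 2 ^ (2 * L) := by
          refine (hcard S hS').trans ?_
          rw [two_mul, pow_add]
          exact Nat.mul_le_mul (by have := Nat.lt_two_pow_self (n := L); omega) hk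
        calc (T.card.choose 2) ^ m ≤ ((2 ^ (2 * L)) ^ 2) ^ m :=
              Nat.pow_le_pow_left ((Nat.choose_le_pow _ _).trans (Nat.pow_le_pow_left c2 2)) m
          _ = 2 ^ (4 * L * m) := by rw [← pow_mul, ← pow_mul]; ring_nf
          _ ≤ _ := Nat.pow_le_pow_right (by norm_num) (Nat.mul_le_mul_left _ (by omega))
      exact_mod_cast c1
    · intro G G' hG
      exact forall_congr' fun i => depOn_eF (S i) (fun E => E.card = ν i) G G' fun x y hxy =>
        hG x y (prs_mono (Finset.subset_biUnion_of_mem S (Finset.mem_univ i)) hxy)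
    · refine DepOn.exists fun e => ?_
      by_cases he : e ∈ Q
      · have := (depOn_hasExt k T e (hQmem e he)).not
        intro G G' hG
        exact and_congr_right fun _ => this G G' hG
      · intro G G' _
        exact ⟨fun h => absurd h.1 he, fun h => absurd h.1 he⟩
    · exact Set.disjoint_left.2 fun f hf hf' => hf' hf
  have hsub : pr V (fun G => (∃ S : ι → Finset V, (∀ i, (S i).card = k + 1) ∧
      (∀ i i', i ≠ i' → Disjoint (S i) (S i')) ∧ ∀ i, (eF G (S i)).card = ν i) ∧ ¬ Large s r G) ≤
      pr V (fun G => ∃ S ∈ P, ((∀ i i', i ≠ i' → Disjoint (S i) (S i')) ∧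
      ∀ i, (eF G (S i)).card = ν i) ∧ ¬ Large s r G) := by
    refine pr_mono fun G hG => ?_
    obtain ⟨⟨S, hS, hd, hn⟩, hG⟩ := hG
    refine ⟨S, Fintype.mem_piFinset.2 fun i => ?_, ⟨hd, hn⟩, hG⟩
    exact Finset.mem_powersetCard.2 ⟨Finset.subset_univ _, hS i⟩
  refine hsub.trans ((pr_exists_le P _).trans ((Finset.sum_le_sum step).trans ?_))
  have hprod : ∑ _S ∈ P, ∏ i, ((K.choose (ν i) : ℝ) * (1 / 2) ^ K) = ∏ i, lam (Fintype.card V) k (ν i) := by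
    rw [Finset.sum_const, hP, Fintype.card_piFinset, Finset.card_powersetCard, Finset.card_univ,
      nsmul_eq_mul, Nat.cast_prod, ← Finset.prod_mul_distrib]
    refine Finset.prod_congr rfl fun i _ => ?_
    unfold lam eInd
    ring
  rw [← Finset.sum_mul, hprod]
  have hle : ∏ i, lam (Fintype.card V) k (ν i) ≤ 2 ^ (L * (2 * r + 1) * r) := by
    refine (Finset.prod_le_prod (fun i _ => lam_nonneg _ _ _) fun i _ => lam_le_two_pow h ?_).trans ?_
    · have := Finset.single_le_sum (f := ν) (fun _ _ => Nat.zero_le _) (Finset.mem_univ i)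
      omega
    · rw [Finset.prod_const, ← pow_mul, Finset.card_univ]
      exact pow_le_pow_right₀ (by norm_num) (Nat.mul_le_mul_left _ (by omega))
  have hL1 := h.L_ge
  have hk2 := h.k_big
  have hrl := h.r_le
  have hr1 := h.r_ge
  calc (∏ i, lam (Fintype.card V) k (ν i)) * (2 ^ (4 * L * r) * θ)
      ≤ 2 ^ (L * (2 * r + 1) * r) * (2 ^ (4 * L * r) * θ) := mul_le_mul_of_nonneg_right hle (by positivity)
    _ = 2 ^ ((L : ℝ) * (2 * r + 1) * r + 4 * L * r + -(k : ℝ) / 20) := by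
        rw [hθ, Real.rpow_add (by norm_num), Real.rpow_add (by norm_num), ← mul_assoc, ← Real.rpow_natCast,
          ← Real.rpow_natCast]
        push_cast
        rfl
    _ ≤ _ := by
        refine Real.rpow_le_rpow_of_exponent_le (by norm_num) ?_
        have e1 : (r : ℝ) * 5100 ≤ L := by linarith
        have e2 : (L : ℝ) * (2 * r + 1) * r + 4 * L * r ≤ L ^ 3 := by
          calc (L : ℝ) * (2 * r + 1) * r + 4 * L * r = L * (r * (2 * r + 5)) := by ring
            _ ≤ L * (L * L) := mul_le_mul_of_nonneg_left
                (mul_le_mul (by linarith) (by linarith) (by positivity) (by positivity)) (by positivity)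
            _ = _ := by ring
        have e3 : 40 * (L : ℝ) ^ 3 ≤ k := by
          refine le_trans ?_ hk2.2.1
          calc 40 * (L : ℝ) ^ 3 ≤ L ^ 7 * L ^ 3 := by
                refine mul_le_mul_of_nonneg_right ?_ (by positivity)
                calc (40 : ℝ) ≤ (10 ^ 6) ^ 7 := by norm_num
                  _ ≤ _ := pow_le_pow_left₀ (by norm_num) hL1 7
            _ = _ := by ring
        linarith

lemma exists_embedding_of_le_card {α : Type*} {s : Finset α} {m : ℕ} (h : m ≤ s.card) :
    ∃ f : Fin m ↪ α, ∀ i, f i ∈ s := by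
  obtain ⟨t, ht, hc⟩ := Finset.exists_subset_card_eq h
  exact ⟨(t.equivFinOfCardEq hc).symm.toEmbedding.trans (Function.Embedding.subtype _),
    fun i => ht ((t.equivFinOfCardEq hc).symm i).2⟩

theorem Win.pr_many_not_large_le {k r L j : ℕ} (h : Win k r L (Fintype.card V))
    (hlow : (2 : ℝ) ^ (-(L * (2 * r + 2) : ℝ)) ≤ eInd (Fintype.card V) (k + 1))
    (h1 : 1 ≤ j) (hj : j ≤ r) (hlam : 1 / (k : ℝ) ≤ lam (Fintype.card V) k (muD r j)) :
    pr V (fun G => Many (xiD r j) (k + 1) (muD r j) G ∧ ¬ Large (k * r + j) r G) ≤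
      32 * (r + 1) / k + 2 ^ (-(k : ℝ) / 10) + 2 ^ (-(k : ℝ) / 40) := by
  obtain ⟨hξ, hξ1, hξj, hμ⟩ := mu_xi h1 hj
  set μ := muD r j with hμd
  set ξ := xiD r j with hξd
  obtain ⟨b, hb⟩ := Nat.exists_eq_add_of_le hξj
  set n := Fintype.card V with hn
  have hk0 : (0 : ℝ) < k := by linarith [h.k_big.1]
  have hrr := h.r_ge
  have hμr : (μ : ℝ) ≤ r := by exact_mod_cast hμ
  have hbr : (b : ℝ) ≤ r := by exact_mod_cast (by omega : b ≤ r)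
  have hlam' : (k : ℝ) ≤ lam n k (μ + 1) * (4 * (r + 1)) := by
    calc (k : ℝ) = 1 / k * k ^ 2 := by field_simp
      _ ≤ lam n k μ * k ^ 2 := mul_le_mul_of_nonneg_right hlam (by positivity)
      _ ≤ lam n k (μ + 1) * (4 * (μ + 1)) := h.toScale.lam_succ n hμ
      _ ≤ _ := mul_le_mul_of_nonneg_left (by linarith) (lam_nonneg _ _ _)
  have hkr : 8 * (r : ℝ) * (r + 1) ≤ k := by
    have e1 := h.k_big.2.2
    have e2 := h.r_le
    nlinarith [h.L_ge]
  have hl0 : 0 < lam n k (μ + 1) := by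
    by_contra hc
    nlinarith
  have h2b : 2 * (b : ℝ) ≤ lam n k (μ + 1) := by
    by_contra hc
    nlinarith
  have p1 := h.pr_exists_meeting_sparse_le (t := μ + 1) (by omega)
  have p2 := h.pr_not_many_le (i := μ + 1) (ξ := b) (by omega)
    (by
      rw [div_le_iff₀ hk0]
      nlinarith) h2b
  have p2' : 8 / lam n k (μ + 1) ≤ 32 * (r + 1) / k := by
    rw [div_le_div_iff₀ hl0 hk0]
    linarith
  have p3 := h.pr_pattern_not_large_le hlow (ι := Fin ξ ⊕ Fin b)
    (Sum.elim (fun _ => μ) fun _ => μ + 1) (m := r - j) (s := k * r + j)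
    (by
      simp only [Fintype.sum_sum_type, Sum.elim_inl, Sum.elim_inr, Finset.sum_const, Finset.card_univ,
        Fintype.card_fin, smul_eq_mul]
      have : r + ξ = ξ * μ + b * (μ + 1) + ξ + j := by rw [hξ, hb]; ring
      omega)
    (by simp only [Fintype.card_sum, Fintype.card_fin]; omega)
    (by
      simp only [Fintype.card_sum, Fintype.card_fin]
      rw [← hb]
      obtain ⟨m, rfl⟩ := Nat.exists_eq_add_of_le hj
      rw [Nat.add_sub_cancel_left]
      ring)
  have hor : pr V (fun G => Many ξ (k + 1) μ G ∧ ¬ Large (k * r + j) r G) ≤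
      pr V (fun G => ¬ Many b (k + 1) (μ + 1) G ∨ (∃ W W', W ≠ W' ∧ ¬ Disjoint W W' ∧ W.card = k + 1 ∧
        W'.card = k + 1 ∧ (eF G W).card ≤ μ + 1 ∧ (eF G W').card ≤ μ + 1) ∨
        ((∃ S : Fin ξ ⊕ Fin b → Finset V, (∀ i, (S i).card = k + 1) ∧
          (∀ i i', i ≠ i' → Disjoint (S i) (S i')) ∧
          ∀ i, (eF G (S i)).card = Sum.elim (fun _ => μ) (fun _ => μ + 1) i) ∧ ¬ Large (k * r + j) r G)) := by
    refine pr_mono fun G hG => ?_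
    by_contra hc
    rw [not_or, not_or, not_not] at hc
    obtain ⟨hc1, hc2, hc3⟩ := hc
    refine hc3 ⟨?_, hG.2⟩
    obtain ⟨f, hf⟩ := exists_embedding_of_le_card hG.1
    obtain ⟨g, hg⟩ := exists_embedding_of_le_card hc1
    simp only [Finset.mem_filter, Finset.mem_powersetCard] at hf hg
    have hc : ∀ i, (Sum.elim f g i).card = k + 1 := by
      rintro (i | i)
      exacts [(hf i).1.2, (hg i).1.2]
    have he : ∀ i, (eF G (Sum.elim f g i)).card = Sum.elim (fun _ => μ) (fun _ => μ + 1) i := by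
      rintro (i | i)
      exacts [(hf i).2, (hg i).2]
    have hle : ∀ i, (eF G (Sum.elim f g i)).card ≤ μ + 1 := by
      intro i
      rw [he]
      rcases i with i | i <;> simp
    refine ⟨Sum.elim f g, hc, fun i i' hi => ?_, he⟩
    by_contra hd
    refine hc2 ⟨_, _, fun heq => ?_, hd, hc i, hc i', hle i, hle i'⟩
    have hν : Sum.elim (fun _ => μ) (fun _ => μ + 1) i = Sum.elim (fun _ => μ) (fun _ => μ + 1) i' := by
      rw [← he, ← he, heq]
    rcases i with i | i <;> rcases i' with i' | i'
    · exact hi (congrArg Sum.inl (f.injective heq))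
    · simp at hν
    · simp at hν
    · exact hi (congrArg Sum.inr (g.injective heq))
  refine hor.trans ((pr_or_le _ _).trans ?_)
  have := pr_or_le (V := V) (fun G => ∃ W W', W ≠ W' ∧ ¬ Disjoint W W' ∧ W.card = k + 1 ∧
        W'.card = k + 1 ∧ (eF G W).card ≤ μ + 1 ∧ (eF G W').card ≤ μ + 1) (fun G =>
        (∃ S : Fin ξ ⊕ Fin b → Finset V, (∀ i, (S i).card = k + 1) ∧
          (∀ i i', i ≠ i' → Disjoint (S i) (S i')) ∧
          ∀ i, (eF G (S i)).card = Sum.elim (fun _ => μ) (fun _ => μ + 1) i) ∧ ¬ Large (k * r + j) r G)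
  linarith

end Combine

lemma two_pow_le_factorial_succ (k : ℕ) : 2 ^ k ≤ (k + 1).factorial := by
  induction k with
  | zero => simp
  | succ k ih =>
    rw [Nat.factorial_succ, pow_succ, mul_comm]
    exact Nat.mul_le_mul (by omega) ih

lemma two_rpow_half_pow (k : ℕ) : ((2 : ℝ) ^ ((k : ℝ) / 2)) ^ (k + 1) = 2 ^ (k + 1).choose 2 := by
  rw [← Real.rpow_natCast, ← Real.rpow_mul (by norm_num), ← Real.rpow_natCast 2 ((k + 1).choose 2),
    two_mul_cast_choose_two]
  push_cast
  ring_nf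

lemma eInd_eq_div (n m : ℕ) : eInd n m = n.choose m / 2 ^ m.choose 2 := by
  rw [eInd, one_div, inv_pow, ← div_eq_mul_inv]

lemma lam_mono {n n' : ℕ} (h : n ≤ n') (k i : ℕ) : lam n k i ≤ lam n' k i := by
  have h2 : (n.choose (k + 1) : ℝ) ≤ n'.choose (k + 1) := by exact_mod_cast Nat.choose_le_choose (k + 1) h
  unfold lam eInd
  exact mul_le_mul_of_nonneg_right (mul_le_mul_of_nonneg_right h2 (by positivity)) (by positivity)

lemma lam_succ_le {n k : ℕ} (h : 2 * k + 1 ≤ n) (i : ℕ) : lam (n + 1) k i ≤ 2 * lam n k i := by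
  have h2 : ((n + 1).choose (k + 1) : ℝ) ≤ 2 * n.choose (k + 1) := by
    have e1 := Nat.choose_mul_succ_eq n (k + 1)
    have e2 : n + 1 - (k + 1) = n - k := by omega
    have e3 : (n + 1).choose (k + 1) * (n - k) ≤ 2 * n.choose (k + 1) * (n - k) := by
      rw [← e2, ← e1, mul_comm 2, mul_assoc]
      exact Nat.mul_le_mul_left _ (by omega)
    exact_mod_cast Nat.le_of_mul_le_mul_right e3 (by omega)
  unfold lam eInd
  calc _ ≤ (2 * (n.choose (k + 1) : ℝ)) * (1 / 2) ^ (k + 1).choose 2 * ((k + 1).choose 2).choose i :=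
        mul_le_mul_of_nonneg_right (mul_le_mul_of_nonneg_right h2 (by positivity)) (by positivity)
    _ = _ := by ring

namespace Scale

variable {k r L : ℕ} (h : Scale k r L)
include h

lemma one_le_choose {i : ℕ} (hi : i ≤ r) : (1 : ℝ) ≤ ((k + 1).choose 2).choose i := by
  have h1 := h.r_lt_k
  have : i ≤ (k + 1).choose 2 := by
    rw [Nat.choose_succ_succ' k 1, Nat.choose_one_right]
    omega
  exact_mod_cast Nat.choose_pos this

lemma L_mul_le : L * (2 * r + 2) + 3 ≤ k := by
  have h1 := h.k_big.2.2
  have h2 := h.r_le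
  have h3 := h.L_ge
  have : ((L * (2 * r + 2) + 3 : ℕ) : ℝ) ≤ k := by
    push_cast
    have : (L : ℝ) * (2 * r + 2) ≤ L * L := mul_le_mul_of_nonneg_left (by linarith) (by linarith)
    nlinarith
  exact_mod_cast this

lemma low_of_lam {n i : ℕ} (hi : i ≤ r) (hl : 1 / (k : ℝ) ≤ lam n k i) :
    (2 : ℝ) ^ (-(L * (2 * r + 2) : ℝ)) ≤ eInd n (k + 1) := by
  have hk0 : (0 : ℝ) < k := by linarith [h.k_big.1]
  have h1 : (k : ℝ) ≤ 2 ^ L := by exact_mod_cast h.hk.le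
  have h2 : (2 : ℝ) ^ (-(L * (2 * r + 2) : ℝ)) = 1 / 2 ^ (L * (2 * r + 2)) := by
    rw [Real.rpow_neg (by norm_num), ← one_div, ← Real.rpow_natCast]
    push_cast
    rfl
  rw [div_le_iff₀ hk0] at hl
  rw [h2, div_le_iff₀ (by positivity)]
  refine hl.trans ?_
  have e0 := eInd_nonneg n (k + 1)
  calc lam n k i * k ≤ eInd n (k + 1) * 2 ^ (2 * L * r) * 2 ^ L :=
        mul_le_mul (mul_le_mul_of_nonneg_left (h.choose_le hi) e0) h1 hk0.le (by positivity)
    _ = eInd n (k + 1) * 2 ^ (2 * L * r + L) := by rw [pow_add, mul_assoc]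
    _ ≤ _ := mul_le_mul_of_nonneg_left (pow_le_pow_right₀ (by norm_num) (by nlinarith)) e0

theorem win_of_lam {n i : ℕ} (hi : i ≤ r) (hl : 1 / (k : ℝ) ≤ lam n k i) (hu : lam n k i ≤ k) :
    Win k r L n := by
  have hlow := h.low_of_lam hi hl
  have hc : eInd n (k + 1) ≤ k :=
    (le_mul_of_one_le_right (eInd_nonneg _ _) (h.one_le_choose hi)).trans hu
  have hkL : (k : ℝ) ≤ 2 ^ (k + 1) := by
    exact_mod_cast (Nat.lt_two_pow_self.le.trans (Nat.pow_le_pow_right (by norm_num) (Nat.le_succ k)))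
  refine ⟨h, hc, ?_, ?_⟩
  · rw [← pow_le_pow_iff_left₀ (n := k + 1) (by positivity) (by positivity) (by omega), two_rpow_half_pow]
    have h1 : (n.choose (k + 1) : ℝ) ≤ n ^ (k + 1) / (k + 1).factorial := Nat.choose_le_pow_div _ _
    have hf : (2 : ℝ) ^ k ≤ (k + 1).factorial := by exact_mod_cast two_pow_le_factorial_succ k
    have h3 : (1 : ℝ) / 2 ^ k ≤ eInd n (k + 1) := by
      refine le_trans ?_ hlow
      rw [one_div, ← Real.rpow_natCast, ← Real.rpow_neg (by norm_num)]
      refine Real.rpow_le_rpow_of_exponent_le (by norm_num) ?_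
      have : ((L * (2 * r + 2) + 3 : ℕ) : ℝ) ≤ k := by exact_mod_cast h.L_mul_le
      push_cast at this
      linarith
    rw [eInd_eq_div, div_le_div_iff₀ (by positivity) (by positivity), one_mul] at h3
    rw [le_div_iff₀ (by positivity)] at h1
    exact h3.trans ((mul_le_mul_of_nonneg_left hf (by positivity)).trans h1)
  · have h1 : ((n - k : ℕ) : ℝ) ≤ (k + 1) * (2 * 2 ^ ((k : ℝ) / 2)) := by
      rw [← pow_le_pow_iff_left₀ (n := k + 1) (by positivity) (by positivity) (by omega), mul_pow, mul_pow,
        two_rpow_half_pow]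
      have h2 : ((n + 1 - (k + 1) : ℕ) ^ (k + 1) : ℝ) / (k + 1).factorial ≤ n.choose (k + 1) :=
        Nat.pow_le_choose _ _
      rw [div_le_iff₀ (by positivity), Nat.add_sub_add_right] at h2
      have hf : ((k + 1).factorial : ℝ) ≤ (k + 1) ^ (k + 1) := by
        exact_mod_cast Nat.factorial_le_pow (k + 1)
      rw [eInd_eq_div, div_le_iff₀ (by positivity)] at hc
      calc _ ≤ _ := h2
        _ ≤ (2 ^ (k + 1) * 2 ^ (k + 1).choose 2) * (k + 1) ^ (k + 1) :=
          mul_le_mul (hc.trans (mul_le_mul_of_nonneg_right hkL (by positivity))) hf (by positivity) (by positivity)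
        _ = _ := by ring
    have h2 : (n : ℝ) ≤ (n - k : ℕ) + k := by exact_mod_cast (by omega : n ≤ n - k + k)
    have h3 : ((k : ℝ) + 1) ≤ 2 ^ L := by exact_mod_cast h.hk
    have h4 : (1 : ℝ) ≤ 2 ^ ((k : ℝ) / 2) := Real.one_le_rpow (by norm_num) (by positivity)
    have h5 : (4 : ℝ) ≤ 2 ^ L := by
      calc (4 : ℝ) = 2 ^ 2 := by norm_num
        _ ≤ 2 ^ L := pow_le_pow_right₀ (by norm_num) (by have := h.hL; omega)
    calc (n : ℝ) ≤ (k + 1) * (2 * 2 ^ ((k : ℝ) / 2)) + k := by linarith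
      _ ≤ (k + 1) * 4 * 2 ^ ((k : ℝ) / 2) := by nlinarith
      _ ≤ 2 ^ L * 2 ^ L * 2 ^ ((k : ℝ) / 2) := mul_le_mul_of_nonneg_right
          (mul_le_mul h3 h5 (by norm_num) (by positivity)) (by positivity)
      _ = _ := by
        rw [← Real.rpow_natCast, ← Real.rpow_add (by norm_num), ← Real.rpow_add (by norm_num)]
        ring_nf

lemma lam_small {i : ℕ} (hi : i ≤ r) : lam (2 * k + 2) k i < 1 / k := by
  have hk0 : (0 : ℝ) < k := by linarith [h.k_big.1]
  have h1 : (k : ℝ) < 2 ^ L := by exact_mod_cast h.hk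
  have h2 : ((2 * k + 2).choose (k + 1) : ℝ) ≤ 2 ^ (2 * k + 2) := by exact_mod_cast Nat.choose_le_two_pow _ _
  have h3 := h.choose_le hi
  have hK : 2 * k + 2 + 2 * L * r + L ≤ (k + 1).choose 2 := by
    have e1 := h.L_mul_le
    have e2 := h.k_big.1
    have e3 : 6 ≤ k := by
      have : (6 : ℝ) ≤ k := by linarith
      exact_mod_cast this
    rw [Nat.choose_two_right, Nat.le_div_iff_mul_le (by norm_num), Nat.add_sub_cancel]
    nlinarith
  rw [lt_div_iff₀ hk0, lam, eInd_eq_div, div_mul_eq_mul_div, div_mul_eq_mul_div, div_lt_one (by positivity)]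
  calc ((2 * k + 2).choose (k + 1) : ℝ) * ((k + 1).choose 2).choose i * k
      < 2 ^ (2 * k + 2) * 2 ^ (2 * L * r) * 2 ^ L := by
        refine mul_lt_mul' (mul_le_mul h2 h3 (by positivity) (by positivity)) h1 hk0.le (by positivity)
    _ = 2 ^ (2 * k + 2 + 2 * L * r + L) := by ring
    _ ≤ _ := pow_le_pow_right₀ (by norm_num) hK

lemma exists_lam_ge {i : ℕ} (hi : i ≤ r) : ∃ n, (k : ℝ) ≤ lam n k i := by
  have hk0 : (0 : ℝ) < k := by linarith [h.k_big.1]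
  set K := (k + 1).choose 2 with hK
  refine ⟨(k + 1) * (k * 2 ^ K) + k, ?_⟩
  have h2 : ((((k + 1) * (k * 2 ^ K) + k + 1 - (k + 1) : ℕ) ^ (k + 1) : ℝ)) / (k + 1).factorial ≤
      ((k + 1) * (k * 2 ^ K) + k).choose (k + 1) := Nat.pow_le_choose _ _
  rw [Nat.add_sub_add_right, Nat.add_sub_cancel] at h2
  have hf : ((k + 1).factorial : ℝ) ≤ (k + 1) ^ (k + 1) := by
    exact_mod_cast Nat.factorial_le_pow (k + 1)
  have h1 : (1 : ℝ) ≤ k * 2 ^ K := by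
    have e1 : (1 : ℝ) ≤ k := by linarith [h.k_big.1]
    exact one_le_mul_of_one_le_of_one_le e1 (one_le_pow₀ (by norm_num))
  have h3 : (k : ℝ) * 2 ^ K ≤ ((k + 1) * (k * 2 ^ K) + k).choose (k + 1) := by
    refine le_trans ?_ h2
    rw [le_div_iff₀ (by positivity)]
    push_cast
    rw [mul_pow, mul_comm]
    exact mul_le_mul hf (le_self_pow₀ h1 (by omega)) (by positivity) (by positivity)
  calc (k : ℝ) ≤ eInd ((k + 1) * (k * 2 ^ K) + k) (k + 1) := by
        rw [eInd_eq_div, le_div_iff₀ (by positivity)]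
        exact h3
    _ ≤ _ := le_mul_of_one_le_right (eInd_nonneg _ _) (h.one_le_choose hi)

/-- The expected number of sparse sets passes every threshold without jumping over it. -/
lemma exists_lam_near {i : ℕ} (hi : i ≤ r) {τ : ℝ} (h1 : 1 / (k : ℝ) ≤ τ) (h2 : τ ≤ k) :
    ∃ n, τ ≤ lam n k i ∧ lam n k i ≤ 2 * τ := by
  have hex : ∃ n, τ ≤ lam n k i := by
    obtain ⟨n, hn⟩ := h.exists_lam_ge hi
    exact ⟨n, h2.trans hn⟩
  refine ⟨Nat.find hex, Nat.find_spec hex, ?_⟩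
  have hgt : 2 * k + 2 < Nat.find hex := by
    by_contra hc
    have := lam_mono (not_lt.1 hc) k i
    linarith [h.lam_small hi, Nat.find_spec hex]
  obtain ⟨m, hm⟩ := Nat.exists_eq_add_of_lt (Nat.zero_lt_of_lt hgt)
  rw [zero_add] at hm
  have h3 := Nat.find_min hex (m := m) (by omega)
  have h4 := lam_succ_le (n := m) (k := k) (by omega) i
  rw [hm]
  linarith

end Scale

section Monotone

variable {V W : Type*} [Fintype V] [Fintype W]

lemma large_of_comap {s r : ℕ} (f : V ↪ W) {G : SimpleGraph W} (h : Large s r (G.comap f)) : Large s r G := by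
  obtain ⟨g, hg⟩ := h
  exact ⟨g.trans f, hg⟩

lemma card_eF_map (f : V ↪ W) (G : SimpleGraph W) (A : Finset V) :
    (eF G (A.map f)).card = (eF (G.comap f) A).card := by
  rw [← Finset.card_map ⟨Sym2.map f, Sym2.map.injective f.injective⟩]
  congr 1
  ext e
  simp only [Finset.mem_map, Function.Embedding.coeFn_mk]
  constructor
  · induction e with
    | h x y =>
      rw [mem_eF, mk_mem_prs]
      rintro ⟨⟨hx, hy, hne⟩, he⟩
      obtain ⟨a, ha, rfl⟩ := Finset.mem_map.1 hx
      obtain ⟨b, hb, rfl⟩ := Finset.mem_map.1 hy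
      refine ⟨s(a, b), ?_, rfl⟩
      rw [mem_eF, mk_mem_prs]
      exact ⟨⟨ha, hb, fun h => hne (congrArg f h)⟩, he⟩
  · rintro ⟨e', he', rfl⟩
    induction e' with
    | h x y =>
      rw [mem_eF, mk_mem_prs] at he'
      show s(f x, f y) ∈ _
      rw [mem_eF, mk_mem_prs]
      exact ⟨⟨Finset.mem_map_of_mem f he'.1.1, Finset.mem_map_of_mem f he'.1.2.1,
        fun h => he'.1.2.2 (f.injective h)⟩, he'.2⟩

lemma many_of_comap {ξ m i : ℕ} (f : V ↪ W) {G : SimpleGraph W} (h : Many ξ m i (G.comap f)) :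
    Many ξ m i G := by
  unfold Many at h ⊢
  refine h.trans ?_
  rw [← Finset.card_map (Finset.mapEmbedding f).toEmbedding]
  refine Finset.card_le_card fun A hA => ?_
  obtain ⟨B, hB, rfl⟩ := Finset.mem_map.1 hA
  rw [Finset.mem_filter, Finset.mem_powersetCard] at hB ⊢
  refine ⟨⟨Finset.subset_univ _, ?_⟩, ?_⟩
  · exact (Finset.card_map f).trans hB.1.2
  · exact (card_eF_map f G B).trans hB.2

lemma pr_mono_of_comap (f : V ↪ W) {Φ : SimpleGraph V → Prop} {Ψ : SimpleGraph W → Prop}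
    (h : ∀ G : SimpleGraph W, Φ (G.comap f) → Ψ G) : pr V Φ ≤ pr W Ψ := by
  rw [← pr_comap f Φ]
  exact pr_mono h

end Monotone

namespace Scale

variable {k r L : ℕ} (h : Scale k r L)
include h

lemma sqrt_facts : 0 < √(k : ℝ) ∧ 400 * (r : ℝ) ^ 2 * √k ≤ k ∧
    (2 : ℝ) ^ (-(k : ℝ) / 40) ≤ 1 / k := by
  have hk := h.k_big
  have hL := h.L_ge
  have hrl := h.r_le
  have hr := h.r_ge
  have hk0 : (0 : ℝ) < k := by linarith [hk.1]
  have e1 : 400 * (r : ℝ) ^ 2 ≤ L ^ 2 := by nlinarith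
  have e2 : (L : ℝ) ^ 2 ≤ √k := by
    refine Real.le_sqrt_of_sq_le ?_
    refine le_trans ?_ hk.2.1
    rw [← pow_mul]
    exact pow_le_pow_right₀ (by linarith) (by norm_num)
  refine ⟨Real.sqrt_pos.2 hk0, ?_, ?_⟩
  · calc _ ≤ √k * √k := mul_le_mul_of_nonneg_right (e1.trans e2) (Real.sqrt_nonneg _)
      _ = k := Real.mul_self_sqrt hk0.le
  · rw [neg_div, Real.rpow_neg (by norm_num), ← one_div]
    refine one_div_le_one_div_of_le hk0 (h.k_le.trans ?_)
    refine Real.rpow_le_rpow_of_exponent_le (by norm_num) ?_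
    have := hk.2.2
    nlinarith

lemma err_le : 32 * ((r : ℝ) + 1) / k + 4 * r ^ 2 / k + 20 / k ≤ 1 / (4 * √k) := by
  have hk0 : (0 : ℝ) < k := by linarith [h.k_big.1]
  obtain ⟨h1, h2, -⟩ := h.sqrt_facts
  have hr := h.r_ge
  rw [← add_div, ← add_div, div_le_div_iff₀ hk0 (by positivity)]
  have : (32 * ((r : ℝ) + 1) + 4 * r ^ 2 + 20) * 4 ≤ 400 * r ^ 2 := by nlinarith
  nlinarith

variable {j n : ℕ} (h1 : 1 ≤ j) (hj : j ≤ r) (hl : 1 / (k : ℝ) ≤ lam n k (muD r j))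
  (hu : lam n k (muD r j) ≤ k)
include h1 hj hl hu

theorem pr_large_not_many : pr (Fin n) (fun G => Large (k * r + j) r G ∧
    ¬ Many (xiD r j) (k + 1) (muD r j) G) ≤ 1 / (4 * √k) := by
  have hw := h.win_of_lam (mu_xi h1 hj).2.2.2 hl hu
  rw [← Fintype.card_fin n] at hw hu
  refine (pr_large_not_many_le hw h1 hj hu).trans (le_trans ?_ h.err_le)
  have e0 := h.sqrt_facts.2.2
  have hk0 : (0 : ℝ) < k := by linarith [h.k_big.1]
  have e1 : (2 : ℝ) ^ (-(k : ℝ)) ≤ 2 ^ (-(k : ℝ) / 40) :=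
    Real.rpow_le_rpow_of_exponent_le (by norm_num) (by linarith)
  have e2 : (2 : ℝ) ^ (-(k : ℝ) / 4) ≤ 2 ^ (-(k : ℝ) / 40) :=
    Real.rpow_le_rpow_of_exponent_le (by norm_num) (by linarith)
  have e3 : (2 : ℝ) ^ (-(3 / 40 * (k : ℝ))) ≤ 2 ^ (-(k : ℝ) / 40) :=
    Real.rpow_le_rpow_of_exponent_le (by norm_num) (by linarith)
  have e4 : 0 ≤ 32 * ((r : ℝ) + 1) / k := by positivity
  have e5 : 20 / (k : ℝ) = 20 * (1 / k) := by ring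
  have e6 : 0 < 1 / (k : ℝ) := by positivity
  linarith

theorem pr_many_not_large : pr (Fin n) (fun G => Many (xiD r j) (k + 1) (muD r j) G ∧
    ¬ Large (k * r + j) r G) ≤ 1 / (4 * √k) := by
  have hμ := (mu_xi h1 hj).2.2.2
  have hw := h.win_of_lam hμ hl hu
  have hlow := h.low_of_lam hμ hl
  rw [← Fintype.card_fin n] at hw hlow hl
  refine (hw.pr_many_not_large_le hlow h1 hj hl).trans (le_trans ?_ h.err_le)
  have e0 := h.sqrt_facts.2.2
  have hk0 : (0 : ℝ) < k := by linarith [h.k_big.1]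
  have e2 : (2 : ℝ) ^ (-(k : ℝ) / 10) ≤ 2 ^ (-(k : ℝ) / 40) :=
    Real.rpow_le_rpow_of_exponent_le (by norm_num) (by linarith)
  have e4 : 0 ≤ 4 * (r : ℝ) ^ 2 / k := by positivity
  have e5 : 20 / (k : ℝ) = 20 * (1 / k) := by ring
  have e6 : 0 < 1 / (k : ℝ) := by positivity
  linarith

end Scale

lemma pr_le_add_and_not {V : Type*} [Fintype V] (Φ Ψ : SimpleGraph V → Prop) :
    pr V Φ ≤ pr V Ψ + pr V (fun G => Φ G ∧ ¬ Ψ G) := by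
  refine le_trans (pr_mono fun G hG => ?_) (pr_or_le Ψ fun G => Φ G ∧ ¬ Ψ G)
  by_cases h : Ψ G
  exacts [Or.inl h, Or.inr ⟨hG, h⟩]

lemma pr_many_le_lam {V : Type*} [Fintype V] {ξ : ℕ} (hξ : 1 ≤ ξ) (k i : ℕ) :
    pr V (fun G => Many ξ (k + 1) i G) ≤ lam (Fintype.card V) k i := by
  refine le_trans (pr_mono fun G hG => ?_) (pr_exists_edges_le k i)
  obtain ⟨A, hA⟩ := Finset.card_pos.1 (Nat.lt_of_lt_of_le hξ hG)
  rw [Finset.mem_filter] at hA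
  exact ⟨A, hA.1, hA.2⟩

theorem Scale.abs_pr_sub_pr_le {k r L j : ℕ} (h : Scale k r L) (h1 : 1 ≤ j) (hj : j ≤ r) (n : ℕ) :
    |pr (Fin n) (fun G => Large (k * r + j) r G) -
      pr (Fin n) (fun G => Many (xiD r j) (k + 1) (muD r j) G)| ≤ 1 / √k := by
  obtain ⟨hξ, hξ1, hξj, hμ⟩ := mu_xi h1 hj
  set μ := muD r j
  set ξ := xiD r j
  have hk1 : (100 : ℝ) ≤ k := by linarith [h.k_big.1]
  have hk0 : (0 : ℝ) < k := by linarith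
  have hs0 := h.sqrt_facts.1
  have hkk : 1 / (k : ℝ) ≤ k / 2 := by
    rw [div_le_div_iff₀ hk0 (by norm_num)]
    nlinarith
  have hδ : 20 * (1 / (k : ℝ)) ≤ 1 / (4 * √k) := by
    refine le_trans ?_ h.err_le
    have e4 : 0 ≤ 32 * ((r : ℝ) + 1) / k + 4 * (r : ℝ) ^ 2 / k := by positivity
    have e5 : 20 / (k : ℝ) = 20 * (1 / k) := by ring
    linarith
  have hδ' : 1 / (4 * √(k : ℝ)) = 1 / √k / 4 := by field_simp
  have hki : 0 < 1 / (k : ℝ) := by positivity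
  have monoL : ∀ {a b : ℕ}, a ≤ b → pr (Fin a) (fun G => Large (k * r + j) r G) ≤
      pr (Fin b) (fun G => Large (k * r + j) r G) := fun hab =>
    pr_mono_of_comap (Fin.castLEEmb hab) fun G => large_of_comap _
  have monoM : ∀ {a b : ℕ}, a ≤ b → pr (Fin a) (fun G => Many ξ (k + 1) μ G) ≤
      pr (Fin b) (fun G => Many ξ (k + 1) μ G) := fun hab =>
    pr_mono_of_comap (Fin.castLEEmb hab) fun G => many_of_comap _
  have fwd : ∀ m, 1 / (k : ℝ) ≤ lam m k μ → lam m k μ ≤ k → pr (Fin m) (fun G => Large (k * r + j) r G) ≤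
      pr (Fin m) (fun G => Many ξ (k + 1) μ G) + 1 / (4 * √k) := fun m hm hm' =>
    (pr_le_add_and_not _ _).trans (by linarith [h.pr_large_not_many h1 hj hm hm'])
  have bwd : ∀ m, 1 / (k : ℝ) ≤ lam m k μ → lam m k μ ≤ k → pr (Fin m) (fun G => Many ξ (k + 1) μ G) ≤
      pr (Fin m) (fun G => Large (k * r + j) r G) + 1 / (4 * √k) := fun m hm hm' =>
    (pr_le_add_and_not _ _).trans (by linarith [h.pr_many_not_large h1 hj hm hm'])
  rcases lt_or_ge (lam n k μ) (1 / k) with hlt | hge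
  · obtain ⟨m, hm, hm'⟩ := h.exists_lam_near hμ le_rfl (by linarith)
    have hnm : n ≤ m := by
      by_contra hc
      have := lam_mono (not_le.1 hc).le k μ
      linarith
    have a1 := monoL hnm
    have a2 := monoM hnm
    have a3 := fwd m hm (by linarith)
    have a4 := pr_many_le_lam (V := Fin m) hξ1 k μ
    rw [Fintype.card_fin] at a4
    have a5 := pr_nonneg (V := Fin n) (fun G => Large (k * r + j) r G)
    have a6 := pr_nonneg (V := Fin n) (fun G => Many ξ (k + 1) μ G)
    rw [abs_le]
    constructor <;> linarith
  rcases lt_or_ge (k : ℝ) (lam n k μ) with hgt | hle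
  · obtain ⟨m, hm, hm'⟩ := h.exists_lam_near hμ (τ := k / 2) hkk (by linarith)
    have hmn : m ≤ n := by
      by_contra hc
      have := lam_mono (not_le.1 hc).le k μ
      linarith
    have hw := h.win_of_lam hμ (hkk.trans hm) (by linarith)
    rw [← Fintype.card_fin m] at hw
    have hξk : 2 * (ξ : ℝ) ≤ k / 2 := by
      have := h.r_lt_k
      have : ((10 * ξ : ℕ) : ℝ) ≤ k := by exact_mod_cast (by omega : 10 * ξ ≤ k)
      push_cast at this
      linarith
    have a0 := hw.pr_not_many_le (i := μ) (ξ := ξ) (by omega)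
      (by rw [Fintype.card_fin]; exact hkk.trans hm) (by rw [Fintype.card_fin]; exact hξk.trans hm)
    rw [Fintype.card_fin, pr_not] at a0
    have a1 : 8 / lam m k μ ≤ 16 * (1 / k) := by
      rw [mul_one_div, div_le_div_iff₀ (by linarith) hk0]
      linarith
    have a2 := monoL hmn
    have a3 := monoM hmn
    have a4 := bwd m (hkk.trans hm) (by linarith)
    have a5 := pr_le_one (V := Fin n) (fun G => Large (k * r + j) r G)
    have a6 := pr_le_one (V := Fin n) (fun G => Many ξ (k + 1) μ G)
    rw [abs_le]
    constructor <;> linarith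
  · have a1 := fwd n hge hle
    have a2 := bwd n hge hle
    rw [abs_le]
    constructor <;> linarith

lemma pr_eq_natCard {V : Type*} [Fintype V] (Φ : SimpleGraph V → Prop) :
    pr V Φ = Nat.card {G // Φ G} / Nat.card (SimpleGraph V) := by
  unfold pr ex
  rw [← card_filter_eq_sum_ind, ← Fintype.card_subtype, Nat.card_eq_fintype_card, Nat.card_eq_fintype_card]

lemma toReal_uniform_eq_natCard {α : Type*} [Fintype α] [Nonempty α] (Φ : α → Prop) :
    ((PMF.uniformOfFintype α).toOuterMeasure {a | Φ a}).toReal = Nat.card {a // Φ a} / Nat.card α := by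
  rw [PMF.toOuterMeasure_uniformOfFintype_apply, ENNReal.toReal_div, ENNReal.toReal_natCast,
    ENNReal.toReal_natCast, Nat.card_eq_fintype_card, Nat.card_eq_fintype_card]
  rfl

lemma grPr_eq_pr (n : ℕ) (Φ : SimpleGraph (Fin n) → Prop) : grPr n {G | Φ G} = pr (Fin n) Φ := by
  rw [pr_eq_natCard]
  exact toReal_uniform_eq_natCard Φ

lemma edgesIn_eq {n : ℕ} (G : SimpleGraph (Fin n)) (s : Finset (Fin n)) : edgesIn G s = (eF G s).card := by
  unfold edgesIn
  rw [← Set.ncard_coe_finset]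
  congr 1
  ext e
  rw [Set.mem_ofPred_eq, Finset.mem_coe, mem_eF, mem_prs]
  exact ⟨fun h => ⟨⟨h.2, G.not_isDiag_of_mem_edgeSet h.1⟩, h.1⟩, fun h => ⟨h.2, h.1.1⟩⟩

lemma le_numZ_iff {n k i ξ : ℕ} (G : SimpleGraph (Fin n)) : ξ ≤ numZ n k i G ↔ Many ξ k i G := by
  unfold numZ Many
  simp only [edgesIn_eq]

lemma le_alphaClq_iff {n r s : ℕ} (G : SimpleGraph (Fin n)) : s ≤ alphaClq n (r + 1) G ↔ Large s r G := by
  set M := {m | ∃ s : Finset (Fin n), s.card = m ∧ (G.induce (s : Set (Fin n))).CliqueFree (r + 1)} with hM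
  have hbdd : BddAbove M := ⟨n, by
    rintro m ⟨s, rfl, -⟩
    simpa using s.card_le_univ⟩
  have hne : M.Nonempty := by
    refine ⟨0, ∅, rfl, ?_⟩
    haveI : IsEmpty ((∅ : Finset (Fin n)) : Set (Fin n)) := by simp
    exact SimpleGraph.cliqueFree_of_card_lt (by simp)
  constructor
  · intro h
    obtain ⟨A, hA, hfree⟩ : sSup M ∈ M := Nat.sSup_mem hne hbdd
    obtain ⟨f, hf⟩ := exists_embedding_of_le_card (h.trans_eq hA.symm)
    refine ⟨f, ?_⟩
    exact hfree.comap ⟨⟨⟨fun i => ⟨f i, hf i⟩, fun h => h⟩, fun a b hab => f.injective (Subtype.ext_iff.1 hab)⟩⟩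
  · rintro ⟨f, hf⟩
    refine le_csSup hbdd ⟨Finset.univ.map f, by simp, ?_⟩
    have hsurj : ∀ x : (Finset.univ.map f : Set (Fin n)), ∃ i, f i = x := fun x => by
      obtain ⟨i, -, hi⟩ := Finset.mem_map.1 x.2
      exact ⟨i, hi⟩
    choose g hg using hsurj
    refine hf.comap ⟨⟨⟨g, fun {a b} hab => ?_⟩, fun a b hab => Subtype.ext ?_⟩⟩
    · show G.Adj (f (g a)) (f (g b))
      rw [hg, hg]
      exact hab
    · rw [← hg a, ← hg b]
      exact congrArg f hab

open Filter in
lemma exists_scale (C : ℝ) :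
    ∃ ε₀ : ℝ, 0 < ε₀ ∧ ∃ N : ℕ, ∀ n : ℕ, N ≤ n → ∀ k r : ℕ,
      |(k : ℝ) - 2 * Real.logb 2 n| ≤ C * Real.log (Real.log n) → 1 ≤ r →
      (r : ℝ) ≤ ε₀ * Real.log (Real.log n) / Real.log (Real.log (Real.log n)) →
      0 < Real.log n ∧ Real.log n ≤ k ∧ Scale k r (Nat.log 2 k + 1) := by
  refine ⟨1 / 20400, by norm_num, ?_⟩
  have t1 : Tendsto (fun n : ℕ => Real.log n) atTop atTop :=
    Real.tendsto_log_atTop.comp tendsto_natCast_atTop_atTop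
  have t2 := Real.tendsto_log_atTop.comp t1
  have o1 : ∀ c : ℝ, 0 < c → ∀ᶠ x : ℝ in atTop, Real.log x ≤ c * x := fun c hc => by
    filter_upwards [Real.isLittleO_log_id_atTop.bound hc, eventually_ge_atTop 1] with x hx h1
    rw [Real.norm_of_nonneg (Real.log_nonneg h1), id, Real.norm_of_nonneg (by linarith)] at hx
    exact hx
  have c1 : (0 : ℝ) < 1 / (|C| + 1) / 2 := by positivity
  have E : ∀ᶠ n : ℕ in atTop, (2 : ℝ) ^ (10 ^ 6 : ℕ) ≤ Real.log n ∧
      Real.log (Real.log n) ≤ 1 / (|C| + 1) / 2 * Real.log n ∧ 10 ≤ Real.log (Real.log n) ∧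
      Real.log (Real.log (Real.log n)) ≤ 1 / 20400 * Real.log (Real.log n) ∧
      1 ≤ Real.log (Real.log (Real.log n)) :=
    (t1.eventually_ge_atTop _).and ((t1.eventually (o1 _ c1)).and ((t2.eventually_ge_atTop _).and
      ((t2.eventually (o1 _ (by norm_num))).and
        ((Real.tendsto_log_atTop.comp t2).eventually_ge_atTop _))))
  obtain ⟨N, hN⟩ := eventually_atTop.1 E
  refine ⟨N, fun n hn k r hk hr hrx => ?_⟩
  obtain ⟨h1, h2, h3, h4, h5⟩ := hN n hn
  set ℓ := Real.log n
  set x := Real.log ℓ with hx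
  set y := Real.log x with hy
  have hℓ0 : 0 < ℓ := lt_of_lt_of_le (by positivity) h1
  have hln2 := Real.log_two_gt_d9
  have hln2' := Real.log_two_lt_d9
  have hlogb : Real.logb 2 n * Real.log 2 = ℓ := by
    rw [Real.logb, div_mul_cancel₀ _ (by positivity)]
  have hCx : |C * x| ≤ ℓ / 2 := by
    rw [abs_mul, abs_of_pos (by linarith : 0 < x)]
    have e1 : (|C| + 1) * x ≤ ℓ / 2 := by
      have := mul_le_mul_of_nonneg_left h2 (by positivity : (0 : ℝ) ≤ |C| + 1)
      refine this.trans_eq ?_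
      field_simp
    linarith
  have hb1 : ℓ ≤ Real.logb 2 n := by nlinarith
  have hb2 : Real.logb 2 n ≤ 3 / 2 * ℓ := by nlinarith
  rw [abs_le] at hk
  have hCx' := abs_le.1 hCx
  have hkl : ℓ ≤ k := by linarith [hk.1]
  have hku : (k : ℝ) ≤ 4 * ℓ := by linarith [hk.2]
  have hk0 : (0 : ℝ) < k := by linarith
  have hkne : k ≠ 0 := by
    rintro rfl
    simp at hk0
  set L := Nat.log 2 k + 1 with hL
  have hL6 : 10 ^ 6 ≤ Nat.log 2 k :=
    Nat.le_log_of_pow_le (by norm_num) (by exact_mod_cast h1.trans hkl)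
  have hlogk : Real.log k ≤ 2 + x := by
    have e1 : Real.log k ≤ Real.log (4 * ℓ) := Real.log_le_log hk0 hku
    rw [Real.log_mul (by norm_num) hℓ0.ne', show (4 : ℝ) = 2 ^ 2 by norm_num, Real.log_pow] at e1
    push_cast at e1
    linarith
  have hLx : (L : ℝ) ≤ x ^ 2 := by
    have e1 : ((Nat.log 2 k : ℕ) : ℝ) * Real.log 2 ≤ Real.log k := by
      rw [← Real.log_pow]
      refine Real.log_le_log (by positivity) ?_
      exact_mod_cast Nat.pow_log_le_self 2 hkne
    have e2 : (L : ℝ) = Nat.log 2 k + 1 := by rw [hL]; push_cast; ring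
    nlinarith
  refine ⟨hℓ0, hkl, hr, by omega, Nat.lt_pow_succ_log_self (by norm_num) k, ?_⟩
  have hL0 : (0 : ℝ) < L := by rw [hL]; positivity
  have hlogL : Real.log L ≤ 2 * y := by
    have := Real.log_le_log hL0 hLx
    rwa [Real.log_pow] at this
  have hry : (r : ℝ) * y ≤ 1 / 20400 * x := (le_div_iff₀ (by linarith)).1 hrx
  have hxk : x ≤ Real.log k := Real.log_le_log hℓ0 hkl
  have hfin : (L : ℝ) ^ (5100 * (r + 1)) ≤ k := by
    rw [← Real.log_le_log_iff (by positivity) hk0, Real.log_pow]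
    push_cast
    calc 5100 * ((r : ℝ) + 1) * Real.log L ≤ 5100 * ((r : ℝ) + 1) * (2 * y) :=
          mul_le_mul_of_nonneg_left hlogL (by positivity)
      _ = 10200 * (r * y) + 10200 * y := by ring
      _ ≤ x := by linarith
      _ ≤ _ := hxk
  exact_mod_cast hfin

theorem stmt0 (C : ℝ) (hC : 0 < C) :
    ∃ ε₀ : ℝ, 0 < ε₀ ∧ ∃ N : ℕ, ∀ n : ℕ, N ≤ n → ∀ k r j : ℕ,
      |(k : ℝ) - 2 * Real.logb 2 n| ≤ C * Real.log (Real.log n) →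
      1 ≤ r →
      (r : ℝ) ≤ ε₀ * Real.log (Real.log n) / Real.log (Real.log (Real.log n)) →
      1 ≤ j → j ≤ r →
      |grPr n {G | k * r + j ≤ alphaClq n (r + 1) G} -
          grPr n {G | xiD r j ≤ numZ n (k + 1) (muD r j) G}| ≤
        (Real.log n) ^ (-(1 / 2 : ℝ)) := by
  obtain ⟨ε₀, hε, N, hN⟩ := exists_scale C
  refine ⟨ε₀, hε, N, fun n hn k r j hk hr hrx h1 hj => ?_⟩
  obtain ⟨hl0, hlk, hs⟩ := hN n hn k r hk hr hrx
  rw [grPr_eq_pr, grPr_eq_pr]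
  simp only [le_alphaClq_iff, le_numZ_iff]
  refine (hs.abs_pr_sub_pr_le h1 hj n).trans ?_
  rw [Real.rpow_neg hl0.le, ← Real.sqrt_eq_rpow, ← one_div]
  exact one_div_le_one_div_of_le (Real.sqrt_pos.2 hl0) (Real.sqrt_le_sqrt hlk)
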